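/- Let 𝓕 be an iterated function system on ℝ satisfying the open set condition, let K be its self-similar set, and let s = dim_H(K). Then there exist constants ṽ > 1 and C > 0, both depending only on 𝓕, such that for every v with 1 < v < ṽ one has dim_H(W(v) ∩ K) ≥ s − C·(1 − 2/(v+1)) = s − C·(v−1)/(v+1). -/

import Mathlib

open MeasureTheory Set

/-- An iterated function system on ℝ: finitely many affine contractions
`x ↦ c i * x + b i` with contraction ratios `c i ∈ (0,1)`. -/
structure IFS where
  n : ℕ
  npos : 0 < n
  c : Fin n → ℝ
  b : Fin n → ℝ
  c_pos : ∀ i, 0 < c i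
  c_lt_one : ∀ i, c i < 1

namespace IFS

/-- The `i`-th map of the IFS. -/
noncomputable def map (F : IFS) (i : Fin F.n) : ℝ → ℝ := fun x => F.c i * x + F.b i

/-- `F` satisfies the open set condition witnessed by the open set `U`. -/
def OSCWith (F : IFS) (U : Set ℝ) : Prop :=
  U.Nonempty ∧ IsOpen U ∧ Bornology.IsBounded U ∧
    (⋃ i, F.map i '' U) ⊆ U ∧
    Pairwise fun i j => Disjoint (F.map i '' U) (F.map j '' U)

/-- The open set condition. -/
def OSC (F : IFS) : Prop := ∃ U, F.OSCWith U

/-- `K` is the attractor (self-similar set) of `F`. -/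
def IsAttractor (F : IFS) (K : Set ℝ) : Prop :=
  K.Nonempty ∧ IsCompact K ∧ K = ⋃ i, F.map i '' K

/-- Composition `f_α = f_{i₁} ∘ ⋯ ∘ f_{i_k}` of the maps along a word `α`. -/
noncomputable def wordMap (F : IFS) : List (Fin F.n) → ℝ → ℝ
  | [] => id
  | i :: w => F.map i ∘ F.wordMap w

/-- Contraction ratio `c_α` of `f_α`. -/
noncomputable def wordC (F : IFS) (w : List (Fin F.n)) : ℝ := (w.map F.c).prod

end IFS

/-- The set `W(ψ)` of `ψ`-well approximable real numbers: those `x` with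
`|q·x − p| < ψ q` for infinitely many pairs `(p, q) ∈ ℤ × ℕ`, `q ≥ 1`. -/
def wellApprox (ψ : ℕ → ℝ) : Set ℝ :=
  {x : ℝ | {pq : ℤ × ℕ | 0 < pq.2 ∧ |(pq.2 : ℝ) * x - (pq.1 : ℝ)| < ψ pq.2}.Infinite}

/-- `ψ_v (q) = q^{-v}`. -/
noncomputable def psiv (v : ℝ) : ℕ → ℝ := fun q => (q : ℝ) ^ (-v)

/-- The set of very well approximable numbers: `VWA = ⋃_{v > 1} W(ψ_v)`. -/
noncomputable def VWA : Set ℝ := ⋃ v ∈ Set.Ioi (1 : ℝ), wellApprox (psiv v)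

/-- The (topological) support of a Borel measure on ℝ. -/
def msupport (μ : Measure ℝ) : Set ℝ :=
  {x | ∀ U : Set ℝ, IsOpen U → x ∈ U → 0 < μ U}

/-- `μ` is the self-similar measure of `F` with exponent `s`: a compactly supported
Borel probability measure with `μ = ∑ i, (c i ^ s) • (F.map i)_* μ`. -/
def selfSimilarMeasure (F : IFS) (s : ℝ) (μ : Measure ℝ) : Prop :=
  IsProbabilityMeasure μ ∧ IsCompact (msupport μ) ∧
    μ = ∑ i, ENNReal.ofReal (F.c i ^ s) • Measure.map (F.map i) μ

/-- The set `A_m(ψ)`: points within `ψ(2^m)/q` of a reduced fraction `p/q` with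
`2^m ≤ q < 2^{m+1}`. -/
def Aset (ψ : ℕ → ℝ) (m : ℕ) : Set ℝ :=
  {x | ∃ p : ℤ, ∃ q : ℕ, Int.gcd p q = 1 ∧ 2 ^ m ≤ q ∧ q < 2 ^ (m + 1) ∧
    |(q : ℝ) * x - (p : ℝ)| < ψ (2 ^ m)}

/-- The set `D_m(ψ)`: points within `ψ(2^m)/q` of a reduced fraction `p/q` with
`2^{m-1} ≤ q < 2^m`. -/
def Dset (ψ : ℕ → ℝ) (m : ℕ) : Set ℝ :=
  {x | ∃ p : ℤ, ∃ q : ℕ, Int.gcd p q = 1 ∧ 2 ^ (m - 1) ≤ q ∧ q < 2 ^ m ∧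
    |(q : ℝ) * x - (p : ℝ)| < ψ (2 ^ m)}

/-- Index set of the family of balls `𝒟_m`: primitive pairs `(p,q)` with
`2^{m-1} ≤ q < 2^m`. -/
def Didx (m : ℕ) : Set (ℤ × ℕ) :=
  {pq | Int.gcd pq.1 pq.2 = 1 ∧ 2 ^ (m - 1) ≤ pq.2 ∧ pq.2 < 2 ^ m}

/-- The ball `B(p/q, ψ(2^m)/q)` of the families `𝒟_m(ψ)` and `𝒜_m(ψ)`. -/
noncomputable def ballOf (ψ : ℕ → ℝ) (m : ℕ) (pq : ℤ × ℕ) : Set ℝ :=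
  Metric.ball ((pq.1 : ℝ) / (pq.2 : ℝ)) (ψ (2 ^ m) / (pq.2 : ℝ))

set_option linter.unusedSectionVars false

section Entropy

variable {Ω Ω' β β' β'' β''' : Type*} [Fintype Ω] [Fintype Ω']

open Classical in
/-- Number of points in the fibre of `f` through `ω`. -/
noncomputable def fiberCard (f : Ω → β) (ω : Ω) : ℕ :=
  (Finset.univ.filter fun a => f a = f ω).card

/-- Shannon entropy of `f` under the uniform probability on `Ω`. -/
noncomputable def ent (f : Ω → β) : ℝ :=
  (∑ ω, Real.log (Fintype.card Ω / fiberCard f ω)) / Fintype.card Ω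

lemma fiberCard_pos (f : Ω → β) (ω : Ω) : 0 < fiberCard f ω := by
  classical
  exact Finset.card_pos.2 ⟨ω, by simp⟩

lemma fiberCard_le_card (f : Ω → β) (ω : Ω) : fiberCard f ω ≤ Fintype.card Ω :=
  Finset.card_le_univ _

lemma fiberCard_eq_of_eq {f : Ω → β} {a b : Ω} (h : f a = f b) : fiberCard f a = fiberCard f b := by
  unfold fiberCard
  rw [h]

lemma fiberCard_le_of_imp {f : Ω → β} {g : Ω → β'} (h : ∀ a b, g a = g b → f a = f b) (ω : Ω) :
    fiberCard g ω ≤ fiberCard f ω := by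
  classical
  refine Finset.card_le_card fun a ha => ?_
  simp only [Finset.mem_filter, Finset.mem_univ, true_and] at ha ⊢
  exact h _ _ ha

lemma ent_nonneg (f : Ω → β) : 0 ≤ ent f := by
  refine div_nonneg (Finset.sum_nonneg fun ω _ => Real.log_nonneg ?_) (by positivity)
  rw [le_div_iff₀ (by exact_mod_cast fiberCard_pos f ω), one_mul]
  exact_mod_cast fiberCard_le_card f ω

lemma ent_mono {f : Ω → β} {g : Ω → β'} (h : ∀ a b, g a = g b → f a = f b) : ent f ≤ ent g := by
  refine div_le_div_of_nonneg_right (Finset.sum_le_sum fun ω _ => ?_) (by positivity)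
  have h1 : (0 : ℝ) < fiberCard g ω := by exact_mod_cast fiberCard_pos g ω
  have h0 : (0 : ℝ) < Fintype.card Ω := by
    exact_mod_cast Fintype.card_pos_iff.2 ⟨ω⟩
  have h2 : (fiberCard g ω : ℝ) ≤ fiberCard f ω := by exact_mod_cast fiberCard_le_of_imp h ω
  have h3 : (0 : ℝ) < fiberCard f ω := h1.trans_le h2
  exact Real.log_le_log (by positivity) (div_le_div_of_nonneg_left h0.le h1 h2)

open Classical in
/-- Reciprocals of fibre sizes sum to the number of values. -/
lemma sum_inv_fiberCard_filter (f : Ω → β) (g : Ω → β') (ω : Ω) :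
    ∑ a ∈ Finset.univ.filter (fun a => f a = f ω), (1 : ℝ) / fiberCard (fun x => (f x, g x)) a =
      ((Finset.univ.filter (fun a => f a = f ω)).image g).card := by
  classical
  rw [Finset.card_eq_sum_ones, Nat.cast_sum,
    ← Finset.sum_fiberwise_of_maps_to (g := g) (t := (Finset.univ.filter (fun a => f a = f ω)).image g)
      (fun x hx => Finset.mem_image_of_mem g hx)]
  refine Finset.sum_congr rfl fun y hy => ?_
  obtain ⟨x, hx, rfl⟩ := Finset.mem_image.1 hy
  simp only [Finset.mem_filter, Finset.mem_univ, true_and] at hx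
  have h1 : ∀ a ∈ (Finset.univ.filter (fun a => f a = f ω)).filter (fun a => g a = g x),
      (1 : ℝ) / fiberCard (fun x => (f x, g x)) a = 1 / fiberCard (fun x => (f x, g x)) x := by
    intro a ha
    simp only [Finset.mem_filter, Finset.mem_univ, true_and] at ha
    rw [fiberCard_eq_of_eq (f := fun x => (f x, g x)) (a := a) (b := x)
      (by simp [ha.1, ha.2, hx])]
  rw [Finset.sum_congr rfl h1, Finset.sum_const, nsmul_eq_mul]
  have h2 : ((Finset.univ.filter (fun a => f a = f ω)).filter (fun a => g a = g x)).card =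
      fiberCard (fun x => (f x, g x)) x := by
    unfold fiberCard
    congr 1
    ext a
    simp [hx]
  rw [h2, Nat.cast_one, mul_one_div, div_self]
  exact_mod_cast (fiberCard_pos _ _).ne'

/-- If `g` takes at most `N` values on each fibre of `f`, then adjoining `g` costs at most
`log N`. -/
lemma ent_le_add_log {f : Ω → β} {g : Ω → β'} {h : Ω → β''} {N : ℕ} (hN : 0 < N)
    (hdet : ∀ a b, f a = f b → g a = g b → h a = h b)
    (hcard : ∀ ω, (g '' {a | f a = f ω}).encard ≤ N) :
    ent h ≤ ent f + Real.log N := by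
  classical
  refine (ent_mono (g := fun x => (f x, g x)) (fun a b hab => ?_)).trans ?_
  · simp only [Prod.mk.injEq] at hab
    exact hdet a b hab.1 hab.2
  rcases isEmpty_or_nonempty Ω with hΩ | hΩ
  · simp only [ent, Finset.univ_eq_empty, Finset.sum_empty, zero_div, zero_add]
    exact Real.log_nonneg (by exact_mod_cast hN)
  have hΩ0 : (0 : ℝ) < Fintype.card Ω := by exact_mod_cast Fintype.card_pos
  have hN0 : (0 : ℝ) < N := by exact_mod_cast hN
  unfold ent
  rw [← sub_le_iff_le_add', ← sub_div, div_le_iff₀ hΩ0, ← Finset.sum_sub_distrib]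
  have key : ∀ ω : Ω, Real.log (Fintype.card Ω / fiberCard (fun x => (f x, g x)) ω) -
      Real.log (Fintype.card Ω / fiberCard f ω) ≤
      Real.log N + ((fiberCard f ω : ℝ) / fiberCard (fun x => (f x, g x)) ω / N - 1) := by
    intro ω
    have h1 : (0 : ℝ) < fiberCard f ω := by exact_mod_cast fiberCard_pos f ω
    have h2 : (0 : ℝ) < fiberCard (fun x => (f x, g x)) ω := by exact_mod_cast fiberCard_pos _ ω
    have h3 := Real.log_le_sub_one_of_pos
      (x := (fiberCard f ω : ℝ) / fiberCard (fun x => (f x, g x)) ω / N) (by positivity)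
    rw [Real.log_div (by positivity) (by positivity), Real.log_div (by positivity) (by positivity)]
      at h3
    rw [Real.log_div (by positivity) (by positivity), Real.log_div (by positivity) (by positivity)]
    linarith
  refine (Finset.sum_le_sum fun ω _ => key ω).trans ?_
  have hsum : ∑ ω, (fiberCard f ω : ℝ) / fiberCard (fun x => (f x, g x)) ω ≤ N * Fintype.card Ω := by
    calc ∑ ω, (fiberCard f ω : ℝ) / fiberCard (fun x => (f x, g x)) ω
        = ∑ ω, ∑ a ∈ Finset.univ.filter (fun a => f a = f ω),
            (1 : ℝ) / fiberCard (fun x => (f x, g x)) ω := by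
          refine Finset.sum_congr rfl fun ω _ => ?_
          rw [Finset.sum_const, nsmul_eq_mul, mul_one_div]
          congr 2
      _ = ∑ a, ∑ ω ∈ Finset.univ.filter (fun ω => f ω = f a),
            (1 : ℝ) / fiberCard (fun x => (f x, g x)) ω := by
          refine Finset.sum_comm' fun x y => ?_
          simp only [Finset.mem_univ, Finset.mem_filter, true_and, and_true]
          exact eq_comm
      _ ≤ ∑ a : Ω, (N : ℝ) := by
          refine Finset.sum_le_sum fun a _ => ?_
          rw [sum_inv_fiberCard_filter f g a]
          have := hcard a
          have h4 : g '' {b | f b = f a} =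
              (((Finset.univ.filter (fun ω => f ω = f a)).image g : Finset β') : Set β') := by
            ext; simp
          rw [h4, Set.encard_coe_eq_coe_finsetCard] at this
          exact_mod_cast this
      _ = N * Fintype.card Ω := by simp [mul_comm]
  have h5 : ∑ ω, (fiberCard f ω : ℝ) / fiberCard (fun x => (f x, g x)) ω / N ≤ Fintype.card Ω := by
    rw [← Finset.sum_div, div_le_iff₀ hN0]
    linarith
  rw [Finset.sum_add_distrib, Finset.sum_sub_distrib]
  simp only [Finset.sum_const, Finset.card_univ, nsmul_eq_mul, mul_one]
  linarith [mul_comm (Real.log N) (Fintype.card Ω : ℝ)]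

/-- Submodularity of entropy. -/
lemma ent_submod {f : Ω → β} {g : Ω → β'} {k : Ω → β''} {h : Ω → β'''}
    (hk : ∀ a b, f a = f b → g a = g b → k a = k b)
    (hf : ∀ a b, f a = f b → h a = h b) (hg : ∀ a b, g a = g b → h a = h b) :
    ent k + ent h ≤ ent f + ent g := by
  classical
  have hk' : ent k ≤ ent (fun x => (f x, g x)) := ent_mono (fun a b hab => by
    simp only [Prod.mk.injEq] at hab
    exact hk a b hab.1 hab.2)
  refine (add_le_add_left hk' _).trans ?_
  rcases isEmpty_or_nonempty Ω with hΩ | hΩ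
  · simp [ent]
  have hΩ0 : (0 : ℝ) < Fintype.card Ω := by exact_mod_cast Fintype.card_pos
  set p : Ω → β × β' := fun x => (f x, g x) with hp
  unfold ent
  rw [← add_div, ← add_div]
  refine div_le_div_of_nonneg_right ?_ hΩ0.le
  rw [← Finset.sum_add_distrib, ← Finset.sum_add_distrib, ← sub_nonpos, ← Finset.sum_sub_distrib]
  have key : ∀ ω : Ω, Real.log (Fintype.card Ω / fiberCard p ω) +
      Real.log (Fintype.card Ω / fiberCard h ω) - (Real.log (Fintype.card Ω / fiberCard f ω) +
      Real.log (Fintype.card Ω / fiberCard g ω)) ≤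
      (fiberCard f ω : ℝ) * fiberCard g ω / (fiberCard p ω * fiberCard h ω) - 1 := by
    intro ω
    have h1 : (0 : ℝ) < fiberCard f ω := by exact_mod_cast fiberCard_pos f ω
    have h2 : (0 : ℝ) < fiberCard g ω := by exact_mod_cast fiberCard_pos g ω
    have h3 : (0 : ℝ) < fiberCard p ω := by exact_mod_cast fiberCard_pos p ω
    have h4 : (0 : ℝ) < fiberCard h ω := by exact_mod_cast fiberCard_pos h ω
    have h5 := Real.log_le_sub_one_of_pos
      (x := (fiberCard f ω : ℝ) * fiberCard g ω / (fiberCard p ω * fiberCard h ω)) (by positivity)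
    refine le_trans (le_of_eq ?_) h5
    rw [Real.log_div (by positivity) (by positivity), Real.log_div (by positivity) (by positivity),
      Real.log_div (by positivity) (by positivity), Real.log_div (by positivity) (by positivity),
      Real.log_div (by positivity) (by positivity), Real.log_mul (by positivity) (by positivity),
      Real.log_mul (by positivity) (by positivity)]
    ring
  refine (Finset.sum_le_sum fun ω _ => key ω).trans ?_
  rw [Finset.sum_sub_distrib]
  simp only [Finset.sum_const, Finset.card_univ, nsmul_eq_mul, mul_one]
  rw [sub_nonpos]
  have hprod : ∀ ω : Ω, (fiberCard f ω : ℝ) * fiberCard g ω / (fiberCard p ω * fiberCard h ω) =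
      ∑ a, ∑ b, if f ω = f a ∧ g ω = g b then (1 : ℝ) / (fiberCard p ω * fiberCard h ω) else 0 := by
    intro ω
    have : ∀ a b, (if f ω = f a ∧ g ω = g b then (1 : ℝ) / (fiberCard p ω * fiberCard h ω) else 0) =
        (if f a = f ω then (1 : ℝ) else 0) * (if g b = g ω then (1 : ℝ) else 0) *
          (1 / (fiberCard p ω * fiberCard h ω)) := by
      intro a b
      by_cases h1 : f ω = f a <;> by_cases h2 : g ω = g b <;> simp [h1, h2, eq_comm]
    simp only [this, ← Finset.sum_mul, ← Finset.mul_sum, Finset.sum_boole]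
    rw [mul_one_div]
    congr 2
  simp only [hprod]
  rw [Finset.sum_comm]
  have hinner : ∀ a, ∑ ω, ∑ b, (if f ω = f a ∧ g ω = g b then
      (1 : ℝ) / (fiberCard p ω * fiberCard h ω) else 0) ≤ 1 := by
    intro a
    rw [Finset.sum_comm]
    have hb : ∀ b, ∑ ω, (if f ω = f a ∧ g ω = g b then
        (1 : ℝ) / (fiberCard p ω * fiberCard h ω) else 0) ≤
        if h b = h a then (1 : ℝ) / fiberCard h a else 0 := by
      intro b
      by_cases hex : ∃ ω, f ω = f a ∧ g ω = g b
      · obtain ⟨ω, h1, h2⟩ := hex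
        have h3 : h b = h a := by rw [← hg ω b h2, hf ω a h1]
        rw [if_pos h3, ← Finset.sum_filter]
        have h4 : ∀ x ∈ Finset.univ.filter (fun x => f x = f a ∧ g x = g b),
            (1 : ℝ) / (fiberCard p x * fiberCard h x) = 1 / (fiberCard p ω * fiberCard h a) := by
          intro x hx
          simp only [Finset.mem_filter, Finset.mem_univ, true_and] at hx
          rw [fiberCard_eq_of_eq (hf x a hx.1),
            fiberCard_eq_of_eq (f := p) (a := x) (b := ω) (by simp [hp, hx.1, hx.2, h1, h2])]
        rw [Finset.sum_congr rfl h4, Finset.sum_const, nsmul_eq_mul]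
        have h5 : (Finset.univ.filter (fun x => f x = f a ∧ g x = g b)).card = fiberCard p ω := by
          unfold fiberCard
          congr 1
          ext x
          simp [hp, h1, h2]
        rw [h5]
        have h6 : (0 : ℝ) < fiberCard p ω := by exact_mod_cast fiberCard_pos p ω
        rw [mul_one_div, div_mul_eq_div_div, div_self h6.ne']
      · push Not at hex
        rw [Finset.sum_eq_zero]
        · split_ifs <;> positivity
        · intro ω _
          rw [if_neg]
          rintro ⟨h1, h2⟩
          exact hex ω h1 h2
    refine (Finset.sum_le_sum fun b _ => hb b).trans ?_
    rw [← Finset.sum_filter, Finset.sum_const, nsmul_eq_mul]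
    have h7 : (0 : ℝ) < fiberCard h a := by exact_mod_cast fiberCard_pos h a
    rw [mul_one_div, div_le_one h7]
    simp only [fiberCard]
    exact le_of_eq (by congr)
  refine (Finset.sum_le_sum fun a _ => hinner a).trans ?_
  simp

lemma ent_le_log_of_encard_range_le {f : Ω → β} {N : ℕ} (hN : 0 < N)
    (h : (Set.range f).encard ≤ N) : ent f ≤ Real.log N := by
  have h1 := ent_le_add_log (f := fun _ : Ω => ()) (g := f) (h := f) hN (fun a b _ h => h)
    (fun ω => (Set.encard_le_encard (Set.image_subset_range _ _)).trans h)
  have h2 : ent (fun _ : Ω => ()) = 0 := by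
    rcases isEmpty_or_nonempty Ω with hΩ | hΩ
    · simp [ent]
    · simp [ent, fiberCard]
  linarith

/-- Entropy is unchanged under pull-back along a map with fibres of constant size. -/
lemma ent_comp_of_fiber {π : Ω' → Ω} {M : ℕ} (hM : 0 < M)
    (hπ : ∀ ω, (π ⁻¹' {ω}).encard = M) (f : Ω → β) : ent (f ∘ π) = ent f := by
  classical
  have hπ' : ∀ ω, (Finset.univ.filter fun x => π x = ω).card = M := by
    intro ω
    have := hπ ω
    rw [show π ⁻¹' {ω} = ((Finset.univ.filter fun x => π x = ω : Finset Ω') : Set Ω') by ext; simp,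
      Set.encard_coe_eq_coe_finsetCard] at this
    exact_mod_cast this
  have hM0 : (M : ℝ) ≠ 0 := by exact_mod_cast hM.ne'
  have hcard : (Fintype.card Ω' : ℝ) = M * Fintype.card Ω := by
    have := Finset.card_eq_sum_card_fiberwise (f := π) (s := Finset.univ) (t := Finset.univ)
      (by intro x _; simp)
    simp only [hπ', Finset.card_univ, Finset.sum_const, smul_eq_mul] at this
    rw [this]; push_cast; ring
  have hfib : ∀ x, (fiberCard (f ∘ π) x : ℝ) = M * fiberCard f (π x) := by
    intro x
    have := Finset.card_eq_sum_card_fiberwise (f := π)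
      (s := Finset.univ.filter fun a => (f ∘ π) a = (f ∘ π) x)
      (t := Finset.univ.filter fun a => f a = f (π x)) (by intro y hy; simpa using hy)
    have h2 : ∀ ω ∈ Finset.univ.filter (fun a => f a = f (π x)),
        ((Finset.univ.filter fun a => (f ∘ π) a = (f ∘ π) x).filter fun a => π a = ω).card = M := by
      intro ω hω
      rw [← hπ' ω]
      congr 1
      ext a
      simp only [Finset.mem_filter, Finset.mem_univ, true_and, Function.comp] at hω ⊢
      constructor
      · exact fun h => h.2
      · rintro rfl; exact ⟨hω, rfl⟩
    rw [Finset.sum_congr rfl h2, Finset.sum_const, smul_eq_mul] at this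
    unfold fiberCard
    have h3 : ((Finset.univ.filter fun a => (f ∘ π) a = (f ∘ π) x).card : ℝ) =
      (Finset.univ.filter fun a => f a = f (π x)).card * M := by exact_mod_cast this
    rw [mul_comm] at h3
    convert h3
  unfold ent
  have h1 : ∀ x, Real.log (Fintype.card Ω' / fiberCard (f ∘ π) x) =
      Real.log (Fintype.card Ω / fiberCard f (π x)) := by
    intro x
    rw [hcard, hfib, mul_div_mul_left _ _ hM0]
  simp only [h1]
  rw [hcard, ← Finset.sum_fiberwise_of_maps_to (g := π) (t := Finset.univ) (by simp)]
  have h2 : ∀ ω ∈ (Finset.univ : Finset Ω), ∑ x ∈ Finset.univ.filter (fun x => π x = ω),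
      Real.log (Fintype.card Ω / fiberCard f (π x)) =
      M * Real.log (Fintype.card Ω / fiberCard f ω) := by
    intro ω _
    rw [← nsmul_eq_mul, ← hπ' ω, ← Finset.sum_const]
    refine Finset.sum_congr rfl fun x hx => ?_
    simp only [Finset.mem_filter, Finset.mem_univ, true_and] at hx
    rw [hx]
  rw [Finset.sum_congr rfl h2, ← Finset.mul_sum, mul_div_mul_left _ _ hM0]

lemma ent_comp_equiv (e : Ω' ≃ Ω) (f : Ω → β) : ent (f ∘ e) = ent f := by
  refine ent_comp_of_fiber (M := 1) one_pos (fun ω => ?_) f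
  rw [← e.image_symm_eq_preimage, Set.image_singleton]
  simp

lemma ent_comp_snd [Nonempty Ω'] (f : Ω → β) : ent (fun x : Ω' × Ω => f x.2) = ent f := by
  refine ent_comp_of_fiber (π := Prod.snd) (M := Fintype.card Ω') Fintype.card_pos (fun ω => ?_) f
  have : (Prod.snd ⁻¹' {ω} : Set (Ω' × Ω)) = (fun x => (x, ω)) '' Set.univ := by
    ext ⟨a, b⟩
    simp [eq_comm]
  rw [this, Function.Injective.encard_image (fun a b h => by simpa using h)]
  simp

/-- Chain rule over a product. -/
lemma ent_fst_pair (f : Ω' × Ω → β) [Nonempty Ω'] [Nonempty Ω] :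
    ent (fun x => (x.1, f x)) =
      Real.log (Fintype.card Ω') + (∑ a, ent (fun ω => f (a, ω))) / Fintype.card Ω' := by
  classical
  have h1 : (0 : ℝ) < Fintype.card Ω' := by exact_mod_cast Fintype.card_pos
  have h2 : (0 : ℝ) < Fintype.card Ω := by exact_mod_cast Fintype.card_pos
  have hfib : ∀ a ω, fiberCard (fun x : Ω' × Ω => (x.1, f x)) (a, ω) =
      fiberCard (fun ω => f (a, ω)) ω := by
    intro a ω
    unfold fiberCard
    refine Finset.card_bij' (fun x _ => x.2) (fun x _ => (a, x)) ?_ ?_ ?_ ?_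
    · rintro ⟨b, y⟩ h
      simp only [Finset.mem_filter, Finset.mem_univ, true_and, Prod.mk.injEq] at h ⊢
      rw [← h.2, h.1]
    · intro x h
      simpa using h
    · rintro ⟨b, y⟩ h
      simp only [Finset.mem_filter, Finset.mem_univ, true_and, Prod.mk.injEq] at h
      simp [h.1]
    · intro x _; rfl
  unfold ent
  rw [Fintype.sum_prod_type, Fintype.card_prod]
  simp only [hfib]
  have h3 : ∀ a ω, Real.log (((Fintype.card Ω' * Fintype.card Ω : ℕ) : ℝ) /
      fiberCard (fun ω => f (a, ω)) ω) = Real.log (Fintype.card Ω') +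
      Real.log (Fintype.card Ω / fiberCard (fun ω => f (a, ω)) ω) := by
    intro a ω
    have : (0 : ℝ) < fiberCard (fun ω => f (a, ω)) ω := by exact_mod_cast fiberCard_pos _ _
    rw [Nat.cast_mul, mul_div_assoc, Real.log_mul (by positivity) (by positivity)]
  simp only [h3, Finset.sum_add_distrib, Finset.sum_const, Finset.card_univ, nsmul_eq_mul]
  rw [← Finset.sum_div]
  push_cast
  field_simp

lemma avg_ent_le_ent (f : Ω' × Ω → β) [Nonempty Ω'] :
    (∑ a, ent (fun ω => f (a, ω))) / Fintype.card Ω' ≤ ent f := by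
  rcases isEmpty_or_nonempty Ω with hΩ | hΩ
  · simp [ent]
  have h1 := ent_fst_pair f
  have h2 := ent_le_add_log (f := f) (g := Prod.fst) (h := fun x : Ω' × Ω => (x.1, f x))
    (N := Fintype.card Ω') Fintype.card_pos (fun a b h h' => by simp [h, h'])
    (fun ω => (Set.encard_le_encard (Set.subset_univ _)).trans (by simp))
  linarith

lemma ent_id : ent (fun ω : Ω => ω) = Real.log (Fintype.card Ω) := by
  rcases isEmpty_or_nonempty Ω with hΩ | hΩ
  · simp [ent]
  have h0 : (Fintype.card Ω : ℝ) ≠ 0 := by exact_mod_cast Fintype.card_ne_zero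
  have h1 : ∀ ω : Ω, fiberCard (fun ω : Ω => ω) ω = 1 := fun ω =>
    Finset.card_eq_one.2 ⟨ω, by ext; simp⟩
  simp only [ent, h1, Finset.sum_const, Finset.card_univ, nsmul_eq_mul, Nat.cast_one, div_one]
  field_simp

/-- Adjoining an integer part of a quantity controlled by `f` costs little. -/
lemma ent_floor_le {f : Ω → β} {X : Ω → ℝ} {η : ℝ} (hη : 0 < η) {K : ℕ}
    (h : ∀ a b, f a = f b → |X a - X b| ≤ K * η) :
    ent (fun ω => (f ω, ⌊X ω / η⌋)) ≤ ent f + Real.log (2 * K + 3 : ℕ) := by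
  refine ent_le_add_log (g := fun ω => ⌊X ω / η⌋) (by positivity)
    (fun a b h1 h2 => by simp [h1, h2]) (fun ω => ?_)
  have : (fun ω => ⌊X ω / η⌋) '' {a | f a = f ω} ⊆
      (Finset.Icc (⌊X ω / η⌋ - (K + 1)) (⌊X ω / η⌋ + (K + 1)) : Finset ℤ) := by
    rintro _ ⟨a, ha, rfl⟩
    have h1 := h a ω ha
    have h2 : |X a / η - X ω / η| ≤ K := by
      rw [← sub_div, abs_div, abs_of_pos hη, div_le_iff₀ hη]
      exact h1
    rw [abs_le] at h2
    simp only [Finset.coe_Icc, Set.mem_Icc]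
    have h3 := Int.floor_le (X a / η)
    have h4 := Int.lt_floor_add_one (X a / η)
    have h5 := Int.floor_le (X ω / η)
    have h6 := Int.lt_floor_add_one (X ω / η)
    constructor
    · have : ((⌊X ω / η⌋ - (K + 1) : ℤ) : ℝ) < ⌊X a / η⌋ + 1 := by push_cast; linarith
      have : (⌊X ω / η⌋ - (K + 1) : ℤ) < ⌊X a / η⌋ + 1 := by exact_mod_cast this
      omega
    · have : ((⌊X a / η⌋ : ℤ) : ℝ) < ⌊X ω / η⌋ + (K + 1) + 1 := by linarith
      have : (⌊X a / η⌋ : ℤ) < ⌊X ω / η⌋ + (K + 1) + 1 := by exact_mod_cast this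
      omega
  refine (Set.encard_le_encard this).trans ?_
  rw [Set.encard_coe_eq_coe_finsetCard, Int.card_Icc]
  have : (⌊X ω / η⌋ + (↑K + 1) + 1 - (⌊X ω / η⌋ - (↑K + 1))).toNat = 2 * K + 3 := by omega
  rw [this]

end Entropy

section Lattice

/-- `SL(2, ℝ)`. -/
abbrev SLR := Matrix.SpecialLinearGroup (Fin 2) ℝ

/-- `SL(2, ℤ)`. -/
abbrev SLZ := Matrix.SpecialLinearGroup (Fin 2) ℤ

/-- The inclusion of `SL(2, ℤ)` in `SL(2, ℝ)`. -/
noncomputable def embZ : SLZ →* SLR := Matrix.SpecialLinearGroup.map (Int.castRingHom ℝ)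

lemma embZ_apply (γ : SLZ) (i j : Fin 2) : embZ γ i j = ((γ i j : ℤ) : ℝ) := rfl

lemma SLR.mul_apply (g h : SLR) (i j : Fin 2) : (g * h) i j = g i 0 * h 0 j + g i 1 * h 1 j := by
  simp [Matrix.mul_apply, Fin.sum_univ_two]

lemma SLR.det_eq (g : SLR) : g 0 0 * g 1 1 - g 0 1 * g 1 0 = 1 := by
  rw [← Matrix.det_fin_two]; exact g.2

lemma SLR.inv00 (g : SLR) : g⁻¹ 0 0 = g 1 1 := by simp [Matrix.SpecialLinearGroup.SL2_inv_expl]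
lemma SLR.inv01 (g : SLR) : g⁻¹ 0 1 = -g 0 1 := by simp [Matrix.SpecialLinearGroup.SL2_inv_expl]
lemma SLR.inv10 (g : SLR) : g⁻¹ 1 0 = -g 1 0 := by simp [Matrix.SpecialLinearGroup.SL2_inv_expl]
lemma SLR.inv11 (g : SLR) : g⁻¹ 1 1 = g 0 0 := by simp [Matrix.SpecialLinearGroup.SL2_inv_expl]

lemma SLR.ext4 {g h : SLR} (h00 : g 0 0 = h 0 0) (h01 : g 0 1 = h 0 1) (h10 : g 1 0 = h 1 0)
    (h11 : g 1 1 = h 1 1) : g = h := by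
  ext i j
  fin_cases i <;> fin_cases j <;> assumption

/-- The upper unipotent matrix with parameter `x`. -/
def uu (x : ℝ) : SLR := ⟨!![1, x; 0, 1], by simp [Matrix.det_fin_two]⟩

@[simp] lemma uu00 (x : ℝ) : uu x 0 0 = 1 := rfl
@[simp] lemma uu01 (x : ℝ) : uu x 0 1 = x := rfl
@[simp] lemma uu10 (x : ℝ) : uu x 1 0 = 0 := rfl
@[simp] lemma uu11 (x : ℝ) : uu x 1 1 = 1 := rfl

/-- The diagonal matrix `diag(e^y, e^{-y})`. -/
noncomputable def av (y : ℝ) : SLR :=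
  ⟨!![Real.exp y, 0; 0, Real.exp (-y)], by simp [Matrix.det_fin_two, ← Real.exp_add]⟩

@[simp] lemma av00 (x : ℝ) : av x 0 0 = Real.exp x := rfl
@[simp] lemma av01 (x : ℝ) : av x 0 1 = 0 := rfl
@[simp] lemma av10 (x : ℝ) : av x 1 0 = 0 := rfl
@[simp] lemma av11 (x : ℝ) : av x 1 1 = Real.exp (-x) := rfl

lemma uu_add (x y : ℝ) : uu (x + y) = uu x * uu y := by
  apply SLR.ext4 <;> simp [SLR.mul_apply, add_comm]

lemma uu_zero : uu 0 = 1 := by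
  apply SLR.ext4 <;> simp

lemma uu_neg (x : ℝ) : uu (-x) = (uu x)⁻¹ := by
  apply SLR.ext4 <;> simp [SLR.inv00, SLR.inv01, SLR.inv10, SLR.inv11]

lemma av_add (x y : ℝ) : av (x + y) = av x * av y := by
  apply SLR.ext4 <;> simp [SLR.mul_apply, Real.exp_add, mul_comm]

lemma av_neg (x : ℝ) : av (-x) = (av x)⁻¹ := by
  apply SLR.ext4 <;> simp [SLR.inv00, SLR.inv01, SLR.inv10, SLR.inv11]

lemma av_mul_uu (y x : ℝ) : av y * uu x = uu (Real.exp (2 * y) * x) * av y := by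
  apply SLR.ext4 <;> simp [SLR.mul_apply]
  rw [mul_right_comm, ← Real.exp_add]
  ring_nf

/-- All entries of `k - 1` are at most `ε`. -/
structure Near1 (ε : ℝ) (k : SLR) : Prop where
  h00 : |k 0 0 - 1| ≤ ε
  h01 : |k 0 1| ≤ ε
  h10 : |k 1 0| ≤ ε
  h11 : |k 1 1 - 1| ≤ ε

lemma Near1.nonneg {ε : ℝ} {k : SLR} (h : Near1 ε k) : 0 ≤ ε := (abs_nonneg _).trans h.h00

lemma Near1.mono {ε ε' : ℝ} {k : SLR} (h : Near1 ε k) (h' : ε ≤ ε') : Near1 ε' k :=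
  ⟨h.1.trans h', h.2.trans h', h.3.trans h', h.4.trans h'⟩

lemma Near1.inv {ε : ℝ} {k : SLR} (h : Near1 ε k) : Near1 ε k⁻¹ := by
  refine ⟨?_, ?_, ?_, ?_⟩
  · rw [SLR.inv00]; exact h.h11
  · rw [SLR.inv01, abs_neg]; exact h.h01
  · rw [SLR.inv10, abs_neg]; exact h.h10
  · rw [SLR.inv11]; exact h.h00

lemma Near1.one {ε : ℝ} (h : 0 ≤ ε) : Near1 ε 1 := by
  constructor <;> simp [h]

lemma abs_mul_le_mul {a b x y : ℝ} (ha : |a| ≤ x) (hb : |b| ≤ y) : |a * b| ≤ x * y := by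
  rw [abs_mul]; exact mul_le_mul ha hb (abs_nonneg _) ((abs_nonneg _).trans ha)

lemma Near1.mul {ε ε' : ℝ} {k k' : SLR} (h : Near1 ε k) (h' : Near1 ε' k') (h1 : ε' ≤ 1) :
    Near1 (3 * (ε + ε')) (k * k') := by
  have e0 := h.nonneg
  have e0' := h'.nonneg
  have hb : ε * ε' ≤ ε := mul_le_of_le_one_right e0 h1
  obtain ⟨a1, a2, a3, a4⟩ := h
  obtain ⟨b1, b2, b3, b4⟩ := h'
  have p11 := abs_le.1 (abs_mul_le_mul a1 b1)
  have p12 := abs_le.1 (abs_mul_le_mul a1 b2)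
  have p23 := abs_le.1 (abs_mul_le_mul a2 b3)
  have p24 := abs_le.1 (abs_mul_le_mul a2 b4)
  have p31 := abs_le.1 (abs_mul_le_mul a3 b1)
  have p32 := abs_le.1 (abs_mul_le_mul a3 b2)
  have p43 := abs_le.1 (abs_mul_le_mul a4 b3)
  have p44 := abs_le.1 (abs_mul_le_mul a4 b4)
  rw [abs_le] at a1 a2 a3 a4 b1 b2 b3 b4
  constructor <;> rw [SLR.mul_apply, abs_le] <;> constructor <;> nlinarith

lemma Near1.conj_uu {ε X x : ℝ} {k : SLR} (h : Near1 ε k) (hx : |x| ≤ X) :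
    Near1 ((1 + X) ^ 2 * ε) (uu x * k * (uu x)⁻¹) := by
  have e0 := h.nonneg
  have hX : 0 ≤ X := (abs_nonneg _).trans hx
  obtain ⟨a1, a2, a3, a4⟩ := h
  have p1 := abs_le.1 (abs_mul_le_mul hx a1)
  have p3 := abs_le.1 (abs_mul_le_mul hx a3)
  have p4 := abs_le.1 (abs_mul_le_mul hx a4)
  have p33 := abs_le.1 (abs_mul_le_mul hx (abs_mul_le_mul hx a3))
  rw [abs_le] at a1 a2 a3 a4
  have q : 0 ≤ X * ε := by positivity
  have q2 : 0 ≤ X * (X * ε) := by positivity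
  constructor <;> simp only [SLR.mul_apply, SLR.inv00, SLR.inv01, SLR.inv10, SLR.inv11, uu00, uu01,
    uu10, uu11, abs_le] <;> constructor <;> nlinarith

/-- Every nonzero vector of the lattice `g ℤ²` has sup norm at least `1 / A`. -/
def Bad (A : ℝ) (g : SLR) : Prop :=
  ∀ p q : ℤ, (p ≠ 0 ∨ q ≠ 0) → 1 / A ≤ max |g 0 0 * p + g 0 1 * q| |g 1 0 * p + g 1 1 * q|

lemma Bad.mono {A B : ℝ} {g : SLR} (h : Bad A g) (hA : 0 < A) (hAB : A ≤ B) : Bad B g :=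
  fun p q hpq => (one_div_le_one_div_of_le hA hAB).trans (h p q hpq)

lemma Bad.mul_embZ {A : ℝ} {g : SLR} (h : Bad A g) (γ : SLZ) : Bad A (g * embZ γ) := by
  intro p q hpq
  have := h (γ 0 0 * p + γ 0 1 * q) (γ 1 0 * p + γ 1 1 * q) (by
    by_contra hcon
    push Not at hcon
    have hdet : γ 0 0 * γ 1 1 - γ 0 1 * γ 1 0 = 1 := by rw [← Matrix.det_fin_two]; exact γ.2
    have hp : p = 0 := by linear_combination γ 1 1 * hcon.1 - γ 0 1 * hcon.2 - p * hdet
    have hq : q = 0 := by linear_combination -γ 1 0 * hcon.1 + γ 0 0 * hcon.2 - q * hdet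
    simp [hp, hq] at hpq)
  convert this using 3 <;>
  · simp only [SLR.mul_apply, embZ_apply]; push_cast; ring

lemma Bad.uu_mul {A X x : ℝ} {g : SLR} (h : Bad A g) (hA : 0 < A) (hx : 1 + |x| ≤ X) :
    Bad (A * X) (uu x * g) := by
  intro p q hpq
  have hX : 0 < X := by linarith [abs_nonneg x]
  have := h p q hpq
  simp only [SLR.mul_apply, uu00, uu01, uu10, uu11]
  set α := g 0 0 * p + g 0 1 * q
  set β := g 1 0 * p + g 1 1 * q
  rw [show (1 * g 0 0 + x * g 1 0) * (p : ℝ) + (1 * g 0 1 + x * g 1 1) * q = α + x * β by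
    simp only [α, β]; ring, show (0 * g 0 0 + 1 * g 1 0) * (p : ℝ) + (0 * g 0 1 + 1 * g 1 1) * q = β by
    simp only [β]; ring]
  have h1 : max |α| |β| ≤ X * max |α + x * β| |β| := by
    have m1 := le_max_left |α + x * β| |β|
    have m2 := le_max_right |α + x * β| |β|
    have m0 : 0 ≤ max |α + x * β| |β| := (abs_nonneg _).trans m1
    refine max_le ?_ ?_
    · have : |α| ≤ |α + x * β| + |x| * |β| := by
        have := abs_sub (α + x * β) (x * β)
        rwa [add_sub_cancel_right, abs_mul] at this
      nlinarith [abs_nonneg x]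
    · nlinarith [abs_nonneg x]
  have h2 : 1 / (A * X) * X = 1 / A := by field_simp
  have h3 : 1 / (A * X) * X ≤ max |α + x * β| |β| * X := by rw [h2]; linarith
  exact le_of_mul_le_mul_right h3 hX

/-- Gauss reduction. -/
lemma exists_reduced (g : SLR) : ∃ γ : SLZ,
    (g * embZ γ) 0 0 ^ 2 + (g * embZ γ) 1 0 ^ 2 ≤ 6 / 5 ∧
    (g * embZ γ) 0 1 ^ 2 + (g * embZ γ) 1 1 ^ 2 ≤
      ((g * embZ γ) 0 0 ^ 2 + (g * embZ γ) 1 0 ^ 2) / 4 +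
      1 / ((g * embZ γ) 0 0 ^ 2 + (g * embZ γ) 1 0 ^ 2) := by
  have hdet := g.det_eq
  set v1 : ℂ := ⟨g 0 0, g 1 0⟩ with hv1
  set v2 : ℂ := ⟨g 0 1, g 1 1⟩ with hv2
  have hn1 : Complex.normSq v1 = g 0 0 ^ 2 + g 1 0 ^ 2 := by simp [Complex.normSq_apply, hv1, sq]
  have hN : 0 < g 0 0 ^ 2 + g 1 0 ^ 2 := by
    rcases eq_or_ne (g 0 0) 0 with h | h
    · have : g 1 0 ≠ 0 := by rintro h'; rw [h, h'] at hdet; simp at hdet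
      positivity
    · positivity
  have hv10 : v1 ≠ 0 := by
    rw [← Complex.normSq_pos, hn1]; exact hN
  have him : (v2 / v1).im = 1 / Complex.normSq v1 := by
    rw [Complex.div_im]
    simp only [hv1, hv2]
    rw [← sub_div]
    congr 1
    linarith
  have him0 : 0 < (v2 / v1).im := by rw [him, hn1]; positivity
  obtain ⟨σ, hσ1, hσ2⟩ := ModularGroup.exists_smul_mem_fd (⟨v2 / v1, him0⟩ : UpperHalfPlane)
  have hσdet : σ 0 0 * σ 1 1 - σ 0 1 * σ 1 0 = 1 := by rw [← Matrix.det_fin_two]; exact σ.2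
  refine ⟨⟨!![σ 1 1, σ 0 1; σ 1 0, σ 0 0], by rw [Matrix.det_fin_two]; simp; linarith⟩, ?_⟩
  set γ : SLZ := ⟨!![σ 1 1, σ 0 1; σ 1 0, σ 0 0], by rw [Matrix.det_fin_two]; simp; linarith⟩
  set h := g * embZ γ with hh
  set w1 : ℂ := ⟨h 0 0, h 1 0⟩ with hw1
  set w2 : ℂ := ⟨h 0 1, h 1 1⟩ with hw2
  have g00 : embZ γ 0 0 = (σ 1 1 : ℝ) := rfl
  have g01 : embZ γ 0 1 = (σ 0 1 : ℝ) := rfl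
  have g10 : embZ γ 1 0 = (σ 1 0 : ℝ) := rfl
  have g11 : embZ γ 1 1 = (σ 0 0 : ℝ) := rfl
  have e1 : w1 = (σ 1 0 : ℝ) * v2 + (σ 1 1 : ℝ) * v1 := by
    apply Complex.ext <;> simp [hw1, hh, SLR.mul_apply, g00, g10, hv1, hv2] <;> ring
  have e2 : w2 = (σ 0 0 : ℝ) * v2 + (σ 0 1 : ℝ) * v1 := by
    apply Complex.ext <;> simp [hw2, hh, SLR.mul_apply, g01, g11, hv1, hv2] <;> ring
  have hdet' := h.det_eq
  have hm1 : Complex.normSq w1 = h 0 0 ^ 2 + h 1 0 ^ 2 := by simp [Complex.normSq_apply, hw1, sq]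
  have hm2 : Complex.normSq w2 = h 0 1 ^ 2 + h 1 1 ^ 2 := by simp [Complex.normSq_apply, hw2, sq]
  have hM : 0 < h 0 0 ^ 2 + h 1 0 ^ 2 := by
    rcases eq_or_ne (h 0 0) 0 with h' | h'
    · have : h 1 0 ≠ 0 := by rintro h''; rw [h', h''] at hdet'; simp at hdet'
      positivity
    · positivity
  have hcoe : ((σ • (⟨v2 / v1, him0⟩ : UpperHalfPlane) : UpperHalfPlane) : ℂ) = w2 / w1 := by
    rw [UpperHalfPlane.coe_specialLinearGroup_apply, e1, e2]
    have hw10 : (σ 1 0 : ℝ) * v2 + (σ 1 1 : ℝ) * v1 ≠ 0 := by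
      rw [← e1, ← Complex.normSq_pos, hm1]; exact hM
    have hden : (σ 1 0 : ℂ) * (v2 / v1) + (σ 1 1 : ℂ) ≠ 0 := by
      intro h0
      apply hw10
      push_cast
      field_simp at h0
      linear_combination h0
    simp only [algebraMap_int_eq, eq_intCast, Complex.ofReal_intCast] at *
    rw [div_eq_div_iff hden hw10]
    field_simp
  rw [hcoe, Complex.normSq_div, hm1, hm2, le_div_iff₀ hM] at hσ1
  rw [← UpperHalfPlane.coe_re, hcoe, Complex.div_re, hm1] at hσ2
  simp only [hw1, hw2] at hσ2
  rw [← add_div, abs_div, abs_of_pos hM, div_le_iff₀ hM] at hσ2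
  set P := h 0 0 ^ 2 + h 1 0 ^ 2 with hP
  set Q := h 0 1 ^ 2 + h 1 1 ^ 2 with hQ
  set D := h 0 1 * h 0 0 + h 1 1 * h 1 0 with hD
  have hPQ : P * Q = D ^ 2 + 1 := by
    simp only [hP, hQ, hD]
    linear_combination (h 0 0 * h 1 1 - h 0 1 * h 1 0 + 1) * hdet'
  have hD2 : D ^ 2 ≤ P ^ 2 / 4 := by
    rw [← sq_abs D]
    have : |D| ^ 2 ≤ (1 / 2 * P) ^ 2 := pow_le_pow_left₀ (abs_nonneg _) hσ2 2
    linarith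
  constructor
  · nlinarith
  · rw [div_add_div _ _ (by norm_num) hM.ne', le_div_iff₀ (by positivity)]
    nlinarith

/-- A reducing element for `g`. -/
noncomputable def redZ (g : SLR) : SLZ := (exists_reduced g).choose

/-- A reduced basis of the lattice of `g`. -/
noncomputable def red (g : SLR) : SLR := g * embZ (redZ g)

lemma Bad.abs_red_le {A : ℝ} {g : SLR} (h : Bad A g) (hA : 1 ≤ A) (i j : Fin 2) :
    |red g i j| ≤ 2 * A := by
  have h1 := (exists_reduced g).choose_spec.1
  have h2 := (exists_reduced g).choose_spec.2
  have hb := h.mul_embZ (exists_reduced g).choose 1 0 (by simp)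
  change red g 0 0 ^ 2 + red g 1 0 ^ 2 ≤ 6 / 5 at h1
  change red g 0 1 ^ 2 + red g 1 1 ^ 2 ≤ (red g 0 0 ^ 2 + red g 1 0 ^ 2) / 4 +
    1 / (red g 0 0 ^ 2 + red g 1 0 ^ 2) at h2
  change 1 / A ≤ max |red g 0 0 * (1 : ℤ) + red g 0 1 * (0 : ℤ)|
    |red g 1 0 * (1 : ℤ) + red g 1 1 * (0 : ℤ)| at hb
  simp only [Int.cast_one, mul_one, Int.cast_zero, mul_zero, add_zero] at hb
  have hA0 : 0 < A := by linarith
  have hlow : 1 / A ^ 2 ≤ red g 0 0 ^ 2 + red g 1 0 ^ 2 := by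
    have : (1 / A) ^ 2 ≤ (max |red g 0 0| |red g 1 0|) ^ 2 :=
      pow_le_pow_left₀ (by positivity) hb 2
    rw [one_div_pow] at this
    refine this.trans ?_
    rcases max_choice |red g 0 0| |red g 1 0| with h | h <;> rw [h, sq_abs] <;> nlinarith [
      sq_nonneg (red g 0 0), sq_nonneg (red g 1 0)]
  have hpos : 0 < 1 / A ^ 2 := by positivity
  have hup : 1 / (red g 0 0 ^ 2 + red g 1 0 ^ 2) ≤ A ^ 2 := by
    rw [div_le_iff₀ (by linarith)]
    rw [div_le_iff₀ (by positivity)] at hlow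
    linarith
  have hA2 : 1 ≤ A ^ 2 := by nlinarith
  apply abs_le_of_sq_le_sq _ (by positivity)
  fin_cases i <;> fin_cases j <;> simp <;>
  nlinarith [sq_nonneg (red g 0 0), sq_nonneg (red g 1 0), sq_nonneg (red g 0 1),
    sq_nonneg (red g 1 1)]

lemma Bad.red {A : ℝ} {g : SLR} (h : Bad A g) : Bad A (red g) := h.mul_embZ _

lemma SLR.inv_le {B : ℝ} {g : SLR} (h : ∀ i j, |g i j| ≤ B) (i j : Fin 2) : |g⁻¹ i j| ≤ B := by
  fin_cases i <;> fin_cases j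
  · have := h 1 1; simpa [SLR.inv00] using this
  · have := h 0 1; simpa [SLR.inv01] using this
  · have := h 1 0; simpa [SLR.inv10] using this
  · have := h 0 0; simpa [SLR.inv11] using this

lemma abs_dot_le {a b c d x y : ℝ} (ha : |a| ≤ x) (hb : |b| ≤ y) (hc : |c| ≤ x) (hd : |d| ≤ y) :
    |a * b + c * d| ≤ 2 * (x * y) := by
  have h1 := abs_mul_le_mul ha hb
  have h2 := abs_mul_le_mul hc hd
  exact (abs_add_le _ _).trans (by linarith)

lemma SLR.mul_le {B C : ℝ} {g h : SLR} (hg : ∀ i j, |g i j| ≤ B) (hh : ∀ i j, |h i j| ≤ C)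
    (i j : Fin 2) : |(g * h) i j| ≤ 2 * (B * C) := by
  rw [SLR.mul_apply]; exact abs_dot_le (hg _ _) (hh _ _) (hg _ _) (hh _ _)

lemma Near1.mul_sub_le {ε B : ℝ} {k h : SLR} (hk : Near1 ε k) (hh : ∀ i j, |h i j| ≤ B)
    (i j : Fin 2) : |(k * h) i j - h i j| ≤ 2 * (ε * B) := by
  rw [SLR.mul_apply]
  fin_cases i
  · have : k 0 0 * h 0 j + k 0 1 * h 1 j - h 0 j = (k 0 0 - 1) * h 0 j + k 0 1 * h 1 j := by ring
    simp only [Fin.zero_eta]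
    rw [this]
    exact abs_dot_le hk.h00 (hh _ _) hk.h01 (hh _ _)
  · have : k 1 0 * h 0 j + k 1 1 * h 1 j - h 1 j = k 1 0 * h 0 j + (k 1 1 - 1) * h 1 j := by ring
    simp only [Fin.mk_one]
    rw [this]
    exact abs_dot_le hk.h10 (hh _ _) hk.h11 (hh _ _)

lemma Near1.abs_le {ε : ℝ} {k : SLR} (hk : Near1 ε k) (hε : ε ≤ 1) (i j : Fin 2) :
    |k i j| ≤ 2 := by
  obtain ⟨a, b, c, d⟩ := hk
  rw [_root_.abs_le] at a b c d ⊢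
  fin_cases i <;> fin_cases j <;> simp <;> constructor <;> linarith

/-- `g'` and `g` define nearby lattices. -/
def Near (ε : ℝ) (g g' : SLR) : Prop := ∃ (γ : SLZ) (k : SLR), Near1 ε k ∧ g' * embZ γ = k * g

/-- A matrix commuting with a bad lattice and close to the identity is the identity. -/
lemma Bad.eq_one {A ε : ℝ} {g k : SLR} {γ : SLZ} (h : Bad A g) (hA : 1 ≤ A) (hk : Near1 ε k)
    (hε : 4 * A ^ 2 * ε < 1) (e : g * embZ γ = k * g) : k = 1 := by
  set h0 := _root_.red g with hh0
  have hA0 : 0 < A := by linarith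
  set σ : SLZ := (redZ g)⁻¹ * γ * redZ g
  have e1 : k * h0 = h0 * embZ σ := by
    simp only [hh0, _root_.red, σ, map_mul, map_inv]
    rw [← mul_assoc, ← e]
    group
  have hsub := hk.mul_sub_le (h.abs_red_le hA)
  rw [← hh0] at hsub
  have hlt : 2 * (ε * (2 * A)) < 1 / A := by
    rw [lt_div_iff₀ hA0]; nlinarith
  have hcol : ∀ j : Fin 2, (k * h0) 0 j = h0 0 j ∧ (k * h0) 1 j = h0 1 j := by
    intro j
    have hb := h.red (σ 0 j - (if j = 0 then 1 else 0)) (σ 1 j - (if j = 1 then 1 else 0))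
    have ea : ∀ i, h0 i 0 * ((σ 0 j - (if j = 0 then 1 else 0) : ℤ) : ℝ) +
        h0 i 1 * ((σ 1 j - (if j = 1 then 1 else 0) : ℤ) : ℝ) = (k * h0) i j - h0 i j := by
      intro i
      rw [e1, SLR.mul_apply, embZ_apply, embZ_apply]
      fin_cases j <;> simp <;> ring
    rw [← hh0, ea, ea] at hb
    by_cases hz : (σ 0 j - (if j = 0 then 1 else 0) ≠ 0 ∨ σ 1 j - (if j = 1 then 1 else 0) ≠ 0)
    · have := hb hz
      have := max_lt ((hsub 0 j).trans_lt hlt) ((hsub 1 j).trans_lt hlt)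
      linarith
    · push Not at hz
      have e2 := ea 0
      have e3 := ea 1
      rw [hz.1, hz.2] at e2 e3
      simp only [Int.cast_zero, mul_zero, add_zero] at e2 e3
      constructor <;> linarith
  have : k * h0 = h0 := SLR.ext4 (hcol 0).1 (hcol 1).1 (hcol 0).2 (hcol 1).2
  simpa using this

/-- The cell of mesh `η` containing the reduced basis of `g`. -/
noncomputable def cell (η : ℝ) (g : SLR) : ℤ × ℤ × ℤ × ℤ :=
  (⌊red g 0 0 / η⌋, ⌊red g 0 1 / η⌋, ⌊red g 1 0 / η⌋, ⌊red g 1 1 / η⌋)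

lemma abs_sub_le_of_floor_eq {x y η : ℝ} (hη : 0 < η) (h : ⌊x / η⌋ = ⌊y / η⌋) : |x - y| ≤ η := by
  have := Int.abs_sub_lt_one_of_floor_eq_floor h
  rw [← sub_div, abs_div, abs_of_pos hη, div_lt_one hη] at this
  exact this.le

lemma near_of_cell_eq {A η : ℝ} {g g' : SLR} (h : Bad A g) (hA : 1 ≤ A) (hη : 0 < η)
    (hc : cell η g = cell η g') : Near (4 * A * η) g g' := by
  simp only [cell, Prod.mk.injEq] at hc
  have hd : ∀ i j, |red g' i j - red g i j| ≤ η := by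
    intro i j
    fin_cases i <;> fin_cases j
    · exact abs_sub_le_of_floor_eq hη hc.1.symm
    · exact abs_sub_le_of_floor_eq hη hc.2.1.symm
    · exact abs_sub_le_of_floor_eq hη hc.2.2.1.symm
    · exact abs_sub_le_of_floor_eq hη hc.2.2.2.symm
  have hi := SLR.inv_le (h.abs_red_le hA)
  refine ⟨redZ g' * (redZ g)⁻¹, red g' * (red g)⁻¹, ?_, ?_⟩
  · have h1 : ∀ i j, (red g' * (red g)⁻¹) i j - (1 : SLR) i j =
        (red g' i 0 - red g i 0) * (red g)⁻¹ 0 j + (red g' i 1 - red g i 1) * (red g)⁻¹ 1 j := by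
      intro i j
      rw [← mul_inv_cancel (red g), SLR.mul_apply, SLR.mul_apply]
      ring
    have h2 : ∀ i j, |(red g' * (red g)⁻¹) i j - (1 : SLR) i j| ≤ 4 * A * η := by
      intro i j
      rw [h1]
      exact (abs_dot_le (hd _ _) (hi _ _) (hd _ _) (hi _ _)).trans (by linarith)
    exact ⟨by simpa using h2 0 0, by simpa using h2 0 1, by simpa using h2 1 0, by simpa using h2 1 1⟩
  · simp only [red, map_mul, map_inv]
    group

lemma abs_floor_sub_le {x y c : ℝ} (h : |x - y| ≤ c) : |⌊x⌋ - ⌊y⌋| ≤ ⌈c⌉ + 1 := by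
  rw [abs_le] at h ⊢
  have h3 := Int.floor_le x
  have h4 := Int.lt_floor_add_one x
  have h5 := Int.floor_le y
  have h6 := Int.lt_floor_add_one y
  have h7 := Int.le_ceil c
  constructor
  · have : ((⌊y⌋ - ⌈c⌉ : ℤ) : ℝ) < ((⌊x⌋ + 1 : ℤ) : ℝ) := by push_cast; linarith
    have := Int.cast_lt.1 this
    linarith
  · have : ((⌊x⌋ - ⌈c⌉ : ℤ) : ℝ) < ((⌊y⌋ + 1 : ℤ) : ℝ) := by push_cast; linarith
    have := Int.cast_lt.1 this
    linarith

/-- Number of cells near a given bad lattice. -/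
lemma encard_cell_near_le {A ε η : ℝ} {g : SLR} (h : Bad A g) (hA : 1 ≤ A) (hη : 0 < η)
    (hε : ε ≤ 1) {S : Set SLR} (hS : ∀ g' ∈ S, Bad A g' ∧ Near ε g g') :
    (cell η '' S).encard ≤
      (((2 * ⌈32 * A ^ 2⌉ + 1).toNat ^ 4 * (2 * (⌈256 * A ^ 3 * ε / η⌉ + 1) + 1).toNat ^ 4 : ℕ) : ℕ∞) := by
  set B := ⌈32 * A ^ 2⌉ with hB
  set C := ⌈256 * A ^ 3 * ε / η⌉ + 1 with hC
  set IB := Finset.Icc (-B) B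
  set IC := Finset.Icc (-C) C
  let F : (ℤ × ℤ × ℤ × ℤ) × (ℤ × ℤ × ℤ × ℤ) → ℤ × ℤ × ℤ × ℤ := fun x =>
    (⌊(red g 0 0 * x.1.1 + red g 0 1 * x.1.2.2.1) / η⌋ + x.2.1,
      ⌊(red g 0 0 * x.1.2.1 + red g 0 1 * x.1.2.2.2) / η⌋ + x.2.2.1,
      ⌊(red g 1 0 * x.1.1 + red g 1 1 * x.1.2.2.1) / η⌋ + x.2.2.2.1,
      ⌊(red g 1 0 * x.1.2.1 + red g 1 1 * x.1.2.2.2) / η⌋ + x.2.2.2.2)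
  have hsub : cell η '' S ⊆ (((IB ×ˢ IB ×ˢ IB ×ˢ IB) ×ˢ (IC ×ˢ IC ×ˢ IC ×ˢ IC)).image F :
      Finset (ℤ × ℤ × ℤ × ℤ)) := by
    rintro _ ⟨g', hg', rfl⟩
    obtain ⟨hb', γ, k, hk, e⟩ := hS g' hg'
    set σ : SLZ := (redZ g)⁻¹ * γ⁻¹ * redZ g' with hσ
    have e1 : red g' = k * (red g * embZ σ) := by
      have : g' = k * g * (embZ γ)⁻¹ := by rw [← e]; group
      simp only [red, hσ, map_mul, map_inv]
      generalize redZ g' = ρ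
      rw [this]
      group
    have e2 : embZ σ = (red g)⁻¹ * k⁻¹ * red g' := by rw [e1]; group
    have hσb : ∀ i j, |embZ σ i j| ≤ 32 * A ^ 2 := by
      intro i j
      rw [e2]
      refine (SLR.mul_le (SLR.mul_le (SLR.inv_le (h.abs_red_le hA)) (hk.inv.abs_le hε))
        (hb'.abs_red_le hA) i j).trans (le_of_eq (by ring))
    have hσb' : ∀ i j, σ i j ∈ IB := by
      intro i j
      have := (hσb i j).trans (Int.le_ceil _)
      rw [embZ_apply, ← Int.cast_abs, Int.cast_le, _root_.abs_le] at this
      exact Finset.mem_Icc.2 this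
    have hprod := SLR.mul_le (h.abs_red_le hA) hσb
    have hdiff := hk.mul_sub_le hprod
    rw [← e1] at hdiff
    have hfl : ∀ i j, ⌊red g' i j / η⌋ - ⌊(red g * embZ σ) i j / η⌋ ∈ IC := by
      intro i j
      have : |red g' i j / η - (red g * embZ σ) i j / η| ≤ 256 * A ^ 3 * ε / η := by
        rw [← sub_div, abs_div, abs_of_pos hη]
        gcongr
        refine (hdiff i j).trans (le_of_eq (by ring))
      have := abs_floor_sub_le this
      rw [_root_.abs_le] at this
      exact Finset.mem_Icc.2 this
    rw [Finset.coe_image]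
    refine ⟨((σ 0 0, σ 0 1, σ 1 0, σ 1 1), (⌊red g' 0 0 / η⌋ - ⌊(red g * embZ σ) 0 0 / η⌋,
      ⌊red g' 0 1 / η⌋ - ⌊(red g * embZ σ) 0 1 / η⌋, ⌊red g' 1 0 / η⌋ - ⌊(red g * embZ σ) 1 0 / η⌋,
      ⌊red g' 1 1 / η⌋ - ⌊(red g * embZ σ) 1 1 / η⌋)), ?_, ?_⟩
    · simp only [Finset.coe_product, Set.mem_prod, Finset.mem_coe]
      exact ⟨⟨hσb' _ _, hσb' _ _, hσb' _ _, hσb' _ _⟩, hfl _ _, hfl _ _, hfl _ _, hfl _ _⟩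
    · simp only [F, cell, SLR.mul_apply, embZ_apply, add_sub_cancel]
  refine (Set.encard_le_encard hsub).trans ?_
  rw [Set.encard_coe_eq_coe_finsetCard]
  refine Nat.cast_le.2 (Finset.card_image_le.trans (le_of_eq ?_))
  simp only [Finset.card_product, IB, IC, Int.card_Icc]
  rw [show B + 1 - -B = 2 * B + 1 by ring, show C + 1 - -C = 2 * C + 1 by ring]
  ring

lemma log_cell_count_le {A ε η : ℝ} {p : ℕ} (hA : 16 ≤ A) (hη : 0 < η) (hε0 : 0 ≤ ε)
    (hεη : ε ≤ A ^ p * η) :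
    Real.log (((2 * ⌈32 * A ^ 2⌉ + 1).toNat ^ 4 *
      (2 * (⌈256 * A ^ 3 * ε / η⌉ + 1) + 1).toNat ^ 4 : ℕ) : ℝ) ≤ (40 + 4 * p) * Real.log A := by
  have hA0 : 0 < A := by linarith
  have h1 : (((2 * ⌈32 * A ^ 2⌉ + 1).toNat : ℕ) : ℝ) ≤ A ^ 4 := by
    have h0 : (0 : ℤ) ≤ ⌈32 * A ^ 2⌉ := Int.ceil_nonneg (by positivity)
    have : (((2 * ⌈32 * A ^ 2⌉ + 1).toNat : ℤ) : ℝ) = ((2 * ⌈32 * A ^ 2⌉ + 1 : ℤ) : ℝ) := by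
      rw [Int.toNat_of_nonneg (by omega)]
    rw [Int.cast_natCast] at this
    rw [this]
    push_cast
    have := Int.ceil_lt_add_one (32 * A ^ 2)
    have h2 : (16 : ℝ) ^ 2 ≤ A ^ 2 := pow_le_pow_left₀ (by norm_num) hA 2
    nlinarith [sq_nonneg (A ^ 2)]
  have h0 : 0 ≤ 256 * A ^ 3 * ε / η := by positivity
  have h2 : (((2 * (⌈256 * A ^ 3 * ε / η⌉ + 1) + 1).toNat : ℕ) : ℝ) ≤ A ^ (6 + p) := by
    have h0' : (0 : ℤ) ≤ ⌈256 * A ^ 3 * ε / η⌉ := Int.ceil_nonneg h0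
    have : (((2 * (⌈256 * A ^ 3 * ε / η⌉ + 1) + 1).toNat : ℤ) : ℝ) =
        ((2 * (⌈256 * A ^ 3 * ε / η⌉ + 1) + 1 : ℤ) : ℝ) := by
      rw [Int.toNat_of_nonneg (by omega)]
    rw [Int.cast_natCast] at this
    rw [this]
    push_cast
    have h3 := Int.ceil_lt_add_one (256 * A ^ 3 * ε / η)
    have h4 : 256 * A ^ 3 * ε / η ≤ 256 * A ^ 3 * A ^ p := by
      rw [div_le_iff₀ hη]
      calc 256 * A ^ 3 * ε ≤ 256 * A ^ 3 * (A ^ p * η) := by gcongr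
        _ = _ := by ring
    have h5 : (16 : ℝ) ^ 3 ≤ A ^ 3 := pow_le_pow_left₀ (by norm_num) hA 3
    have h6 : (1 : ℝ) ≤ A ^ p := one_le_pow₀ (by linarith)
    have h7 : A ^ (6 + p) = A ^ 3 * (A ^ 3 * A ^ p) := by ring
    rw [h7]
    have h8 : 1 ≤ A ^ 3 * A ^ p := by nlinarith
    nlinarith
  have hpos1 : (0 : ℝ) < ((2 * ⌈32 * A ^ 2⌉ + 1).toNat : ℕ) := by
    have h0 : (0 : ℤ) ≤ ⌈32 * A ^ 2⌉ := Int.ceil_nonneg (by positivity)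
    exact_mod_cast (by omega : 0 < (2 * ⌈32 * A ^ 2⌉ + 1).toNat)
  have hpos2 : (0 : ℝ) < ((2 * (⌈256 * A ^ 3 * ε / η⌉ + 1) + 1).toNat : ℕ) := by
    have h0' : (0 : ℤ) ≤ ⌈256 * A ^ 3 * ε / η⌉ := Int.ceil_nonneg h0
    exact_mod_cast (by omega : 0 < (2 * (⌈256 * A ^ 3 * ε / η⌉ + 1) + 1).toNat)
  have l1 := Real.log_le_log hpos1 h1
  have l2 := Real.log_le_log hpos2 h2
  rw [Real.log_pow] at l1 l2
  rw [Nat.cast_mul, Nat.cast_pow, Nat.cast_pow, Real.log_mul (by positivity) (by positivity),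
    Real.log_pow, Real.log_pow]
  push_cast at *
  linarith

/-- If equality of `f` forces the lattices `Ψ` to be close, the cell of `Ψ` costs little. -/
lemma ent_cell_le {Ω β : Type*} [Fintype Ω] {f : Ω → β} {Ψ : Ω → SLR} {A ε η : ℝ} (p : ℕ)
    (hA : 16 ≤ A) (hη : 0 < η) (hε0 : 0 ≤ ε) (hε : ε ≤ 1) (hεη : ε ≤ A ^ p * η)
    (hbad : ∀ ω, Bad A (Ψ ω)) (h : ∀ a b, f a = f b → Near ε (Ψ a) (Ψ b)) :
    ent (fun ω => (f ω, cell η (Ψ ω))) ≤ ent f + (40 + 4 * p) * Real.log A := by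
  refine (ent_le_add_log (f := f) (g := fun ω => cell η (Ψ ω)) (N := (2 * ⌈32 * A ^ 2⌉ + 1).toNat ^ 4 *
      (2 * (⌈256 * A ^ 3 * ε / η⌉ + 1) + 1).toNat ^ 4) ?_ (fun a b h1 h2 => by simp [h1, h2])
      (fun ω => ?_)).trans (add_le_add_right (log_cell_count_le hA hη hε0 hεη) _)
  · have h0 : (0 : ℤ) ≤ ⌈32 * A ^ 2⌉ := Int.ceil_nonneg (by positivity)
    have h0' : (0 : ℤ) ≤ ⌈256 * A ^ 3 * ε / η⌉ := Int.ceil_nonneg (by positivity)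
    have h1 : 0 < (2 * ⌈32 * A ^ 2⌉ + 1).toNat := by omega
    have h2 : 0 < (2 * (⌈256 * A ^ 3 * ε / η⌉ + 1) + 1).toNat := by omega
    positivity
  · have := encard_cell_near_le (hbad ω) (by linarith) hη hε (S := Ψ '' {a | f a = f ω}) (by
      rintro _ ⟨a, ha, rfl⟩
      exact ⟨hbad a, h ω a (Eq.symm ha)⟩)
    rwa [Set.image_image] at this

end Lattice

/-! ### Entropy growth under random unipotent translation -/

/-- Bounded unipotent translates of the lattices `Λ ω` are bad, and the mesh `η` is small. -/
structure KVCtx {Ω : Type*} (A X η : ℝ) (Λ : Ω → SLR) : Prop where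
  hX : 0 ≤ X
  hA : 16 ≤ A
  hXA : 2 * (1 + X) ≤ A
  hη0 : 0 < η
  hη : A ^ 3 * η ≤ 1
  bad : ∀ ω x, |x| ≤ X → Bad A (uu x * Λ ω)

/-- The basic error term. -/
noncomputable def kverr (A : ℝ) : ℝ := 52 * Real.log A

lemma KVCtx.kverr_nonneg {Ω : Type*} {A X η : ℝ} {Λ : Ω → SLR} (H : KVCtx A X η Λ) :
    0 ≤ kverr A := by
  have := Real.log_nonneg (by linarith [H.hA] : (1 : ℝ) ≤ A)
  unfold kverr; positivity

section
variable {Ω Ω₁ Ω₂ Ω₃ σ σ' β : Type*} [Fintype Ω] [Fintype Ω₁] [Fintype Ω₂] [Fintype Ω₃]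
  [Nonempty Ω] [Nonempty Ω₁] [Nonempty Ω₂] [Nonempty Ω₃] [Fintype σ] [Fintype σ']
  {A X η : ℝ} {Λ : Ω → SLR}

/-- Applying a known unipotent to a known cell costs a bounded error. -/
lemma KVCtx.ent_le (H : KVCtx A X η Λ) {f : Ω₃ → β} {π : Ω₃ → Ω} {d d' : Ω₃ → ℝ}
    (hd : ∀ x, |d x| ≤ X) (hd' : ∀ x, |d' x| ≤ X) (hdd : ∀ x, |d' x - d x| ≤ X)
    (h : ∀ a b, f a = f b → d' a - d a = d' b - d b ∧
      cell η (uu (d a) * Λ (π a)) = cell η (uu (d b) * Λ (π b))) :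
    ent (fun x => (f x, cell η (uu (d' x) * Λ (π x)))) ≤ ent f + kverr A := by
  have hA := H.hA
  have hX := H.hX
  have hη0 := H.hη0
  have hp : 4 * A * (1 + X) ^ 2 ≤ A ^ 3 := by
    have : (2 * (1 + X)) ^ 2 ≤ A ^ 2 := pow_le_pow_left₀ (by linarith) H.hXA 2
    nlinarith
  have e : (1 + X) ^ 2 * (4 * A * η) ≤ A ^ 3 * η := by
    have := mul_le_mul_of_nonneg_right hp hη0.le
    linarith
  have := ent_cell_le (f := f) (Ψ := fun x => uu (d' x) * Λ (π x)) (A := A)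
    (ε := (1 + X) ^ 2 * (4 * A * η)) 3 hA hη0 (by positivity)
    (e.trans H.hη) e (fun x => H.bad _ _ (hd' x)) ?_
  · unfold kverr
    norm_num at this ⊢
    linarith
  · intro a b hab
    obtain ⟨h1, h2⟩ := h a b hab
    obtain ⟨γ, k, hk, hg⟩ := near_of_cell_eq (H.bad _ _ (hd a)) (by linarith) hη0 h2
    refine ⟨γ, _, hk.conj_uu (hdd a), ?_⟩
    have ea : uu (d' a) = uu (d' a - d a) * uu (d a) := by rw [← uu_add]; congr 1; ring
    have eb : uu (d' b) = uu (d' a - d a) * uu (d b) := by rw [← uu_add]; congr 1; linarith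
    rw [ea, eb]
    have : uu (d' a - d a) * uu (d b) * Λ (π b) * embZ γ =
        uu (d' a - d a) * (uu (d b) * Λ (π b) * embZ γ) := by group
    rw [this, hg]
    group

variable (η Λ) in
/-- Entropy growth of the lattice variable under translation by `V`. -/
noncomputable def growth (V : Ω₁ → ℝ) : ℝ :=
  ent (fun x : Ω₁ × Ω => cell η (uu (V x.1) * Λ x.2)) - ent (fun ω => cell η (Λ ω))

lemma ent_indep {f : Ω → β} : ent (fun x : Ω₁ × Ω => (x.1, f x.2)) =
    Real.log (Fintype.card Ω₁) + ent f := by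
  rw [ent_fst_pair (fun x : Ω₁ × Ω => f x.2)]
  simp [Finset.sum_const]

lemma KVCtx.growth_const_add (H : KVCtx A X η Λ) {V : Ω₁ → ℝ} {x : ℝ} (hV : ∀ a, |V a| ≤ X)
    (hVx : ∀ a, |x + V a| ≤ X) (hx : |x| ≤ X) :
    growth η Λ V ≤ growth η Λ (fun a => x + V a) + kverr A := by
  have h1 : ent (fun y : Ω₁ × Ω => cell η (uu (V y.1) * Λ y.2)) ≤ _ :=
    (ent_mono (by intro a b hab; exact (Prod.ext_iff.1 hab).2)).trans
    (H.ent_le (f := fun y : Ω₁ × Ω => cell η (uu (x + V y.1) * Λ y.2)) (π := fun y => y.2)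
      (d := fun y => x + V y.1) (d' := fun y => V y.1) (fun _ => hVx _) (fun _ => hV _)
      (by intro y; simpa using hx) (by intro a b hab; exact ⟨by ring, hab⟩))
  unfold growth
  linarith

lemma KVCtx.growth_ge_avg (V : Ω₁ × Ω₂ → ℝ) :
    (∑ a, growth η Λ (fun b => V (a, b))) / Fintype.card Ω₁ ≤ growth η Λ V := by
  have := avg_ent_le_ent (fun x : Ω₁ × (Ω₂ × Ω) => cell η (uu (V (x.1, x.2.1)) * Λ x.2.2))
  have e : ent (fun x : Ω₁ × (Ω₂ × Ω) => cell η (uu (V (x.1, x.2.1)) * Λ x.2.2)) =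
      ent (fun x : (Ω₁ × Ω₂) × Ω => cell η (uu (V x.1) * Λ x.2)) :=
    ent_comp_equiv (Equiv.prodAssoc Ω₁ Ω₂ Ω).symm
      (fun x : (Ω₁ × Ω₂) × Ω => cell η (uu (V x.1) * Λ x.2))
  rw [e] at this
  unfold growth
  rw [Finset.sum_sub_distrib, sub_div]
  simp only [Finset.sum_const, Finset.card_univ, nsmul_eq_mul]
  have h0 : (Fintype.card Ω₁ : ℝ) ≠ 0 := by exact_mod_cast Fintype.card_ne_zero
  rw [mul_div_cancel_left₀ _ h0]
  linarith

lemma growth_comp_of_fiber {π : Ω₂ → Ω₁} {M : ℕ} (hM : 0 < M)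
    (hπ : ∀ ω, (π ⁻¹' {ω}).encard = M) (V : Ω₁ → ℝ) : growth η Λ (V ∘ π) = growth η Λ V := by
  unfold growth
  congr 1
  refine ent_comp_of_fiber (π := fun x : Ω₂ × Ω => (π x.1, x.2)) hM ?_
    (fun x : Ω₁ × Ω => cell η (uu (V x.1) * Λ x.2))
  intro ω
  have : (fun x : Ω₂ × Ω => (π x.1, x.2)) ⁻¹' {ω} = (fun a => (a, ω.2)) '' (π ⁻¹' {ω.1}) := by
    ext ⟨a, b⟩
    simp [Prod.ext_iff, eq_comm]
  rw [this, Function.Injective.encard_image, hπ]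
  intro a b; simp

/-- Subadditivity of entropy growth. -/
lemma KVCtx.growth_add (H : KVCtx A X η Λ) {V : Ω₁ → ℝ} {V' : Ω₂ → ℝ} (hV : ∀ a, |V a| ≤ X)
    (hV' : ∀ a, |V' a| ≤ X) (hVV : ∀ a b, |V a + V' b| ≤ X) :
    growth η Λ (fun x : Ω₁ × Ω₂ => V x.1 + V' x.2) ≤
      growth η Λ V + growth η Λ V' + 3 * kverr A := by
  let T := (Ω₁ × Ω₂) × Ω
  let S : T → _ := fun x => cell η (uu (V x.1.1 + V' x.1.2) * Λ x.2)
  have hsub := ent_submod (f := fun x : T => (x.1.1, S x)) (g := fun x : T => (x.1.2, S x))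
    (k := fun x : T => (x.1, S x)) (h := S)
    (by intro a b h1 h2; simp only [Prod.mk.injEq] at h1 h2 ⊢; exact ⟨Prod.ext h1.1 h2.1, h1.2⟩)
    (by intro a b h1; exact (Prod.ext_iff.1 h1).2) (by intro a b h1; exact (Prod.ext_iff.1 h1).2)
  have hk : Real.log (Fintype.card (Ω₁ × Ω₂)) + ent (fun ω => cell η (Λ ω)) ≤
      ent (fun x : T => (x.1, S x)) + kverr A := by
    have h1 := H.ent_le (f := fun x : T => (x.1, S x)) (π := fun x => x.2)
      (d := fun x => V x.1.1 + V' x.1.2) (d' := fun x => 0) (fun _ => hVV _ _)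
      (by simpa using H.hX) (by intro x; simpa [abs_sub_comm, neg_add_eq_sub] using (abs_neg _).trans_le (hVV x.1.1 x.1.2))
      (by
        intro a b hab
        simp only [Prod.mk.injEq] at hab
        exact ⟨by rw [hab.1], hab.2⟩)
    rw [← ent_indep (Ω₁ := Ω₁ × Ω₂)]
    refine (ent_mono ?_).trans h1
    intro a b hab
    simp only [Prod.mk.injEq, uu_zero, one_mul] at hab ⊢
    exact ⟨hab.1.1, hab.2⟩
  have hf : ent (fun x : T => (x.1.1, S x)) ≤ Real.log (Fintype.card Ω₁) +
      ent (fun x : Ω₂ × Ω => cell η (uu (V' x.1) * Λ x.2)) + kverr A := by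
    rw [← ent_indep (Ω₁ := Ω₁)]
    rw [← ent_comp_equiv (Equiv.prodAssoc Ω₁ Ω₂ Ω)]
    refine le_trans (ent_mono ?_) (H.ent_le (Ω₃ := T) (π := fun x => x.2)
      (d := fun x => V' x.1.2) (d' := fun x => V x.1.1 + V' x.1.2) (fun _ => hV' _)
      (fun _ => hVV _ _) (by intro x; simpa using hV x.1.1) ?_)
    · intro a b hab
      simp only [Prod.mk.injEq, Function.comp, Equiv.prodAssoc_apply] at hab ⊢
      exact ⟨hab.1.1, hab.2⟩
    · intro a b hab
      simp only [Prod.mk.injEq, Function.comp, Equiv.prodAssoc_apply] at hab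
      exact ⟨by rw [hab.1]; ring, hab.2⟩
  have hg : ent (fun x : T => (x.1.2, S x)) ≤ Real.log (Fintype.card Ω₂) +
      ent (fun x : Ω₁ × Ω => cell η (uu (V x.1) * Λ x.2)) + kverr A := by
    rw [← ent_indep (Ω₁ := Ω₂)]
    rw [← ent_comp_equiv (((Equiv.prodComm Ω₁ Ω₂).prodCongr (Equiv.refl Ω)).trans
      (Equiv.prodAssoc Ω₂ Ω₁ Ω))]
    refine le_trans (ent_mono ?_) (H.ent_le (Ω₃ := T) (π := fun x => x.2)
      (d := fun x => V x.1.1) (d' := fun x => V x.1.1 + V' x.1.2) (fun _ => hV _)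
      (fun _ => hVV _ _) (by intro x; simpa using hV' x.1.2) ?_)
    · intro a b hab
      simp only [Prod.mk.injEq, Function.comp, Equiv.prodAssoc_apply, Equiv.trans_apply,
        Equiv.prodCongr_apply, Prod.map, Equiv.prodComm_apply, Equiv.refl_apply] at hab ⊢
      exact ⟨hab.1.1, hab.2⟩
    · intro a b hab
      simp only [Prod.mk.injEq, Function.comp, Equiv.prodAssoc_apply, Equiv.trans_apply,
        Equiv.prodCongr_apply, Prod.map, Equiv.prodComm_apply, Equiv.refl_apply] at hab
      obtain ⟨h1, h2⟩ := hab
      exact ⟨by rw [show a.1.2 = b.1.2 from h1]; ring, h2⟩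
  have hc : Real.log (Fintype.card (Ω₁ × Ω₂)) = Real.log (Fintype.card Ω₁) + Real.log (Fintype.card Ω₂) := by
    rw [Fintype.card_prod, Nat.cast_mul, Real.log_mul] <;> exact_mod_cast Fintype.card_ne_zero
  unfold growth
  change ent (fun x : T => (x.1, S x)) + ent S ≤ _ at hsub
  change ent S - _ ≤ _
  linarith

/-- Adding an independent variable does not decrease growth. -/
lemma KVCtx.growth_le_add (H : KVCtx A X η Λ) {V : Ω₁ → ℝ} {V' : Ω₂ → ℝ} (hV : ∀ a, |V a| ≤ X)
    (hV' : ∀ a, |V' a| ≤ X) (hVV : ∀ a b, |V a + V' b| ≤ X) :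
    growth η Λ V ≤ growth η Λ (fun x : Ω₂ × Ω₁ => V' x.1 + V x.2) + kverr A := by
  have h1 := KVCtx.growth_ge_avg (η := η) (Λ := Λ) (fun x : Ω₂ × Ω₁ => V' x.1 + V x.2)
  have h2 : ∀ b : Ω₂, growth η Λ V - kverr A ≤ growth η Λ (fun a => V' b + V a) := by
    intro b
    have := H.growth_const_add hV (x := V' b) (fun a => by rw [add_comm]; exact hVV a b) (hV' b)
    linarith
  have h3 : growth η Λ V - kverr A ≤ (∑ b, growth η Λ (fun a => V' b + V a)) / Fintype.card Ω₂ := by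
    rw [le_div_iff₀ (by exact_mod_cast Fintype.card_pos)]
    calc _ = ∑ b : Ω₂, (growth η Λ V - kverr A) := by
            rw [Finset.sum_const, Finset.card_univ, nsmul_eq_mul, mul_comm]
      _ ≤ _ := Finset.sum_le_sum fun b _ => h2 b
  linarith

lemma KVCtx.growth_nonneg (H : KVCtx A X η Λ) {V : Ω₁ → ℝ} (hV : ∀ a, |V a| ≤ X) :
    -kverr A ≤ growth η Λ V := by
  have := H.growth_le_add (V := fun _ : Unit => (0 : ℝ)) (V' := V) (by simpa using H.hX) hV
    (by simpa using hV)
  have e0 : growth η Λ (fun _ : Unit => (0 : ℝ)) = 0 := by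
    unfold growth
    simp only [uu_zero, one_mul]
    rw [ent_comp_snd (fun ω => cell η (Λ ω)), sub_self]
  have e1 : growth η Λ (fun x : Ω₁ × Unit => V x.1 + 0) = growth η Λ V := by
    have : (fun x : Ω₁ × Unit => V x.1 + 0) = V ∘ Prod.fst := by ext; simp
    rw [this]
    refine growth_comp_of_fiber (M := 1) one_pos ?_ V
    intro ω
    have : (Prod.fst ⁻¹' {ω} : Set (Ω₁ × Unit)) = {(ω, ())} := by ext ⟨a, b⟩; simp
    rw [this]; simp
  rw [e0, e1] at this
  linarith

/-- The random sum with coefficients `c`. -/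
noncomputable def bsum (c : σ → ℝ) (ε : σ → Bool) : ℝ := ∑ t, if ε t then c t else 0

lemma abs_bsum_le (c : σ → ℝ) (ε : σ → Bool) : |bsum c ε| ≤ ∑ t, |c t| := by
  refine (Finset.abs_sum_le_sum_abs _ _).trans (Finset.sum_le_sum fun t _ => ?_)
  split_ifs <;> simp

lemma encard_eq_card_fiber {α γ : Type*} [Fintype α] [Fintype γ] (δ : Type*) [Fintype δ]
    (e : α ≃ γ × δ) (ω : γ) :
    ((fun a => (e a).1) ⁻¹' {ω}).encard = Fintype.card δ := by
  have : ((fun a => (e a).1) ⁻¹' {ω}) = (fun d => e.symm (ω, d)) '' univ := by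
    ext a
    simp only [mem_preimage, mem_singleton_iff, mem_image, mem_univ, true_and]
    constructor
    · rintro rfl; exact ⟨(e a).2, by simp⟩
    · rintro ⟨d, rfl⟩; simp
  rw [this, Function.Injective.encard_image]
  · simp [Set.encard_univ]
  · intro x y h; simpa using h

section
variable [DecidableEq σ] [DecidableEq σ']

lemma growth_bsum_swap (c : σ → ℝ) (ι : σ → Bool) :
    growth η Λ (fun x : (σ → Bool) × (σ → Bool) =>
      bsum (fun t => if ι t then c t else 0) x.1 + bsum (fun t => if ι t then 0 else c t) x.2) =
    growth η Λ (bsum c) := by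
  let e : (σ → Bool) × (σ → Bool) ≃ (σ → Bool) × (σ → Bool) :=
    { toFun := fun x => (fun t => if ι t then x.1 t else x.2 t, fun t => if ι t then x.2 t else x.1 t)
      invFun := fun x => (fun t => if ι t then x.1 t else x.2 t, fun t => if ι t then x.2 t else x.1 t)
      left_inv := by intro x; ext t <;> by_cases h : ι t <;> simp [h]
      right_inv := by intro x; ext t <;> by_cases h : ι t <;> simp [h] }
  rw [← growth_comp_of_fiber (π := fun a => (e a).1) (M := Fintype.card (σ → Bool)) Fintype.card_pos
    (encard_eq_card_fiber _ e) (bsum c)]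
  congr 1
  funext x
  simp only [Function.comp, bsum, ← Finset.sum_add_distrib]
  refine Finset.sum_congr rfl fun t _ => ?_
  by_cases h : ι t <;> simp [e, h]

lemma sum_abs_ite_le (c : σ → ℝ) (ι : σ → Bool) : ∑ t, |if ι t then c t else 0| ≤ ∑ t, |c t| :=
  Finset.sum_le_sum fun t _ => by split_ifs <;> simp

lemma sum_abs_ite_le' (c : σ → ℝ) (ι : σ → Bool) : ∑ t, |if ι t then 0 else c t| ≤ ∑ t, |c t| :=
  Finset.sum_le_sum fun t _ => by split_ifs <;> simp

lemma abs_bsum_split_le (c : σ → ℝ) (ι ε ε' : σ → Bool) :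
    |bsum (fun t => if ι t then c t else 0) ε + bsum (fun t => if ι t then 0 else c t) ε'| ≤
      ∑ t, |c t| := by
  unfold bsum
  rw [← Finset.sum_add_distrib]
  refine (Finset.abs_sum_le_sum_abs _ _).trans (Finset.sum_le_sum fun t _ => ?_)
  by_cases h : ι t <;> simp only [h] <;> split_ifs <;> simp_all

lemma KVCtx.growth_bsum_split (H : KVCtx A X η Λ) {c : σ → ℝ} (hc : ∑ t, |c t| ≤ X) (ι : σ → Bool) :
    growth η Λ (bsum c) ≤ growth η Λ (bsum fun t => if ι t then c t else 0) +
      growth η Λ (bsum fun t => if ι t then 0 else c t) + 3 * kverr A := by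
  rw [← growth_bsum_swap c ι]
  exact H.growth_add (fun a => (abs_bsum_le _ _).trans ((sum_abs_ite_le _ _).trans hc))
    (fun a => (abs_bsum_le _ _).trans ((sum_abs_ite_le' _ _).trans hc))
    (fun a b => (abs_bsum_split_le _ _ _ _).trans hc)

lemma KVCtx.growth_bsum_restrict (H : KVCtx A X η Λ) {c : σ → ℝ} (hc : ∑ t, |c t| ≤ X)
    (ι : σ → Bool) :
    growth η Λ (bsum fun t => if ι t then 0 else c t) ≤ growth η Λ (bsum c) + kverr A := by
  rw [← growth_bsum_swap c ι]
  exact H.growth_le_add (fun a => (abs_bsum_le _ _).trans ((sum_abs_ite_le' _ _).trans hc))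
    (fun a => (abs_bsum_le _ _).trans ((sum_abs_ite_le _ _).trans hc))
    (fun a b => by rw [add_comm]; exact (abs_bsum_split_le _ _ _ _).trans hc)

lemma growth_bsum_pair (c : σ → ℝ) :
    growth η Λ (fun x : (σ → Bool) × (σ → Bool) => bsum c x.1 + bsum c x.2) =
      growth η Λ (fun x : (σ → Bool) × (σ → Bool) =>
        bsum c x.1 + bsum (fun t => if x.1 t then 0 else 2 * c t) x.2) := by
  let e : (σ → Bool) × (σ → Bool) ≃ (σ → Bool) × (σ → Bool) :=
    { toFun := fun x => (x.2, fun t => xor (x.2 t) (x.1 t))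
      invFun := fun x => (fun t => xor (x.1 t) (x.2 t), x.1)
      left_inv := by intro x; ext t <;> simp
      right_inv := by intro x; ext t <;> simp }
  rw [← growth_comp_of_fiber (π := e) (M := 1) one_pos (by
    intro ω
    have : (e ⁻¹' {ω}) = {e.symm ω} := by ext a; simp [Equiv.eq_symm_apply]
    rw [this]; simp)]
  congr 1
  funext x
  simp only [Function.comp, bsum, ← Finset.sum_add_distrib]
  refine Finset.sum_congr rfl fun t _ => ?_
  by_cases h : x.1 t <;> by_cases h' : x.2 t <;> simp [e, h, h'] <;> ring

lemma KVCtx.growth_bsum_double (H : KVCtx A X η Λ) {c : σ → ℝ} (hc : ∑ t, |2 * c t| ≤ X) :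
    growth η Λ (bsum fun t => 2 * c t) ≤ 4 * growth η Λ (bsum c) + 11 * kverr A := by
  have hc2 : ∑ t, |c t| + ∑ t, |c t| ≤ X := by
    rw [← two_mul, Finset.mul_sum]; simpa [abs_mul] using hc
  have hc0 : 0 ≤ ∑ t, |c t| := Finset.sum_nonneg fun _ _ => abs_nonneg _
  have hb : ∀ a, |bsum c a| ≤ X := fun a => (abs_bsum_le c a).trans (by linarith)
  have h1 := H.growth_add (V := bsum c) (V' := bsum c) hb hb (fun a b => (abs_add_le _ _).trans
    ((add_le_add (abs_bsum_le _ _) (abs_bsum_le _ _)).trans hc2))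
  have h2 := growth_bsum_pair (η := η) (Λ := Λ) c
  have h3 := KVCtx.growth_ge_avg (η := η) (Λ := Λ) (fun x : (σ → Bool) × (σ → Bool) =>
    bsum c x.1 + bsum (fun t => if x.1 t then 0 else 2 * c t) x.2)
  simp only at h3
  set g : (σ → Bool) → ℝ := fun ι => growth η Λ (bsum fun t => if ι t then 0 else 2 * c t) with hg
  have h4 : ∀ ι, g ι ≤ growth η Λ (fun b => bsum c ι + bsum (fun t => if ι t then 0 else 2 * c t) b)
      + kverr A := by
    intro ι
    refine H.growth_const_add (fun a => (abs_bsum_le _ _).trans ((sum_abs_ite_le' _ _).trans hc))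
      (fun a => ?_) (hb ι)
    have e1 : bsum c ι = bsum (fun t => if ι t then c t else 0) fun _ => true := by
      simp [bsum]
    have e2 : |bsum (fun t => if ι t then c t else 0) fun _ => true| ≤ ∑ t, |if ι t then c t else 0| := abs_bsum_le _ _
    have e3 : |bsum (fun t => if ι t then 0 else 2 * c t) a| ≤ ∑ t, |if ι t then 0 else 2 * c t| := abs_bsum_le _ _
    rw [e1]
    refine (abs_add_le _ _).trans ((add_le_add e2 e3).trans (le_trans ?_ hc))
    rw [← Finset.sum_add_distrib]
    refine Finset.sum_le_sum fun t _ => ?_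
    by_cases h : ι t <;> simp [h, abs_mul]; linarith [abs_nonneg (c t)]
  have h5 : ∀ ι, growth η Λ (bsum fun t => 2 * c t) ≤ g (fun t => !ι t) + g ι + 3 * kverr A := by
    intro ι
    have := H.growth_bsum_split (c := fun t => 2 * c t) hc ι
    have e1 : (fun t => if ι t then 2 * c t else 0) = (fun t => if (!ι t) then 0 else 2 * c t) := by
      funext t; by_cases h : ι t <;> simp [h]
    rw [e1] at this
    exact this
  have h6 : ∑ ι : σ → Bool, g (fun t => !ι t) = ∑ ι, g ι :=
    Equiv.sum_comp (Function.Involutive.toPerm (fun (ι : σ → Bool) t => !ι t)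
      (fun ι => by ext; simp)) g
  have hcard : (0 : ℝ) < Fintype.card (σ → Bool) := by exact_mod_cast Fintype.card_pos
  have h7 := Finset.sum_le_sum fun (ι : σ → Bool) (_ : ι ∈ Finset.univ) => h5 ι
  rw [Finset.sum_add_distrib, Finset.sum_add_distrib, h6] at h7
  simp only [Finset.sum_const, Finset.card_univ, nsmul_eq_mul] at h7
  have h8 := Finset.sum_le_sum fun (ι : σ → Bool) (_ : ι ∈ Finset.univ) => h4 ι
  rw [Finset.sum_add_distrib] at h8
  simp only [Finset.sum_const, Finset.card_univ, nsmul_eq_mul] at h8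
  rw [div_le_iff₀ hcard] at h3
  rw [h2] at h1
  clear_value g
  generalize (Fintype.card (σ → Bool) : ℝ) = N at *
  have h9 := mul_le_mul_of_nonneg_left h1 hcard.le
  refine le_of_mul_le_mul_left ?_ hcard
  linarith

lemma growth_bsum_reindex (j : σ → σ') (hj : Function.Injective j) (c : σ' → ℝ)
    (hc : ∀ t, t ∉ range j → c t = 0) :
    growth η Λ (bsum c) = growth η Λ (bsum (c ∘ j)) := by
  classical
  let e0 : σ' ≃ σ ⊕ {t // t ∉ range j} :=
    ((Equiv.sumCongr (Equiv.ofInjective j hj) (Equiv.refl _)).trans (Equiv.Set.sumCompl (range j))).symm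
  let e : (σ' → Bool) ≃ (σ → Bool) × ({t // t ∉ range j} → Bool) :=
    (Equiv.arrowCongr e0 (Equiv.refl Bool)).trans (Equiv.sumArrowEquivProdArrow _ _ _)
  have he : ∀ ε, (e ε).1 = ε ∘ j := by
    intro ε
    funext t
    simp [e, e0, Equiv.sumArrowEquivProdArrow, Equiv.arrowCongr]
  rw [← growth_comp_of_fiber (π := fun a => (e a).1) (M := Fintype.card ({t // t ∉ range j} → Bool))
    Fintype.card_pos (encard_eq_card_fiber _ e) (bsum (c ∘ j))]
  congr 1
  funext ε
  simp only [Function.comp, he, bsum]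
  rw [← Finset.sum_image (f := fun t => if ε t then c t else 0) (g := j) (hj.injOn)]
  symm
  refine Finset.sum_subset (Finset.subset_univ _) ?_
  intro t _ ht
  rw [hc t (by simpa using ht)]
  simp

end
end

section
variable {Ω Ω₁ σ σ' : Type*} [Fintype Ω] [Fintype Ω₁] [Nonempty Ω] [Nonempty Ω₁] [Fintype σ]
  [Fintype σ'] [DecidableEq σ] [DecidableEq σ'] {A X η : ℝ} {Λ : Ω → SLR}

lemma growth_zero : growth η Λ (fun _ : Ω₁ => (0 : ℝ)) = 0 := by
  unfold growth
  simp only [uu_zero, one_mul]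
  rw [ent_comp_snd (fun ω => cell η (Λ ω)), sub_self]

lemma KVCtx.growth_bsum_comp_le (H : KVCtx A X η Λ) {c : σ' → ℝ} (hc : ∑ t, |c t| ≤ X)
    (j : σ → σ') (hj : Function.Injective j) :
    growth η Λ (bsum (c ∘ j)) ≤ growth η Λ (bsum c) + kverr A := by
  classical
  have h1 := H.growth_bsum_restrict hc (fun t => decide (t ∉ range j))
  have h2 := growth_bsum_reindex (η := η) (Λ := Λ) j hj
    (fun t => if decide (t ∉ range j) = true then 0 else c t) (by intro t ht; simp at ht; simp [ht])
  have h3 : (fun t => if decide (t ∉ range j) = true then 0 else c t) ∘ j = c ∘ j := by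
    funext t; simp
  rw [h2, h3] at h1
  exact h1

lemma KVCtx.growth_bsum_digits (H : KVCtx A X η Λ) {p : ℕ} (hp : 0 < p) (ρ : σ → ℝ)
    (hc : ∑ x : Fin p × σ, |2 ^ (x.1 : ℕ) * ρ x.2| ≤ X) :
    growth η Λ (bsum fun x : Fin p × σ => 2 ^ (x.1 : ℕ) * ρ x.2) ≤
      4 ^ p * (growth η Λ (bsum ρ) + 4 * kverr A) := by
  have he := H.kverr_nonneg
  have hq : ∀ q, q < p → ∑ t, |2 ^ q * ρ t| ≤ X := by
    intro q hq
    refine le_trans ?_ hc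
    rw [Fintype.sum_prod_type]
    exact Finset.single_le_sum (f := fun i : Fin p => ∑ t, |2 ^ (i : ℕ) * ρ t|)
      (fun i _ => Finset.sum_nonneg fun _ _ => abs_nonneg _) (Finset.mem_univ (⟨q, hq⟩ : Fin p))
  have hx0 : -kverr A ≤ growth η Λ (bsum ρ) :=
    H.growth_nonneg fun a => (abs_bsum_le _ _).trans (by simpa using hq 0 hp)
  have hx : ∀ q, q < p → growth η Λ (bsum fun t => 2 ^ q * ρ t) ≤
      4 ^ q * (growth η Λ (bsum ρ) + 4 * kverr A) - 4 * kverr A := by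
    intro q
    induction q with
    | zero => intro _; simp
    | succ q ih =>
      intro hq'
      have h1 := ih (by omega)
      have e : (fun t => 2 ^ (q + 1) * ρ t) = fun t => 2 * (2 ^ q * ρ t) := by funext t; ring
      have h2 := H.growth_bsum_double (c := fun t => 2 ^ q * ρ t) (by
        have := hq (q + 1) hq'
        refine le_of_eq_of_le (Finset.sum_congr rfl fun t _ => ?_) this
        rw [pow_succ]; ring_nf)
      rw [e, pow_succ]
      linarith
  have hS : ∀ q, q ≤ p → growth η Λ (bsum fun x : Fin p × σ =>
      if (x.1 : ℕ) < q then 2 ^ (x.1 : ℕ) * ρ x.2 else 0) ≤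
      4 ^ q * (growth η Λ (bsum ρ) + 4 * kverr A) := by
    intro q
    induction q with
    | zero =>
      intro _
      have : (bsum fun x : Fin p × σ => if (x.1 : ℕ) < 0 then 2 ^ (x.1 : ℕ) * ρ x.2 else 0) =
          fun _ => 0 := by
        funext ε; simp [bsum]
      rw [this, growth_zero]
      simp; linarith
    | succ q ih =>
      intro hq'
      have h1 := ih (by omega)
      set c : Fin p × σ → ℝ := fun x => if (x.1 : ℕ) < q + 1 then 2 ^ (x.1 : ℕ) * ρ x.2 else 0 with hcdef
      have h2 := H.growth_bsum_split (c := c) (by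
        refine le_trans (Finset.sum_le_sum fun x _ => ?_) hc
        simp only [c]
        split_ifs <;> simp [abs_nonneg]) (fun x => decide ((x.1 : ℕ) < q))
      have e1 : (fun t => if decide ((t.1 : ℕ) < q) = true then c t else 0) = fun x : Fin p × σ =>
          if (x.1 : ℕ) < q then 2 ^ (x.1 : ℕ) * ρ x.2 else 0 := by
        funext x
        simp only [c, decide_eq_true_eq]
        split_ifs <;> first | rfl | omega
      have h3 := growth_bsum_reindex (η := η) (Λ := Λ) (fun t : σ => ((⟨q, by omega⟩ : Fin p), t))
        (by intro a b h; simpa using h)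
        (fun t => if decide ((t.1 : ℕ) < q) = true then 0 else c t) (by
          rintro ⟨i, t⟩ ht
          simp only [c, decide_eq_true_eq]
          by_cases h : (i : ℕ) < q
          · simp [h]
          · have : ¬ ((i : ℕ) < q + 1) := by
              intro h'
              apply ht
              refine ⟨t, ?_⟩
              have : (i : ℕ) = q := by omega
              ext <;> simp [this]
            simp [this])
      have e2 : (fun t : Fin p × σ => if decide ((t.1 : ℕ) < q) = true then 0 else c t) ∘
          (fun t : σ => ((⟨q, by omega⟩ : Fin p), t)) = fun t => 2 ^ q * ρ t := by
        funext t; simp [c]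
      rw [e1, h3, e2] at h2
      have h4 := hx q (by omega)
      have h5 : 0 ≤ 4 ^ q * (growth η Λ (bsum ρ) + 4 * kverr A) :=
        mul_nonneg (by positivity) (by linarith)
      rw [pow_succ]
      linarith
  have := hS p le_rfl
  simpa using this

end

lemma horner_sep {Q : ℝ} {M : ℝ} (hQ : M + 1 ≤ Q) (hM : 0 ≤ M) {h : ℕ → ℤ} (hh : ∀ t, |(h t : ℝ)| ≤ M)
    (t : ℕ) (hne : ∃ s < t + 1, h s ≠ 0) :
    Q⁻¹ ^ t ≤ |∑ s ∈ Finset.range (t + 1), (h s : ℝ) * Q⁻¹ ^ s| := by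
  have hQ0 : 0 < Q := by linarith
  have habs : ∀ s, h s ≠ 0 → 1 ≤ |(h s : ℝ)| := by
    intro s hs; exact_mod_cast Int.one_le_abs hs
  induction t with
  | zero =>
    obtain ⟨s, hs, h0⟩ := hne
    obtain rfl : s = 0 := by omega
    simpa using habs 0 h0
  | succ t ih =>
    rw [Finset.sum_range_succ]
    by_cases hex : ∃ s < t + 1, h s ≠ 0
    · have h1 := ih hex
      have h2 : |(h (t + 1) : ℝ) * Q⁻¹ ^ (t + 1)| ≤ M * Q⁻¹ ^ (t + 1) := by
        rw [abs_mul, abs_of_nonneg (by positivity : 0 ≤ Q⁻¹ ^ (t + 1))]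
        exact mul_le_mul_of_nonneg_right (hh _) (by positivity)
      have h3 := abs_sub_abs_le_abs_add (∑ s ∈ Finset.range (t + 1), (h s : ℝ) * Q⁻¹ ^ s)
        ((h (t + 1) : ℝ) * Q⁻¹ ^ (t + 1))
      have h4 : Q⁻¹ ^ t = Q * Q⁻¹ ^ (t + 1) := by rw [pow_succ]; field_simp
      have h5 : (M + 1) * Q⁻¹ ^ (t + 1) ≤ Q * Q⁻¹ ^ (t + 1) :=
        mul_le_mul_of_nonneg_right hQ (by positivity)
      linarith
    · push Not at hex
      rw [Finset.sum_eq_zero (by intro s hs; simp [hex s (Finset.mem_range.1 hs)]), zero_add, abs_mul,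
        abs_of_nonneg (by positivity : 0 ≤ Q⁻¹ ^ (t + 1))]
      obtain ⟨s, hs, h0⟩ := hne
      have : s = t + 1 := by
        by_contra h'
        exact h0 (hex s (by omega))
      subst this
      exact le_mul_of_one_le_left (by positivity) (habs _ h0)

/-- The digit `∑ 2^i ε_i`. -/
noncomputable def dig {p : ℕ} (ε : Fin p → Bool) : ℕ :=
  finFunctionFinEquiv (fun i => if ε i then (1 : Fin 2) else 0)

lemma dig_lt {p : ℕ} (ε : Fin p → Bool) : dig ε < 2 ^ p := Fin.is_lt _

lemma dig_cast {p : ℕ} (ε : Fin p → Bool) : (dig ε : ℝ) = ∑ i, if ε i then 2 ^ (i : ℕ) else 0 := by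
  unfold dig
  rw [finFunctionFinEquiv_apply]
  push_cast
  refine Finset.sum_congr rfl fun i _ => ?_
  split_ifs <;> simp

lemma dig_inj {p : ℕ} {ε ε' : Fin p → Bool} (h : dig ε = dig ε') : ε = ε' := by
  have := finFunctionFinEquiv.injective (Fin.ext h)
  funext i
  have := congrFun this i
  by_cases h1 : ε i <;> by_cases h2 : ε' i <;> simp_all

/-- Distinct digit expansions are separated. -/
lemma bsum_digits_sep {p τ : ℕ} {Q a : ℝ} (hQ : 2 ^ p ≤ Q) (ha : 0 ≤ a)
    {ε ε' : Fin p × Fin (τ + 1) → Bool} (hne : ε ≠ ε') :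
    a * Q⁻¹ ^ τ ≤ |bsum (fun x : Fin p × Fin (τ + 1) => 2 ^ (x.1 : ℕ) * (a * Q⁻¹ ^ (x.2 : ℕ))) ε -
      bsum (fun x : Fin p × Fin (τ + 1) => 2 ^ (x.1 : ℕ) * (a * Q⁻¹ ^ (x.2 : ℕ))) ε'| := by
  let N : (Fin p × Fin (τ + 1) → Bool) → ℕ → ℕ := fun ε t =>
    if h : t < τ + 1 then dig (fun i => ε (i, ⟨t, h⟩)) else 0
  have hN : ∀ ε, bsum (fun x : Fin p × Fin (τ + 1) => 2 ^ (x.1 : ℕ) * (a * Q⁻¹ ^ (x.2 : ℕ))) ε =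
      a * ∑ s ∈ Finset.range (τ + 1), (N ε s : ℝ) * Q⁻¹ ^ s := by
    intro ε
    unfold bsum
    rw [Finset.sum_range, Fintype.sum_prod_type_right, Finset.mul_sum]
    refine Finset.sum_congr rfl fun t _ => ?_
    simp only [N, Fin.is_lt, dite_true, dig_cast, Fin.eta]
    rw [Finset.sum_mul, Finset.mul_sum]
    refine Finset.sum_congr rfl fun i _ => ?_
    split_ifs
    · ring
    · ring
  have hNlt : ∀ ε t, (N ε t : ℝ) ≤ 2 ^ p - 1 := by
    intro ε t
    have : N ε t + 1 ≤ 2 ^ p := by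
      simp only [N]
      split_ifs
      · exact dig_lt _
      · exact Nat.one_le_two_pow
    have : ((N ε t + 1 : ℕ) : ℝ) ≤ ((2 ^ p : ℕ) : ℝ) := by exact_mod_cast this
    push_cast at this
    linarith
  have h1 := horner_sep (Q := Q) (M := 2 ^ p - 1) (by linarith)
    (by have := one_le_pow₀ (one_le_two : (1 : ℝ) ≤ 2) (n := p); linarith)
    (h := fun t => (N ε t : ℤ) - N ε' t) (by
      intro t
      push_cast
      rw [abs_le]
      have := hNlt ε t
      have := hNlt ε' t
      have := (N ε t).cast_nonneg (α := ℝ)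
      have := (N ε' t).cast_nonneg (α := ℝ)
      constructor <;> linarith) τ (by
      by_contra hcon
      push Not at hcon
      apply hne
      funext ⟨i, t⟩
      have := hcon t t.2
      simp only [N, Fin.is_lt, dite_true, Fin.eta] at this
      have := dig_inj (by omega : dig (fun i => ε (i, t)) = dig (fun i => ε' (i, t)))
      exact congrFun this i)
  rw [hN, hN, ← mul_sub, abs_mul, abs_of_nonneg ha, ← Finset.sum_sub_distrib]
  refine mul_le_mul_of_nonneg_left (h1.trans_eq ?_) ha
  congr 1
  refine Finset.sum_congr rfl fun s _ => ?_
  push_cast; ring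

/-- Near the identity up to conjugation by a diagonal matrix of ratio `θ`. -/
structure Skew (ε θ : ℝ) (F : SLR) : Prop where
  h00 : |F 0 0 - 1| ≤ ε
  h01 : |F 0 1| ≤ ε * θ
  h10 : |F 1 0| ≤ ε / θ
  h11 : |F 1 1 - 1| ≤ ε

lemma Skew.nonneg {ε θ : ℝ} {F : SLR} (h : Skew ε θ F) : 0 ≤ ε := (abs_nonneg _).trans h.h00

lemma Skew.near {ε θ : ℝ} {F : SLR} (h : Skew ε θ F) (hθ0 : 0 < θ) (hθ : θ ≤ 1) :
    Near1 (ε / θ) F := by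
  have h1 : ε ≤ ε / θ := by rw [le_div_iff₀ hθ0]; nlinarith [h.nonneg]
  exact ⟨h.h00.trans h1, h.h01.trans (by nlinarith [h.nonneg]), h.h10, h.h11.trans h1⟩

lemma av_conj_skew {ε y : ℝ} {k : SLR} (hk : Near1 ε k) :
    Skew ε (Real.exp (-(2 * y))) ((av y)⁻¹ * k * av y) := by
  have e1 : Real.exp (-y) * Real.exp y = 1 := by rw [← Real.exp_add]; simp
  have e2 : Real.exp (-y) * Real.exp (-y) = Real.exp (-(2 * y)) := by rw [← Real.exp_add]; ring_nf
  have e3 : Real.exp y * Real.exp y = (Real.exp (-(2 * y)))⁻¹ := by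
    rw [← Real.exp_add, ← Real.exp_neg]; ring_nf
  have c00 : ((av y)⁻¹ * k * av y) 0 0 = k 0 0 := by
    rw [← av_neg]; simp only [SLR.mul_apply, av00, av01, av10]; linear_combination k 0 0 * e1
  have c11 : ((av y)⁻¹ * k * av y) 1 1 = k 1 1 := by
    rw [← av_neg]; simp only [SLR.mul_apply, av01, av10, av11, neg_neg]; linear_combination k 1 1 * e1
  have c01 : ((av y)⁻¹ * k * av y) 0 1 = k 0 1 * Real.exp (-(2 * y)) := by
    rw [← av_neg]; simp only [SLR.mul_apply, av00, av01, av11]; linear_combination k 0 1 * e2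
  have c10 : ((av y)⁻¹ * k * av y) 1 0 = k 1 0 * (Real.exp (-(2 * y)))⁻¹ := by
    rw [← av_neg]; simp only [SLR.mul_apply, av00, av10, av11, neg_neg]; linear_combination k 1 0 * e3
  have hpos := Real.exp_pos (-(2 * y))
  refine ⟨by rw [c00]; exact hk.h00, ?_, ?_, by rw [c11]; exact hk.h11⟩
  · rw [c01, abs_mul, abs_of_pos hpos]
    exact mul_le_mul_of_nonneg_right hk.h01 hpos.le
  · rw [c10, abs_mul, abs_of_pos (inv_pos.2 hpos), div_eq_mul_inv]
    exact mul_le_mul_of_nonneg_right hk.h10 (inv_pos.2 hpos).le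

lemma skew_of_cell_eq {A η y d d' : ℝ} {g g' : SLR} (h : Bad A (av y * uu d * g)) (hA : 1 ≤ A)
    (hη : 0 < η) (hc : cell η (av y * uu d * g) = cell η (av y * uu d' * g')) :
    ∃ (γ : SLZ) (F : SLR), Skew (4 * A * η) (Real.exp (-(2 * y))) F ∧
      g' * embZ γ = ((uu d')⁻¹ * F * uu d) * g := by
  obtain ⟨γ, k, hk, e⟩ := near_of_cell_eq h hA hη hc
  refine ⟨γ, _, av_conj_skew (y := y) hk, ?_⟩
  have : g' * embZ γ = (uu d')⁻¹ * (av y)⁻¹ * (av y * uu d' * g' * embZ γ) := by group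
  rw [this, e]
  group

/-- Local coordinates with respect to representatives of the cells. -/
lemma exists_coord {Ω : Type*} {A η : ℝ} (hA : 1 ≤ A) (hη : 0 < η)
    {Λ : Ω → SLR} (hbad : ∀ ω, Bad A (Λ ω)) : ∃ κ : Ω → SLR, (∀ ω, Near1 (4 * A * η) (κ ω)) ∧
      ∀ a b, cell η (Λ a) = cell η (Λ b) → ∃ γ, Λ b * embZ γ = κ b * (κ a)⁻¹ * Λ a := by
  classical
  have h0 : ∀ ω, ∃ ω', cell η (Λ ω') = cell η (Λ ω) := fun ω => ⟨ω, rfl⟩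
  let rep : (ℤ × ℤ × ℤ × ℤ) → Ω → Ω := fun z ω => if h : ∃ ω', cell η (Λ ω') = z then h.choose else ω
  let ρ : Ω → Ω := fun ω => rep (cell η (Λ ω)) ω
  have hρ : ∀ ω, cell η (Λ (ρ ω)) = cell η (Λ ω) := by
    intro ω
    simp only [ρ, rep, dif_pos (h0 ω)]
    exact (h0 ω).choose_spec
  have hρ2 : ∀ a b, cell η (Λ a) = cell η (Λ b) → ρ a = ρ b := by
    intro a b h
    simp only [ρ, rep, h, dif_pos (h0 b)]
  choose γ κ hκ e using fun ω => near_of_cell_eq (hbad (ρ ω)) hA hη (hρ ω)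
  refine ⟨κ, hκ, fun a b hab => ⟨γ b * (γ a)⁻¹, ?_⟩⟩
  have h1 := e a
  have h2 := e b
  rw [hρ2 a b hab] at h1
  rw [map_mul, map_inv, ← mul_assoc, h2]
  have : Λ (ρ b) = (κ a)⁻¹ * (Λ a * embZ (γ a)) := by rw [h1]; group
  rw [this]
  group

lemma coord_eq {A η ε : ℝ} (hA : 1 ≤ A) {g g' κ κ' k : SLR}
    (hbad : Bad A g) (hκ : Near1 (4 * A * η) κ) (hκ' : Near1 (4 * A * η) κ') {γ γ' : SLZ}
    (e : g' * embZ γ = κ' * κ⁻¹ * g) (hk : Near1 ε k) (ek : g' * embZ γ' = k * g)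
    (hη : 4 * A ^ 2 * (3 * (ε + 24 * A * η)) < 1) (h24 : 24 * A * η ≤ 1) : κ' = k * κ := by
  have h1 : Near1 (24 * A * η) (κ' * κ⁻¹) := by
    have := hκ'.mul hκ.inv (by linarith [hκ.nonneg])
    exact this.mono (by linarith)
  have h2 := hk.inv.mul h1 h24
  have h3 : g * embZ (γ'⁻¹ * γ) = (k⁻¹ * (κ' * κ⁻¹)) * g := by
    rw [map_mul, map_inv, mul_assoc, ← e]
    have : g = k⁻¹ * (g' * embZ γ') := by rw [ek]; group
    nth_rewrite 1 [this]
    group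
  have h4 := hbad.eq_one hA h2 hη h3
  have : κ' * κ⁻¹ = k := by
    have := congrArg (fun z => k * z) h4
    simpa using this
  rw [← this]; group

lemma near1_of_sub_le {ε : ℝ} {k : SLR} (h : ∀ i j, |k i j - (1 : SLR) i j| ≤ ε) : Near1 ε k :=
  ⟨by simpa using h 0 0, by simpa using h 0 1, by simpa using h 1 0, by simpa using h 1 1⟩

/-- Two matrices with close entries, both near the identity. -/
lemma near1_mul_inv {ε : ℝ} {κ κ' : SLR} (hκ : Near1 1 κ) (h : ∀ i j, |κ' i j - κ i j| ≤ ε) :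
    Near1 (4 * ε) (κ' * κ⁻¹) := by
  refine near1_of_sub_le fun i j => ?_
  have h1 : (κ' * κ⁻¹) i j - (1 : SLR) i j =
      (κ' i 0 - κ i 0) * κ⁻¹ 0 j + (κ' i 1 - κ i 1) * κ⁻¹ 1 j := by
    rw [← mul_inv_cancel κ, SLR.mul_apply, SLR.mul_apply]; ring
  have h2 := hκ.inv.abs_le le_rfl
  rw [h1]
  exact (abs_dot_le (h _ _) (h2 _ _) (h _ _) (h2 _ _)).trans (by linarith)

lemma ent_floor_le_pow {Ω β : Type*} [Fintype Ω] {f : Ω → β} {Y : Ω → ℝ} {A η : ℝ} (q : ℕ)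
    (hA : 7 ≤ A) (hη : 0 < η) (h : ∀ a b, f a = f b → |Y a - Y b| ≤ A ^ q * η) :
    ent (fun ω => (f ω, ⌊Y ω / η⌋)) ≤ ent f + (q + 1) * Real.log A := by
  have h1 := ent_floor_le (f := f) (X := Y) hη (K := ⌈A ^ q⌉₊) (fun a b hab => (h a b hab).trans
    (mul_le_mul_of_nonneg_right (Nat.le_ceil _) hη.le))
  refine h1.trans (add_le_add_right ?_ _)
  have h2 : (((2 * ⌈A ^ q⌉₊ + 3 : ℕ)) : ℝ) ≤ A ^ (q + 1) := by
    push_cast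
    have h3 := Nat.ceil_lt_add_one (by positivity : 0 ≤ A ^ q)
    have h4 : 1 ≤ A ^ q := one_le_pow₀ (by linarith)
    rw [pow_succ]
    nlinarith
  calc _ ≤ Real.log (A ^ (q + 1)) := Real.log_le_log (by positivity) h2
    _ = _ := by rw [Real.log_pow]; push_cast; ring

lemma av_conj_near {ε y : ℝ} (hy : 0 ≤ y) {k : SLR} (hk : Near1 ε k) :
    Near1 (ε / Real.exp (-(2 * y))) (av y * k * (av y)⁻¹) := by
  have h := av_conj_skew (y := -y) hk
  rw [av_neg, inv_inv] at h
  have hε := hk.nonneg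
  have e1 : ε / Real.exp (-(2 * y)) = ε * Real.exp (-(2 * -y)) := by
    rw [div_eq_mul_inv, ← Real.exp_neg]; ring_nf
  have e2 : 1 ≤ Real.exp (-(2 * -y)) := Real.one_le_exp (by linarith)
  rw [e1]
  refine ⟨h.h00.trans (by nlinarith), h.h01, h.h10.trans ?_, h.h11.trans (by nlinarith)⟩
  rw [div_le_iff₀ (by positivity)]
  nlinarith [mul_nonneg hε (by linarith : (0:ℝ) ≤ Real.exp (-(2 * -y)))]

lemma row_diff_le {A θ η d v v' : ℝ} {F κa κb : SLR} (hA : 200 ≤ A) (hη0 : 0 < η) (hθ0 : 0 < θ)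
    (hηθ : η ≤ θ) (hθ1 : θ ≤ 1) (hAη : A * η ≤ 1) (hF : Skew (4 * A * (θ * η)) θ F) (hd : |d| ≤ 2)
    (ha : Near1 (4 * A * η) κa) (hvv : |v| ≤ η) (hvv' : |v'| ≤ η)
    (e : uu d * κb = uu (-v') * F * uu v * (uu d * κa)) :
    |κb 0 0 + d * κb 1 0 - (κa 0 0 + d * κa 1 0)| ≤ A ^ 2 * (θ * η) := by
  have e2 := congrArg (fun g : SLR => g 0 0) e
  simp only [SLR.mul_apply, uu00, uu01, uu10, uu11] at e2
  have hη1 : η ≤ 1 := hηθ.trans hθ1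
  have hs : η * η ≤ θ * η := mul_le_mul_of_nonneg_right hηθ hη0.le
  have hn0 : 0 < θ * η := by positivity
  have hn : θ * η ≤ η := by nlinarith
  have hAn : A * (θ * η) ≤ A * η := mul_le_mul_of_nonneg_left hn (by linarith)
  have b10 : |κa 1 0| ≤ 4 * A * η := ha.h10
  have b10' : |κa 1 0| ≤ 4 := b10.trans (by linarith)
  set p := κa 0 0 + d * κa 1 0 with hp
  have hp4 : |p| ≤ 13 := by
    have h1 : |d * κa 1 0| ≤ 2 * 4 := abs_mul_le_mul hd b10'
    have b00 := abs_le.1 ha.h00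
    have h2 : |κa 0 0| ≤ 5 := by rw [abs_le]; constructor <;> linarith
    exact (abs_add_le _ _).trans (by linarith)
  have hF10 : |F 1 0| ≤ 4 * A * η := hF.h10.trans (by rw [div_le_iff₀ hθ0]; linarith)
  have hF00 := hF.h00
  have hF01 : |F 0 1| ≤ 4 * A * (θ * η) := hF.h01.trans (by
    have : 0 ≤ 4 * A * (θ * η) := by positivity
    nlinarith)
  have hF00' : |F 0 0| ≤ 5 := by
    have := abs_le.1 hF00; rw [abs_le]; constructor <;> linarith
  have hF11' : |F 1 1| ≤ 5 := by
    have := abs_le.1 hF.h11; rw [abs_le]; constructor <;> linarith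
  have key2 : κb 0 0 + d * κb 1 0 - p = (F 0 0 - 1) * p - v' * F 1 0 * p +
      F 0 0 * (v * κa 1 0) - v' * F 1 0 * (v * κa 1 0) + F 0 1 * κa 1 0 - F 1 1 * (v' * κa 1 0) := by
    linear_combination e2
  have t1 : |(F 0 0 - 1) * p| ≤ 4 * A * (θ * η) * 13 := abs_mul_le_mul hF00 hp4
  have t2 : |v' * F 1 0 * p| ≤ η * (4 * A * η) * 13 := abs_mul_le_mul (abs_mul_le_mul hvv' hF10) hp4
  have t3 : |F 0 0 * (v * κa 1 0)| ≤ 5 * (η * (4 * A * η)) :=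
    abs_mul_le_mul hF00' (abs_mul_le_mul hvv b10)
  have t4 : |v' * F 1 0 * (v * κa 1 0)| ≤ η * (4 * A * η) * (1 * 4) :=
    abs_mul_le_mul (abs_mul_le_mul hvv' hF10) (abs_mul_le_mul (hvv.trans hη1) b10')
  have t5 : |F 0 1 * κa 1 0| ≤ 4 * A * (θ * η) * 4 := abs_mul_le_mul hF01 b10'
  have t6 : |F 1 1 * (v' * κa 1 0)| ≤ 5 * (η * (4 * A * η)) :=
    abs_mul_le_mul hF11' (abs_mul_le_mul hvv' b10)
  have hAs : A * (η * η) ≤ A * (θ * η) := mul_le_mul_of_nonneg_left hs (by linarith)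
  have hA2 : 200 * (A * (θ * η)) ≤ A * (A * (θ * η)) :=
    mul_le_mul_of_nonneg_right hA (by positivity)
  have hA0 : 0 ≤ A * (θ * η) := by positivity
  rw [key2]
  generalize (F 0 0 - 1) * p = q1 at *
  generalize v' * F 1 0 * p = q2 at *
  generalize F 0 0 * (v * κa 1 0) = q3 at *
  generalize v' * F 1 0 * (v * κa 1 0) = q4 at *
  generalize F 0 1 * κa 1 0 = q5 at *
  generalize F 1 1 * (v' * κa 1 0) = q6 at *
  rw [abs_le] at t1 t2 t3 t4 t5 t6 ⊢
  rw [pow_two, mul_assoc]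
  constructor <;> linarith

/-- Three nearby entries of a matrix of determinant one determine the fourth. -/
lemma entry11_diff_le {κa κb : SLR} {S : ℝ} (ka : Near1 (1 / 2) κa) (kb : Near1 (1 / 2) κb)
    (p00 : |κb 0 0 - κa 0 0| ≤ 5 * S) (p01 : |κb 0 1 - κa 0 1| ≤ S)
    (p10 : |κb 1 0 - κa 1 0| ≤ 2 * S) : |κb 1 1 - κa 1 1| ≤ 26 * S := by
  have da := κa.det_eq
  have db := κb.det_eq
  have b00 := abs_le.1 kb.h00
  have a11 := abs_le.1 ka.h11
  have t1 : |κa 1 1 * (κb 0 0 - κa 0 0)| ≤ 2 * (5 * S) :=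
    abs_mul_le_mul (by rw [abs_le]; constructor <;> linarith) p00
  have t2 : |κb 0 1 * (κb 1 0 - κa 1 0)| ≤ 1 / 2 * (2 * S) := abs_mul_le_mul kb.h01 p10
  have t3 : |(κb 0 1 - κa 0 1) * κa 1 0| ≤ S * (1 / 2) := abs_mul_le_mul p01 ka.h10
  have hS : 0 ≤ S := (abs_nonneg _).trans p01
  have e0 : κb 0 0 * (κb 1 1 - κa 1 1) = -(κa 1 1 * (κb 0 0 - κa 0 0)) +
      κb 0 1 * (κb 1 0 - κa 1 0) + (κb 0 1 - κa 0 1) * κa 1 0 := by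
    linear_combination db - da
  have h7 : |κb 0 0 * (κb 1 1 - κa 1 1)| ≤ 13 * S := by
    rw [e0]
    refine (abs_add_le _ _).trans ?_
    have := abs_add_le (-(κa 1 1 * (κb 0 0 - κa 0 0))) (κb 0 1 * (κb 1 0 - κa 1 0))
    rw [abs_neg] at this
    linarith
  rw [abs_mul] at h7
  have h8 : 1 / 2 ≤ |κb 0 0| := by rw [le_abs]; left; linarith
  nlinarith [abs_nonneg (κb 1 1 - κa 1 1)]

/-- Parameters for the two-scale comparison. -/
structure ScaleCtx {Ω : Type*} (A y η : ℝ) (Λ : Ω → SLR) : Prop where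
  hA : 200 ≤ A
  hy : 0 ≤ y
  hη0 : 0 < η
  hη : A ^ 10 * η ≤ 1
  hηθ : η ≤ Real.exp (-(2 * y))
  bad : ∀ ω, Bad A (Λ ω)

section
variable {Ω Ω₁ : Type*} [Fintype Ω] [Fintype Ω₁] [Nonempty Ω] [Nonempty Ω₁]
  {A X y η ηm d : ℝ} {Λ κ : Ω → SLR}

lemma ScaleCtx.pow_le (H : ScaleCtx A y η Λ) : 1 ≤ A ∧ A * η ≤ 1 ∧ A ^ 2 * η ≤ 1 ∧ A ^ 3 * η ≤ 1 ∧
    A ^ 4 * η ≤ 1 ∧ A ^ 5 * η ≤ 1 ∧ A ^ 6 * η ≤ 1 ∧ A ^ 7 * η ≤ 1 ∧ A ^ 8 * η ≤ 1 := by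
  have hA : 1 ≤ A := by linarith [H.hA]
  have h : ∀ n ≤ 10, A ^ n * η ≤ 1 := fun n hn =>
    (mul_le_mul_of_nonneg_right (pow_le_pow_right₀ hA hn) H.hη0.le).trans H.hη
  exact ⟨hA, by simpa using h 1 (by norm_num), h 2 (by norm_num), h 3 (by norm_num), h 4 (by norm_num),
    h 5 (by norm_num), h 6 (by norm_num), h 7 (by norm_num), h 8 (by norm_num)⟩

/-- Coordinates of two lattices related by a small matrix differ by that matrix. -/
lemma ScaleCtx.coord_eq (H : ScaleCtx A y η Λ) (hκ : ∀ ω, Near1 (4 * A * η) (κ ω))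
    (hκ2 : ∀ a b, cell η (Λ a) = cell η (Λ b) → ∃ γ, Λ b * embZ γ = κ b * (κ a)⁻¹ * Λ a)
    {a b : Ω} (hab : cell η (Λ a) = cell η (Λ b)) {k : SLR} {γ : SLZ} (hk : Near1 (A ^ 2 * η) k)
    (e : Λ b * embZ γ = k * Λ a) : κ b = k * κ a := by
  obtain ⟨hA1, h1, h2, h3, h4, h5, h6, -⟩ := H.pow_le
  have hA := H.hA
  have hη0 := H.hη0
  obtain ⟨γ', e'⟩ := hκ2 a b hab
  refine _root_.coord_eq hA1 (H.bad a) (hκ a) (hκ b) e' hk e ?_ ?_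
  · have : 200 * (A ^ 4 * η) ≤ A * (A ^ 4 * η) := mul_le_mul_of_nonneg_right hA (by positivity)
    have : 200 * (A ^ 3 * η) ≤ A * (A ^ 3 * η) := mul_le_mul_of_nonneg_right hA (by positivity)
    have : A ^ 3 * η > 0 := by positivity
    nlinarith
  · have : 200 * (A * η) ≤ A * (A * η) := mul_le_mul_of_nonneg_right hA (by positivity)
    nlinarith [mul_pos (by linarith : 0 < A) hη0]

lemma ScaleCtx.ent_translate_le (H : ScaleCtx A y η Λ) (HK : KVCtx A X ηm Λ)
    (hm : ηm ≤ Real.exp (-(2 * y)) * (Real.exp (-(2 * y)) * η)) (hd : |d| ≤ 2)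
    (hbad : ∀ ω x, |x - d| ≤ Real.exp (-(2 * y)) → Bad A (av y * uu x * Λ ω))
    {V : Ω₁ → ℝ} (hV : ∀ a, |V a| ≤ η) (hVX : ∀ a, |V a| ≤ X) :
    ent (fun x : Ω₁ × Ω => cell (Real.exp (-(2 * y)) * η) (av y * uu (d + V x.1) * Λ x.2)) ≤
      ent (fun ω => cell (Real.exp (-(2 * y)) * η) (av y * uu d * Λ ω)) + growth ηm Λ V +
        3 * kverr A := by
  obtain ⟨hA1, h1, h2, h3, h4, h5, h6, -⟩ := H.pow_le
  have hA := H.hA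
  have hη0 := H.hη0
  have hηθ := H.hηθ
  have hθ1 : Real.exp (-(2 * y)) ≤ 1 := Real.exp_le_one_iff.2 (by linarith [H.hy])
  have hθe : Real.exp (2 * y) * Real.exp (-(2 * y)) = 1 := by rw [← Real.exp_add]; simp
  have hav := @av_conj_near
  set θ := Real.exp (-(2 * y)) with hθ
  have hθ0 : 0 < θ := Real.exp_pos _
  have hn : θ * η ≤ η := by nlinarith
  have hn0 : 0 < θ * η := by positivity
  have hm0 := HK.hη0
  set Y : Ω₁ × Ω → _ := fun x => cell (θ * η) (av y * uu (d + V x.1) * Λ x.2) with hY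
  have hVθ : ∀ a, |V a| ≤ θ := fun a => (hV a).trans hηθ
  have hbY : ∀ x : Ω₁ × Ω, Bad A (av y * uu (d + V x.1) * Λ x.2) := fun x =>
    hbad _ _ (by simpa using hVθ x.1)
  have hA3 : 200 * A * (θ * η) ≤ A ^ 3 * (θ * η) :=
    mul_le_mul_of_nonneg_right (by nlinarith) hn0.le
  have hA3' : A ^ 3 * (θ * η) ≤ 1 := (mul_le_mul_of_nonneg_left hn (by positivity)).trans h3
  have hAp : 0 < A * (θ * η) := by positivity
  have hA16 : (1 + 1) ^ 2 * (4 * A * (θ * η)) ≤ A ^ 3 * (θ * η) := by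
    refine le_trans ?_ hA3
    linarith
  have ha : ent (fun x : Ω₁ × Ω => (x.1, Y x)) ≤ Real.log (Fintype.card Ω₁) +
      ent (fun ω => cell (θ * η) (av y * uu d * Λ ω)) + kverr A := by
    rw [← ent_indep (Ω₁ := Ω₁)]
    have := ent_cell_le (f := fun x : Ω₁ × Ω => (x.1, cell (θ * η) (av y * uu d * Λ x.2)))
      (Ψ := fun x => av y * uu (d + V x.1) * Λ x.2) (A := A) (ε := (1 + 1) ^ 2 * (4 * A * (θ * η))) 3
      (by linarith) hn0 (by positivity) (hA16.trans hA3') hA16 hbY ?_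
    · refine (ent_mono ?_).trans (this.trans_eq ?_)
      · intro a b hab
        simp only [Prod.mk.injEq] at hab ⊢
        exact ⟨hab.1.1, hab.2⟩
      · unfold kverr; norm_num
    · rintro ⟨a, ω⟩ ⟨b, ω'⟩ hab
      simp only [Prod.mk.injEq] at hab ⊢
      obtain ⟨rfl, hc⟩ := hab
      obtain ⟨γ, k, hk, e⟩ := near_of_cell_eq (hbad ω d (by simpa using hθ0.le)) hA1 hn0 hc
      refine ⟨γ, _, hk.conj_uu (x := Real.exp (2 * y) * V a) (X := 1) ?_, ?_⟩
      · rw [abs_mul, abs_of_pos (Real.exp_pos _)]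
        calc _ ≤ Real.exp (2 * y) * θ := mul_le_mul_of_nonneg_left (hVθ a) (Real.exp_pos _).le
          _ = 1 := hθe
      · have : av y * uu (d + V a) = uu (Real.exp (2 * y) * V a) * (av y * uu d) := by
          rw [add_comm, uu_add, ← mul_assoc, av_mul_uu, mul_assoc]
        rw [this]
        have : uu (Real.exp (2 * y) * V a) * (av y * uu d) * Λ ω' * embZ γ =
            uu (Real.exp (2 * y) * V a) * (av y * uu d * Λ ω' * embZ γ) := by group
        rw [this, e]
        group
  have hb : ent (fun x : Ω₁ × Ω => (cell ηm (uu (V x.1) * Λ x.2), Y x)) ≤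
      ent (fun x : Ω₁ × Ω => cell ηm (uu (V x.1) * Λ x.2)) + kverr A := by
    have hm' : (1 + 2) ^ 2 * (4 * A * ηm) / θ ≤ A ^ 3 * (θ * η) := by
      rw [div_le_iff₀ hθ0]
      have : 36 * A * ηm ≤ 36 * A * (θ * (θ * η)) := mul_le_mul_of_nonneg_left hm (by positivity)
      have : 200 * A * (θ * η) * θ ≤ A ^ 3 * (θ * η) * θ := mul_le_mul_of_nonneg_right hA3 hθ0.le
      have : 0 < A * (θ * η) * θ := by positivity
      nlinarith
    have := ent_cell_le (f := fun x : Ω₁ × Ω => cell ηm (uu (V x.1) * Λ x.2))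
      (Ψ := fun x => av y * uu (d + V x.1) * Λ x.2) (A := A) (ε := (1 + 2) ^ 2 * (4 * A * ηm) / θ) 3
      (by linarith) hn0 (by positivity) (hm'.trans hA3') hm' hbY ?_
    · refine this.trans_eq ?_
      unfold kverr; norm_num
    · intro a b hab
      obtain ⟨γ, k, hk, e⟩ := near_of_cell_eq (HK.bad _ _ (hVX a.1)) hA1 hm0 hab
      refine ⟨γ, _, hav H.hy (hk.conj_uu hd), ?_⟩
      rw [uu_add, uu_add]
      have : av y * (uu d * uu (V b.1)) * Λ b.2 * embZ γ =
          av y * uu d * (uu (V b.1) * Λ b.2 * embZ γ) := by group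
      rw [this, e]
      group
  have hk : Real.log (Fintype.card Ω₁) + ent (fun ω => cell ηm (Λ ω)) ≤
      ent (fun x : Ω₁ × Ω => (x.1, cell ηm (uu (V x.1) * Λ x.2))) + kverr A := by
    rw [← ent_indep (Ω₁ := Ω₁)]
    refine le_trans (ent_mono ?_) (HK.ent_le (f := fun x : Ω₁ × Ω => (x.1, cell ηm (uu (V x.1) * Λ x.2)))
      (π := fun x => x.2) (d := fun x => V x.1) (d' := fun _ => 0) (fun _ => hVX _)
      (by simpa using HK.hX) (by intro x; simpa using hVX x.1) ?_)
    · intro a b hab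
      simp only [Prod.mk.injEq, uu_zero, one_mul] at hab ⊢
      exact ⟨hab.1.1, hab.2⟩
    · intro a b hab
      simp only [Prod.mk.injEq] at hab
      exact ⟨by rw [hab.1], hab.2⟩
  have hsub := ent_submod (f := fun x : Ω₁ × Ω => (cell ηm (uu (V x.1) * Λ x.2), Y x))
    (g := fun x : Ω₁ × Ω => (x.1, Y x)) (k := fun x => (x.1, cell ηm (uu (V x.1) * Λ x.2))) (h := Y)
    (by intro a b h1 h2; simp only [Prod.mk.injEq] at h1 h2 ⊢; exact ⟨h2.1, h1.1⟩)
    (by intro a b h1; exact (Prod.ext_iff.1 h1).2) (by intro a b h1; exact (Prod.ext_iff.1 h1).2)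
  unfold growth
  linarith

/-- Coordinates of the stable row. -/
noncomputable def rowFun (η η' : ℝ) (Λ κ : Ω → SLR) (d : ℝ) (ω : Ω) : (ℤ × ℤ × ℤ × ℤ) × ℤ :=
  (cell η (Λ ω), ⌊(κ ω 0 0 + d * κ ω 1 0) / η'⌋)

lemma ScaleCtx.log_card_add_ent_row_le (H : ScaleCtx A y η Λ) (hd : |d| ≤ 2)
    (hbad : ∀ ω x, |x - d| ≤ Real.exp (-(2 * y)) → Bad A (av y * uu x * Λ ω))
    (hκ : ∀ ω, Near1 (4 * A * η) (κ ω))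
    (hκ2 : ∀ a b, cell η (Λ a) = cell η (Λ b) → ∃ γ, Λ b * embZ γ = κ b * (κ a)⁻¹ * Λ a)
    {V : Ω₁ → ℝ} (hV : ∀ a, |V a| ≤ η)
    (hsep : ∀ a b, a ≠ b →
      4 * A * (Real.exp (-(2 * y)) * η) * Real.exp (-(2 * y)) < |V a - V b|) :
    Real.log (Fintype.card Ω₁) + ent (rowFun η (Real.exp (-(2 * y)) * η) Λ κ d) ≤
      ent (fun x : Ω₁ × Ω => cell (Real.exp (-(2 * y)) * η) (av y * uu (d + V x.1) * Λ x.2)) +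
        2 * kverr A := by
  obtain ⟨hA1, h1, h2, h3, h4, h5, h6, -⟩ := H.pow_le
  have hA := H.hA
  have hη0 := H.hη0
  have hηθ := H.hηθ
  have hθ1 : Real.exp (-(2 * y)) ≤ 1 := Real.exp_le_one_iff.2 (by linarith [H.hy])
  have hsk := @skew_of_cell_eq
  set θ := Real.exp (-(2 * y)) with hθ
  have hθ0 : 0 < θ := Real.exp_pos _
  have hn : θ * η ≤ η := by nlinarith
  have hn0 : 0 < θ * η := by positivity
  set Y : Ω₁ × Ω → _ := fun x => cell (θ * η) (av y * uu (d + V x.1) * Λ x.2) with hY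
  have hVθ : ∀ a, |V a| ≤ θ := fun a => (hV a).trans hηθ
  have hbY : ∀ x : Ω₁ × Ω, Bad A (av y * uu (d + V x.1) * Λ x.2) := fun x =>
    hbad _ _ (by simpa using hVθ x.1)
  have hη1 : η ≤ 1 := hηθ.trans hθ1
  have key : ∀ a b, Y a = Y b → ∃ (γ : SLZ) (F : SLR), Skew (4 * A * (θ * η)) θ F ∧
      Λ b.2 * embZ γ = ((uu (d + V b.1))⁻¹ * F * uu (d + V a.1)) * Λ a.2 ∧
      Near1 (A ^ 2 * η) ((uu (d + V b.1))⁻¹ * F * uu (d + V a.1)) := by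
    intro a b hab
    obtain ⟨γ, F, hF, e⟩ := hsk (hbY a) hA1 hn0 hab
    refine ⟨γ, F, hF, e, ?_⟩
    have h1 : Near1 (4 * A * η) F := by
      have := hF.near hθ0 hθ1
      refine this.mono ?_
      rw [div_le_iff₀ hθ0]; linarith
    have h2 := h1.conj_uu (x := -(d + V b.1)) (X := 3) (by
      rw [abs_neg]; exact (abs_add_le _ _).trans (by linarith [hVθ b.1]))
    have h3 : Near1 (2 * η) (uu (V a.1 - V b.1)) := by
      have h0 : (0:ℝ) ≤ 2 * η := by positivity
      refine ⟨by simpa using hη0.le, ?_, by simpa using hη0.le, by simpa using hη0.le⟩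
      rw [uu01]
      exact (abs_sub _ _).trans (by linarith [hV a.1, hV b.1])
    have hη2 : 2 * η ≤ 1 := by nlinarith
    have h4 := h2.mul h3 hη2
    have e4 : uu (-(d + V b.1)) * F * (uu (-(d + V b.1)))⁻¹ * uu (V a.1 - V b.1) =
        (uu (d + V b.1))⁻¹ * F * uu (d + V a.1) := by
      rw [uu_neg, inv_inv, mul_assoc _ _ (uu (V a.1 - V b.1)), ← uu_add]
      congr 2; ring
    rw [e4] at h4
    refine h4.mono ?_
    nlinarith [mul_pos (by linarith : 0 < A) hη0]
  have hcellj : ent (fun x => (Y x, cell η (Λ x.2))) ≤ ent Y + kverr A := by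
    have := ent_cell_le (f := Y) (Ψ := fun x => Λ x.2) (A := A) (ε := A ^ 2 * η) 3
      (by linarith) hη0 (by positivity) (by linarith)
      (mul_le_mul_of_nonneg_right (pow_le_pow_right₀ hA1 (by norm_num)) hη0.le)
      (fun x => H.bad x.2) (fun a b hab => by
        obtain ⟨γ, F, -, e, hk⟩ := key a b hab
        exact ⟨γ, _, hk, e⟩)
    refine this.trans_eq ?_
    unfold kverr; norm_num
  have hlog : 0 ≤ Real.log A := Real.log_nonneg hA1
  have hrow : ent (fun x => ((Y x, cell η (Λ x.2)), ⌊(κ x.2 0 0 + d * κ x.2 1 0) / (θ * η)⌋)) ≤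
      ent (fun x => (Y x, cell η (Λ x.2))) + kverr A := by
    have := ent_floor_le_pow (f := fun x => (Y x, cell η (Λ x.2))) (A := A)
      (Y := fun x => κ x.2 0 0 + d * κ x.2 1 0) 2 (by linarith) hn0 ?_
    · refine this.trans ?_
      unfold kverr; push_cast; linarith
    · intro a b hab
      simp only [Prod.mk.injEq] at hab
      obtain ⟨γ, F, hF, e, hk⟩ := key a b hab.1
      have hc := H.coord_eq hκ hκ2 hab.2 hk e
      rw [abs_sub_comm]
      refine row_diff_le hA hη0 hθ0 hηθ hθ1 h1 hF hd (hκ a.2) (hV a.1) (hV b.1) ?_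
      rw [hc, add_comm d (V b.1), uu_add, add_comm d (V a.1), uu_add, uu_neg]; group
  have hsub := ent_submod (f := fun x : Ω₁ × Ω => ((Y x, cell η (Λ x.2)), ⌊(κ x.2 0 0 + d * κ x.2 1 0) / (θ * η)⌋))
    (g := fun x : Ω₁ × Ω => x.2) (k := fun x => x) (h := fun x => rowFun η (θ * η) Λ κ d x.2)
    (by
      intro a b h1 h2
      simp only [Prod.mk.injEq] at h1
      refine Prod.ext ?_ h2
      by_contra hne
      obtain ⟨γ, F, hF, e, hk⟩ := key a b h1.1.1
      have h24 : 4 * A ^ 2 * (A ^ 2 * η) < 1 := by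
        have : 200 * (A ^ 4 * η) ≤ A * (A ^ 4 * η) := mul_le_mul_of_nonneg_right hA (by positivity)
        nlinarith
      rw [← h2] at e
      have := (H.bad a.2).eq_one hA1 hk h24 e
      have hFe : F = uu (V b.1 - V a.1) := by
        have h3 : F = uu (d + V b.1) * ((uu (d + V b.1))⁻¹ * F * uu (d + V a.1)) * (uu (d + V a.1))⁻¹ := by group
        rw [h3, this, mul_one, ← uu_neg, ← uu_add]; congr 1; ring
      have h5 := hF.h01
      rw [hFe, uu01, abs_sub_comm] at h5
      linarith [hsep _ _ hne])
    (by
      intro a b h1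
      simp only [Prod.mk.injEq, rowFun] at h1 ⊢
      exact ⟨h1.1.2, h1.2⟩)
    (by intro a b h1; exact congrArg _ h1)
  rw [ent_id, ent_comp_snd (Ω' := Ω₁) (rowFun η (θ * η) Λ κ d), ent_comp_snd (Ω' := Ω₁) (fun ω : Ω => ω), ent_id, Fintype.card_prod,
    Nat.cast_mul, Real.log_mul (by exact_mod_cast Fintype.card_ne_zero)
      (by exact_mod_cast Fintype.card_ne_zero)] at hsub
  linarith

lemma ScaleCtx.ent_rows_ge (H : ScaleCtx A y η Λ) (hd : |d| ≤ 2)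
    (hκ : ∀ ω, Near1 (4 * A * η) (κ ω))
    (hκ2 : ∀ a b, cell η (Λ a) = cell η (Λ b) → ∃ γ, Λ b * embZ γ = κ b * (κ a)⁻¹ * Λ a) :
    ent (fun ω => cell (Real.exp (-(2 * y)) * η) (Λ ω)) + ent (fun ω => cell η (Λ ω)) ≤
      ent (rowFun η (Real.exp (-(2 * y)) * η) Λ κ d) +
      ent (rowFun η (Real.exp (-(2 * y)) * η) Λ κ (d + 1)) + 2 * y + 2 * kverr A := by
  obtain ⟨hA1, h1, h2, h3, h4, h5, h6, -⟩ := H.pow_le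
  have hA := H.hA
  have hη0 := H.hη0
  have hηθ := H.hηθ
  have hθ1 : Real.exp (-(2 * y)) ≤ 1 := Real.exp_le_one_iff.2 (by linarith [H.hy])
  have hlogθ : Real.log (Real.exp (-(2 * y))) = -(2 * y) := Real.log_exp _
  set θ := Real.exp (-(2 * y)) with hθ
  have hθ0 : 0 < θ := Real.exp_pos _
  have hn : θ * η ≤ η := by nlinarith
  have hn0 : 0 < θ * η := by positivity
  have hlog : 0 ≤ Real.log A := Real.log_nonneg hA1
  have hsub := ent_submod (f := rowFun η (θ * η) Λ κ d) (g := rowFun η (θ * η) Λ κ (d + 1))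
    (k := fun ω => (rowFun η (θ * η) Λ κ d ω, rowFun η (θ * η) Λ κ (d + 1) ω))
    (h := fun ω => cell η (Λ ω)) (by intro a b h1 h2; simp only [h1, h2])
    (by intro a b h1; exact (Prod.ext_iff.1 h1).1) (by intro a b h1; exact (Prod.ext_iff.1 h1).1)
  have hfl := ent_floor_le (f := fun ω => (rowFun η (θ * η) Λ κ d ω, rowFun η (θ * η) Λ κ (d + 1) ω))
    (X := fun ω => κ ω 0 1) hn0 (K := ⌈8 * A / θ⌉₊) (by
      intro a b _
      have h1 := abs_sub (κ a 0 1) (κ b 0 1)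
      have h2 := (hκ a).h01
      have h3 := (hκ b).h01
      have h4 : 8 * A / θ * (θ * η) ≤ ⌈8 * A / θ⌉₊ * (θ * η) :=
        mul_le_mul_of_nonneg_right (Nat.le_ceil _) hn0.le
      have h5 : 8 * A / θ * (θ * η) = 8 * A * η := by field_simp
      linarith)
  have hK : Real.log (2 * ⌈8 * A / θ⌉₊ + 3 : ℕ) ≤ 2 * Real.log A + 2 * y := by
    have h3 := Nat.ceil_lt_add_one (by positivity : 0 ≤ 8 * A / θ)
    have h4 : 1 ≤ A / θ := by rw [le_div_iff₀ hθ0]; linarith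
    have h5 : ((2 * ⌈8 * A / θ⌉₊ + 3 : ℕ) : ℝ) ≤ A ^ 2 / θ := by
      push_cast
      have : 8 * A / θ = 8 * (A / θ) := by ring
      have h6 : A ^ 2 / θ = A * (A / θ) := by ring
      rw [h6]
      nlinarith
    calc _ ≤ Real.log (A ^ 2 / θ) := Real.log_le_log (by positivity) h5
      _ = _ := by
        rw [Real.log_div (by positivity) hθ0.ne', hlogθ, Real.log_pow]; push_cast; ring
  have h104 : 4 * (26 * (θ * η)) ≤ A ^ 2 * (θ * η) := by
    rw [← mul_assoc]; exact mul_le_mul_of_nonneg_right (by nlinarith) hn0.le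
  have hA21 : A ^ 2 * (θ * η) ≤ 1 := (mul_le_mul_of_nonneg_left hn (by positivity)).trans h2
  have hcell := ent_cell_le (f := fun ω => ((rowFun η (θ * η) Λ κ d ω, rowFun η (θ * η) Λ κ (d + 1) ω),
      ⌊κ ω 0 1 / (θ * η)⌋)) (Ψ := Λ) (A := A) (ε := 4 * (26 * (θ * η))) 2 (by linarith) hn0
      (by positivity) (h104.trans hA21) h104 H.bad (by
      intro a b hab
      simp only [Prod.mk.injEq, rowFun] at hab
      obtain ⟨⟨⟨hc, r1⟩, -, r2⟩, r3⟩ := hab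
      obtain ⟨γ, e⟩ := hκ2 a b hc
      have q1 := abs_le.1 (abs_sub_le_of_floor_eq hn0 r1)
      have q2 := abs_le.1 (abs_sub_le_of_floor_eq hn0 r2)
      have q3 := abs_le.1 (abs_sub_le_of_floor_eq hn0 r3)
      have h4A : 4 * A * η ≤ 1 / 2 := by nlinarith [mul_pos (by linarith : 0 < A) hη0]
      have ka := (hκ a).mono h4A
      have kb := (hκ b).mono h4A
      have p10 : |κ b 1 0 - κ a 1 0| ≤ 2 * (θ * η) := by rw [abs_le]; constructor <;> linarith
      have p01 : |κ b 0 1 - κ a 0 1| ≤ θ * η := by rw [abs_le]; constructor <;> linarith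
      have p00 : |κ b 0 0 - κ a 0 0| ≤ 5 * (θ * η) := by
        have := abs_mul_le_mul hd p10
        rw [abs_le] at this ⊢
        constructor <;> linarith
      have p11 := entry11_diff_le ka kb p00 p01 p10
      refine ⟨γ, _, near1_mul_inv (ε := 26 * (θ * η)) (ka.mono (by norm_num)) ?_, e⟩
      intro i j
      fin_cases i <;> fin_cases j
      · exact p00.trans (by linarith)
      · exact p01.trans (by linarith)
      · exact p10.trans (by linarith)
      · exact p11)
  have hmono : ent (fun ω => cell (θ * η) (Λ ω)) ≤ _ := (ent_mono (by
    intro a b hab; exact (Prod.ext_iff.1 hab).2)).trans hcell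
  norm_num at hmono
  unfold kverr
  linarith

end

section
variable {Ω Ω₁ : Type*} [Fintype Ω] [Fintype Ω₁] [Nonempty Ω] [Nonempty Ω₁]
  {A X y η ηm d : ℝ} {Λ κ : Ω → SLR}

lemma ScaleCtx.exists_coord (H : ScaleCtx A y η Λ) : ∃ κ : Ω → SLR, (∀ ω, Near1 (4 * A * η) (κ ω)) ∧
    ∀ a b, cell η (Λ a) = cell η (Λ b) → ∃ γ, Λ b * embZ γ = κ b * (κ a)⁻¹ * Λ a :=
  _root_.exists_coord H.pow_le.1 H.hη0 H.bad

/-- Two unstable translates at distance one see the lattice ensemble at two scales. -/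
lemma ScaleCtx.ent_pair_ge (H : ScaleCtx A y η Λ) (HK : KVCtx A X ηm Λ)
    (hm : ηm ≤ Real.exp (-(2 * y)) * (Real.exp (-(2 * y)) * η)) (hd : |d| ≤ 1)
    (hbad : ∀ ω x, |x - d| ≤ Real.exp (-(2 * y)) → Bad A (av y * uu x * Λ ω))
    (hbad' : ∀ ω x, |x - (d + 1)| ≤ Real.exp (-(2 * y)) → Bad A (av y * uu x * Λ ω))
    {V : Ω₁ → ℝ} (hV : ∀ a, |V a| ≤ η) (hVX : ∀ a, |V a| ≤ X)
    (hsep : ∀ a b, a ≠ b →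
      4 * A * (Real.exp (-(2 * y)) * η) * Real.exp (-(2 * y)) < |V a - V b|) :
    ent (fun ω => cell (Real.exp (-(2 * y)) * η) (Λ ω)) + ent (fun ω => cell η (Λ ω)) +
      2 * Real.log (Fintype.card Ω₁) ≤
      ent (fun ω => cell (Real.exp (-(2 * y)) * η) (av y * uu d * Λ ω)) +
      ent (fun ω => cell (Real.exp (-(2 * y)) * η) (av y * uu (d + 1) * Λ ω)) +
      2 * growth ηm Λ V + 2 * y + 12 * kverr A := by
  obtain ⟨κ, hκ, hκ2⟩ := H.exists_coord
  have hd1 : |d| ≤ 2 := by linarith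
  have hd2 : |d + 1| ≤ 2 := (abs_add_le _ _).trans (by rw [abs_one]; linarith)
  have h1 := H.ent_translate_le HK hm hd1 hbad hV hVX
  have h2 := H.ent_translate_le HK hm hd2 hbad' hV hVX
  have h3 := H.log_card_add_ent_row_le hd1 hbad hκ hκ2 hV hsep
  have h4 := H.log_card_add_ent_row_le hd2 hbad' hκ hκ2 hV hsep
  have h5 := H.ent_rows_ge hd1 hκ hκ2
  linarith

/-- The upper right entry of `uu d * κ * uu (-d')`. -/
noncomputable def mob (κ : SLR) (d d' : ℝ) : ℝ := κ 0 1 + d * κ 1 1 - d' * κ 0 0 - d * d' * κ 1 0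

lemma mob_one_near {ε d d' : ℝ} {κ : SLR} (h : Near1 ε κ) (hd : |d| ≤ 2) (hd' : |d'| ≤ 2) :
    |mob κ d d' - (d - d')| ≤ 9 * ε := by
  have e : mob κ d d' - (d - d') = κ 0 1 + d * (κ 1 1 - 1) + (-d') * (κ 0 0 - 1) + (d * -d') * κ 1 0 := by
    unfold mob; ring
  have hd'' : |-d'| ≤ 2 := by rwa [abs_neg]
  have t1 := abs_mul_le_mul hd h.h11
  have t2 := abs_mul_le_mul hd'' h.h00
  have t3 := abs_mul_le_mul (abs_mul_le_mul hd hd'') h.h10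
  rw [e]
  refine (abs_add_le _ _).trans ?_
  have := abs_add_le (κ 0 1 + d * (κ 1 1 - 1)) ((-d') * (κ 0 0 - 1))
  have := abs_add_le (κ 0 1) (d * (κ 1 1 - 1))
  linarith [h.h01]

lemma entries_of_conj {d : ℝ} {F κa κb : SLR} (e : κb = (uu d)⁻¹ * F * uu d * κa) :
    κb 0 0 + d * κb 1 0 = F 0 0 * (κa 0 0 + d * κa 1 0) + F 0 1 * κa 1 0 ∧
    κb 0 1 + d * κb 1 1 = F 0 0 * (κa 0 1 + d * κa 1 1) + F 0 1 * κa 1 1 ∧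
    κb 1 0 = F 1 0 * (κa 0 0 + d * κa 1 0) + F 1 1 * κa 1 0 ∧
    κb 1 1 = F 1 0 * (κa 0 1 + d * κa 1 1) + F 1 1 * κa 1 1 := by
  have e' : uu d * κb = F * (uu d * κa) := by rw [e]; group
  have h := fun i j => congrArg (fun g : SLR => g i j) e'
  have h00 := h 0 0; have h01 := h 0 1; have h10 := h 1 0; have h11 := h 1 1
  simp only [SLR.mul_apply, uu00, uu01, uu10, uu11] at h00 h01 h10 h11
  refine ⟨by linear_combination h00, by linear_combination h01, by linear_combination h10,
    by linear_combination h11⟩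

lemma entries_of_conj_one {d : ℝ} {F k : SLR} (e : k = (uu d)⁻¹ * F * uu d) :
    k 0 0 + d * k 1 0 = F 0 0 ∧ k 0 1 + d * k 1 1 = F 0 0 * d + F 0 1 ∧
    k 1 0 = F 1 0 ∧ k 1 1 = F 1 0 * d + F 1 1 := by
  have o00 : (1 : SLR) 0 0 = 1 := rfl
  have o01 : (1 : SLR) 0 1 = 0 := rfl
  have o10 : (1 : SLR) 1 0 = 0 := rfl
  have o11 : (1 : SLR) 1 1 = 1 := rfl
  have c := entries_of_conj (κa := 1) (κb := k) (d := d) (F := F) (by rw [mul_one]; exact e)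
  simpa only [o00, o01, o10, o11, mul_zero, mul_one, add_zero, zero_add] using c

section pure
variable {A θ η d d' : ℝ} {F κa κb : SLR}

lemma mob_left (hA : 200 ≤ A) (hη0 : 0 < η) (hθ0 : 0 < θ) (hθ1 : θ ≤ 1) (hAη : 4 * A * η ≤ 1)
    (hF : Skew (4 * A * (θ * η)) θ F) (hd : |d| ≤ 2) (hd' : |d'| ≤ 2)
    (ha : Near1 (4 * A * η) κa) (e : κb = (uu d)⁻¹ * F * uu d * κa) :
    |mob κb d d' - mob κa d d'| ≤ A ^ 2 * (θ * η) ∧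
    |(κb 0 0 + d * κb 1 0) - (κa 0 0 + d * κa 1 0)| ≤ A ^ 2 * (θ * η) := by
  obtain ⟨e00, e01, -, -⟩ := entries_of_conj e
  have h1 := mob_one_near ha hd hd'
  have hd'' : |-d'| ≤ 2 := by rwa [abs_neg]
  have hM : |mob κa d d'| ≤ 13 := by
    have := abs_sub_abs_le_abs_sub (mob κa d d') (d - d')
    have := abs_sub d d'
    linarith
  have h11 : |κa 1 1| ≤ 2 := by
    have := abs_le.1 ha.h11; rw [abs_le]; constructor <;> linarith
  have h00 : |κa 0 0| ≤ 2 := by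
    have := abs_le.1 ha.h00; rw [abs_le]; constructor <;> linarith
  have h10 : |κa 1 0| ≤ 1 := ha.h10.trans hAη
  have hp0 : 0 < A * (θ * η) := by positivity
  have hF01 : |F 0 1| ≤ 4 * A * (θ * η) := hF.h01.trans (by nlinarith)
  have hA2 : 200 * (A * (θ * η)) ≤ A ^ 2 * (θ * η) := by
    rw [pow_two, mul_assoc]; exact mul_le_mul_of_nonneg_right hA hp0.le
  constructor
  · have key : mob κb d d' - mob κa d d' = (F 0 0 - 1) * mob κa d d' + F 0 1 * (κa 1 1 + -d' * κa 1 0) := by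
      unfold mob; linear_combination e01 - d' * e00
    have t1 := abs_mul_le_mul hF.h00 hM
    have t2 : |κa 1 1 + -d' * κa 1 0| ≤ 4 := (abs_add_le _ _).trans (by
      have := abs_mul_le_mul hd'' h10; linarith)
    have t3 := abs_mul_le_mul hF01 t2
    rw [key]
    exact (abs_add_le _ _).trans (by linarith)
  · have key : (κb 0 0 + d * κb 1 0) - (κa 0 0 + d * κa 1 0) =
        (F 0 0 - 1) * (κa 0 0 + d * κa 1 0) + F 0 1 * κa 1 0 := by linear_combination e00
    have t2 : |κa 0 0 + d * κa 1 0| ≤ 4 := (abs_add_le _ _).trans (by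
      have := abs_mul_le_mul hd h10; linarith)
    have t1 := abs_mul_le_mul hF.h00 t2
    have t3 := abs_mul_le_mul hF01 h10
    rw [key]
    exact (abs_add_le _ _).trans (by linarith)

lemma mob_right (hA : 200 ≤ A) (hη0 : 0 < η) (hθ0 : 0 < θ) (hθ1 : θ ≤ 1) (hηθ : η ≤ θ)
    (hAη : 4 * A * η ≤ 1) (hF : Skew (4 * A * (θ * η)) θ F) (hd : |d| ≤ 2) (hd' : |d'| ≤ 2)
    (ha : Near1 (4 * A * η) κa) (e : κb = (uu d)⁻¹ * F * uu d * κa) :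
    |mob κb d' d - mob κa d' d| ≤ A ^ 4 * (θ * η) := by
  obtain ⟨e00, e01, e10, e11⟩ := entries_of_conj e
  have h1 := (mob_left hA hη0 hθ0 hθ1 hAη hF hd hd ha e).1
  have h2 := mob_one_near ha hd hd
  rw [sub_self, sub_zero] at h2
  have hp0 : 0 < A * (θ * η) := by positivity
  have hF10 : |F 1 0| ≤ 4 * A * η := hF.h10.trans (by rw [div_le_iff₀ hθ0]; linarith)
  have h11 : |κa 1 1| ≤ 2 := by
    have := abs_le.1 ha.h11; rw [abs_le]; constructor <;> linarith
  have h10 : |κa 1 0| ≤ 1 := ha.h10.trans hAη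
  have key : mob κb d' d - mob κa d' d = (mob κb d d - mob κa d d) +
      (d' - d) * (F 1 0 * mob κa d d + (F 1 1 - 1) * (κa 1 1 - d * κa 1 0)) := by
    unfold mob; linear_combination (d' - d) * (e11 - d * e10)
  have t1 : |d' - d| ≤ 4 := (abs_sub _ _).trans (by linarith)
  have t2 := abs_mul_le_mul hF10 h2
  have t3 : |κa 1 1 - d * κa 1 0| ≤ 4 := (abs_sub _ _).trans (by
    have := abs_mul_le_mul hd h10; linarith)
  have t4 := abs_mul_le_mul hF.h11 t3
  have t5 := abs_mul_le_mul t1 ((abs_add_le _ _).trans (add_le_add t2 t4))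
  have hA1 : A * (η * η) ≤ A * (θ * η) :=
    mul_le_mul_of_nonneg_left (mul_le_mul_of_nonneg_right hηθ hη0.le) (by linarith)
  have hA2' : A * (A * (η * η)) ≤ A * (A * (θ * η)) := mul_le_mul_of_nonneg_left hA1 (by linarith)
  have hA2 : 200 * (A * (θ * η)) ≤ A * (A * (θ * η)) := mul_le_mul_of_nonneg_right hA hp0.le
  have hA3 : 200 * (A * (A * (θ * η))) ≤ A * (A * (A * (θ * η))) := mul_le_mul_of_nonneg_right hA (by positivity)
  have hA4 : A ^ 4 * (θ * η) = A * (A * (A * (A * (θ * η)))) := by ring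
  rw [key, hA4]
  have hA5 : A ^ 2 * (θ * η) = A * (A * (θ * η)) := by ring
  rw [hA5] at h1
  refine (abs_add_le _ _).trans ?_
  have hA6 : 4 * (4 * A * η * (9 * (4 * A * η)) + 4 * A * (θ * η) * 4) =
    576 * (A * (A * (η * η))) + 64 * (A * (θ * η)) := by ring
  rw [hA6] at t5
  have hA7 : 200 * (A * (A * (A * (θ * η)))) ≤ A * (A * (A * (A * (θ * η)))) :=
    mul_le_mul_of_nonneg_right hA (by positivity)
  linarith

/-- Conjugates at two points control the whole matrix at the coarse scale. -/
lemma near_of_two {d₁ d₂ : ℝ} {k F₁ F₂ : SLR} (hA : 200 ≤ A) (hη0 : 0 < η) (hθ0 : 0 < θ) (hθ1 : θ ≤ 1)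
    (hF₁ : Skew (4 * A * (θ * η)) θ F₁) (hF₂ : Skew (4 * A * (θ * η)) θ F₂)
    (e₁ : k = (uu d₁)⁻¹ * F₁ * uu d₁) (e₂ : k = (uu d₂)⁻¹ * F₂ * uu d₂) (hd₁ : |d₁| ≤ 2)
    (hd : 1 ≤ A * |d₁ - d₂|) : Near1 (A ^ 3 * (θ * η)) k := by
  have c1 := entries_of_conj_one e₁
  have c2 := entries_of_conj_one e₂
  obtain ⟨p1, p2, p3, p4⟩ := c1
  obtain ⟨q1, q2, q3, q4⟩ := c2
  set S := A * (θ * η) with hS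
  have hS0 : 0 < S := by positivity
  have hSA : 200 * S ≤ A * S := mul_le_mul_of_nonneg_right hA hS0.le
  have hSA2 : 200 * (A * S) ≤ A * (A * S) := mul_le_mul_of_nonneg_right hA (by positivity)
  have f1 := hF₁.h00; have f2 := hF₂.h00
  have f3 : |F₁ 0 1| ≤ 4 * S := hF₁.h01.trans (by rw [mul_assoc 4]; nlinarith)
  have f4 := hF₁.h11
  have f1' : |F₁ 0 0 - 1| ≤ 4 * S := by rw [hS]; linarith
  have f2' : |F₂ 0 0 - 1| ≤ 4 * S := by rw [hS]; linarith
  have f4' : |F₁ 1 1 - 1| ≤ 4 * S := by rw [hS]; linarith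
  have g1 : |k 1 0| ≤ 8 * (A * S) := by
    have e : (d₁ - d₂) * k 1 0 = (F₁ 0 0 - 1) - (F₂ 0 0 - 1) := by linear_combination p1 - q1
    have := abs_sub (F₁ 0 0 - 1) (F₂ 0 0 - 1)
    rw [← e, abs_mul] at this
    have h3 : A * |d₁ - d₂| * |k 1 0| ≤ A * (8 * S) := by
      rw [mul_assoc]; exact mul_le_mul_of_nonneg_left (by linarith) (by linarith)
    nlinarith [abs_nonneg (k 1 0)]
  have t := abs_mul_le_mul hd₁ g1
  have g2 : |k 0 0 - 1| ≤ 20 * (A * S) := by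
    have e : k 0 0 - 1 = (F₁ 0 0 - 1) - d₁ * k 1 0 := by linear_combination p1
    rw [e]; exact (abs_sub _ _).trans (by linarith)
  have g3 : |k 1 1 - 1| ≤ 20 * (A * S) := by
    have e : k 1 1 - 1 = (F₁ 1 1 - 1) + d₁ * k 1 0 := by linear_combination p4 - d₁ * p3
    rw [e]; exact (abs_add_le _ _).trans (by linarith)
  have g4 : |k 0 1| ≤ 180 * (A * S) := by
    have e : k 0 1 = F₁ 0 1 + d₁ * (F₁ 0 0 - 1) - d₁ * (k 1 1 - 1) := by linear_combination p2
    have t1 := abs_mul_le_mul hd₁ f1'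
    have t2 := abs_mul_le_mul hd₁ g3
    rw [e]; exact (abs_sub _ _).trans (by linarith [abs_add_le (F₁ 0 1) (d₁ * (F₁ 0 0 - 1))])
  have e3 : A ^ 3 * (θ * η) = A * (A * S) := by rw [hS]; ring
  rw [e3]
  exact ⟨by linarith, by linarith, by linarith, by linarith⟩

lemma left_mul_diff {ε : ℝ} {k : SLR} (hk : Near1 ε k) (ha : Near1 1 κa) (e : κb = k * κa) (i j : Fin 2) :
    |κb i j - κa i j| ≤ 3 * ε := by
  have h := fun i j => congrArg (fun g : SLR => g i j) e
  have h00 := h 0 0; have h01 := h 0 1; have h10 := h 1 0; have h11 := h 1 1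
  simp only [SLR.mul_apply] at h00 h01 h10 h11
  have a00 : |κa 0 0| ≤ 2 := by
    have := abs_le.1 ha.h00; rw [abs_le]; constructor <;> linarith
  have a11 : |κa 1 1| ≤ 2 := by
    have := abs_le.1 ha.h11; rw [abs_le]; constructor <;> linarith
  have a01 := ha.h01; have a10 := ha.h10
  fin_cases i <;> fin_cases j
  · have e : κb 0 0 - κa 0 0 = (k 0 0 - 1) * κa 0 0 + k 0 1 * κa 1 0 := by linear_combination h00
    change |κb 0 0 - κa 0 0| ≤ _
    rw [e]
    exact (abs_add_le _ _).trans (by linarith [abs_mul_le_mul hk.h00 a00, abs_mul_le_mul hk.h01 a10])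
  · have e : κb 0 1 - κa 0 1 = (k 0 0 - 1) * κa 0 1 + k 0 1 * κa 1 1 := by linear_combination h01
    change |κb 0 1 - κa 0 1| ≤ _
    rw [e]
    exact (abs_add_le _ _).trans (by linarith [abs_mul_le_mul hk.h00 a01, abs_mul_le_mul hk.h01 a11])
  · have e : κb 1 0 - κa 1 0 = k 1 0 * κa 0 0 + (k 1 1 - 1) * κa 1 0 := by linear_combination h10
    change |κb 1 0 - κa 1 0| ≤ _
    rw [e]
    exact (abs_add_le _ _).trans (by linarith [abs_mul_le_mul hk.h10 a00, abs_mul_le_mul hk.h11 a10])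
  · have e : κb 1 1 - κa 1 1 = k 1 0 * κa 0 1 + (k 1 1 - 1) * κa 1 1 := by linear_combination h11
    change |κb 1 1 - κa 1 1| ≤ _
    rw [e]
    exact (abs_add_le _ _).trans (by linarith [abs_mul_le_mul hk.h10 a01, abs_mul_le_mul hk.h11 a11])

lemma mob_diff_le {ε d d' : ℝ} (h : ∀ i j, |κb i j - κa i j| ≤ ε) (hd : |d| ≤ 2) (hd' : |d'| ≤ 2) :
    |mob κb d d' - mob κa d d'| ≤ 9 * ε := by
  have e : mob κb d d' - mob κa d d' = (κb 0 1 - κa 0 1) + d * (κb 1 1 - κa 1 1) +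
      (-d') * (κb 0 0 - κa 0 0) + (d * -d') * (κb 1 0 - κa 1 0) := by
    unfold mob; ring
  have hd'' : |-d'| ≤ 2 := by rwa [abs_neg]
  have t1 := abs_mul_le_mul hd (h 1 1)
  have t2 := abs_mul_le_mul hd'' (h 0 0)
  have t3 := abs_mul_le_mul (abs_mul_le_mul hd hd'') (h 1 0)
  rw [e]
  refine (abs_add_le _ _).trans ?_
  have := abs_add_le ((κb 0 1 - κa 0 1) + d * (κb 1 1 - κa 1 1)) ((-d') * (κb 0 0 - κa 0 0))
  have := abs_add_le (κb 0 1 - κa 0 1) (d * (κb 1 1 - κa 1 1))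
  linarith [h 0 1]

/-- A quadratic small at three separated points has small coefficients. -/
lemma quad_coeff_le {p0 p1 p2 d₁ d₂ d₃ M : ℝ} (hA : 200 ≤ A) (hM : 0 ≤ M)
    (h1 : |p0 + d₁ * p1 + d₁ ^ 2 * p2| ≤ M) (h2 : |p0 + d₂ * p1 + d₂ ^ 2 * p2| ≤ M)
    (h3 : |p0 + d₃ * p1 + d₃ ^ 2 * p2| ≤ M) (hd₁ : |d₁| ≤ 2) (hd₂ : |d₂| ≤ 2)
    (h12 : 1 ≤ A * |d₁ - d₂|) (h13 : 1 ≤ A * |d₁ - d₃|) (h23 : 1 ≤ A * |d₂ - d₃|) :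
    |p2| ≤ A ^ 3 * M ∧ |p1| ≤ A ^ 4 * M ∧ |p0| ≤ A ^ 5 * M := by
  have key : ∀ {x u z : ℝ}, 1 ≤ A * |u| → |u * x| ≤ z → |x| ≤ A * z := by
    intro x u z hu h
    rw [abs_mul] at h
    have := mul_le_mul_of_nonneg_left h (by linarith : 0 ≤ A)
    nlinarith [abs_nonneg x]
  have q12 : |p1 + (d₁ + d₂) * p2| ≤ A * (2 * M) := by
    refine key h12 ?_
    have e : (d₁ - d₂) * (p1 + (d₁ + d₂) * p2) =
      (p0 + d₁ * p1 + d₁ ^ 2 * p2) - (p0 + d₂ * p1 + d₂ ^ 2 * p2) := by ring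
    rw [e]; exact (abs_sub _ _).trans (by linarith)
  have q13 : |p1 + (d₁ + d₃) * p2| ≤ A * (2 * M) := by
    refine key h13 ?_
    have e : (d₁ - d₃) * (p1 + (d₁ + d₃) * p2) =
      (p0 + d₁ * p1 + d₁ ^ 2 * p2) - (p0 + d₃ * p1 + d₃ ^ 2 * p2) := by ring
    rw [e]; exact (abs_sub _ _).trans (by linarith)
  have q2 : |p2| ≤ A * (A * (4 * M)) := by
    refine key h23 ?_
    have e : (d₂ - d₃) * p2 = (p1 + (d₁ + d₂) * p2) - (p1 + (d₁ + d₃) * p2) := by ring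
    rw [e]; exact (abs_sub _ _).trans (by linarith)
  have m1 : 200 * M ≤ A * M := mul_le_mul_of_nonneg_right hA hM
  have m2 : 200 * (A * M) ≤ A * (A * M) := mul_le_mul_of_nonneg_right hA (by positivity)
  have m3 : 200 * (A * (A * M)) ≤ A * (A * (A * M)) := mul_le_mul_of_nonneg_right hA (by positivity)
  have m4 : 200 * (A * (A * (A * M))) ≤ A * (A * (A * (A * M))) := mul_le_mul_of_nonneg_right hA (by positivity)
  have e3 : A ^ 3 * M = A * (A * (A * M)) := by ring
  have e4 : A ^ 4 * M = A * (A * (A * (A * M))) := by ring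
  have e5 : A ^ 5 * M = A * (A * (A * (A * (A * M)))) := by ring
  have m5 : 200 * (A * (A * (A * (A * M)))) ≤ A * (A * (A * (A * (A * M)))) :=
    mul_le_mul_of_nonneg_right hA (by positivity)
  have hp : |p1| ≤ 20 * (A * (A * M)) := by
    have t := abs_mul_le_mul ((abs_add_le d₁ d₂).trans (add_le_add hd₁ hd₂)) q2
    have : p1 = (p1 + (d₁ + d₂) * p2) - (d₁ + d₂) * p2 := by ring
    rw [this]; exact (abs_sub _ _).trans (by linarith)
  refine ⟨by linarith, by linarith, ?_⟩
  have t1 := abs_mul_le_mul hd₁ hp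
  have t2 := abs_mul_le_mul (abs_mul_le_mul hd₁ hd₁) q2
  have : p0 = (p0 + d₁ * p1 + d₁ ^ 2 * p2) - d₁ * p1 - (d₁ * d₁) * p2 := by ring
  rw [this]
  refine (abs_sub _ _).trans ?_
  have := abs_sub (p0 + d₁ * p1 + d₁ ^ 2 * p2) (d₁ * p1)
  linarith

lemma near_of_three {d₁ d₂ d₃ : ℝ} {k F₁ F₂ F₃ : SLR} (hA : 200 ≤ A) (hη0 : 0 < η) (hθ0 : 0 < θ)
    (hθ1 : θ ≤ 1) (hAη : A ^ 10 * η ≤ 1)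
    (hF₁ : Skew (4 * A * (θ * η)) θ F₁) (hF₂ : Skew (4 * A * (θ * η)) θ F₂)
    (hF₃ : Skew (4 * A * (θ * η)) θ F₃)
    (e₁ : k = (uu d₁)⁻¹ * F₁ * uu d₁) (e₂ : k = (uu d₂)⁻¹ * F₂ * uu d₂)
    (e₃ : k = (uu d₃)⁻¹ * F₃ * uu d₃) (hd₁ : |d₁| ≤ 2) (hd₂ : |d₂| ≤ 2)
    (h12 : 1 ≤ A * |d₁ - d₂|) (h13 : 1 ≤ A * |d₁ - d₃|) (h23 : 1 ≤ A * |d₂ - d₃|) :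
    Near1 (A ^ 7 * (θ * (θ * η))) k := by
  have hA1 : 1 ≤ A := by linarith
  have hn := near_of_two hA hη0 hθ0 hθ1 hF₁ hF₂ e₁ e₂ hd₁ h12
  set M := θ * (θ * η) with hM
  have hM0 : 0 < M := by positivity
  have c : ∀ {d F}, (k = (uu d)⁻¹ * F * uu d) → Skew (4 * A * (θ * η)) θ F →
      |k 0 1 + d * (k 1 1 - k 0 0) + d ^ 2 * (-k 1 0)| ≤ 4 * A * M := by
    intro d F e hF
    have c1 := entries_of_conj_one e
    obtain ⟨p1, p2, p3, p4⟩ := c1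
    have : k 0 1 + d * (k 1 1 - k 0 0) + d ^ 2 * (-k 1 0) = F 0 1 := by linear_combination p2 - d * p1
    rw [this]
    refine hF.h01.trans_eq ?_
    rw [hM]; ring
  obtain ⟨b2, b1, b0⟩ := quad_coeff_le hA (by positivity) (c e₁ hF₁) (c e₂ hF₂) (c e₃ hF₃) hd₁ hd₂ h12 h13 h23
  rw [abs_neg] at b2
  have hAk : ∀ n, A ^ n * (4 * A * M) = 4 * (A ^ (n + 1) * M) := by intro n; ring
  rw [hAk] at b0 b1 b2
  have hs : ∀ n, 200 * (A ^ n * M) ≤ A ^ (n + 1) * M := by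
    intro n
    rw [pow_succ, mul_comm _ A, mul_assoc]; exact mul_le_mul_of_nonneg_right hA (by positivity)
  have s4 := hs 4; have s5 := hs 5; have s6 := hs 6
  have s40 : 0 ≤ A ^ 4 * M := by positivity
  norm_num at b0 b1 b2 s4 s5 s6
  have small : A ^ 3 * (θ * η) ≤ 1 / 2 := by
    have h3 : A ^ 3 * (θ * η) ≤ A ^ 3 * η := mul_le_mul_of_nonneg_left (by nlinarith) (by positivity)
    have h5 : A ^ 4 * η ≤ 1 := (mul_le_mul_of_nonneg_right (pow_le_pow_right₀ hA1 (by norm_num)) hη0.le).trans hAη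
    have h6 : 200 * (A ^ 3 * η) ≤ A ^ 4 * η := by
      have : A ^ 4 * η = A * (A ^ 3 * η) := by ring
      rw [this]; exact mul_le_mul_of_nonneg_right hA (by positivity)
    linarith
  have hn' := hn.mono small
  have hdet := k.det_eq
  have k00 := abs_le.1 hn'.h00
  have k11 := abs_le.1 hn'.h11
  have main : |k 0 0 - 1| ≤ 20 * (A ^ 6 * M) := by
    have e : (k 0 0 + 1) * (k 0 0 - 1) = k 0 1 * k 1 0 - k 0 0 * (k 1 1 - k 0 0) := by
      linear_combination hdet
    have t1 := abs_mul_le_mul b0 hn'.h10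
    have t2 := abs_mul_le_mul (show |k 0 0| ≤ 2 by rw [abs_le]; constructor <;> linarith) b1
    have t3 : |(k 0 0 + 1) * (k 0 0 - 1)| ≤ 20 * (A ^ 6 * M) := by
      rw [e]; exact (abs_sub _ _).trans (by linarith)
    rw [abs_mul] at t3
    have : 1 ≤ |k 0 0 + 1| := by rw [le_abs]; left; linarith
    nlinarith [abs_nonneg (k 0 0 - 1)]
  refine ⟨by linarith, by linarith, by linarith, ?_⟩
  have e : k 1 1 - 1 = (k 1 1 - k 0 0) + (k 0 0 - 1) := by ring
  rw [e]; exact (abs_add_le _ _).trans (by linarith)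

end pure
end

section
variable {Ω : Type*} [Fintype Ω] [Nonempty Ω] {A y η d d₁ d₂ d₃ : ℝ} {Λ κ : Ω → SLR}

lemma ScaleCtx.conj_near (H : ScaleCtx A y η Λ) (hd : |d| ≤ 2)
    (hbad : ∀ ω, Bad A (av y * uu d * Λ ω)) {a b : Ω}
    (hab : cell (Real.exp (-(2 * y)) * η) (av y * uu d * Λ a) =
      cell (Real.exp (-(2 * y)) * η) (av y * uu d * Λ b)) :
    ∃ (γ : SLZ) (F : SLR), Skew (4 * A * (Real.exp (-(2 * y)) * η)) (Real.exp (-(2 * y))) F ∧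
      Λ b * embZ γ = ((uu d)⁻¹ * F * uu d) * Λ a ∧ Near1 (A ^ 2 * η) ((uu d)⁻¹ * F * uu d) := by
  have hA := H.hA
  have hη0 := H.hη0
  have hθ1 : Real.exp (-(2 * y)) ≤ 1 := Real.exp_le_one_iff.2 (by linarith [H.hy])
  have hθ0 := Real.exp_pos (-(2 * y))
  obtain ⟨γ, F, hF, e⟩ := skew_of_cell_eq (hbad a) H.pow_le.1 (by positivity) hab
  refine ⟨γ, F, hF, e, ?_⟩
  have h1 : Near1 (4 * A * η) F := (hF.near hθ0 hθ1).mono (by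
    rw [div_le_iff₀ hθ0]; linarith)
  have h2 := h1.conj_uu (x := -d) (X := 2) (by rwa [abs_neg])
  rw [uu_neg, inv_inv] at h2
  refine h2.mono ?_
  have : 200 * (A * η) ≤ A * (A * η) := mul_le_mul_of_nonneg_right hA (by positivity)
  have : 0 < A * η := by positivity
  linarith

/-- The cell of a translate together with the cell of the base point. -/
noncomputable def pairCell (η' η y d : ℝ) (Λ : Ω → SLR) (ω : Ω) : (ℤ × ℤ × ℤ × ℤ) × (ℤ × ℤ × ℤ × ℤ) :=
  (cell η' (av y * uu d * Λ ω), cell η (Λ ω))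

lemma ScaleCtx.ent_pairCell_le (H : ScaleCtx A y η Λ) (hd : |d| ≤ 2)
    (hbad : ∀ ω, Bad A (av y * uu d * Λ ω)) :
    ent (pairCell (Real.exp (-(2 * y)) * η) η y d Λ) ≤
      ent (fun ω => cell (Real.exp (-(2 * y)) * η) (av y * uu d * Λ ω)) + kverr A := by
  have hA := H.hA
  have hη0 := H.hη0
  obtain ⟨hA1, h1, h2, -⟩ := H.pow_le
  have := ent_cell_le (f := fun ω => cell (Real.exp (-(2 * y)) * η) (av y * uu d * Λ ω)) (Ψ := Λ)
    (A := A) (ε := A ^ 2 * η) 3 (by linarith) hη0 (by positivity) (by linarith)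
    (mul_le_mul_of_nonneg_right (pow_le_pow_right₀ hA1 (by norm_num)) hη0.le)
    H.bad (fun a b hab => by
      obtain ⟨γ, F, -, e, hk⟩ := H.conj_near hd hbad hab
      exact ⟨γ, _, hk, e⟩)
  refine this.trans_eq ?_
  unfold kverr; norm_num

lemma ScaleCtx.conj_coord (H : ScaleCtx A y η Λ) (hd : |d| ≤ 2)
    (hbad : ∀ ω, Bad A (av y * uu d * Λ ω)) (hκ : ∀ ω, Near1 (4 * A * η) (κ ω))
    (hκ2 : ∀ a b, cell η (Λ a) = cell η (Λ b) → ∃ γ, Λ b * embZ γ = κ b * (κ a)⁻¹ * Λ a) {a b : Ω}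
    (hab : pairCell (Real.exp (-(2 * y)) * η) η y d Λ a = pairCell (Real.exp (-(2 * y)) * η) η y d Λ b) :
    ∃ F : SLR, Skew (4 * A * (Real.exp (-(2 * y)) * η)) (Real.exp (-(2 * y))) F ∧
      κ b = (uu d)⁻¹ * F * uu d * κ a := by
  obtain ⟨h1, h2⟩ := Prod.ext_iff.1 hab
  obtain ⟨γ, F, hF, e, hk⟩ := H.conj_near hd hbad h1
  exact ⟨F, hF, H.coord_eq hκ hκ2 h2 hk e⟩

/-- Small changes of three independent functionals force a small change of the coordinate. -/
lemma coord_near_of_functionals {S : ℝ} {κa κb : SLR} (hA : 200 ≤ A) (hS : 0 ≤ S)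
    (hsq : 64 * A ^ 2 * η ^ 2 ≤ A ^ 3 * S) (ha : Near1 (4 * A * η) κa) (hb : Near1 (4 * A * η) κb)
    (h1 : |mob κb d₁ d₂ - mob κa d₁ d₂| ≤ S) (h2 : |mob κb d₃ d₃ - mob κa d₃ d₃| ≤ S)
    (h3 : |(κb 0 0 + d₃ * κb 1 0) - (κa 0 0 + d₃ * κa 1 0)| ≤ S)
    (hd₁ : |d₁| ≤ 2) (hd₂ : |d₂| ≤ 2) (hd₃ : |d₃| ≤ 2)
    (h13 : 1 ≤ A * |d₁ - d₃|) (h23 : 1 ≤ A * |d₂ - d₃|) (i j : Fin 2) :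
    |κb i j - κa i j| ≤ A ^ 7 * S := by
  set E00 := κb 0 0 - κa 0 0 with hE00
  set E01 := κb 0 1 - κa 0 1 with hE01
  set E10 := κb 1 0 - κa 1 0 with hE10
  set E11 := κb 1 1 - κa 1 1 with hE11
  have big : ∀ {p q : ℝ}, |p| ≤ 4 * A * η → |q| ≤ 4 * A * η → |q - p| ≤ 8 * A * η := by
    intro p q hp hq; exact (abs_sub _ _).trans (by linarith)
  have g00 : |E00| ≤ 8 * A * η := by
    have := big ha.h00 hb.h00; rwa [sub_sub_sub_cancel_right] at this
  have g01 : |E01| ≤ 8 * A * η := big ha.h01 hb.h01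
  have g10 : |E10| ≤ 8 * A * η := big ha.h10 hb.h10
  have da := κa.det_eq
  have db := κb.det_eq
  have hT0' : 0 ≤ A ^ 3 * S := by positivity
  have htr : |E00 + E11| ≤ 3 * (A ^ 3 * S) := by
    have e : E00 + E11 = -((κb 1 1 - 1) * E00) - (κa 0 0 - 1) * E11 + κb 0 1 * E10 + κa 1 0 * E01 := by
      rw [hE00, hE01, hE10, hE11]; linear_combination db - da
    have g11 : |E11| ≤ 8 * A * η := by
      have := big ha.h11 hb.h11; rwa [sub_sub_sub_cancel_right] at this
    have t1 := abs_mul_le_mul hb.h11 g00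
    have t2 := abs_mul_le_mul ha.h00 g11
    have t3 := abs_mul_le_mul hb.h01 g10
    have t4 := abs_mul_le_mul ha.h10 g01
    have e4 : 4 * A * η * (8 * A * η) = (64 * A ^ 2 * η ^ 2) / 2 := by ring
    rw [e4] at t1 t2 t3 t4
    rw [e]
    refine (abs_add_le _ _).trans ?_
    have s1 := abs_add_le (-((κb 1 1 - 1) * E00) - (κa 0 0 - 1) * E11) (κb 0 1 * E10)
    have s2 := abs_sub (-((κb 1 1 - 1) * E00)) ((κa 0 0 - 1) * E11)
    rw [abs_neg] at s2
    linarith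
  set T := A ^ 3 * S with hT
  have hT0 : 0 ≤ T := by positivity
  have hST : S ≤ T := by
    have := one_le_pow₀ (by linarith : 1 ≤ A) (n := 3); nlinarith
  have f1 : |E01 + d₁ * E11 - d₂ * E00 - d₁ * d₂ * E10| ≤ T := by
    refine le_trans (le_of_eq ?_) (h1.trans hST)
    congr 1; unfold mob; rw [hE00, hE01, hE10, hE11]; ring
  have f2 : |E01 + d₃ * E11 - d₃ * E00 - d₃ * d₃ * E10| ≤ T := by
    refine le_trans (le_of_eq ?_) (h2.trans hST)
    congr 1; unfold mob; rw [hE00, hE01, hE10, hE11]; ring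
  have f3 : |E00 + d₃ * E10| ≤ T := by
    refine le_trans (le_of_eq ?_) (h3.trans hST)
    congr 1; rw [hE00, hE10]; ring
  have hd₁' : |d₁ - d₃| ≤ 4 := (abs_sub _ _).trans (by linarith)
  have hd₂' : |d₂ - d₃| ≤ 4 := (abs_sub _ _).trans (by linarith)
  have q10 : |(d₁ - d₃) * ((d₂ - d₃) * E10)| ≤ 22 * T := by
    have e : (d₁ - d₃) * ((d₂ - d₃) * E10) =
        (E01 + d₃ * E11 - d₃ * E00 - d₃ * d₃ * E10) - (E01 + d₁ * E11 - d₂ * E00 - d₁ * d₂ * E10) +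
        (d₁ - d₃) * (E00 + E11) - ((d₁ - d₃) + (d₂ - d₃)) * (E00 + d₃ * E10) := by ring
    have t1 := abs_mul_le_mul hd₁' htr
    have t2 := abs_mul_le_mul ((abs_add_le _ _).trans (add_le_add hd₁' hd₂')) f3
    rw [e]
    refine (abs_sub _ _).trans ?_
    have s1 := abs_add_le ((E01 + d₃ * E11 - d₃ * E00 - d₃ * d₃ * E10) -
      (E01 + d₁ * E11 - d₂ * E00 - d₁ * d₂ * E10)) ((d₁ - d₃) * (E00 + E11))
    have s2 := abs_sub (E01 + d₃ * E11 - d₃ * E00 - d₃ * d₃ * E10)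
      (E01 + d₁ * E11 - d₂ * E00 - d₁ * d₂ * E10)
    linarith
  have key : ∀ {x u z : ℝ}, 1 ≤ A * |u| → |u * x| ≤ z → |x| ≤ A * z := by
    intro x u z hu h
    rw [abs_mul] at h
    have := mul_le_mul_of_nonneg_left h (by linarith : 0 ≤ A)
    nlinarith [abs_nonneg x]
  have r10 := key h23 (key h13 q10)
  have m1 : 200 * T ≤ A * T := mul_le_mul_of_nonneg_right hA hT0
  have m2 : 200 * (A * T) ≤ A * (A * T) := mul_le_mul_of_nonneg_right hA (by positivity)
  have m3 : 200 * (A * (A * T)) ≤ A * (A * (A * T)) := mul_le_mul_of_nonneg_right hA (by positivity)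
  have r10' : |E10| ≤ 22 * (A * (A * T)) := by linarith
  have t3 := abs_mul_le_mul hd₃ r10'
  have r00 : |E00| ≤ 45 * (A * (A * T)) := by
    have e : E00 = (E00 + d₃ * E10) - d₃ * E10 := by ring
    rw [e]; exact (abs_sub _ _).trans (by linarith)
  have r11 : |E11| ≤ 46 * (A * (A * T)) := by
    have e : E11 = (E00 + E11) - E00 := by ring
    rw [e]; exact (abs_sub _ _).trans (by linarith)
  have r01 : |E01| ≤ 280 * (A * (A * T)) := by
    have e : E01 = (E01 + d₃ * E11 - d₃ * E00 - d₃ * d₃ * E10) - d₃ * (E11 - E00 - d₃ * E10) := by ring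
    have t4 : |E11 - E00 - d₃ * E10| ≤ 135 * (A * (A * T)) := by
      have s1 := abs_sub E11 E00
      exact (abs_sub _ _).trans (by linarith)
    have t5 := abs_mul_le_mul hd₃ t4
    rw [e]; exact (abs_sub _ _).trans (by linarith)
  have m4 : 200 * (A * (A * (A * T))) ≤ A * (A * (A * (A * T))) :=
    mul_le_mul_of_nonneg_right hA (by positivity)
  have e7 : A ^ 7 * S = A * (A * (A * (A * T))) := by rw [hT]; ring
  rw [e7]
  fin_cases i <;> fin_cases j
  · exact r00.trans (by linarith)
  · exact r01.trans (by linarith)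
  · exact r10'.trans (by linarith)
  · exact r11.trans (by linarith)

/-- Three unstable translates see the lattice ensemble at three scales. -/
lemma ScaleCtx.ent_triple_ge (H : ScaleCtx A y η Λ) (hd₁ : |d₁| ≤ 2) (hd₂ : |d₂| ≤ 2) (hd₃ : |d₃| ≤ 2)
    (h12 : 1 ≤ A * |d₁ - d₂|) (h13 : 1 ≤ A * |d₁ - d₃|) (h23 : 1 ≤ A * |d₂ - d₃|)
    (hb₁ : ∀ ω, Bad A (av y * uu d₁ * Λ ω)) (hb₂ : ∀ ω, Bad A (av y * uu d₂ * Λ ω))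
    (hb₃ : ∀ ω, Bad A (av y * uu d₃ * Λ ω)) :
    ent (fun ω => cell (Real.exp (-(2 * y)) * (Real.exp (-(2 * y)) * η)) (Λ ω)) +
      ent (fun ω => cell (Real.exp (-(2 * y)) * η) (Λ ω)) + ent (fun ω => cell η (Λ ω)) ≤
      ent (fun ω => cell (Real.exp (-(2 * y)) * η) (av y * uu d₁ * Λ ω)) +
      ent (fun ω => cell (Real.exp (-(2 * y)) * η) (av y * uu d₂ * Λ ω)) +
      ent (fun ω => cell (Real.exp (-(2 * y)) * η) (av y * uu d₃ * Λ ω)) + 13 * kverr A := by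
  obtain ⟨κ, hκ, hκ2⟩ := H.exists_coord
  obtain ⟨hA1, q1, q2, q3, q4, q5, q6, q7, q8⟩ := H.pow_le
  have hA := H.hA
  have hη0 := H.hη0
  have hηθ := H.hηθ
  have hη10 := H.hη
  have hθ1 : Real.exp (-(2 * y)) ≤ 1 := Real.exp_le_one_iff.2 (by linarith [H.hy])
  have p1 := H.ent_pairCell_le hd₁ hb₁
  have p2 := H.ent_pairCell_le hd₂ hb₂
  have p3 := H.ent_pairCell_le hd₃ hb₃
  have c1 := fun a b => H.conj_coord (a := a) (b := b) hd₁ hb₁ hκ hκ2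
  have c2 := fun a b => H.conj_coord (a := a) (b := b) hd₂ hb₂ hκ hκ2
  have c3 := fun a b => H.conj_coord (a := a) (b := b) hd₃ hb₃ hκ hκ2
  set θ := Real.exp (-(2 * y)) with hθ
  have hθ0 : 0 < θ := Real.exp_pos _
  have hn : θ * η ≤ η := by nlinarith
  have hn0 : 0 < θ * η := by positivity
  have hnn : θ * (θ * η) ≤ θ * η := by nlinarith
  have h4A : 4 * A * η ≤ 1 := by
    have : 200 * (A * η) ≤ A * (A * η) := mul_le_mul_of_nonneg_right hA (by positivity)
    have : 0 < A * η := by positivity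
    nlinarith
  have hlog : 0 ≤ Real.log A := Real.log_nonneg hA1
  set X1 := pairCell (θ * η) η y d₁ Λ with hX1
  set X2 := pairCell (θ * η) η y d₂ Λ with hX2
  set X3 := pairCell (θ * η) η y d₃ Λ with hX3
  set Z : Ω → _ := fun ω => cell η (Λ ω) with hZ
  have z1 : ∀ a b, X1 a = X1 b → Z a = Z b := fun a b h => (Prod.ext_iff.1 h).2
  have z3 : ∀ a b, X3 a = X3 b → Z a = Z b := fun a b h => (Prod.ext_iff.1 h).2
  set ψ : Ω → ℤ := fun ω => ⌊mob (κ ω) d₁ d₂ / (θ * η)⌋ with hψ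
  set P : Ω → ℤ := fun ω => ⌊mob (κ ω) d₃ d₃ / (θ * η)⌋ with hP
  set Q : Ω → ℤ := fun ω => ⌊(κ ω 0 0 + d₃ * κ ω 1 0) / (θ * η)⌋ with hQ
  have apow : ∀ m n : ℕ, m ≤ n → A ^ m * (θ * η) ≤ A ^ n * (θ * η) := fun m n h =>
    mul_le_mul_of_nonneg_right (pow_le_pow_right₀ hA1 h) hn0.le
  have a5 : 27 * (A ^ 3 * (θ * η)) ≤ A ^ 4 * (θ * η) := by
    have : 200 * (A ^ 3 * (θ * η)) ≤ A * (A ^ 3 * (θ * η)) := mul_le_mul_of_nonneg_right hA (by positivity)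
    have e : A ^ 4 * (θ * η) = A * (A ^ 3 * (θ * η)) := by ring
    have : 0 < A ^ 3 * (θ * η) := by positivity
    linarith
  have s1 : ent (fun ω => (X1 ω, ψ ω)) ≤ ent X1 + kverr A := by
    refine (ent_floor_le_pow (f := X1) (A := A) 4 (by linarith) hn0 ?_).trans ?_
    · intro a b hab
      obtain ⟨F, hF, e⟩ := c1 a b hab
      rw [abs_sub_comm]
      exact (mob_left hA hη0 hθ0 hθ1 h4A hF hd₁ hd₂ (hκ a) e).1.trans (apow _ _ (by norm_num))
    · unfold kverr; push_cast; linarith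
  have s2 : ent (fun ω => (X2 ω, ψ ω)) ≤ ent X2 + kverr A := by
    refine (ent_floor_le_pow (f := X2) (A := A) 4 (by linarith) hn0 ?_).trans ?_
    · intro a b hab
      obtain ⟨F, hF, e⟩ := c2 a b hab
      rw [abs_sub_comm]
      exact mob_right hA hη0 hθ0 hθ1 hηθ h4A hF hd₂ hd₁ (hκ a) e
    · unfold kverr; push_cast; linarith
  have s3 : ent (fun ω => ((X3 ω, P ω), Q ω)) ≤ ent X3 + 2 * kverr A := by
    have t1 := ent_floor_le_pow (f := X3) (Y := fun ω => mob (κ ω) d₃ d₃) (A := A) 4 (by linarith) hn0 (by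
      intro a b hab
      obtain ⟨F, hF, e⟩ := c3 a b hab
      rw [abs_sub_comm]
      exact (mob_left hA hη0 hθ0 hθ1 h4A hF hd₃ hd₃ (hκ a) e).1.trans (apow _ _ (by norm_num)))
    have t2 := ent_floor_le_pow (f := fun ω => (X3 ω, P ω)) (Y := fun ω => κ ω 0 0 + d₃ * κ ω 1 0)
      (A := A) 4 (by linarith) hn0 (by
      intro a b hab
      obtain ⟨F, hF, e⟩ := c3 a b (Prod.ext_iff.1 hab).1
      rw [abs_sub_comm]
      exact (mob_left hA hη0 hθ0 hθ1 h4A hF hd₃ hd₃ (hκ a) e).2.trans (apow _ _ (by norm_num)))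
    refine t2.trans ((add_le_add_left t1 _).trans ?_)
    unfold kverr; push_cast; linarith
  have s12 : ent (fun ω => (((X1 ω, X2 ω), P ω), Q ω)) ≤ ent (fun ω => (X1 ω, X2 ω)) + 2 * kverr A := by
    have hk : ∀ a b, (X1 a, X2 a) = (X1 b, X2 b) → ∀ i j, |κ b i j - κ a i j| ≤ 3 * (A ^ 3 * (θ * η)) := by
      intro a b hab
      obtain ⟨F, hF, e⟩ := c1 a b (Prod.ext_iff.1 hab).1
      obtain ⟨F', hF', e'⟩ := c2 a b (Prod.ext_iff.1 hab).2
      have hn := near_of_two hA hη0 hθ0 hθ1 hF hF' rfl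
        (mul_right_cancel (e.symm.trans e')) hd₁ h12
      exact left_mul_diff hn ((hκ a).mono h4A) e
    have t1 := ent_floor_le_pow (f := fun ω => (X1 ω, X2 ω)) (Y := fun ω => mob (κ ω) d₃ d₃) (A := A) 4
      (by linarith) hn0 (by
      intro a b hab
      rw [abs_sub_comm]
      exact (mob_diff_le (hk a b hab) hd₃ hd₃).trans (by linarith))
    have t2 := ent_floor_le_pow (f := fun ω => ((X1 ω, X2 ω), P ω)) (Y := fun ω => κ ω 0 0 + d₃ * κ ω 1 0)
      (A := A) 4 (by linarith) hn0 (by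
      intro a b hab
      have h := hk a b (Prod.ext_iff.1 hab).1
      rw [abs_sub_comm]
      have e : κ b 0 0 + d₃ * κ b 1 0 - (κ a 0 0 + d₃ * κ a 1 0) =
        (κ b 0 0 - κ a 0 0) + d₃ * (κ b 1 0 - κ a 1 0) := by ring
      rw [e]
      refine (abs_add_le _ _).trans ?_
      have := abs_mul_le_mul hd₃ (h 1 0)
      have := h 0 0
      have : 0 < A ^ 3 * (θ * η) := by positivity
      linarith)
    refine t2.trans ((add_le_add_left t1 _).trans ?_)
    unfold kverr; push_cast; linarith
  have m1 := ent_submod (f := fun ω => (X1 ω, ψ ω)) (g := fun ω => (X2 ω, ψ ω))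
    (k := fun ω => (X1 ω, X2 ω)) (h := fun ω => (Z ω, ψ ω))
    (by intro a b h1 h2; simp only [Prod.mk.injEq] at h1 h2 ⊢; exact ⟨h1.1, h2.1⟩)
    (by intro a b h1; simp only [Prod.mk.injEq] at h1 ⊢; exact ⟨z1 _ _ h1.1, h1.2⟩)
    (by intro a b h1; simp only [Prod.mk.injEq] at h1 ⊢; exact ⟨(Prod.ext_iff.1 h1.1).2, h1.2⟩)
  have m2 := ent_submod (f := fun ω => (((X1 ω, X2 ω), P ω), Q ω)) (g := fun ω => ((X3 ω, P ω), Q ω))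
    (k := fun ω => (X1 ω, X2 ω, X3 ω)) (h := fun ω => ((Z ω, P ω), Q ω))
    (by intro a b h1 h2; simp only [Prod.mk.injEq] at h1 h2 ⊢; exact ⟨h1.1.1.1, h1.1.1.2, h2.1.1⟩)
    (by intro a b h1; simp only [Prod.mk.injEq] at h1 ⊢; exact ⟨⟨z1 _ _ h1.1.1.1, h1.1.2⟩, h1.2⟩)
    (by intro a b h1; simp only [Prod.mk.injEq] at h1 ⊢; exact ⟨⟨z3 _ _ h1.1.1, h1.1.2⟩, h1.2⟩)
  have m3 := ent_submod (f := fun ω => (Z ω, ψ ω)) (g := fun ω => ((Z ω, P ω), Q ω))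
    (k := fun ω => (((Z ω, ψ ω), P ω), Q ω)) (h := Z)
    (by intro a b h1 h2; simp only [Prod.mk.injEq] at h1 h2 ⊢; exact ⟨⟨h1, h2.1.2⟩, h2.2⟩)
    (by intro a b h1; simp only [Prod.mk.injEq] at h1; exact h1.1)
    (by intro a b h1; simp only [Prod.mk.injEq] at h1; exact h1.1.1)
  have f1 : ent (fun ω => cell (θ * (θ * η)) (Λ ω)) ≤ ent (fun ω => (X1 ω, X2 ω, X3 ω)) + 2 * kverr A := by
    have hb7 : A ^ 7 * (θ * (θ * η)) ≤ 1 :=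
      (mul_le_mul_of_nonneg_left (hnn.trans hn) (by positivity)).trans q7
    have t := ent_cell_le (f := fun ω => (X1 ω, X2 ω, X3 ω)) (Ψ := Λ) (A := A)
      (ε := A ^ 7 * (θ * (θ * η))) 7 (by linarith) (by positivity : 0 < θ * (θ * η)) (by positivity) hb7 le_rfl
      H.bad (by
      intro a b hab
      simp only [Prod.mk.injEq] at hab
      obtain ⟨h1, h2, h3⟩ := hab
      obtain ⟨γ, G, -, eΛ, hk⟩ := H.conj_near hd₁ hb₁ (Prod.ext_iff.1 h1).1
      have e := H.coord_eq hκ hκ2 (z1 _ _ h1) hk eΛ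
      obtain ⟨F, hF, e1⟩ := c1 a b h1
      obtain ⟨F', hF', e'⟩ := c2 a b h2
      obtain ⟨F'', hF'', e''⟩ := c3 a b h3
      refine ⟨γ, _, near_of_three hA hη0 hθ0 hθ1 hη10 hF hF' hF'' (mul_right_cancel (e.symm.trans e1))
        (mul_right_cancel (e.symm.trans e')) (mul_right_cancel (e.symm.trans e'')) hd₁ hd₂ h12 h13 h23, eΛ⟩)
    refine ((ent_mono ?_).trans t).trans ?_
    · intro a b hab; exact (Prod.ext_iff.1 hab).2
    · unfold kverr; push_cast; linarith
  have f2 : ent (fun ω => cell (θ * η) (Λ ω)) ≤ ent (fun ω => (((Z ω, ψ ω), P ω), Q ω)) + 2 * kverr A := by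
    have hb8 : A ^ 8 * (θ * η) ≤ 1 :=
      (mul_le_mul_of_nonneg_left hn (by positivity)).trans q8
    have h48 : 4 * (A ^ 7 * (θ * η)) ≤ A ^ 8 * (θ * η) := by
      have : 200 * (A ^ 7 * (θ * η)) ≤ A * (A ^ 7 * (θ * η)) := mul_le_mul_of_nonneg_right hA (by positivity)
      have e : A ^ 8 * (θ * η) = A * (A ^ 7 * (θ * η)) := by ring
      have : 0 < A ^ 7 * (θ * η) := by positivity
      linarith
    have t := ent_cell_le (f := fun ω => (((Z ω, ψ ω), P ω), Q ω)) (Ψ := Λ) (A := A)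
      (ε := 4 * (A ^ 7 * (θ * η))) 8 (by linarith) hn0 (by positivity) (h48.trans hb8) h48
      H.bad (by
      intro a b hab
      simp only [Prod.mk.injEq] at hab
      obtain ⟨⟨⟨hz, r1⟩, r2⟩, r3⟩ := hab
      obtain ⟨γ, e⟩ := hκ2 a b hz
      have b1 := abs_sub_le_of_floor_eq hn0 r1
      have b2 := abs_sub_le_of_floor_eq hn0 r2
      have b3 := abs_sub_le_of_floor_eq hn0 r3
      rw [abs_sub_comm] at b1 b2 b3
      refine ⟨γ, _, near1_mul_inv ((hκ a).mono h4A) (coord_near_of_functionals hA hn0.le ?_ (hκ a) (hκ b)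
        b1 b2 b3 hd₁ hd₂ hd₃ h13 h23), e⟩
      have u1 : η * η ≤ θ * η := mul_le_mul_of_nonneg_right hηθ hη0.le
      have u2 : A ^ 2 * (η * η) ≤ A ^ 2 * (θ * η) := mul_le_mul_of_nonneg_left u1 (by positivity)
      have u3 : 200 * (A ^ 2 * (θ * η)) ≤ A * (A ^ 2 * (θ * η)) := mul_le_mul_of_nonneg_right hA (by positivity)
      have u4 : 0 < A ^ 2 * (θ * η) := by positivity
      have u5 : A ^ 3 * (θ * η) = A * (A ^ 2 * (θ * η)) := by ring
      have u6 : 64 * A ^ 2 * η ^ 2 = 64 * (A ^ 2 * (η * η)) := by ring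
      rw [u5, u6]; linarith)
    refine ((ent_mono ?_).trans t).trans ?_
    · intro a b hab; exact (Prod.ext_iff.1 hab).2
    · unfold kverr; push_cast; linarith
  linarith

end

/-! ### The ensemble of lattices indexed by words -/

/-- The translation `∑ w k * r ^ k` attached to a binary word. -/
noncomputable def xw (r : ℝ) {n : ℕ} (w : Fin n → Bool) : ℝ := bsum (fun k : Fin n => r ^ (k : ℕ)) w

/-- The flow time contracting by `r`. -/
noncomputable def al (r : ℝ) : ℝ := -Real.log r / 2

/-- The lattice attached to a binary word. -/
noncomputable def lat (r : ℝ) (g : SLR) {n : ℕ} (w : Fin n → Bool) : SLR :=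
  av (n * al r) * uu (xw r w) * g

/-- Entropy of the lattice attached to a uniform word of length `i`, at mesh `η`. -/
noncomputable def entL (r : ℝ) (g : SLR) (η : ℝ) (i : ℕ) : ℝ :=
  ent (fun w : Fin i → Bool => cell η (lat r g w))

/-- Translations by words with the first two digits deleted. -/
noncomputable def yw (r : ℝ) (l : ℕ) : (Fin l → Bool) → ℝ := bsum (fun k : Fin l => r ^ ((k : ℕ) + 2))

section
variable {r : ℝ} {g : SLR}

lemma exp_al (hr : 0 < r) (n : ℕ) : Real.exp (-(2 * (n * al r))) = r ^ n := by
  rw [show -(2 * (n * al r)) = n * Real.log r by unfold al; ring, Real.exp_nat_mul, Real.exp_log hr]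

lemma exp_al' (hr : 0 < r) (n : ℕ) : Real.exp (2 * (n * al r)) = (r ^ n)⁻¹ := by
  rw [← exp_al hr, Real.exp_neg, inv_inv]

lemma xw_append {i l : ℕ} (w : Fin i → Bool) (v : Fin l → Bool) :
    xw r (Fin.append w v) = xw r w + r ^ i * xw r v := by
  simp only [xw, bsum, Fin.sum_univ_add, Fin.append_left, Fin.append_right, Finset.mul_sum,
    Fin.val_castAdd, Fin.val_natAdd, pow_add, mul_ite, mul_zero]

lemma xw_cons {l : ℕ} (b : Bool) (v : Fin l → Bool) :
    xw r (Fin.cons b v : Fin (l + 1) → Bool) = (if b then 1 else 0) + r * xw r v := by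
  simp only [xw, bsum, Fin.sum_univ_succ, Fin.cons_zero, Fin.cons_succ, Finset.mul_sum,
    Fin.val_zero, Fin.val_succ, pow_succ, mul_ite, mul_zero, pow_zero]
  congr 1
  refine Finset.sum_congr rfl fun x _ => ?_
  rw [mul_comm]

lemma yw_eq {l : ℕ} (v : Fin l → Bool) : yw r l v = r ^ 2 * xw r v := by
  simp only [xw, yw, bsum, Finset.mul_sum, mul_ite, mul_zero]
  refine Finset.sum_congr rfl fun x _ => ?_
  rw [pow_add, mul_comm]

lemma lat_append (hr : 0 < r) {i l : ℕ} (w : Fin i → Bool) (v : Fin l → Bool) :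
    lat r g (Fin.append w v) = av (l * al r) * uu (xw r v) * lat r g w := by
  have h : uu (xw r v) * av (i * al r) = av (i * al r) * uu (r ^ i * xw r v) := by
    rw [av_mul_uu, exp_al' hr, inv_mul_cancel_left₀ (pow_pos hr i).ne']
  unfold lat
  rw [xw_append, add_comm (xw r w), uu_add]
  push_cast
  rw [add_comm (i : ℝ), add_mul, av_add]
  simp only [mul_assoc]
  rw [← mul_assoc (uu (xw r v)) (av (i * al r)), h]
  simp only [mul_assoc]

lemma sum_pow_le (hr : 0 < r) (hr4 : r ≤ 1 / 4) (n : ℕ) : ∑ k : Fin n, r ^ (k : ℕ) ≤ 4 / 3 := by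
  rw [Fin.sum_univ_eq_sum_range (fun k => r ^ k) n]
  have h := geom_sum_mul_neg r n
  have := pow_pos hr n
  nlinarith [Finset.sum_nonneg (fun k (_ : k ∈ Finset.range n) => (pow_pos hr k).le)]

lemma sum_abs_pow_le (hr : 0 < r) (hr4 : r ≤ 1 / 4) (n : ℕ) : ∑ k : Fin n, |r ^ (k : ℕ)| ≤ 4 / 3 := by
  simpa only [abs_of_pos (pow_pos hr _)] using sum_pow_le hr hr4 n

lemma bsum_nonneg {σ : Type*} [Fintype σ] {c : σ → ℝ} (hc : ∀ t, 0 ≤ c t) (ε : σ → Bool) :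
    0 ≤ bsum c ε := Finset.sum_nonneg fun t _ => by split_ifs <;> simp [hc]

lemma xw_nonneg (hr : 0 < r) {n : ℕ} (w : Fin n → Bool) : 0 ≤ xw r w :=
  bsum_nonneg (fun _ => (pow_pos hr _).le) w

lemma xw_le (hr : 0 < r) (hr4 : r ≤ 1 / 4) {n : ℕ} (w : Fin n → Bool) : xw r w ≤ 4 / 3 :=
  (le_abs_self _).trans ((abs_bsum_le _ _).trans (sum_abs_pow_le hr hr4 n))

lemma sum_abs_yw_le (hr : 0 < r) (hr4 : r ≤ 1 / 4) (l : ℕ) :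
    ∑ k : Fin l, |r ^ ((k : ℕ) + 2)| ≤ 2 := by
  have h := sum_abs_pow_le hr hr4 l
  simp_rw [pow_add, abs_mul]
  rw [← Finset.sum_mul, abs_of_pos (pow_pos hr 2)]
  have : r ^ 2 ≤ 1 := by nlinarith
  have h0 : 0 ≤ ∑ k : Fin l, |r ^ (k : ℕ)| := Finset.sum_nonneg fun _ _ => abs_nonneg _
  nlinarith [pow_pos hr 2]

/-- Words indexed up to length `N` give lattices without short vectors. -/
structure Ens (r a : ℝ) (g : SLR) (N : ℕ) : Prop where
  hr : 0 < r
  hr4 : r ≤ 1 / 4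
  ha : 200 ≤ a
  hra : r⁻¹ ≤ a
  bad : ∀ i ≤ N, ∀ w : Fin i → Bool, Bad a (lat r g w)

variable {a : ℝ} {N : ℕ}

lemma Ens.bad_uu (H : Ens r a g N) {i : ℕ} (hi : i ≤ N) {x : ℝ} (hx : |x| ≤ 2) (w : Fin i → Bool) :
    Bad (a ^ 2) (uu x * lat r g w) := by
  have ha := H.ha
  refine ((H.bad i hi w).uu_mul (by linarith) (X := 3) (by linarith)).mono (by linarith) ?_
  nlinarith

lemma Ens.bad_sq (H : Ens r a g N) {i : ℕ} (hi : i ≤ N) (w : Fin i → Bool) :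
    Bad (a ^ 2) (lat r g w) := by
  simpa [uu_zero] using H.bad_uu hi (x := 0) (by simp) w

lemma Ens.pow_le (H : Ens r a g N) {η : ℝ} (hη0 : 0 < η) (hη : (a ^ 2) ^ 10 * η ≤ 1) :
    200 ≤ a ^ 2 ∧ (a ^ 2) ^ 3 * η ≤ 1 ∧ η ≤ 1 := by
  have ha := H.ha
  have h2 : 200 ≤ a ^ 2 := by nlinarith
  have h1 : 1 ≤ a ^ 2 := by linarith
  have h3 : (a ^ 2) ^ 3 ≤ (a ^ 2) ^ 10 := pow_le_pow_right₀ h1 (by norm_num)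
  have h4 : 1 ≤ (a ^ 2) ^ 10 := one_le_pow₀ h1
  refine ⟨h2, ?_, ?_⟩ <;> nlinarith

lemma Ens.kv (H : Ens r a g N) {η : ℝ} (hη0 : 0 < η) (hη : (a ^ 2) ^ 10 * η ≤ 1) {i : ℕ} (hi : i ≤ N) :
    KVCtx (a ^ 2) 2 η (fun w : Fin i → Bool => lat r g w) := by
  obtain ⟨h1, h2, h3⟩ := H.pow_le hη0 hη
  exact ⟨by norm_num, by linarith, by linarith, hη0, h2, fun w x hx => H.bad_uu hi hx w⟩

lemma entL_add (hr : 0 < r) (η : ℝ) (i l : ℕ) : entL r g η (i + l) =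
    ent (fun x : (Fin l → Bool) × (Fin i → Bool) =>
      cell η (av (l * al r) * uu (xw r x.1) * lat r g x.2)) := by
  unfold entL
  rw [← ent_comp_equiv ((Equiv.prodComm _ _).trans (Fin.appendEquiv i l))]
  congr 1
  ext1 x
  simp only [Function.comp, Equiv.trans_apply, Equiv.prodComm_apply, Fin.appendEquiv, Equiv.coe_fn_mk,
    Prod.fst_swap, Prod.snd_swap]
  rw [lat_append hr]

/-- Condition on the first digit of the appended word. -/
lemma entL_add_succ_ge (hr : 0 < r) (η : ℝ) (i l : ℕ) (c : ℝ)
    (h : ∀ v : Fin l → Bool, c ≤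
      ent (fun w : Fin i → Bool => cell η (av ((l + 1 : ℕ) * al r) * uu (r * xw r v) * lat r g w)) +
      ent (fun w : Fin i → Bool => cell η (av ((l + 1 : ℕ) * al r) * uu (r * xw r v + 1) * lat r g w))) :
    c ≤ 2 * entL r g η (i + (l + 1)) := by
  rw [entL_add hr]
  set F : (Fin (l + 1) → Bool) × (Fin i → Bool) → ℤ × ℤ × ℤ × ℤ := fun x =>
    cell η (av ((l + 1 : ℕ) * al r) * uu (xw r x.1) * lat r g x.2) with hF
  rw [← ent_comp_equiv ((((Equiv.prodComm _ _).trans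
    (Fin.consEquiv (fun _ : Fin (l + 1) => Bool)))).prodCongr (Equiv.refl (Fin i → Bool))) F,
    ← ent_comp_equiv (Equiv.prodAssoc _ _ _).symm]
  have h1 := avg_ent_le_ent ((F ∘ ((((Equiv.prodComm _ _).trans
    (Fin.consEquiv (fun _ : Fin (l + 1) => Bool)))).prodCongr (Equiv.refl (Fin i → Bool)))) ∘
      (Equiv.prodAssoc (Fin l → Bool) Bool (Fin i → Bool)).symm)
  have h2 : ∀ v : Fin l → Bool, c / 2 ≤ ent (fun ω : Bool × (Fin i → Bool) => ((F ∘ ((((Equiv.prodComm _ _).trans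
    (Fin.consEquiv (fun _ : Fin (l + 1) => Bool)))).prodCongr (Equiv.refl (Fin i → Bool)))) ∘
      (Equiv.prodAssoc (Fin l → Bool) Bool (Fin i → Bool)).symm) (v, ω)) := by
    intro v
    refine le_trans ?_ (avg_ent_le_ent _)
    have h3 := h v
    simp only [Fintype.sum_bool, Fintype.card_bool, hF, Function.comp, Equiv.prodAssoc_symm_apply,
      Equiv.prodCongr_apply, Prod.map, Equiv.trans_apply, Equiv.prodComm_apply, Prod.swap, Equiv.refl_apply,
      Fin.consEquiv, Equiv.coe_fn_mk, xw_cons]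
    simp only [if_true, Bool.false_eq_true, if_false, zero_add]
    simp only [add_comm (1 : ℝ)]
    push_cast at h3 ⊢
    linarith
  have h4 : c / 2 ≤ _ := le_trans ?_ h1
  · linarith
  rw [le_div_iff₀ (by exact_mod_cast Fintype.card_pos)]
  refine le_trans (le_of_eq ?_) (Finset.sum_le_sum fun v _ => h2 v)
  simp [mul_comm]

end

section
variable {r a : ℝ} {g : SLR} {N : ℕ}

lemma av_uu_uu (y d e : ℝ) (M : SLR) : av y * uu d * (uu e * M) = av y * uu (d + e) * M := by
  rw [uu_add]; simp only [mul_assoc]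

/-- Condition on the first two digits of the appended word. -/
lemma entL_add_two_ge (hr : 0 < r) (η : ℝ) (i l : ℕ) {E : ℝ → ℝ}
    (hE : ∀ d, E d = ent (fun x : (Fin l → Bool) × (Fin i → Bool) =>
      cell η (av ((l + 2 : ℕ) * al r) * uu d * (uu (yw r l x.1) * lat r g x.2)))) :
    E 0 + E 1 + E r + E (1 + r) ≤ 4 * entL r g η (i + (l + 2)) := by
  rw [entL_add hr]
  set F : (Fin (l + 2) → Bool) × (Fin i → Bool) → ℤ × ℤ × ℤ × ℤ := fun x =>
    cell η (av ((l + 2 : ℕ) * al r) * uu (xw r x.1) * lat r g x.2) with hF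
  set e : (Bool × Bool) × (Fin l → Bool) ≃ (Fin (l + 2) → Bool) := (Equiv.prodAssoc _ _ _).trans
    (((Equiv.refl Bool).prodCongr (Fin.consEquiv (fun _ : Fin (l + 1) => Bool))).trans
      (Fin.consEquiv (fun _ : Fin (l + 2) => Bool))) with he
  rw [← ent_comp_equiv (e.prodCongr (Equiv.refl (Fin i → Bool))) F,
    ← ent_comp_equiv (Equiv.prodAssoc _ _ _).symm]
  have h1 := avg_ent_le_ent ((F ∘ (e.prodCongr (Equiv.refl (Fin i → Bool)))) ∘
      (Equiv.prodAssoc (Bool × Bool) (Fin l → Bool) (Fin i → Bool)).symm)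
  have h2 : ∀ b : Bool × Bool, ent (fun ω : (Fin l → Bool) × (Fin i → Bool) =>
      ((F ∘ (e.prodCongr (Equiv.refl (Fin i → Bool)))) ∘
      (Equiv.prodAssoc (Bool × Bool) (Fin l → Bool) (Fin i → Bool)).symm) (b, ω)) =
      E ((if b.1 then 1 else 0) + r * (if b.2 then 1 else 0)) := by
    intro b
    rw [hE]
    congr 1
    ext1 x
    simp only [hF, he, Function.comp, Equiv.prodAssoc_symm_apply,
      Equiv.prodCongr_apply, Prod.map, Equiv.trans_apply, Equiv.prodAssoc_apply, Equiv.refl_apply,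
      Fin.consEquiv, Equiv.coe_fn_mk, xw_cons, yw_eq]
    rw [av_uu_uu]
    congr 4
    ring
  simp only [h2, Fintype.sum_prod_type, Fintype.sum_bool, Fintype.card_prod, Fintype.card_bool] at h1
  simp only [if_true, Bool.false_eq_true, if_false, zero_add, mul_zero, mul_one, add_zero] at h1
  push_cast at h1
  linarith

lemma Ens.entL_triple (H : Ens r a g N) {i l : ℕ} (hi : i + (l + 2) ≤ N) {η : ℝ} (hη0 : 0 < η)
    (hη : (a ^ 2) ^ 10 * η ≤ 1) (hηl : η ≤ r ^ (l + 2)) :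
    entL r g (r ^ (l + 2) * (r ^ (l + 2) * η)) i + entL r g (r ^ (l + 2) * η) i + entL r g η i +
      growth (r ^ (l + 2) * (r ^ (l + 2) * η)) (fun w : Fin i → Bool => lat r g w) (yw r l) ≤
      3 * entL r g (r ^ (l + 2) * η) (i + (l + 2)) + 15 * kverr (a ^ 2) := by
  have hr := H.hr
  have hr4 := H.hr4
  have ha := H.ha
  obtain ⟨hA, -, -⟩ := H.pow_le hη0 hη
  have hra : 1 ≤ a * r := by
    have := H.hra
    rwa [inv_le_iff_one_le_mul₀ hr] at this
  have hθ0 : 0 < r ^ (l + 2) := pow_pos hr _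
  have hθ1 : r ^ (l + 2) ≤ 1 := pow_le_one₀ hr.le (by linarith)
  have hY : ∀ v : Fin l → Bool, |yw r l v| ≤ 2 := fun v => (abs_bsum_le _ _).trans (sum_abs_yw_le hr hr4 l)
  have HS : ScaleCtx (a ^ 2) ((l + 2 : ℕ) * al r) η (fun x : (Fin l → Bool) × (Fin i → Bool) =>
      uu (yw r l x.1) * lat r g x.2) := by
    refine ⟨hA, ?_, hη0, hη, by rwa [exp_al hr], fun x => H.bad_uu (by omega) (hY _) _⟩
    have : 0 ≤ al r := by
      unfold al
      have := Real.log_nonpos hr.le (by linarith)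
      linarith
    positivity
  have hb : ∀ b b' : Bool, ∀ x : (Fin l → Bool) × (Fin i → Bool), Bad (a ^ 2)
      (av ((l + 2 : ℕ) * al r) * uu ((if b then 1 else 0) + r * (if b' then 1 else 0)) *
        (uu (yw r l x.1) * lat r g x.2)) := by
    intro b b' x
    have h := H.bad_sq hi (Fin.append x.2 (Fin.cons b (Fin.cons b' x.1 : Fin (l + 1) → Bool) : Fin (l + 2) → Bool))
    rw [lat_append hr, xw_cons, xw_cons] at h
    rw [av_uu_uu, yw_eq]
    convert h using 4
    ring
  have b0 := hb false false
  have b1 := hb true false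
  have b2 := hb false true
  have b3 := hb true true
  simp only [if_true, Bool.false_eq_true, if_false, zero_add, mul_zero, mul_one, add_zero] at b0 b1 b2 b3
  have ar : 1 ≤ a ^ 2 * r := by nlinarith
  have t1 := HS.ent_triple_ge (d₁ := 0) (d₂ := 1) (d₃ := r) (by norm_num) (by norm_num)
    (by rw [abs_of_pos hr]; linarith) (by rw [show |(0 : ℝ) - 1| = 1 by norm_num]; linarith) (by rw [zero_sub, abs_neg, abs_of_pos hr]; exact ar)
    (by rw [abs_of_pos (by linarith : 0 < 1 - r)]; nlinarith) b0 b1 b2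
  have t2 := HS.ent_triple_ge (d₁ := 0) (d₂ := 1) (d₃ := 1 + r) (by norm_num) (by norm_num)
    (by rw [abs_of_pos (by linarith)]; linarith) (by rw [show |(0 : ℝ) - 1| = 1 by norm_num]; linarith)
    (by rw [zero_sub, abs_neg, abs_of_pos (by linarith)]; nlinarith)
    (by rw [show 1 - (1 + r) = -r by ring, abs_neg, abs_of_pos hr]; exact ar) b0 b1 b3
  have t3 := HS.ent_triple_ge (d₁ := 0) (d₂ := r) (d₃ := 1 + r) (by norm_num)
    (by rw [abs_of_pos hr]; linarith)
    (by rw [abs_of_pos (by linarith)]; linarith) (by rw [zero_sub, abs_neg, abs_of_pos hr]; exact ar)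
    (by rw [zero_sub, abs_neg, abs_of_pos (by linarith)]; nlinarith)
    (by rw [show r - (1 + r) = -1 by ring, abs_neg, abs_one]; linarith) b0 b2 b3
  have t4 := HS.ent_triple_ge (d₁ := 1) (d₂ := r) (d₃ := 1 + r) (by norm_num)
    (by rw [abs_of_pos hr]; linarith)
    (by rw [abs_of_pos (by linarith)]; linarith)
    (by rw [abs_of_pos (by linarith : 0 < 1 - r)]; nlinarith)
    (by rw [show 1 - (1 + r) = -r by ring, abs_neg, abs_of_pos hr]; exact ar)
    (by rw [show r - (1 + r) = -1 by ring, abs_neg, abs_one]; linarith) b1 b2 b3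
  have t0 := entL_add_two_ge (g := g) hr (r ^ (l + 2) * η) i l (fun d => rfl)
  rw [exp_al hr] at t1 t2 t3 t4
  have gr : ∀ η' : ℝ, ent (fun x : (Fin l → Bool) × (Fin i → Bool) => cell η' (uu (yw r l x.1) * lat r g x.2)) =
      entL r g η' i + growth η' (fun w : Fin i → Bool => lat r g w) (yw r l) := by
    intro η'
    unfold growth entL
    ring
  rw [gr, gr, gr] at t1 t2 t3 t4
  have gn : ∀ η' : ℝ, 0 < η' → η' ≤ η →
      -kverr (a ^ 2) ≤ growth η' (fun w : Fin i → Bool => lat r g w) (yw r l) := by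
    intro η' h0 h1
    refine (H.kv h0 (le_trans ?_ hη) (by omega)).growth_nonneg hY
    gcongr
  have g1 := gn η hη0 le_rfl
  have h2 : r ^ (l + 2) * η ≤ η := by nlinarith
  have g2 := gn (r ^ (l + 2) * η) (by positivity) h2
  linarith

lemma Ens.entL_pair (H : Ens r a g N) {i l : ℕ} (hi : i + (l + 1) ≤ N) {η ηm : ℝ} (hη0 : 0 < η)
    (hη : (a ^ 2) ^ 10 * η ≤ 1) (hηl : η ≤ r ^ (l + 1)) (hm0 : 0 < ηm)
    (hm : ηm ≤ r ^ (l + 1) * (r ^ (l + 1) * η)) {Ω₁ : Type*} [Fintype Ω₁] [Nonempty Ω₁] {V : Ω₁ → ℝ}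
    (hV : ∀ b, |V b| ≤ η)
    (hsep : ∀ b b', b ≠ b' → 4 * a ^ 2 * (r ^ (l + 1) * η) * r ^ (l + 1) < |V b - V b'|) :
    entL r g (r ^ (l + 1) * η) i + entL r g η i + 2 * Real.log (Fintype.card Ω₁) ≤
      2 * entL r g (r ^ (l + 1) * η) (i + (l + 1)) +
      2 * growth ηm (fun w : Fin i → Bool => lat r g w) V - (l + 1 : ℕ) * Real.log r + 12 * kverr (a ^ 2) := by
  have hr := H.hr
  have hr4 := H.hr4
  have ha := H.ha
  obtain ⟨hA, -, hη1⟩ := H.pow_le hη0 hη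
  have hθ0 : 0 < r ^ (l + 1) := pow_pos hr _
  have hθ1 : r ^ (l + 1) ≤ 1 := pow_le_one₀ hr.le (by linarith)
  have hal : 0 ≤ al r := by
    unfold al
    have := Real.log_nonpos hr.le (by linarith)
    linarith
  have HS : ScaleCtx (a ^ 2) ((l + 1 : ℕ) * al r) η (fun w : Fin i → Bool => lat r g w) :=
    ⟨hA, by positivity, hη0, hη, by rwa [exp_al hr], fun x => H.bad_sq (by omega) _⟩
  have hmη : ηm ≤ η := hm.trans (by
    have := mul_le_of_le_one_left hη0.le hθ1
    exact (mul_le_of_le_one_left (by positivity) hθ1).trans this)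
  have HK := H.kv hm0 (le_trans (by gcongr) hη) (by omega : i ≤ N)
  have hb : ∀ (b : Bool) (v : Fin l → Bool) (w : Fin i → Bool) (x : ℝ),
      |x - ((if b then 1 else 0) + r * xw r v)| ≤ r ^ (l + 1) →
      Bad (a ^ 2) (av ((l + 1 : ℕ) * al r) * uu x * lat r g w) := by
    intro b v w x hx
    have h := H.bad_uu hi (x := (r ^ (l + 1))⁻¹ * (x - ((if b then 1 else 0) + r * xw r v))) (by
      rw [abs_mul, abs_of_pos (inv_pos.2 hθ0)]
      calc _ ≤ (r ^ (l + 1))⁻¹ * r ^ (l + 1) := by gcongr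
        _ = 1 := inv_mul_cancel₀ hθ0.ne'
        _ ≤ 2 := by norm_num) (Fin.append w (Fin.cons b v : Fin (l + 1) → Bool))
    rw [lat_append hr, xw_cons] at h
    convert h using 1
    rw [← exp_al' hr, ← mul_assoc, ← mul_assoc, ← av_mul_uu, 
      mul_assoc _ (uu ((if b then (1 : ℝ) else 0) + r * xw r v)) (lat r g w), av_uu_uu]
    congr 3
    ring
  refine (entL_add_succ_ge (g := g) hr (r ^ (l + 1) * η) i l (entL r g (r ^ (l + 1) * η) i + entL r g η i +
    2 * Real.log (Fintype.card Ω₁) - 2 * growth ηm (fun w : Fin i → Bool => lat r g w) V +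
      (l + 1 : ℕ) * Real.log r - 12 * kverr (a ^ 2)) fun v => ?_) |> fun h => by linarith
  have hx0 := xw_nonneg hr v
  have hx1 := xw_le hr hr4 v
  have key := HS.ent_pair_ge HK (d := r * xw r v) (V := V) (by rwa [exp_al hr])
    (by rw [abs_of_nonneg (by positivity)]; nlinarith)
    (fun w x hx => hb false v w x (by
      rw [exp_al hr] at hx
      simpa using hx))
    (fun w x hx => hb true v w x (by
      rw [exp_al hr] at hx
      simpa [add_comm] using hx)) hV (fun b => (hV b).trans (by linarith))
    (by rw [exp_al hr]; exact hsep)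
  rw [exp_al hr] at key
  have : 2 * (((l + 1 : ℕ) : ℝ) * al r) = -((l + 1 : ℕ) * Real.log r) := by unfold al; ring
  unfold entL
  linarith

/-- The number of cells is bounded. -/
lemma Ens.entL_le (H : Ens r a g N) {i : ℕ} (hi : i ≤ N) {η : ℝ} (hη0 : 0 < η) (hη : η ≤ 1) :
    entL r g η i ≤ 4 * Real.log (a ^ 2 / η) := by
  have ha := H.ha
  have hbnd : ∀ w : Fin i → Bool, ∀ j k : Fin 2,
      ⌊(red (lat r g w)) j k / η⌋ ∈ Finset.Icc (-⌈2 * a / η⌉) (⌈2 * a / η⌉) := by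
    intro w j k
    have h := abs_le.1 ((H.bad i hi w).abs_red_le (by linarith) j k)
    have h1 : -(2 * a / η) ≤ red (lat r g w) j k / η := by
      rw [← neg_div]; gcongr; exact h.1
    have h2 : red (lat r g w) j k / η ≤ 2 * a / η := by gcongr; exact h.2
    have h3 := Int.le_ceil (2 * a / η)
    rw [Finset.mem_Icc]
    refine ⟨Int.le_floor.2 (by push_cast; linarith), ?_⟩
    exact Int.cast_le.1 (((Int.floor_le _).trans (h2.trans h3)) : (_ : ℝ) ≤ _)
  set S := Finset.Icc (-⌈2 * a / η⌉) (⌈2 * a / η⌉) with hS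
  have hpos : 0 < 2 * a / η := by positivity
  have hc : (1 : ℤ) ≤ ⌈2 * a / η⌉ := Int.one_le_ceil_iff.2 hpos
  have hcard : (S.card : ℝ) ≤ a ^ 2 / η := by
    rw [hS, Int.card_Icc]
    have e : (((⌈2 * a / η⌉ + 1 - -⌈2 * a / η⌉).toNat : ℕ) : ℝ) = 2 * ⌈2 * a / η⌉ + 1 := by
      have : (((⌈2 * a / η⌉ + 1 - -⌈2 * a / η⌉).toNat : ℕ) : ℤ) = 2 * ⌈2 * a / η⌉ + 1 := by
        rw [Int.toNat_of_nonneg (by omega)]; ring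
      exact_mod_cast this
    rw [e]
    have h4 := Int.ceil_lt_add_one (2 * a / η)
    have h5 : 1 ≤ 1 / η := by rw [le_div_iff₀ hη0]; linarith
    have h6 : a ^ 2 / η = a ^ 2 * (1 / η) := by ring
    have h7 : 2 * a / η = 2 * a * (1 / η) := by ring
    rw [h6]
    rw [h7] at h4 ⊢
    nlinarith
  have hne : (-⌈2 * a / η⌉) ∈ S := by rw [hS, Finset.mem_Icc]; omega
  have hS0 : 0 < S.card := Finset.card_pos.2 ⟨_, hne⟩
  have := ent_le_log_of_encard_range_le (f := fun w : Fin i → Bool => cell η (lat r g w))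
    (N := S.card ^ 4) (by positivity) (by
      calc _ ≤ ((S ×ˢ S ×ˢ S ×ˢ S : Finset (ℤ × ℤ × ℤ × ℤ)) : Set (ℤ × ℤ × ℤ × ℤ)).encard := by
            refine Set.encard_le_encard ?_
            rintro _ ⟨w, rfl⟩
            simp only [cell, Finset.coe_product, Set.mem_prod, Finset.mem_coe]
            exact ⟨hbnd w 0 0, hbnd w 0 1, hbnd w 1 0, hbnd w 1 1⟩
        _ = _ := by
            rw [Set.encard_coe_eq_coe_finsetCard]
            simp only [Finset.card_product]
            norm_cast
            ring)
  refine this.trans ?_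
  push_cast
  rw [Real.log_pow]
  push_cast
  gcongr

/-- Refining the mesh increases the entropy. -/
lemma Ens.entL_mono (H : Ens r a g N) {i : ℕ} (hi : i ≤ N) {η η' : ℝ} (hη0 : 0 < η') (hη : η' ≤ η)
    (hη1 : (a ^ 2) ^ 10 * η ≤ 1) : entL r g η i ≤ entL r g η' i + kverr (a ^ 2) := by
  obtain ⟨hA, h2, h3⟩ := H.pow_le (hη0.trans_le hη) hη1
  have hη0' := hη0.trans_le hη
  have h4 : 4 * a ^ 2 * η' ≤ (a ^ 2) ^ 2 * η := by
    calc 4 * a ^ 2 * η' ≤ 4 * a ^ 2 * η := by gcongr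
      _ ≤ (a ^ 2) ^ 2 * η := by gcongr; nlinarith
  have h5 : (a ^ 2) ^ 2 * η ≤ (a ^ 2) ^ 3 * η := by
    gcongr
    · linarith
    · norm_num
  have := ent_cell_le (f := fun w : Fin i → Bool => cell η' (lat r g w)) (Ψ := fun w : Fin i → Bool => lat r g w)
    (A := a ^ 2) (ε := 4 * a ^ 2 * η') (η := η) 2 (by linarith) hη0' (by positivity) (by linarith) h4
    (fun w => H.bad_sq hi w) (fun w w' h => near_of_cell_eq (H.bad_sq hi w) (by linarith) hη0 h)
  have h6 : entL r g η i ≤ ent (fun w : Fin i → Bool => (cell η' (lat r g w), cell η (lat r g w))) :=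
    ent_mono (by intro w w' h; exact (Prod.ext_iff.1 h).2)
  have hl := Real.log_nonneg (by linarith : (1 : ℝ) ≤ a ^ 2)
  unfold kverr
  rw [show (40 : ℝ) + 4 * (2 : ℕ) = 48 by norm_num] at this
  have h7 : entL r g η' i = ent (fun w : Fin i → Bool => cell η' (lat r g w)) := rfl
  linarith

end

section
variable {r a : ℝ} {g : SLR} {N : ℕ}

lemma sum_digits_le (hr : 0 < r) (hr4 : r ≤ 1 / 4) {p τ k0 B : ℕ} (hB : 1 ≤ B) :
    ∑ x : Fin p × Fin (τ + 1), |(2 : ℝ) ^ (x.1 : ℕ) * (r ^ k0 * (r ^ B) ^ (x.2 : ℕ))| ≤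
      2 * 2 ^ p * r ^ k0 := by
  have hrB : 0 < r ^ B := pow_pos hr B
  have hrB4 : r ^ B ≤ 1 / 4 := (pow_le_of_le_one hr.le (by linarith) (by omega)).trans hr4
  have h1 := sum_pow_le hrB hrB4 (τ + 1)
  have h2 : ∑ x : Fin p, (2 : ℝ) ^ (x : ℕ) ≤ 2 ^ p := by
    rw [Fin.sum_univ_eq_sum_range (fun k => (2 : ℝ) ^ k) p, geom_sum_eq (by norm_num)]
    norm_num
  have e : ∀ x : Fin p × Fin (τ + 1), |(2 : ℝ) ^ (x.1 : ℕ) * (r ^ k0 * (r ^ B) ^ (x.2 : ℕ))| =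
      (2 : ℝ) ^ (x.1 : ℕ) * (r ^ k0 * (r ^ B) ^ (x.2 : ℕ)) := fun x => abs_of_pos (by positivity)
  simp_rw [e, Fintype.sum_prod_type, ← Finset.mul_sum]
  rw [← Finset.sum_mul]
  have h3 : 0 ≤ ∑ x : Fin p, (2 : ℝ) ^ (x : ℕ) := Finset.sum_nonneg fun _ _ => by positivity
  calc _ ≤ (2 : ℝ) ^ p * (r ^ k0 * (4 / 3)) := by gcongr
    _ ≤ _ := by nlinarith [mul_pos (pow_pos (by norm_num : (0 : ℝ) < 2) p) (pow_pos hr k0)]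

lemma Ens.growth_digits (H : Ens r a g N) {i : ℕ} (hi : i ≤ N) {ηm : ℝ} (hη0 : 0 < ηm)
    (hη : (a ^ 2) ^ 10 * ηm ≤ 1) {p τ k0 B l : ℕ} (hp : 0 < p) (hB : 1 ≤ B) (hk0 : 2 ≤ k0)
    (hl : k0 + B * τ < l + 2) (hs : 2 * 2 ^ p * r ^ k0 ≤ 1) :
    growth ηm (fun w : Fin i → Bool => lat r g w) (bsum fun x : Fin p × Fin (τ + 1) =>
        (2 : ℝ) ^ (x.1 : ℕ) * (r ^ k0 * (r ^ B) ^ (x.2 : ℕ))) ≤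
      4 ^ p * (growth ηm (fun w : Fin i → Bool => lat r g w) (yw r l) + 5 * kverr (a ^ 2)) := by
  have hr := H.hr
  have hr4 := H.hr4
  have HK := H.kv hη0 hη hi
  have h1 := HK.growth_bsum_digits hp (fun t : Fin (τ + 1) => r ^ k0 * (r ^ B) ^ (t : ℕ))
    ((sum_digits_le hr hr4 hB).trans (by linarith))
  have hj : ∀ t : Fin (τ + 1), k0 + B * t - 2 < l := fun t => by
    have : B * t ≤ B * τ := Nat.mul_le_mul_left _ (by omega)
    omega
  have h2 := HK.growth_bsum_comp_le (sum_abs_yw_le hr hr4 l) (fun t : Fin (τ + 1) => (⟨_, hj t⟩ : Fin l)) (by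
    intro t t' h
    simp only [Fin.mk.injEq] at h
    have : B * (t : ℕ) = B * t' := by omega
    exact Fin.ext (Nat.eq_of_mul_eq_mul_left (by omega) this))
  have e : ((fun k : Fin l => r ^ ((k : ℕ) + 2)) ∘ fun t : Fin (τ + 1) => (⟨_, hj t⟩ : Fin l)) =
      fun t : Fin (τ + 1) => r ^ k0 * (r ^ B) ^ (t : ℕ) := by
    ext1 t
    simp only [Function.comp]
    rw [← pow_mul, ← pow_add]
    congr 1
    omega
  rw [e] at h2
  refine h1.trans (mul_le_mul_of_nonneg_left ?_ (by positivity))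
  unfold yw
  linarith

/-- The base mesh. -/
noncomputable def mesh (a : ℝ) : ℝ := ((a ^ 2) ^ 10)⁻¹

lemma Ens.mesh_pos (H : Ens r a g N) : 0 < mesh a := by
  have := H.ha
  unfold mesh; positivity

lemma Ens.mesh_le (H : Ens r a g N) (n : ℕ) : 0 < r ^ n * mesh a ∧ (a ^ 2) ^ 10 * (r ^ n * mesh a) ≤ 1 := by
  have ha := H.ha
  have hm := H.mesh_pos
  have hr := H.hr
  have h1 : r ^ n ≤ 1 := pow_le_one₀ hr.le (by linarith [H.hr4])
  refine ⟨by positivity, ?_⟩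
  rw [mul_left_comm]
  unfold mesh
  rw [mul_inv_cancel₀ (by positivity)]
  linarith

lemma Ens.triple_units (H : Ens r a g N) {lam q t k : ℕ} (hq : 2 ≤ q * lam) (hk : 1 ≤ k)
    (ht : (t + q) * lam ≤ N) :
    entL r g (r ^ ((k + 2) * q * lam) * mesh a) (t * lam) + entL r g (r ^ ((k + 1) * q * lam) * mesh a) (t * lam) +
      entL r g (r ^ (k * q * lam) * mesh a) (t * lam) +
      growth (r ^ ((k + 2) * q * lam) * mesh a) (fun w : Fin (t * lam) → Bool => lat r g w)
        (yw r (q * lam - 2)) ≤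
    3 * entL r g (r ^ ((k + 1) * q * lam) * mesh a) ((t + q) * lam) + 15 * kverr (a ^ 2) := by
  have hr := H.hr
  obtain ⟨h1, h2⟩ := H.mesh_le (k * q * lam)
  obtain ⟨l, hl⟩ : ∃ l, q * lam = l + 2 := ⟨q * lam - 2, by omega⟩
  have key := H.entL_triple (i := t * lam) (l := l) (by rw [← hl, ← add_mul]; exact ht) h1 h2 (by
    have hm : mesh a ≤ 1 := by
      have := H.mesh_le 0
      simpa using (H.pow_le this.1 this.2).2.2
    have h3 : r ^ (k * q * lam) ≤ r ^ (l + 2) := by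
      rw [← hl]
      refine pow_le_pow_of_le_one hr.le (by linarith [H.hr4]) ?_
      rw [mul_assoc]
      exact Nat.le_mul_of_pos_left _ hk
    exact (mul_le_of_le_one_right (by positivity) hm).trans h3)
  rw [← hl] at key
  have e1 : r ^ (q * lam) * (r ^ (k * q * lam) * mesh a) = r ^ ((k + 1) * q * lam) * mesh a := by
    rw [← mul_assoc, ← pow_add]; congr 2; ring
  have e2 : r ^ (q * lam) * (r ^ ((k + 1) * q * lam) * mesh a) = r ^ ((k + 2) * q * lam) * mesh a := by
    rw [← mul_assoc, ← pow_add]; congr 2; ring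
  rw [e1, e2, ← add_mul] at key
  have e3 : q * lam - 2 = l := by omega
  rw [e3]
  exact key

lemma Ens.pair_units (H : Ens r a g N) {lam q t k j p τ κ B : ℕ} (hlam : 1 ≤ lam) (hk : 1 ≤ k) (hj : 1 ≤ j)
    (hjq : j + 2 ≤ q) (hp : 0 < p) (hB : 1 ≤ B) (hκ : 2 ≤ κ) (hpB : 2 ^ p * r ^ B ≤ 1)
    (hκη : 2 * 2 ^ p * r ^ κ ≤ mesh a) (hτ : κ + B * τ < 2 * lam) (ht : (t + 1) * lam ≤ N) :
    entL r g (r ^ ((j + 1) * lam) * mesh a) (t * lam) + entL r g (r ^ (j * lam) * mesh a) (t * lam) +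
      2 * (p * (τ + 1) * Real.log 2) ≤
    2 * entL r g (r ^ ((j + 1) * lam) * mesh a) ((t + 1) * lam) +
      2 * (4 ^ p * (growth (r ^ (k * q * lam) * mesh a) (fun w : Fin (t * lam) → Bool => lat r g w)
        (yw r (q * lam - 2)) + 5 * kverr (a ^ 2))) - lam * Real.log r + 12 * kverr (a ^ 2) := by
  have hr := H.hr
  have hr4 := H.hr4
  have ha := H.ha
  have hm0 := H.mesh_pos
  obtain ⟨h1, h2⟩ := H.mesh_le (j * lam)
  obtain ⟨h3, h4⟩ := H.mesh_le (k * q * lam)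
  have hm1 : mesh a ≤ 1 := by
    have := H.mesh_le 0
    simpa using (H.pow_le this.1 this.2).2.2
  obtain ⟨l, hl⟩ : ∃ l, lam = l + 1 := ⟨lam - 1, by omega⟩
  have hmono : ∀ m n : ℕ, m ≤ n → r ^ n ≤ r ^ m := fun m n h => pow_le_pow_of_le_one hr.le (by linarith) h
  have hjl : (j + 2) * lam ≤ q * lam := Nat.mul_le_mul_right _ hjq
  have hqk : q * lam ≤ k * q * lam := by
    rw [mul_assoc]
    exact Nat.le_mul_of_pos_left _ hk
  have hκ0 : 2 * 2 ^ p * r ^ (j * lam + κ) ≤ r ^ (j * lam) * mesh a := by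
    rw [pow_add, mul_left_comm]
    gcongr
  have hdig := H.growth_digits (i := t * lam) (by nlinarith) h3 h4 (l := q * lam - 2) (k0 := j * lam + κ) (τ := τ) hp hB
    (by omega) (by
      have : q * lam - 2 + 2 = q * lam := by
        have : 2 * 1 ≤ q * lam := Nat.mul_le_mul (by omega) hlam
        omega
      rw [this]
      refine lt_of_lt_of_le ?_ hjl
      rw [add_mul]
      omega) (hκ0.trans (mul_le_one₀ (pow_le_one₀ hr.le (by linarith)) hm0.le hm1))
  have key := H.entL_pair (i := t * lam) (l := l) (η := r ^ (j * lam) * mesh a) (ηm := r ^ (k * q * lam) * mesh a)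
    (V := bsum fun x : Fin p × Fin (τ + 1) => (2 : ℝ) ^ (x.1 : ℕ) * (r ^ (j * lam + κ) * (r ^ B) ^ (x.2 : ℕ)))
    (by rw [← hl]; convert ht using 1; ring) h1 h2 (by
      rw [← hl]
      refine (mul_le_of_le_one_right (by positivity) hm1).trans (hmono _ _ ?_)
      exact Nat.le_mul_of_pos_left _ hj) h3 (by
      rw [← hl, ← mul_assoc, ← mul_assoc, ← pow_add, ← pow_add]
      refine mul_le_mul_of_nonneg_right (hmono _ _ (le_trans (le_of_eq ?_) (hjl.trans hqk))) hm0.le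
      ring)
    (fun b => (abs_bsum_le _ _).trans ((sum_digits_le hr hr4 hB).trans hκ0)) (by
      intro b b' hbb
      have hs := bsum_digits_sep (p := p) (τ := τ) (Q := (r ^ B)⁻¹) (a := r ^ (j * lam + κ)) (by
        rw [le_inv_comm₀ (by positivity) (by positivity), le_inv_comm₀ (by positivity) (by positivity)]
        rw [← one_div, le_div_iff₀ (by positivity)]
        exact hpB) (by positivity) hbb
      simp only [inv_inv] at hs
      refine lt_of_lt_of_le ?_ hs
      rw [← hl, ← pow_mul, ← pow_add]
      have e1 : 4 * a ^ 2 * (r ^ lam * (r ^ (j * lam) * mesh a)) * r ^ lam =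
          r ^ ((j + 2) * lam) * (4 * a ^ 2 * mesh a) := by
        rw [show (j + 2) * lam = lam + j * lam + lam by ring, pow_add, pow_add]; ring
      rw [e1]
      have h5 : 4 * a ^ 2 * mesh a < 1 := by
        unfold mesh
        rw [← div_eq_mul_inv, div_lt_one (by positivity)]
        have h7 : 200 ≤ a ^ 2 := by nlinarith
        have h6 : 4 * a ^ 2 < (a ^ 2) ^ 2 := by nlinarith
        exact h6.trans_le (pow_le_pow_right₀ (by nlinarith) (by norm_num))
      calc r ^ ((j + 2) * lam) * (4 * a ^ 2 * mesh a) < r ^ ((j + 2) * lam) * 1 := by gcongr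
        _ ≤ _ := by
          rw [mul_one]
          refine hmono _ _ ?_
          rw [add_mul]
          omega)
  rw [← hl] at key
  have e1 : r ^ lam * (r ^ (j * lam) * mesh a) = r ^ ((j + 1) * lam) * mesh a := by
    rw [← mul_assoc, ← pow_add]; congr 2; ring
  have e2 : t * lam + lam = (t + 1) * lam := by ring
  have e3 : Real.log (Fintype.card (Fin p × Fin (τ + 1) → Bool)) = p * (τ + 1) * Real.log 2 := by
    simp only [Fintype.card_pi, Fintype.card_bool, Finset.prod_const, Finset.card_univ, Fintype.card_prod,
      Fintype.card_fin]
    push_cast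
    rw [Real.log_pow]
    push_cast
    ring
  rw [e1, e2, e3] at key
  linarith

end

/-- Telescoping of the two families of entropy inequalities. -/
lemma exists_large_entropy {D G : ℕ → ℕ → ℝ} {q M N : ℕ} {e W E F Dmax D2 : ℝ} (hq : 3 ≤ q) (hM : 1 ≤ M)
    (hN : 1 ≤ N) (hE : 0 ≤ E)
    (h1 : ∀ t < N, ∀ k, 1 ≤ k → k ≤ M → D t ((k + 2) * q) + D t ((k + 1) * q) + D t (k * q) + G t (k + 2) ≤
      3 * D (t + q) ((k + 1) * q) + 15 * e)
    (h2 : ∀ t < N, ∀ j k, 1 ≤ j → j + 2 ≤ q → 3 ≤ k → D t (j + 1) + D t j + W ≤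
      2 * D (t + 1) (j + 1) + E * G t k + F)
    (h0 : ∀ t < N + q, ∀ k, 0 ≤ D t k)
    (h3 : ∀ t < N + q, ∀ k ≤ (M + 2) * q, D t k ≤ Dmax) (h4 : ∀ t < N, D t (2 * q) ≤ D2)
    (h5 : ∀ t < N, D t ((M + 1) * q) ≤ D t ((M + 2) * q) + e) :
    ∃ t < N, (q - 2) * (W - F - 2 * Dmax / N - E * ((D2 + e) / M + 15 * e + 3 * q * Dmax / N)) ≤ D t (q - 1) := by
  have hN0 : (0 : ℝ) < N := by exact_mod_cast hN
  have hM0 : (0 : ℝ) < M := by exact_mod_cast hM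
  set f : ℕ → ℝ := fun k => ∑ t ∈ Finset.range N, D t k with hf
  set G' : ℕ → ℝ := fun k => ∑ t ∈ Finset.range N, G t k with hG'
  have shift : ∀ m ≤ q, ∀ k ≤ (M + 2) * q, ∑ t ∈ Finset.range N, D (t + m) k ≤ f k + m * Dmax := by
    intro m hm k hk
    have e1 : ∑ t ∈ Finset.range (N + m), D t k = ∑ t ∈ Finset.range m, D t k + ∑ t ∈ Finset.range N, D (t + m) k := by
      rw [add_comm N m, Finset.sum_range_add]
      simp only [add_comm m]
    have e2 : ∑ t ∈ Finset.range (N + m), D t k = f k + ∑ t ∈ Finset.range m, D (N + t) k := by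
      rw [Finset.sum_range_add]
    have e3 : 0 ≤ ∑ t ∈ Finset.range m, D t k := Finset.sum_nonneg fun t ht => h0 t (by
      have := Finset.mem_range.1 ht; omega) k
    have e4 : ∑ t ∈ Finset.range m, D (N + t) k ≤ m * Dmax := by
      calc _ ≤ ∑ t ∈ Finset.range m, Dmax := Finset.sum_le_sum fun t ht => h3 _ (by
            have := Finset.mem_range.1 ht; omega) k hk
        _ = _ := by simp
    linarith
  have f0 : ∀ k, 0 ≤ f k := fun k => Finset.sum_nonneg fun t ht => h0 t (by
      have := Finset.mem_range.1 ht; omega) k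
  set c := 3 * q * Dmax + 15 * e * N with hc
  have step : ∀ k, 1 ≤ k → k ≤ M → (f ((k + 2) * q) - f ((k + 1) * q)) + G' (k + 2) ≤
      (f ((k + 1) * q) - f (k * q)) + c := by
    intro k hk hkM
    have h := Finset.sum_le_sum fun t (ht : t ∈ Finset.range N) => h1 t (Finset.mem_range.1 ht) k hk hkM
    simp only [Finset.sum_add_distrib, ← Finset.mul_sum, Finset.sum_const, Finset.card_range, nsmul_eq_mul] at h
    have h' := shift q le_rfl ((k + 1) * q) (Nat.mul_le_mul_right _ (by omega))
    simp only [hf, hG'] at h' ⊢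
    linarith
  have tele : ∀ m ≤ M, (f ((m + 2) * q) - f ((m + 1) * q)) + ∑ k ∈ Finset.range m, G' (k + 3) ≤
      f (2 * q) + m * c := by
    intro m
    induction m with
    | zero => intro _; simp; exact f0 _
    | succ m ih =>
      intro hm
      have a1 := ih (by omega)
      have a2 := step (m + 1) (by omega) hm
      rw [Finset.sum_range_succ]
      push_cast
      linarith
  have hfin : f ((M + 1) * q) ≤ f ((M + 2) * q) + N * e := by
    have h := Finset.sum_le_sum fun t (ht : t ∈ Finset.range N) => h5 t (Finset.mem_range.1 ht)
    simpa [Finset.sum_add_distrib] using h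
  have h2q : f (2 * q) ≤ N * D2 := by
    have h := Finset.sum_le_sum fun t (ht : t ∈ Finset.range N) => h4 t (Finset.mem_range.1 ht)
    simpa using h
  obtain ⟨k, hk, hG⟩ : ∃ k ∈ Finset.range M, G' (k + 3) ≤ (N * D2 + N * e + M * c) / M := by
    refine Finset.exists_le_of_sum_le (by simp; omega) ?_
    simp only [Finset.sum_const, Finset.card_range, nsmul_eq_mul]
    rw [mul_div_cancel₀ _ hM0.ne']
    linarith [tele M le_rfl]
  have inc : ∀ j, 1 ≤ j → j + 2 ≤ q → f j + (N * W - 2 * Dmax - E * G' (k + 3) - N * F) ≤ f (j + 1) := by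
    intro j hj hjq
    have h := Finset.sum_le_sum fun t (ht : t ∈ Finset.range N) =>
      h2 t (Finset.mem_range.1 ht) j (k + 3) hj hjq (by omega)
    simp only [Finset.sum_add_distrib, ← Finset.mul_sum, Finset.sum_const, Finset.card_range, nsmul_eq_mul] at h
    have h' := shift 1 (by omega) (j + 1) (by nlinarith)
    simp only [hf, hG', Nat.cast_one] at h' ⊢
    linarith
  set w := N * W - 2 * Dmax - E * G' (k + 3) - N * F with hw
  have tot : ∀ m, m + 2 ≤ q → m * w ≤ f (m + 1) := by
    intro m
    induction m with
    | zero => intro _; simpa using f0 1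
    | succ m ih =>
      intro hm
      have a1 := ih (by omega)
      have a2 := inc (m + 1) (by omega) (by omega)
      push_cast
      linarith
  have hlast := tot (q - 2) (by omega)
  rw [show q - 2 + 1 = q - 1 by omega, Nat.cast_sub (by omega)] at hlast
  push_cast at hlast
  have hq2 : (0 : ℝ) ≤ q - 2 := by
    have : (3 : ℝ) ≤ q := by exact_mod_cast hq
    linarith
  have hww : N * (W - F - 2 * Dmax / N - E * ((D2 + e) / M + 15 * e + 3 * q * Dmax / N)) ≤ w := by
    have h6 := mul_le_mul_of_nonneg_left hG hE
    have e5 : N * (W - F - 2 * Dmax / N - E * ((D2 + e) / M + 15 * e + 3 * q * Dmax / N)) =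
        N * W - N * F - 2 * Dmax - E * ((N * D2 + N * e + M * c) / M) := by
      rw [hc]; field_simp; ring
    rw [e5, hw]
    linarith
  by_contra hcon
  push Not at hcon
  have hlt : f (q - 1) < ∑ t ∈ Finset.range N,
      (q - 2) * (W - F - 2 * Dmax / N - E * ((D2 + e) / M + 15 * e + 3 * q * Dmax / N)) :=
    Finset.sum_lt_sum_of_nonempty (by simp; omega) fun t ht => hcon t (Finset.mem_range.1 ht)
  simp only [Finset.sum_const, Finset.card_range, nsmul_eq_mul] at hlt
  have := mul_le_mul_of_nonneg_left hww hq2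
  linarith

lemma Ens.entL_mesh_le {r a : ℝ} {g : SLR} {N : ℕ} (H : Ens r a g N) {i : ℕ} (hi : i ≤ N) (n : ℕ) :
    entL r g (r ^ n * mesh a) i ≤ 4 * (22 * Real.log a - n * Real.log r) := by
  have ha := H.ha
  have hr := H.hr
  have hm := H.mesh_pos
  obtain ⟨h1, h2⟩ := H.mesh_le n
  refine (H.entL_le hi h1 (H.pow_le h1 h2).2.2).trans (le_of_eq ?_)
  rw [Real.log_div (by positivity) h1.ne', Real.log_mul (by positivity) hm.ne', Real.log_pow]
  unfold mesh
  simp only [Real.log_inv, Real.log_pow]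
  push_cast
  ring

lemma high_entropy_numeric {x ε ρ E T e K1 L l2 lam B p τ q M Q Z : ℝ} (hx0 : 0 < x) (hx1 : x ≤ 1 / 40)
    (hxε : 40 * x ≤ ε) (hρ1 : 1 ≤ ρ) (hE0 : 0 < E) (hT3 : 3 ≤ T) (heT : e = 104 * T) (hK0 : 0 < K1) (hlam : 0 < lam)
    (hτ : 0 ≤ τ) (hZ : Z = lam * ρ)
    (hp2 : (1 - x) * (B * ρ) ≤ p * l2) (hτ2 : (2 - x) * lam ≤ B * (τ + 1)) (hlam1 : L * T ≤ lam) (hL1 : 1 ≤ L)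
    (hLF : (5 * E + 12) * 104 ≤ x * L) (hLE : 1560 * E ≤ x * L) (hq3' : 3 ≤ q) (hqx : 1 ≤ x * (q - 1))
    (hM1' : 1 ≤ M) (hMx : E * (192 + 8 * q) ≤ x * M) (hQ1' : 1 ≤ Q) (hQx : 2 * K1 + 3 * q * E * K1 ≤ x * Q) :
    (3 - ε) * ((q - 1) * lam * ρ) ≤ (q - 2) * (2 * (p * (τ + 1) * l2) - Z - (E * (5 * e) + 12 * e) -
        2 * (K1 * Z) / Q - E * (((88 + 8 * q) * Z + e) / M + 15 * e + 3 * q * (K1 * Z) / Q)) := by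
  have hZ0 : 0 < Z := by rw [hZ]; positivity
  have hlZ : lam ≤ Z := by rw [hZ]; exact le_mul_of_one_le_right hlam.le hρ1
  have hTZ : L * T ≤ Z := hlam1.trans hlZ
  have hTZ' : T ≤ Z := by
    refine le_trans ?_ hTZ
    exact le_mul_of_one_le_left (by linarith) hL1
  have b1 : (3 - 6 * x) * Z ≤ 2 * (p * (τ + 1) * l2) - Z := by
    have h1 : (1 - x) * ((2 - x) * lam * ρ) ≤ p * (τ + 1) * l2 := by
      calc (1 - x) * ((2 - x) * lam * ρ) ≤ (1 - x) * (B * (τ + 1) * ρ) := by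
            have : 0 ≤ 1 - x := by linarith
            gcongr
        _ = (1 - x) * (B * ρ) * (τ + 1) := by ring
        _ ≤ p * l2 * (τ + 1) := by gcongr
        _ = _ := by ring
    have h2 : (2 - 3 * x) * Z ≤ (1 - x) * ((2 - x) * lam * ρ) := by
      rw [show (1 - x) * ((2 - x) * lam * ρ) = (1 - x) * (2 - x) * Z by rw [hZ]; ring]
      gcongr
      nlinarith
    nlinarith
  have b2 : E * (5 * e) + 12 * e ≤ x * Z := by
    rw [heT]
    have : (5 * E + 12) * 104 * T ≤ x * L * T := by gcongr
    nlinarith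
  have b3 : 2 * (K1 * Z) / Q ≤ x * Z := by
    rw [div_le_iff₀ (by linarith)]
    have : 0 < 3 * q * E * K1 := by positivity
    nlinarith
  have b4 : E * (((88 + 8 * q) * Z + e) / M) ≤ x * Z := by
    rw [mul_div_assoc', div_le_iff₀ (by linarith)]
    have h1 : (88 + 8 * q) * Z + e ≤ (192 + 8 * q) * Z := by rw [heT]; linarith
    calc E * ((88 + 8 * q) * Z + e) ≤ E * ((192 + 8 * q) * Z) := by gcongr
      _ = E * (192 + 8 * q) * Z := by ring
      _ ≤ x * M * Z := by gcongr
      _ = _ := by ring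
  have b5 : E * (15 * e) ≤ x * Z := by
    rw [heT]
    have : 1560 * E * T ≤ x * L * T := by gcongr
    nlinarith
  have b6 : E * (3 * q * (K1 * Z) / Q) ≤ x * Z := by
    rw [mul_div_assoc', div_le_iff₀ (by linarith)]
    have h1 : 3 * q * E * K1 * Z ≤ x * Q * Z := by
      have : 3 * q * E * K1 ≤ x * Q := by linarith
      gcongr
    linarith
  have b7 : (3 - 11 * x) * Z ≤ 2 * (p * (τ + 1) * l2) - Z - (E * (5 * e) + 12 * e) -
      2 * (K1 * Z) / Q - E * (((88 + 8 * q) * Z + e) / M + 15 * e + 3 * q * (K1 * Z) / Q) := by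
    rw [mul_add, mul_add]
    linarith
  have hq2 : (0 : ℝ) ≤ q - 2 := by linarith
  refine le_trans ?_ (mul_le_mul_of_nonneg_left b7 hq2)
  have b8 : (3 - ε) * (q - 1) ≤ (q - 2) * (3 - 11 * x) := by nlinarith
  calc (3 - ε) * ((q - 1) * lam * ρ) = (3 - ε) * (q - 1) * Z := by rw [hZ]; ring
    _ ≤ (q - 2) * (3 - 11 * x) * Z := by gcongr
    _ = _ := by ring


set_option maxHeartbeats 1000000 in
/-- If no word produces a short vector, some lattice ensemble has entropy close to the maximum. -/
theorem exists_high_entropy {r : ℝ} (hr : 0 < r) (hr4 : r ≤ 1 / 4) {ε : ℝ} (hε : 0 < ε) (L0 : ℝ) :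
    ∃ C T0 : ℝ, 0 < C ∧ ∀ (a : ℝ) (N : ℕ) (g : SLR), T0 ≤ Real.log a → C * Real.log a ≤ N → Ens r a g N →
      ∃ i n : ℕ, i + n ≤ N ∧ L0 * Real.log a ≤ n ∧
        (3 - ε) * (n * -Real.log r) ≤ entL r g (r ^ n * mesh a) i := by
  obtain ⟨ρ, hρ⟩ : ∃ ρ, ρ = -Real.log r := ⟨_, rfl⟩
  rw [← hρ]
  have hl2 : 0 < Real.log 2 := Real.log_pos (by norm_num)
  have hl2' : Real.log 2 < 0.6931471808 := Real.log_two_lt_d9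
  have hl2'' : 0.6931471803 < Real.log 2 := Real.log_two_gt_d9
  have hρ2 : 2 * Real.log 2 ≤ ρ := by
    rw [hρ, ← Real.log_inv, ← Real.log_rpow (by norm_num)]
    refine Real.log_le_log (by positivity) ?_
    rw [le_inv_comm₀ (by positivity) hr]
    norm_num
    linarith
  have hρ1 : 1 ≤ ρ := by linarith
  obtain ⟨x, hx⟩ : ∃ x, x = min ε 1 / 40 := ⟨_, rfl⟩
  have hx0 : 0 < x := by rw [hx]; positivity
  have hx1 : x ≤ 1 / 40 := by rw [hx]; linarith [min_le_right ε 1]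
  have hxε : 40 * x ≤ ε := by rw [hx]; linarith [min_le_left ε 1]
  obtain ⟨B, hB⟩ := exists_nat_ge (1 + Real.log 2 / x)
  have hB1 : 1 ≤ B := by
    have : (1 : ℝ) ≤ B := by
      have : 0 < Real.log 2 / x := by positivity
      linarith
    exact_mod_cast this
  have hB1' : (1 : ℝ) ≤ B := by exact_mod_cast hB1
  have hBx : Real.log 2 ≤ x * (B * ρ) := by
    have : Real.log 2 / x ≤ B := by linarith
    rw [div_le_iff₀ hx0] at this
    nlinarith
  obtain ⟨p, hp⟩ : ∃ p, p = ⌊B * ρ / Real.log 2⌋₊ := ⟨_, rfl⟩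
  have hp1 : (p : ℝ) * Real.log 2 ≤ B * ρ := by
    rw [← le_div_iff₀ hl2, hp]; exact Nat.floor_le (by positivity)
  have hp2 : (1 - x) * (B * ρ) ≤ p * Real.log 2 := by
    have := Nat.lt_floor_add_one (B * ρ / Real.log 2 : ℝ)
    rw [← hp, div_lt_iff₀ hl2] at this
    linarith
  have hp0 : 0 < p := by
    rw [hp, Nat.floor_pos, one_le_div hl2]
    nlinarith
  have hpB : (2 : ℝ) ^ p * r ^ B ≤ 1 := by
    rw [← Real.log_nonpos_iff (by positivity), Real.log_mul (by positivity) (by positivity), Real.log_pow, Real.log_pow]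
    rw [hρ] at hp1
    linarith
  obtain ⟨E, hE⟩ : ∃ E : ℝ, E = 2 * 4 ^ p := ⟨_, rfl⟩
  have hE0 : 0 < E := by rw [hE]; positivity
  obtain ⟨q, hq⟩ := exists_nat_ge (3 + 1 / x)
  have hx' : 0 < 1 / x := by positivity
  have hq3 : 3 ≤ q := by
    have : (3 : ℝ) ≤ q := by linarith
    exact_mod_cast this
  have hq3' : (3 : ℝ) ≤ q := by exact_mod_cast hq3
  have hqx : 1 ≤ x * (q - 1) := by
    have : 1 / x ≤ q - 1 := by linarith
    rwa [div_le_iff₀' hx0] at this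
  obtain ⟨L, hL⟩ : ∃ L : ℝ, L = max L0 0 + (22 + (5 * E + 12) * 104 + 1560 * E) / x := ⟨_, rfl⟩
  have hm0 := le_max_right L0 0
  have hL22 : 22 ≤ x * L := by
    rw [hL, mul_add, mul_div_cancel₀ _ hx0.ne']; nlinarith
  have hLF : (5 * E + 12) * 104 ≤ x * L := by
    rw [hL, mul_add, mul_div_cancel₀ _ hx0.ne']; nlinarith
  have hLE : 1560 * E ≤ x * L := by
    rw [hL, mul_add, mul_div_cancel₀ _ hx0.ne']; nlinarith
  have hL0 : L0 ≤ L := by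
    have : 0 < (22 + (5 * E + 12) * 104 + 1560 * E) / x := by positivity
    linarith [le_max_left L0 0]
  have hL1 : 1 ≤ L := by
    by_contra! h
    have := mul_lt_mul_of_pos_left h hx0
    linarith
  obtain ⟨M, hM⟩ := exists_nat_ge (1 + E * (192 + 8 * q) / x)
  have hM1' : (1 : ℝ) ≤ M := by
    have : 0 < E * (192 + 8 * q) / x := by positivity
    linarith
  have hM1 : 1 ≤ M := by exact_mod_cast hM1'
  have hMx : E * (192 + 8 * q) ≤ x * M := by
    have : E * (192 + 8 * q) / x ≤ M := by linarith
    rwa [div_le_iff₀' hx0] at this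
  obtain ⟨K1, hK1⟩ : ∃ K1 : ℝ, K1 = 88 + 4 * ((M + 2) * q) := ⟨_, rfl⟩
  have hK0 : 0 < K1 := by rw [hK1]; positivity
  obtain ⟨Q, hQ⟩ := exists_nat_ge (1 + (2 * K1 + 3 * q * E * K1) / x)
  have hQ1' : (1 : ℝ) ≤ Q := by
    have : 0 < (2 * K1 + 3 * q * E * K1) / x := by positivity
    linarith
  have hQ1 : 1 ≤ Q := by exact_mod_cast hQ1'
  have hQx : 2 * K1 + 3 * q * E * K1 ≤ x * Q := by
    have : (2 * K1 + 3 * q * E * K1) / x ≤ Q := by linarith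
    rwa [div_le_iff₀' hx0] at this
  refine ⟨(Q + q) * (L + 1), 3 + (p + 1) * Real.log 2, by positivity, ?_⟩
  intro a N g hT hN H
  have ha := H.ha
  obtain ⟨T, hTdef⟩ : ∃ T, T = Real.log a := ⟨_, rfl⟩
  rw [← hTdef] at hT hN
  rw [← hTdef]
  have hT3 : 3 ≤ T := by
    have : 0 < (p + 1) * Real.log 2 := by positivity
    linarith
  have hTp : (p + 1) * Real.log 2 ≤ T := by linarith
  obtain ⟨lam, hlam⟩ : ∃ lam, lam = ⌈L * T⌉₊ := ⟨_, rfl⟩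
  have hlam1 : L * T ≤ lam := hlam ▸ Nat.le_ceil _
  have hlam2 : (lam : ℝ) ≤ (L + 1) * T := by
    have := Nat.ceil_lt_add_one (by positivity : 0 ≤ L * T)
    rw [← hlam] at this
    linarith
  have hTl : T ≤ lam := (le_mul_of_one_le_left (by linarith) hL1).trans hlam1
  have hlam0 : (3 : ℝ) ≤ lam := by linarith
  have hlam0' : 3 ≤ lam := by exact_mod_cast hlam0
  have hN' : (Q + q) * lam ≤ N := by
    have : ((Q + q : ℕ) * lam : ℝ) ≤ N := by
      push_cast
      calc ((Q : ℝ) + q) * lam ≤ (Q + q) * ((L + 1) * T) := by gcongr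
        _ ≤ N := by linarith
    exact_mod_cast this
  obtain ⟨κ, hκ⟩ : ∃ κ, κ = ⌈(20 * T + (p + 1) * Real.log 2) / ρ⌉₊ + 2 := ⟨_, rfl⟩
  have hκ3 : 2 ≤ κ := by omega
  have hκ1 : 20 * T + (p + 1) * Real.log 2 ≤ κ * ρ := by
    have hρ0 : 0 ≤ ρ := by linarith
    have := Nat.le_ceil ((20 * T + (p + 1) * Real.log 2) / ρ)
    rw [div_le_iff₀ (by linarith)] at this
    rw [hκ]
    push_cast
    rw [add_mul _ 2 ρ]
    linarith
  have hκ2 : (κ : ℝ) ≤ 22 * T := by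
    have h1 := Nat.ceil_lt_add_one (by positivity : 0 ≤ (20 * T + (p + 1) * Real.log 2) / ρ)
    have h2 : (20 * T + (p + 1) * Real.log 2) / ρ ≤ 21 * T := by
      rw [div_le_iff₀ (by linarith)]
      exact le_trans (by linarith : _ ≤ 21 * T) (le_mul_of_one_le_right (by linarith) hρ1)
    rw [hκ]
    push_cast
    linarith
  have hκx : (κ : ℝ) ≤ x * lam := by
    calc (κ : ℝ) ≤ 22 * T := hκ2
      _ ≤ x * L * T := by gcongr
      _ = x * (L * T) := by ring
      _ ≤ x * lam := by gcongr
  have hκη : 2 * 2 ^ p * r ^ κ ≤ mesh a := by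
    have hm := H.mesh_pos
    rw [← Real.log_le_log_iff (by positivity) hm, Real.log_mul (by positivity) (by positivity),
      Real.log_mul (by positivity) (by positivity), Real.log_pow, Real.log_pow]
    unfold mesh
    rw [Real.log_inv, Real.log_pow, Real.log_pow]
    push_cast
    rw [hρ] at hκ1
    linarith
  obtain ⟨τ, hτ1, hτ2⟩ : ∃ τ : ℕ, κ + B * τ < 2 * lam ∧ (2 - x) * lam ≤ B * (τ + 1) := by
    refine ⟨(2 * lam - κ - 1) / B, ?_, ?_⟩
    · have h1 := Nat.mul_div_le (2 * lam - κ - 1) B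
      have h2 : κ < 2 * lam := by
        have : (κ : ℝ) < 2 * lam := by
          have : x * lam ≤ 1 * lam := by gcongr; linarith
          linarith
        exact_mod_cast this
      omega
    · have h1 := Nat.lt_mul_div_succ (2 * lam - κ - 1) (by omega : 0 < B)
      have h2 : 2 * lam ≤ B * ((2 * lam - κ - 1) / B + 1) + κ := by omega
      have h3 : (2 * lam : ℝ) ≤ B * (((2 * lam - κ - 1) / B : ℕ) + 1) + κ := by exact_mod_cast h2
      linarith
  obtain ⟨e, he⟩ : ∃ e, e = kverr (a ^ 2) := ⟨_, rfl⟩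
  have heT : e = 104 * T := by
    rw [he, kverr, Real.log_pow, ← hTdef]; push_cast; ring
  have hle : ∀ t : ℕ, ℕ → t ≤ Q + q → t * lam ≤ N := fun t _ ht => (Nat.mul_le_mul_right _ ht).trans hN'
  have hqlam : 2 ≤ q * lam := by
    have := Nat.mul_le_mul hq3 hlam0'
    omega
  have hDle : ∀ t k : ℕ, t ≤ Q + q → entL r g (r ^ (k * lam) * mesh a) (t * lam) ≤ (88 + 4 * k) * (lam * ρ) := by
    intro t k ht
    refine (H.entL_mesh_le (hle t 0 ht) _).trans ?_
    rw [← hTdef]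
    push_cast
    have h1 : T ≤ lam * ρ := hTl.trans (le_mul_of_one_le_right (by positivity) hρ1)
    have h2 : 4 * (22 * T - k * lam * Real.log r) = 88 * T + 4 * k * (lam * ρ) := by rw [hρ]; ring
    linarith
  obtain ⟨t, ht, hfin⟩ := exists_large_entropy
    (D := fun t k => entL r g (r ^ (k * lam) * mesh a) (t * lam))
    (G := fun t k => growth (r ^ (k * q * lam) * mesh a) (fun w : Fin (t * lam) → Bool => lat r g w)
        (yw r (q * lam - 2))) (q := q) (M := M) (N := Q) (e := e)
    (W := 2 * (p * (τ + 1) * Real.log 2) - lam * ρ) (E := E) (F := E * (5 * e) + 12 * e)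
    (Dmax := K1 * (lam * ρ)) (D2 := (88 + 8 * q) * (lam * ρ)) hq3 hM1 hQ1 hE0.le
    (by
      intro t ht k hk _
      exact he ▸ H.triple_units hqlam hk (hle _ 0 (by omega)))
    (by
      intro t ht j k hj hjq hk
      have := H.pair_units (lam := lam) (q := q) (t := t) (k := k) (j := j) (p := p) (τ := τ) (κ := κ) (B := B)
        (by omega) (by omega) hj hjq hp0 hB1 hκ3 hpB hκη hτ1 (hle _ 0 (by omega))
      rw [hE, hρ, he]
      linarith)
    (fun t _ k => ent_nonneg _)
    (by
      intro t ht k hk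
      refine (hDle t k (by omega)).trans ?_
      have : (k : ℝ) ≤ (M + 2) * q := by exact_mod_cast hk
      rw [hK1]
      gcongr)
    (by
      intro t ht
      refine (hDle t (2 * q) (by omega)).trans (le_of_eq ?_)
      push_cast
      ring)
    (by
      intro t ht
      obtain ⟨h1, h2⟩ := H.mesh_le ((M + 1) * q * lam)
      obtain ⟨h3, h4⟩ := H.mesh_le ((M + 2) * q * lam)
      rw [he]
      refine H.entL_mono (hle t 0 (by omega)) h3 ?_ h2
      refine mul_le_mul_of_nonneg_right (pow_le_pow_of_le_one hr.le (by linarith) ?_) H.mesh_pos.le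
      refine Nat.mul_le_mul_right _ (Nat.mul_le_mul_right _ (by omega)))
  refine ⟨t * lam, (q - 1) * lam, ?_, ?_, ?_⟩
  · rw [← add_mul]
    exact (Nat.mul_le_mul_right _ (by omega)).trans hN'
  · have : lam ≤ (q - 1) * lam := Nat.le_mul_of_pos_left _ (by omega)
    have h : (lam : ℝ) ≤ ((q - 1) * lam : ℕ) := by exact_mod_cast this
    have h2 : L0 * T ≤ L * T := by gcongr
    linarith
  · refine le_trans ?_ hfin
    have hn : (((q - 1) * lam : ℕ) : ℝ) = (q - 1) * lam := by
      rw [Nat.cast_mul, Nat.cast_sub (by omega)]; simp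
    rw [hn]
    exact high_entropy_numeric hx0 hx1 hxε hρ1 hE0 hT3 heT hK0 (by linarith)
      (Nat.cast_nonneg τ) rfl hp2 hτ2 hlam1 hL1 hLF hLE hq3' hqx hM1' hMx hQ1' hQx

/-- The indicator of `[-c, c]`. -/
noncomputable def tophat (c : ℝ) : ℝ → ℝ := (Icc (-c) c).indicator fun _ => 1

/-- A mean-zero combination of a narrow and a wide indicator. -/
noncomputable def spike (ω κ : ℝ) (s : ℝ) : ℝ := tophat ω s - ω / κ * tophat κ s

/-- Autocorrelation of `spike`. -/
noncomputable def spikeCorr (ω κ : ℝ) : ℝ → ℝ :=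
  convolution (spike ω κ) (spike ω κ) (ContinuousLinearMap.mul ℝ ℝ) volume

lemma tophat_nonneg (c s : ℝ) : 0 ≤ tophat c s := indicator_nonneg (fun _ _ => zero_le_one) _

lemma tophat_le_one (c s : ℝ) : tophat c s ≤ 1 := indicator_le_self' (fun _ _ => zero_le_one) _

lemma tophat_of_le {c s : ℝ} (h : |s| ≤ c) : tophat c s = 1 := indicator_of_mem (s := Icc (-c) c) (abs_le.1 h) _

lemma tophat_of_lt {c s : ℝ} (h : c < |s|) : tophat c s = 0 :=
  indicator_of_notMem (s := Icc (-c) c) (fun h' => h.not_ge (abs_le.2 h')) _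

lemma tophat_neg (c s : ℝ) : tophat c (-s) = tophat c s := by
  by_cases h : |s| ≤ c
  · rw [tophat_of_le h, tophat_of_le (by rwa [abs_neg])]
  · rw [tophat_of_lt (not_le.1 h), tophat_of_lt (by rw [abs_neg]; exact not_le.1 h)]

lemma integrable_tophat (c : ℝ) : Integrable (tophat c) :=
  (integrable_indicator_iff measurableSet_Icc).2 (by simp)

lemma integral_tophat {c : ℝ} (hc : 0 ≤ c) : ∫ s, tophat c s = 2 * c := by
  unfold tophat
  rw [integral_indicator_const _ measurableSet_Icc]
  simp only [Measure.real, Real.volume_Icc, smul_eq_mul, mul_one]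
  rw [ENNReal.toReal_ofReal (by linarith)]
  ring

lemma integrable_spike (ω κ : ℝ) : Integrable (spike ω κ) :=
  (integrable_tophat ω).sub ((integrable_tophat κ).const_mul _)

lemma integral_spike {ω κ : ℝ} (hω : 0 ≤ ω) (hκ : 0 < κ) : ∫ s, spike ω κ s = 0 := by
  unfold spike
  rw [integral_sub (integrable_tophat ω) ((integrable_tophat κ).const_mul _), integral_const_mul,
    integral_tophat hω, integral_tophat hκ.le]
  field_simp
  ring

lemma spike_neg (ω κ s : ℝ) : spike ω κ (-s) = spike ω κ s := by
  simp [spike, tophat_neg]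

lemma spikeCorr_apply (ω κ t : ℝ) : spikeCorr ω κ t = ∫ s, spike ω κ s * spike ω κ (t - s) :=
  convolution_mul

lemma integrable_spikeCorr (ω κ : ℝ) : Integrable (spikeCorr ω κ) :=
  (integrable_spike ω κ).integrable_convolution _ (integrable_spike ω κ)

lemma integral_spikeCorr {ω κ : ℝ} (hω : 0 ≤ ω) (hκ : 0 < κ) : ∫ t, spikeCorr ω κ t = 0 := by
  unfold spikeCorr
  rw [integral_convolution _ (integrable_spike ω κ) (integrable_spike ω κ), integral_spike hω hκ]
  simp

lemma abs_spike_le {ω κ : ℝ} (hω : 0 ≤ ω) (hκ : 0 < κ) (s : ℝ) :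
    |spike ω κ s| ≤ tophat ω s + ω / κ * tophat κ s := by
  have h1 := tophat_nonneg ω s
  have h2 : 0 ≤ ω / κ * tophat κ s := mul_nonneg (by positivity) (tophat_nonneg κ s)
  unfold spike
  rw [abs_le]
  constructor <;> linarith

lemma spike_eq_zero {ω κ s : ℝ} (hωκ : ω ≤ κ) (h : κ < |s|) : spike ω κ s = 0 := by
  simp [spike, tophat_of_lt h, tophat_of_lt (hωκ.trans_lt h)]

lemma integral_spike_mul (ω κ u v : ℝ) :
    ∫ b, spike ω κ (b + u) * spike ω κ (b + v) = spikeCorr ω κ (u - v) := by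
  rw [spikeCorr_apply, ← integral_add_right_eq_self (fun s => spike ω κ s * spike ω κ (u - v - s)) u]
  congr 1 with b
  rw [← spike_neg ω κ (b + v)]
  ring_nf

lemma integrable_spike_mul {ω κ : ℝ} (hω : 0 ≤ ω) (hκ : 0 < κ) (u v : ℝ) :
    Integrable fun b => spike ω κ (b + u) * spike ω κ (b + v) := by
  refine ((integrable_spike ω κ).comp_add_right u).mul_bdd (c := 1 + ω / κ)
    ((integrable_spike ω κ).comp_add_right v).aestronglyMeasurable (ae_of_all _ fun b => ?_)
  refine (abs_spike_le hω hκ _).trans ?_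
  gcongr
  · exact tophat_le_one _ _
  · exact mul_le_of_le_one_right (by positivity) (tophat_le_one _ _)

lemma spikeCorr_eq_zero {ω κ t : ℝ} (hωκ : ω ≤ κ) (h : 2 * κ < |t|) : spikeCorr ω κ t = 0 := by
  rw [spikeCorr_apply]
  refine integral_eq_zero_of_ae (ae_of_all _ fun s => ?_)
  simp only [Pi.zero_apply, mul_eq_zero]
  by_contra! hc
  have h1 : |s| ≤ κ := by
    by_contra! h'; exact hc.1 (spike_eq_zero hωκ h')
  have h2 : |t - s| ≤ κ := by
    by_contra! h'; exact hc.2 (spike_eq_zero hωκ h')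
  have := abs_add_le (t - s) s
  rw [sub_add_cancel] at this
  linarith

lemma abs_spikeCorr_le {ω κ : ℝ} (hω : 0 ≤ ω) (hκ : 0 < κ) (hωκ : ω ≤ κ) (t : ℝ) :
    |spikeCorr ω κ t| ≤ 2 * ω * tophat (2 * ω) t + 6 * (ω ^ 2 / κ) * tophat (2 * κ) t := by
  by_cases ht : |t| ≤ 2 * κ
  · rw [tophat_of_le ht, spikeCorr_apply, ← Real.norm_eq_abs]
    set ρ := ω / κ with hρ
    have hρ0 : 0 ≤ ρ := by positivity
    have hi : Integrable fun s => tophat ω s * tophat (2 * ω) t + ρ * tophat ω s + ρ * tophat ω (t - s) +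
        ρ ^ 2 * tophat κ s :=
      ((((integrable_tophat ω).mul_const _).add ((integrable_tophat ω).const_mul _)).add
        (((integrable_tophat ω).comp_sub_left t).const_mul _)).add ((integrable_tophat κ).const_mul _)
    refine (norm_integral_le_of_norm_le hi (ae_of_all _ fun s => ?_)).trans (le_of_eq ?_)
    · rw [norm_mul]
      refine (mul_le_mul (abs_spike_le hω hκ _) (abs_spike_le hω hκ _) (abs_nonneg _)
        (add_nonneg (tophat_nonneg _ _) (mul_nonneg hρ0 (tophat_nonneg _ _)))).trans ?_
      have h1 : tophat ω s * tophat ω (t - s) ≤ tophat ω s * tophat (2 * ω) t := by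
        by_cases h : |s| ≤ ω
        · refine mul_le_mul_of_nonneg_left ?_ (tophat_nonneg _ _)
          by_cases h' : |t - s| ≤ ω
          · rw [tophat_of_le h', tophat_of_le]
            have := abs_add_le (t - s) s
            rw [sub_add_cancel] at this
            linarith
          · rw [tophat_of_lt (not_le.1 h')]
            exact tophat_nonneg _ _
        · simp [tophat_of_lt (not_le.1 h)]
      have h2 : tophat ω s * (ρ * tophat κ (t - s)) ≤ ρ * tophat ω s := by
        rw [mul_comm ρ (tophat ω s)]
        exact mul_le_mul_of_nonneg_left (mul_le_of_le_one_right hρ0 (tophat_le_one _ _)) (tophat_nonneg _ _)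
      have h3 : ρ * tophat κ s * tophat ω (t - s) ≤ ρ * tophat ω (t - s) :=
        mul_le_mul_of_nonneg_right (mul_le_of_le_one_right hρ0 (tophat_le_one _ _)) (tophat_nonneg _ _)
      have h4 : ρ * tophat κ s * (ρ * tophat κ (t - s)) ≤ ρ ^ 2 * tophat κ s := by
        have := mul_le_mul_of_nonneg_left (tophat_le_one κ (t - s))
          (mul_nonneg (sq_nonneg ρ) (tophat_nonneg κ s))
        linarith
      rw [add_mul, mul_add, mul_add]
      linarith
    · have e1 : ∫ s, tophat ω (t - s) = 2 * ω := by
        rw [integral_sub_left_eq_self (tophat ω), integral_tophat hω]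
      have i1 := (integrable_tophat ω).mul_const (tophat (2 * ω) t)
      have i2 := (integrable_tophat ω).const_mul ρ
      have i3 := ((integrable_tophat ω).comp_sub_left t).const_mul ρ
      have i4 : Integrable fun x => tophat ω x * tophat (2 * ω) t + ρ * tophat ω x := i1.add i2
      have i5 : Integrable fun x => tophat ω x * tophat (2 * ω) t + ρ * tophat ω x + ρ * tophat ω (t - x) := i4.add i3
      rw [integral_add i5 ((integrable_tophat κ).const_mul _), integral_add i4 i3,
        integral_add i1 i2,
        integral_mul_const, integral_const_mul, integral_const_mul, integral_const_mul, e1,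
        integral_tophat hω, integral_tophat hκ.le, hρ]
      field_simp
      ring
  · rw [spikeCorr_eq_zero hωκ (not_le.1 ht), abs_zero]
    have := tophat_nonneg (2 * ω) t
    have := tophat_nonneg (2 * κ) t
    positivity

lemma integral_abs_spikeCorr_le {ω κ : ℝ} (hω : 0 ≤ ω) (hκ : 0 < κ) (hωκ : ω ≤ κ) :
    ∫ t, |spikeCorr ω κ t| ≤ 32 * ω ^ 2 := by
  have hi : Integrable fun t => 2 * ω * tophat (2 * ω) t + 6 * (ω ^ 2 / κ) * tophat (2 * κ) t :=
    ((integrable_tophat _).const_mul _).add ((integrable_tophat _).const_mul _)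
  refine (integral_mono (integrable_spikeCorr ω κ).abs hi (abs_spikeCorr_le hω hκ hωκ)).trans (le_of_eq ?_)
  rw [integral_add ((integrable_tophat _).const_mul _) ((integrable_tophat _).const_mul _), integral_const_mul,
    integral_const_mul, integral_tophat (by linarith), integral_tophat (by linarith)]
  field_simp
  ring

/-- The mean-zero correlation integrated along a transversal direction only sees the end points. -/
lemma abs_integral_spikeCorr_le {ω κ ϑ u D : ℝ} (hω : 0 ≤ ω) (hκ : 0 < κ) (hωκ : ω ≤ κ) (hϑ : 8 * κ ≤ ϑ)
    (hu : ϑ ≤ |u|) :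
    |∫ l in (1 / 2 : ℝ)..(3 / 2), spikeCorr ω κ (D * l + u)| ≤
      64 * ω ^ 2 / ϑ * (tophat (2 * κ) (D * (1 / 2) + u) + tophat (2 * κ) (D * (3 / 2) + u)) := by
  have hϑ0 : 0 < ϑ := by linarith
  have hn1 := tophat_nonneg (2 * κ) (D * (1 / 2) + u)
  have hn2 := tophat_nonneg (2 * κ) (D * (3 / 2) + u)
  have hr0 : 0 ≤ 64 * ω ^ 2 / ϑ * (tophat (2 * κ) (D * (1 / 2) + u) + tophat (2 * κ) (D * (3 / 2) + u)) := by
    positivity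
  rcases eq_or_ne D 0 with rfl | hD
  · simp only [zero_mul, zero_add]
    rw [spikeCorr_eq_zero hωκ (by linarith)]
    simpa using hr0
  rw [intervalIntegral.integral_comp_mul_add _ hD, smul_eq_mul, abs_mul, abs_inv]
  set e₁ := D * (1 / 2) + u with he1
  set e₂ := D * (3 / 2) + u with he2
  by_cases h : 2 * κ < |e₁| ∧ 2 * κ < |e₂|
  · have h0 : ∫ t in e₁..e₂, spikeCorr ω κ t = 0 := by
      have hi := integral_spikeCorr hω hκ
      have supp : ∀ t, t ∉ Icc (-(2 * κ)) (2 * κ) → spikeCorr ω κ t = 0 := fun t ht =>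
        spikeCorr_eq_zero hωκ (by by_contra! hc; exact ht (abs_le.1 hc))
      have main : ∀ x y : ℝ, x ≤ y → 2 * κ < |x| → 2 * κ < |y| → ∫ t in x..y, spikeCorr ω κ t = 0 := by
        intro x y hxy hx hy
        rw [intervalIntegral.integral_of_le hxy]
        rcases lt_abs.1 hx with h1 | h1
        · refine setIntegral_eq_zero_of_forall_eq_zero fun t ht => supp t fun ht' => ?_
          have := ht.1; have := ht'.2; linarith
        · rcases lt_abs.1 hy with h2 | h2
          · rw [setIntegral_eq_integral_of_forall_compl_eq_zero, hi]
            intro t ht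
            refine supp t fun ht' => ht ⟨?_, ?_⟩
            · have := ht'.1; linarith
            · have := ht'.2; linarith
          · refine setIntegral_eq_zero_of_forall_eq_zero fun t ht => supp t fun ht' => ?_
            have := ht.2; have := ht'.1; linarith
      rcases le_total e₁ e₂ with h' | h'
      · exact main _ _ h' h.1 h.2
      · rw [intervalIntegral.integral_symm, main _ _ h' h.2 h.1, neg_zero]
    rw [h0, abs_zero, mul_zero]
    exact hr0
  · have hsum : 1 ≤ tophat (2 * κ) e₁ + tophat (2 * κ) e₂ := by
      rcases not_and_or.1 h with h | h
      · rw [tophat_of_le (not_lt.1 h)]; linarith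
      · rw [tophat_of_le (not_lt.1 h)]; linarith
    have hDu : ϑ / 2 ≤ |D| := by
      rcases not_and_or.1 h with h | h
      · have h1 := not_lt.1 h
        have h2 := abs_sub_abs_le_abs_sub u (u + D * (1 / 2))
        rw [show u - (u + D * (1 / 2)) = -(D * (1 / 2)) by ring, abs_neg, abs_mul, abs_of_pos (by norm_num : (0 : ℝ) < 1 / 2),
          add_comm u, ← he1] at h2
        have := abs_nonneg D
        linarith
      · have h1 := not_lt.1 h
        have h2 := abs_sub_abs_le_abs_sub u (u + D * (3 / 2))
        rw [show u - (u + D * (3 / 2)) = -(D * (3 / 2)) by ring, abs_neg, abs_mul, abs_of_pos (by norm_num : (0 : ℝ) < 3 / 2),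
          add_comm u, ← he2] at h2
        linarith
    have hint : |∫ t in e₁..e₂, spikeCorr ω κ t| ≤ 32 * ω ^ 2 := by
      rw [← Real.norm_eq_abs]
      refine intervalIntegral.norm_integral_le_integral_norm_uIoc.trans ?_
      refine (setIntegral_le_integral (integrable_spikeCorr ω κ).abs (ae_of_all _ fun _ => abs_nonneg _)).trans ?_
      exact integral_abs_spikeCorr_le hω hκ hωκ
    calc |D|⁻¹ * |∫ t in e₁..e₂, spikeCorr ω κ t| ≤ (ϑ / 2)⁻¹ * (32 * ω ^ 2) := by gcongr
      _ = 64 * ω ^ 2 / ϑ * 1 := by field_simp; ring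
      _ ≤ _ := by gcongr

lemma sum_tophat_le {Z : Finset ℝ} {σ : ℝ} (hσ : 0 < σ) (hZ : ∀ z ∈ Z, ∀ z' ∈ Z, z ≠ z' → σ ≤ |z - z'|)
    {c a : ℝ} (hc : 0 ≤ c) (ha : a ≠ 0) (y : ℝ) :
    ∑ z ∈ Z, tophat c (a * z + y) ≤ 2 * c / (|a| * σ) + 2 := by
  classical
  have ha' : 0 < |a| := abs_pos.2 ha
  have h1 : ∑ z ∈ Z, tophat c (a * z + y) = ((Z.filter fun z => |a * z + y| ≤ c).card : ℝ) := by
    rw [Finset.card_filter]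
    push_cast
    refine Finset.sum_congr rfl fun z _ => ?_
    split_ifs with h
    · exact tophat_of_le h
    · exact tophat_of_lt (not_le.1 h)
  rw [h1]
  set A := (-y / a - c / |a|) / σ with hA
  set B := (-y / a + c / |a|) / σ with hB
  have hAB : B - A = 2 * c / (|a| * σ) := by rw [hA, hB]; field_simp; ring
  have hmem : ∀ z, |a * z + y| ≤ c → ⌊z / σ⌋ ∈ Finset.Icc ⌊A⌋ ⌊B⌋ := by
    intro z hz
    have h : |z - -y / a| ≤ c / |a| := by
      rw [le_div_iff₀ ha', ← abs_mul]
      have e : (z - -y / a) * a = a * z + y := by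
        rw [sub_mul, div_mul_cancel₀ _ ha]; ring
      rwa [e]
    rw [abs_le] at h
    rw [Finset.mem_Icc]
    constructor
    · refine Int.floor_le_floor ?_
      rw [hA]
      gcongr
      linarith
    · refine Int.floor_le_floor ?_
      rw [hB]
      gcongr
      linarith
  have hinj : ∀ z ∈ Z, ∀ z' ∈ Z, ⌊z / σ⌋ = ⌊z' / σ⌋ → z = z' := by
    intro z hz z' hz' h
    by_contra hne
    have h2 := Int.abs_sub_lt_one_of_floor_eq_floor h
    rw [← sub_div, abs_div, abs_of_pos hσ, div_lt_one hσ] at h2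
    exact h2.not_ge (hZ z hz z' hz' hne)
  have hcard : (Z.filter fun z => |a * z + y| ≤ c).card ≤ (Finset.Icc ⌊A⌋ ⌊B⌋).card := by
    refine Finset.card_le_card_of_injOn (fun z => ⌊z / σ⌋) (fun z hz => hmem z (Finset.mem_filter.1 hz).2) ?_
    intro z hz z' hz' h
    exact hinj z (Finset.mem_filter.1 hz).1 z' (Finset.mem_filter.1 hz').1 h
  have hle : ⌊A⌋ ≤ ⌊B⌋ := Int.floor_le_floor (by
    have : 0 ≤ 2 * c / (|a| * σ) := by positivity
    linarith)
  rw [Int.card_Icc] at hcard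
  have h3 : ((Z.filter fun z => |a * z + y| ≤ c).card : ℝ) ≤ (⌊B⌋ + 1 - ⌊A⌋ : ℤ) := by
    have : ((Z.filter fun z => |a * z + y| ≤ c).card : ℤ) ≤ ⌊B⌋ + 1 - ⌊A⌋ := by omega
    exact_mod_cast this
  push_cast at h3
  have := Int.floor_le B
  have := Int.lt_floor_add_one A
  linarith

lemma intervalIntegrable_finsetSum' {α : Type*} {s : Finset α} {f : α → ℝ → ℝ} {a b : ℝ}
    (h : ∀ i ∈ s, IntervalIntegrable (f i) volume a b) :
    IntervalIntegrable (fun x => ∑ i ∈ s, f i x) volume a b := by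
  have e : (fun x => ∑ i ∈ s, f i x) = ∑ i ∈ s, f i := by
    funext x
    rw [Finset.sum_apply]
  rw [e]
  exact IntervalIntegrable.sum s h

section SecondMoment
variable {ι : Type*} [Fintype ι] {X : ι → ℝ} {Z : Finset ℝ} {ω κ ϑ σ ν ε m : ℝ}

lemma sum_abs_spikeCorr_le (hω : 0 < ω) (hωσ : ω ≤ σ) (hσκ : σ ≤ κ)
    (hZ : ∀ z ∈ Z, ∀ z' ∈ Z, z ≠ z' → σ ≤ |z - z'|) {l : ℝ} (hl : 1 / 2 ≤ l) (u : ℝ) :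
    ∑ z ∈ Z, |spikeCorr ω κ (-l * z + u)| ≤ 80 * ω := by
  have hσ : 0 < σ := by linarith
  have hκ : 0 < κ := by linarith
  have hl0 : -l ≠ 0 := by linarith
  have hla : |-l| = l := by rw [abs_neg, abs_of_pos (by linarith)]
  have h1 := sum_tophat_le hσ hZ (by linarith : 0 ≤ 2 * ω) hl0 u
  have h2 := sum_tophat_le hσ hZ (by linarith : 0 ≤ 2 * κ) hl0 u
  rw [hla] at h1 h2
  have hlσ : σ / 2 ≤ l * σ := by nlinarith
  have h3 : 2 * (2 * ω) / (l * σ) ≤ 8 := by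
    rw [div_le_iff₀ (by positivity)]; linarith
  have h4 : ω ^ 2 / κ * (2 * (2 * κ) / (l * σ) + 2) ≤ 10 * ω := by
    have e1 : 2 * (2 * κ) / (l * σ) ≤ 8 * κ / σ := by
      rw [div_le_div_iff₀ (by positivity) hσ]
      nlinarith
    have e2 : (2 : ℝ) ≤ 2 * κ / σ := by rw [le_div_iff₀ hσ]; linarith
    calc ω ^ 2 / κ * (2 * (2 * κ) / (l * σ) + 2) ≤ ω ^ 2 / κ * (8 * κ / σ + 2 * κ / σ) := by gcongr
      _ = 10 * ω * (ω / σ) := by field_simp; ring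
      _ ≤ 10 * ω * 1 := by gcongr; exact (div_le_one hσ).2 hωσ
      _ = _ := by ring
  calc ∑ z ∈ Z, |spikeCorr ω κ (-l * z + u)|
      ≤ ∑ z ∈ Z, (2 * ω * tophat (2 * ω) (-l * z + u) + 6 * (ω ^ 2 / κ) * tophat (2 * κ) (-l * z + u)) :=
        Finset.sum_le_sum fun z _ => abs_spikeCorr_le hω.le hκ (hωσ.trans hσκ) _
    _ = 2 * ω * ∑ z ∈ Z, tophat (2 * ω) (-l * z + u) + 6 * (ω ^ 2 / κ) * ∑ z ∈ Z, tophat (2 * κ) (-l * z + u) := by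
        rw [Finset.sum_add_distrib, ← Finset.mul_sum, ← Finset.mul_sum]
    _ ≤ 2 * ω * (8 + 2) + 6 * (ω ^ 2 / κ) * (2 * (2 * κ) / (l * σ) + 2) := by
        gcongr
        linarith
    _ ≤ 80 * ω := by linarith

lemma sum_abs_integral_spikeCorr_le (hω : 0 < ω) (hωσ : ω ≤ σ) (hσκ : σ ≤ κ) (hκϑ : 8 * κ ≤ ϑ)
    (hZ : ∀ z ∈ Z, ∀ z' ∈ Z, z ≠ z' → σ ≤ |z - z'|) {u : ℝ} (hu : ϑ ≤ |u|) (z₀ : ℝ) :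
    ∑ z ∈ Z, |∫ l in (1 / 2 : ℝ)..(3 / 2), spikeCorr ω κ ((z₀ - z) * l + u)| ≤ 1280 * ω * (κ / ϑ) := by
  have hσ : 0 < σ := by linarith
  have hκ : 0 < κ := by linarith
  have hϑ : 0 < ϑ := by linarith
  have h1 := sum_tophat_le hσ hZ (by linarith : 0 ≤ 2 * κ) (by norm_num : (-(1 / 2) : ℝ) ≠ 0) (z₀ * (1 / 2) + u)
  have h2 := sum_tophat_le hσ hZ (by linarith : 0 ≤ 2 * κ) (by norm_num : (-(3 / 2) : ℝ) ≠ 0) (z₀ * (3 / 2) + u)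
  rw [abs_neg, abs_of_pos (by norm_num)] at h1 h2
  have e2 : (2 : ℝ) ≤ 2 * κ / σ := by rw [le_div_iff₀ hσ]; linarith
  have h3 : 2 * (2 * κ) / (1 / 2 * σ) + 2 ≤ 10 * κ / σ := by
    have : 2 * (2 * κ) / (1 / 2 * σ) = 8 * κ / σ := by field_simp; ring
    rw [this, show 10 * κ / σ = 8 * κ / σ + 2 * κ / σ by ring]
    linarith
  have h4 : 2 * (2 * κ) / (3 / 2 * σ) + 2 ≤ 10 * κ / σ := by
    have : 2 * (2 * κ) / (3 / 2 * σ) ≤ 8 * κ / σ := by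
      rw [div_le_div_iff₀ (by positivity) hσ]
      nlinarith
    rw [show 10 * κ / σ = 8 * κ / σ + 2 * κ / σ by ring]
    linarith
  calc ∑ z ∈ Z, |∫ l in (1 / 2 : ℝ)..(3 / 2), spikeCorr ω κ ((z₀ - z) * l + u)|
      ≤ ∑ z ∈ Z, 64 * ω ^ 2 / ϑ * (tophat (2 * κ) (-(1 / 2) * z + (z₀ * (1 / 2) + u)) +
          tophat (2 * κ) (-(3 / 2) * z + (z₀ * (3 / 2) + u))) := by
        refine Finset.sum_le_sum fun z _ => ?_
        have h := abs_integral_spikeCorr_le hω.le hκ (hωσ.trans hσκ) hκϑ hu (D := z₀ - z)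
        rw [show (z₀ - z) * (1 / 2) + u = -(1 / 2) * z + (z₀ * (1 / 2) + u) by ring,
          show (z₀ - z) * (3 / 2) + u = -(3 / 2) * z + (z₀ * (3 / 2) + u) by ring] at h
        exact h
    _ = 64 * ω ^ 2 / ϑ * (∑ z ∈ Z, tophat (2 * κ) (-(1 / 2) * z + (z₀ * (1 / 2) + u)) +
          ∑ z ∈ Z, tophat (2 * κ) (-(3 / 2) * z + (z₀ * (3 / 2) + u))) := by
        rw [← Finset.mul_sum, Finset.sum_add_distrib]
    _ ≤ 64 * ω ^ 2 / ϑ * (10 * κ / σ + 10 * κ / σ) := by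
        gcongr
        · exact h1.trans h3
        · exact h2.trans h4
    _ = 1280 * ω * (κ / ϑ) * (ω / σ) := by field_simp; ring
    _ ≤ 1280 * ω * (κ / ϑ) * 1 := by gcongr; exact (div_le_one hσ).2 hωσ
    _ = _ := by ring

lemma intervalIntegrable_spikeCorr {ω κ D u : ℝ} : IntervalIntegrable (fun l => spikeCorr ω κ (D * l + u)) volume (1 / 2) (3 / 2) := by
  rcases eq_or_ne D 0 with rfl | hD
  · simp
  · exact (((integrable_spikeCorr ω κ).comp_add_right u).comp_mul_left' hD).intervalIntegrable

/-- The second moment of a sum of spikes over a product set. -/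
lemma second_moment_upper (hω : 0 < ω) (hωσ : ω ≤ σ) (hσκ : σ ≤ κ) (hκϑ : 8 * κ ≤ ϑ) (hσ1 : σ ≤ 1)
    (hZ : ∀ z ∈ Z, ∀ z' ∈ Z, z ≠ z' → σ ≤ |z - z'|) (hZ4 : ∀ z ∈ Z, |z| ≤ 4)
    (hν : ((Finset.univ.filter fun p : ι × ι => |X p.1 - X p.2| < ϑ).card : ℝ) ≤ ν * Fintype.card ι ^ 2) :
    ∫ l in (1 / 2 : ℝ)..(3 / 2), ∑ p : ι × ι, ∑ z ∈ Z, ∑ z' ∈ Z, spikeCorr ω κ ((z - z') * l + (X p.1 - X p.2)) ≤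
      Fintype.card ι ^ 2 * (800 * ν + 12800 * (κ / ϑ)) := by
  have hσ : 0 < σ := by linarith
  have hκ : 0 < κ := by linarith
  have hϑ : 0 < ϑ := by linarith
  have hcZ : (Z.card : ℝ) ≤ 10 / σ := by
    have h := sum_tophat_le hσ hZ (by norm_num : (0 : ℝ) ≤ 4) one_ne_zero 0
    rw [Finset.sum_congr rfl (g := fun _ => (1 : ℝ)) (fun z hz => tophat_of_le (by simpa using hZ4 z hz))] at h
    simp only [Finset.sum_const, nsmul_eq_mul, mul_one, abs_one, one_mul] at h
    have : (2 : ℝ) ≤ 2 / σ := by rw [le_div_iff₀ hσ]; linarith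
    rw [show 10 / σ = 2 * 4 / σ + 2 / σ by ring]
    linarith
  have hZω : (Z.card : ℝ) * ω ≤ 10 := by
    calc (Z.card : ℝ) * ω ≤ 10 / σ * σ := by gcongr
      _ = 10 := by field_simp
  set J : ι × ι → ℝ := fun p => ∫ l in (1 / 2 : ℝ)..(3 / 2), ∑ z ∈ Z, ∑ z' ∈ Z,
    spikeCorr ω κ ((z - z') * l + (X p.1 - X p.2)) with hJ
  have hii : ∀ u : ℝ, ∀ z ∈ Z, IntervalIntegrable (fun l => ∑ z' ∈ Z, spikeCorr ω κ ((z - z') * l + u))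
      volume (1 / 2) (3 / 2) := fun u z _ => intervalIntegrable_finsetSum' fun z' _ => intervalIntegrable_spikeCorr
  have hii' : ∀ u : ℝ, IntervalIntegrable (fun l => ∑ z ∈ Z, ∑ z' ∈ Z, spikeCorr ω κ ((z - z') * l + u))
      volume (1 / 2) (3 / 2) := fun u => intervalIntegrable_finsetSum' (hii u)
  have hnear : ∀ p, J p ≤ 800 := by
    intro p
    have : ∀ l ∈ Icc (1 / 2 : ℝ) (3 / 2), ∑ z ∈ Z, ∑ z' ∈ Z, spikeCorr ω κ ((z - z') * l + (X p.1 - X p.2)) ≤ 800 := by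
      intro l hl
      calc ∑ z ∈ Z, ∑ z' ∈ Z, spikeCorr ω κ ((z - z') * l + (X p.1 - X p.2)) ≤ ∑ z ∈ Z, 80 * ω := by
            refine Finset.sum_le_sum fun z _ => le_trans ?_ (sum_abs_spikeCorr_le hω hωσ hσκ hZ hl.1 (z * l + (X p.1 - X p.2)))
            refine Finset.sum_le_sum fun z' _ => (le_abs_self _).trans (le_of_eq ?_)
            ring_nf
        _ = 80 * (Z.card * ω) := by rw [Finset.sum_const, nsmul_eq_mul]; ring
        _ ≤ 800 := by linarith
    refine (intervalIntegral.integral_mono_on (by norm_num) (hii' _) intervalIntegrable_const this).trans ?_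
    simp
    norm_num
  have hfar : ∀ p, ϑ ≤ |X p.1 - X p.2| → J p ≤ 12800 * (κ / ϑ) := by
    intro p hp
    rw [hJ]
    simp only
    rw [intervalIntegral.integral_finsetSum (hii _)]
    calc _ ≤ ∑ z ∈ Z, 1280 * ω * (κ / ϑ) := by
          refine Finset.sum_le_sum fun z _ => ?_
          rw [intervalIntegral.integral_finsetSum fun z' _ => intervalIntegrable_spikeCorr]
          exact (Finset.sum_le_sum fun z' _ => le_abs_self _).trans
            (sum_abs_integral_spikeCorr_le hω hωσ hσκ hκϑ hZ hp z)
      _ = 1280 * (κ / ϑ) * (Z.card * ω) := by rw [Finset.sum_const, nsmul_eq_mul]; ring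
      _ ≤ 1280 * (κ / ϑ) * 10 := by gcongr
      _ = _ := by ring
  rw [intervalIntegral.integral_finsetSum fun p _ => hii' _]
  calc ∑ p : ι × ι, J p ≤ ∑ p : ι × ι, (12800 * (κ / ϑ) + if |X p.1 - X p.2| < ϑ then 800 else 0) := by
        refine Finset.sum_le_sum fun p _ => ?_
        have : 0 ≤ κ / ϑ := by positivity
        split_ifs with h
        · have := hnear p
          linarith
        · have := hfar p (not_lt.1 h)
          linarith
    _ = Fintype.card ι ^ 2 * (12800 * (κ / ϑ)) +
        800 * ((Finset.univ.filter fun p : ι × ι => |X p.1 - X p.2| < ϑ).card : ℝ) := by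
        rw [Finset.sum_add_distrib, ← Finset.sum_filter]
        simp only [Finset.sum_const, nsmul_eq_mul, Finset.card_univ, Fintype.card_prod]
        push_cast
        ring
    _ ≤ Fintype.card ι ^ 2 * (12800 * (κ / ϑ)) + 800 * (ν * Fintype.card ι ^ 2) := by gcongr
    _ = _ := by ring

/-- If the spike sum is large on many boxes, its second moment is large. -/
theorem second_moment {B : Finset (ℤ × ℤ)} (hω : 0 < ω) (hωσ : ω ≤ σ) (hσκ : σ ≤ κ) (hκϑ : 8 * κ ≤ ϑ) (hσ1 : σ ≤ 1)
    (hZ : ∀ z ∈ Z, ∀ z' ∈ Z, z ≠ z' → σ ≤ |z - z'|) (hZ4 : ∀ z ∈ Z, |z| ≤ 4)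
    (hν : ((Finset.univ.filter fun p : ι × ι => |X p.1 - X p.2| < ϑ).card : ℝ) ≤ ν * Fintype.card ι ^ 2)
    (hε : 0 < ε) (hB : ∀ p ∈ B, 1 / 2 ≤ p.1 * ε ∧ (p.1 + 1) * ε ≤ 3 / 2)
    (hΦ : ∀ p ∈ B, ∀ l ∈ Ico (p.1 * ε) ((p.1 + 1) * ε), ∀ b ∈ Ico (p.2 * ε) ((p.2 + 1) * ε),
      m ≤ (∑ x, ∑ z ∈ Z, spike ω κ (b + (l * z + X x))) ^ 2) :
    m * (B.card * ε ^ 2) ≤ Fintype.card ι ^ 2 * (800 * ν + 12800 * (κ / ϑ)) := by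
  classical
  have hκ : 0 < κ := by linarith
  refine le_trans ?_ (second_moment_upper hω hωσ hσκ hκϑ hσ1 hZ hZ4 hν)
  set I : ℤ → ℝ → ℝ := fun i => (Ico (i * ε) ((i + 1) * ε)).indicator fun _ => 1 with hI
  have hIe : ∀ i t, I i t = if i = ⌊t / ε⌋ then 1 else 0 := by
    intro i t
    rw [hI]
    simp only [indicator_apply, mem_Ico]
    refine if_congr ?_ rfl rfl
    rw [eq_comm, Int.floor_eq_iff, le_div_iff₀ hε, div_lt_iff₀ hε]
  have hIi : ∀ i, Integrable (I i) := fun i =>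
    (integrable_indicator_iff measurableSet_Ico).2 (by simp)
  have hIint : ∀ i, ∫ t, I i t = ε := fun i => by
    rw [hI]
    simp only
    rw [integral_indicator_const _ measurableSet_Ico]
    simp only [Measure.real, Real.volume_Ico, smul_eq_mul, mul_one]
    rw [ENNReal.toReal_ofReal (by nlinarith)]
    ring
  have hsq : ∀ l b, (∑ x, ∑ z ∈ Z, spike ω κ (b + (l * z + X x))) ^ 2 =
      ∑ p : ι × ι, ∑ z ∈ Z, ∑ z' ∈ Z, spike ω κ (b + (l * z + X p.1)) * spike ω κ (b + (l * z' + X p.2)) := by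
    intro l b
    rw [sq, Finset.sum_mul_sum, ← Finset.sum_product', Finset.univ_product_univ]
    exact Finset.sum_congr rfl fun p _ => Finset.sum_mul_sum _ _ _ _
  have hlow : ∀ l ∈ Icc (1 / 2 : ℝ) (3 / 2), m * ∑ p ∈ B, I p.1 l * ε ≤
      ∑ p : ι × ι, ∑ z ∈ Z, ∑ z' ∈ Z, spikeCorr ω κ ((z - z') * l + (X p.1 - X p.2)) := by
    intro l _
    have e1 : m * ∑ p ∈ B, I p.1 l * ε = ∫ b, m * ∑ p ∈ B, I p.1 l * I p.2 b := by
      rw [integral_const_mul, integral_finsetSum _ fun p _ => (hIi _).const_mul _]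
      congr 1
      refine Finset.sum_congr rfl fun p _ => ?_
      rw [integral_const_mul, hIint]
    have hi : ∀ p : ι × ι, ∀ z z' : ℝ, Integrable fun b =>
        spike ω κ (b + (l * z + X p.1)) * spike ω κ (b + (l * z' + X p.2)) := fun p z z' =>
      integrable_spike_mul hω.le hκ _ _
    have e2 : ∑ p : ι × ι, ∑ z ∈ Z, ∑ z' ∈ Z, spikeCorr ω κ ((z - z') * l + (X p.1 - X p.2)) =
        ∫ b, (∑ x, ∑ z ∈ Z, spike ω κ (b + (l * z + X x))) ^ 2 := by
      simp_rw [hsq]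
      rw [integral_finsetSum _ fun p _ => integrable_finsetSum _ fun z _ => integrable_finsetSum _ fun z' _ => hi p z z']
      refine Finset.sum_congr rfl fun p _ => ?_
      rw [integral_finsetSum _ fun z _ => integrable_finsetSum _ fun z' _ => hi p z z']
      refine Finset.sum_congr rfl fun z _ => ?_
      rw [integral_finsetSum _ fun z' _ => hi p z z']
      refine Finset.sum_congr rfl fun z' _ => ?_
      rw [integral_spike_mul]
      ring_nf
    rw [e1, e2]
    refine integral_mono ((integrable_finsetSum _ fun p _ => (hIi _).const_mul _).const_mul _) ?_ fun b => ?_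
    · simp_rw [hsq]
      exact integrable_finsetSum _ fun p _ => integrable_finsetSum _ fun z _ => integrable_finsetSum _ fun z' _ => hi p z z'
    · have e3 : ∑ p ∈ B, I p.1 l * I p.2 b = ∑ p ∈ B, if p = (⌊l / ε⌋, ⌊b / ε⌋) then 1 else 0 := by
        refine Finset.sum_congr rfl fun p _ => ?_
        rw [hIe, hIe]
        by_cases h1 : p.1 = ⌊l / ε⌋ <;> by_cases h2 : p.2 = ⌊b / ε⌋ <;> simp [h1, h2, Prod.ext_iff]
      simp only [e3]
      rw [Finset.sum_ite_eq']
      split_ifs with h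
      · rw [mul_one]
        refine hΦ _ h l ?_ b ?_
        · constructor
          · rw [← le_div_iff₀ hε]; exact Int.floor_le _
          · rw [← div_lt_iff₀ hε]; exact Int.lt_floor_add_one _
        · constructor
          · rw [← le_div_iff₀ hε]; exact Int.floor_le _
          · rw [← div_lt_iff₀ hε]; exact Int.lt_floor_add_one _
      · rw [mul_zero]; positivity
  have e4 : m * (B.card * ε ^ 2) = ∫ l in (1 / 2 : ℝ)..(3 / 2), m * ∑ p ∈ B, I p.1 l * ε := by
    rw [intervalIntegral.integral_const_mul,
      intervalIntegral.integral_finsetSum fun p _ => ((hIi _).mul_const _).intervalIntegrable]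
    congr 1
    rw [Finset.sum_congr rfl (g := fun _ => ε ^ 2)]
    · simp
    · intro p hp
      rw [intervalIntegral.integral_mul_const, sq, intervalIntegral.integral_of_le (by norm_num),
        ← integral_Icc_eq_integral_Ioc, setIntegral_eq_integral_of_forall_compl_eq_zero, hIint]
      intro t ht
      rw [hI]
      refine indicator_of_notMem (fun h => ht ?_) _
      have := hB p hp
      exact ⟨this.1.trans h.1, h.2.le.trans this.2⟩
  rw [e4]
  refine intervalIntegral.integral_mono_on (by norm_num) ?_ ?_ hlow
  · have : Integrable fun l => m * ∑ p ∈ B, I p.1 l * ε :=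
      (integrable_finsetSum _ fun p _ => (hIi _).mul_const _).const_mul _
    exact this.intervalIntegrable
  · exact intervalIntegrable_finsetSum' fun p _ => intervalIntegrable_finsetSum' fun z _ =>
      intervalIntegrable_finsetSum' fun z' _ => intervalIntegrable_spikeCorr

end SecondMoment

lemma sum_div_sq_le (M k : ℕ) : ∑ d ∈ Finset.Icc 2 (k + 2), ((M / d : ℕ) : ℝ) ^ 2 ≤ (M : ℝ) ^ 2 * (3 / 4 - 1 / (k + 2)) := by
  induction k with
  | zero =>
    have : ((M / 2 : ℕ) : ℝ) ≤ M / 2 := by exact_mod_cast Nat.cast_div_le (α := ℝ)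
    have h0 : (0 : ℝ) ≤ ((M / 2 : ℕ) : ℝ) := Nat.cast_nonneg _
    simp only [zero_add, Finset.Icc_self, Finset.sum_singleton, CharP.cast_eq_zero]
    nlinarith
  | succ k ih =>
    rw [show k + 1 + 2 = (k + 2) + 1 by ring, Finset.sum_Icc_succ_top (by omega)]
    have h1 : ((M / (k + 2 + 1) : ℕ) : ℝ) ≤ M / (k + 3) := by
      have := Nat.cast_div_le (α := ℝ) (m := M) (n := k + 2 + 1)
      refine this.trans (le_of_eq ?_)
      push_cast; ring
    have h2 : ((M / (k + 2 + 1) : ℕ) : ℝ) ^ 2 ≤ (M / (k + 3)) ^ 2 := pow_le_pow_left₀ (Nat.cast_nonneg _) h1 2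
    have h3 : ((M : ℝ) / (k + 3)) ^ 2 ≤ M ^ 2 * (1 / (k + 2) - 1 / (k + 3)) := by
      rw [div_pow, div_eq_mul_one_div]
      gcongr
      rw [div_sub_div _ _ (by positivity) (by positivity), div_le_div_iff₀ (by positivity) (by positivity)]
      nlinarith [(Nat.cast_nonneg k : (0 : ℝ) ≤ k)]
    push_cast
    rw [show (k : ℝ) + 1 + 2 = k + 3 by ring]
    linarith

/-- At least a quarter of the pairs in a square are coprime. -/
lemma sq_le_card_coprime (M : ℕ) : (M : ℝ) ^ 2 / 4 ≤
    (((Finset.Icc 1 M ×ˢ Finset.Icc 1 M).filter fun p : ℕ × ℕ => Nat.Coprime p.1 p.2).card : ℝ) := by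
  classical
  set S := Finset.Icc 1 M ×ˢ Finset.Icc 1 M with hS
  have hcardS : (S.card : ℝ) = (M : ℝ) ^ 2 := by simp [hS, sq]
  have hsplit := Finset.card_filter_add_card_filter_not (s := S) (fun p : ℕ × ℕ => Nat.Coprime p.1 p.2)
  have hsub : (S.filter fun p : ℕ × ℕ => ¬ Nat.Coprime p.1 p.2) ⊆
      (Finset.Icc 2 (M + 2)).biUnion fun d => ((Finset.Ioc 0 M).filter (d ∣ ·)) ×ˢ ((Finset.Ioc 0 M).filter (d ∣ ·)) := by
    intro p hp
    simp only [hS, Finset.mem_filter, Finset.mem_product, Finset.mem_Icc, Finset.mem_biUnion, Finset.mem_Ioc] at hp ⊢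
    obtain ⟨⟨⟨h1, h2⟩, h3, h4⟩, h5⟩ := hp
    refine ⟨p.1.gcd p.2, ⟨?_, ?_⟩, ⟨⟨h1, h2⟩, Nat.gcd_dvd_left _ _⟩, ⟨h3, h4⟩, Nat.gcd_dvd_right _ _⟩
    · have := Nat.gcd_pos_of_pos_left p.2 h1
      have h6 : p.1.gcd p.2 ≠ 1 := h5
      omega
    · have := Nat.gcd_le_left p.2 h1
      omega
  have hc : (((S.filter fun p : ℕ × ℕ => ¬ Nat.Coprime p.1 p.2).card : ℕ) : ℝ) ≤ (M : ℝ) ^ 2 * (3 / 4) := by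
    calc (((S.filter fun p : ℕ × ℕ => ¬ Nat.Coprime p.1 p.2).card : ℕ) : ℝ)
        ≤ ∑ d ∈ Finset.Icc 2 (M + 2), ((M / d : ℕ) : ℝ) ^ 2 := by
          have := (Finset.card_le_card hsub).trans Finset.card_biUnion_le
          simp only [Finset.card_product, Nat.Ioc_filter_dvd_card_eq_div] at this
          have h' : (((S.filter fun p : ℕ × ℕ => ¬ Nat.Coprime p.1 p.2).card : ℕ) : ℝ) ≤
            ((∑ d ∈ Finset.Icc 2 (M + 2), M / d * (M / d) : ℕ) : ℝ) := by exact_mod_cast this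
          refine h'.trans (le_of_eq ?_)
          push_cast
          exact Finset.sum_congr rfl fun d _ => by ring
      _ ≤ (M : ℝ) ^ 2 * (3 / 4 - 1 / (M + 2)) := sum_div_sq_le M M
      _ ≤ _ := by gcongr; have : (0 : ℝ) ≤ 1 / (M + 2) := by positivity
                  linarith
  have : (((S.filter fun p : ℕ × ℕ => Nat.Coprime p.1 p.2).card : ℕ) : ℝ) +
      (((S.filter fun p : ℕ × ℕ => ¬ Nat.Coprime p.1 p.2).card : ℕ) : ℝ) = S.card := by exact_mod_cast hsplit
  linarith

lemma eq_of_xw_near {r : ℝ} (hr : 0 < r) (hr4 : r ≤ 1 / 4) : ∀ (h : ℕ) {l : ℕ} (v v' : Fin h → Bool) (t t' : Fin l → Bool),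
    |xw r (Fin.append v t) - xw r (Fin.append v' t')| < r ^ h → v = v' := by
  intro h
  induction h with
  | zero => intro l v v' t t' _; exact Subsingleton.elim _ _
  | succ h ih =>
    intro l v v' t t' hlt
    obtain ⟨b, u, rfl⟩ : ∃ b u, v = Fin.cons b u := ⟨v 0, Fin.tail v, (Fin.cons_self_tail v).symm⟩
    obtain ⟨b', u', rfl⟩ : ∃ b u, v' = Fin.cons b u := ⟨v' 0, Fin.tail v', (Fin.cons_self_tail v').symm⟩
    have e : ∀ (b : Bool) (u : Fin h → Bool) (t : Fin l → Bool),
        xw r (Fin.append (Fin.cons b u : Fin (h + 1) → Bool) t) = (if b then 1 else 0) + r * xw r (Fin.append u t) := by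
      intro b u t
      rw [xw_append, xw_append, xw_cons]
      ring
    rw [e, e] at hlt
    have x1 := xw_nonneg hr (Fin.append u t)
    have x2 := xw_nonneg hr (Fin.append u' t')
    have x3 := xw_le hr hr4 (Fin.append u t)
    have x4 := xw_le hr hr4 (Fin.append u' t')
    have hp : r ^ (h + 1) ≤ 1 / 4 := by
      rw [pow_succ]
      have := pow_le_one₀ (n := h) hr.le (by linarith)
      nlinarith
    have y1 : r * xw r (Fin.append u t) ≤ 1 / 3 := by nlinarith
    have y2 : r * xw r (Fin.append u' t') ≤ 1 / 3 := by nlinarith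
    have y3 : 0 ≤ r * xw r (Fin.append u t) := by positivity
    have y4 : 0 ≤ r * xw r (Fin.append u' t') := by positivity
    have hb : b = b' := by
      rw [abs_lt] at hlt
      cases b <;> cases b' <;> simp at hlt ⊢ <;> linarith
    subst hb
    have : u = u' := by
      refine ih u u' t t' ?_
      rw [add_sub_add_left_eq_sub, ← mul_sub, abs_mul, abs_of_pos hr, pow_succ'] at hlt
      exact lt_of_mul_lt_mul_left hlt hr.le
    rw [this]

lemma card_near_pairs_le {r : ℝ} (hr : 0 < r) (hr4 : r ≤ 1 / 4) {h n : ℕ} (hn : h ≤ n) :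
    ((Finset.univ.filter fun p : (Fin n → Bool) × (Fin n → Bool) => |xw r p.1 - xw r p.2| < r ^ h).card : ℝ) ≤
      (1 / 2) ^ h * (Fintype.card (Fin n → Bool) : ℝ) ^ 2 := by
  classical
  obtain ⟨l, rfl⟩ := Nat.exists_eq_add_of_le hn
  have hap : ∀ w : Fin (h + l) → Bool, ∃ (v : Fin h → Bool) (t : Fin l → Bool), w = Fin.append v t := fun w =>
    ⟨fun i => w (Fin.castAdd l i), fun i => w (Fin.natAdd h i), (Fin.append_castAdd_natAdd (f := w)).symm⟩
  have hcard : (Finset.univ.filter fun p : (Fin (h + l) → Bool) × (Fin (h + l) → Bool) => |xw r p.1 - xw r p.2| < r ^ h).card ≤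
      (Finset.univ : Finset ((Fin (h + l) → Bool) × (Fin l → Bool))).card := by
    refine Finset.card_le_card_of_injOn (fun p => (p.1, fun i => p.2 (Fin.natAdd h i))) (fun _ _ => Finset.mem_coe.2 (Finset.mem_univ _)) ?_
    rintro ⟨w, w'⟩ hw ⟨z, z'⟩ hz hEq
    simp only [Finset.coe_filter, Finset.mem_univ, true_and, mem_ofPred_eq] at hw hz
    simp only [Prod.mk.injEq] at hEq
    obtain ⟨rfl, h2⟩ := hEq
    obtain ⟨v, t, rfl⟩ := hap w
    obtain ⟨v', t', rfl⟩ := hap w'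
    obtain ⟨v'', t'', rfl⟩ := hap z'
    have e1 := eq_of_xw_near hr hr4 h v v' t t' hw
    have e2 := eq_of_xw_near hr hr4 h v v'' t t'' hz
    simp only [Fin.append_right] at h2
    have : t' = t'' := h2
    rw [← e1, ← e2, this]
  have : ((Finset.univ.filter fun p : (Fin (h + l) → Bool) × (Fin (h + l) → Bool) => |xw r p.1 - xw r p.2| < r ^ h).card : ℝ) ≤
      ((Finset.univ : Finset ((Fin (h + l) → Bool) × (Fin l → Bool))).card : ℝ) := by exact_mod_cast hcard
  refine this.trans (le_of_eq ?_)
  simp only [Finset.card_univ, Fintype.card_prod, Fintype.card_pi, Fintype.card_bool, Finset.prod_const, Fintype.card_fin]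
  push_cast
  rw [pow_add, mul_pow, one_div, inv_pow]
  field_simp

/-- A lattice without short vectors has two independent vectors close to the vertical direction. -/
lemma exists_vertical_pair {a : ℝ} {Λ : SLR} (h : Bad a Λ) (ha : 1 ≤ a) :
    ∃ m₁ m₂ k₁ k₂ : ℤ, m₁ * k₂ - m₂ * k₁ ≠ 0 ∧
      (|Λ 0 0 * m₁ + Λ 0 1 * m₂| ≤ 4 * a ∧ |Λ 1 0 * m₁ + Λ 1 1 * m₂ - 100 * a| ≤ 4 * a) ∧
      (|Λ 0 0 * k₁ + Λ 0 1 * k₂| ≤ 4 * a ∧ |Λ 1 0 * k₁ + Λ 1 1 * k₂ - 100 * a| ≤ 4 * a) := by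
  obtain ⟨γ, hγ⟩ : ∃ γ, γ = redZ Λ := ⟨_, rfl⟩
  have hE : red Λ = Λ * embZ γ := by rw [hγ]; rfl
  obtain ⟨E, hE'⟩ : ∃ E, E = red Λ := ⟨_, rfl⟩
  have hEb : ∀ i j, |E i j| ≤ 2 * a := fun i j => hE' ▸ h.abs_red_le ha i j
  have hdet := E.det_eq
  have hγdet : γ 0 0 * γ 1 1 - γ 0 1 * γ 1 0 = 1 := by rw [← Matrix.det_fin_two]; exact γ.2
  have hent : ∀ i j, E i j = Λ i 0 * (γ 0 j : ℤ) + Λ i 1 * (γ 1 j : ℤ) := by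
    intro i j
    rw [hE', hE, SLR.mul_apply, embZ_apply, embZ_apply]
  obtain ⟨s, hs⟩ : ∃ s, s = round (-E 0 1 * (100 * a)) := ⟨_, rfl⟩
  obtain ⟨t, ht⟩ : ∃ t, t = round (E 0 0 * (100 * a)) := ⟨_, rfl⟩
  have hs' : |(s : ℝ) - -E 0 1 * (100 * a)| ≤ 1 / 2 := by rw [hs, abs_sub_comm]; exact abs_sub_round _
  have ht' : |(t : ℝ) - E 0 0 * (100 * a)| ≤ 1 / 2 := by rw [ht, abs_sub_comm]; exact abs_sub_round _
  have b0 : |E 0 0 * s + E 0 1 * t| ≤ 2 * a := by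
    have e : E 0 0 * s + E 0 1 * t = E 0 0 * (s - -E 0 1 * (100 * a)) + E 0 1 * (t - E 0 0 * (100 * a)) := by ring
    rw [e]
    have := abs_mul_le_mul (hEb 0 0) hs'
    have := abs_mul_le_mul (hEb 0 1) ht'
    refine (abs_add_le _ _).trans ?_
    linarith
  have b1 : |E 1 0 * s + E 1 1 * t - 100 * a| ≤ 2 * a := by
    have e : E 1 0 * s + E 1 1 * t - 100 * a = E 1 0 * (s - -E 0 1 * (100 * a)) + E 1 1 * (t - E 0 0 * (100 * a)) := by
      linear_combination 100 * a * hdet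
    rw [e]
    have := abs_mul_le_mul (hEb 1 0) hs'
    have := abs_mul_le_mul (hEb 1 1) ht'
    refine (abs_add_le _ _).trans ?_
    linarith
  have hne : s ≠ 0 ∨ t ≠ 0 := by
    by_contra! hc
    rw [hc.1, hc.2] at b1
    simp only [Int.cast_zero, mul_zero, add_zero, zero_sub, abs_neg] at b1
    rw [abs_of_pos (by linarith)] at b1
    linarith
  have main : ∀ u w : ℤ, (u = 1 ∧ w = 0 ∨ u = 0 ∧ w = 1) → s * w - t * u ≠ 0 →
      ∃ m₁ m₂ k₁ k₂ : ℤ, m₁ * k₂ - m₂ * k₁ ≠ 0 ∧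
      (|Λ 0 0 * m₁ + Λ 0 1 * m₂| ≤ 4 * a ∧ |Λ 1 0 * m₁ + Λ 1 1 * m₂ - 100 * a| ≤ 4 * a) ∧
      (|Λ 0 0 * k₁ + Λ 0 1 * k₂| ≤ 4 * a ∧ |Λ 1 0 * k₁ + Λ 1 1 * k₂ - 100 * a| ≤ 4 * a) := by
    intro u w huw hd
    have hr : ∀ i, ∀ x y : ℤ, Λ i 0 * ((γ 0 0 * x + γ 0 1 * y : ℤ) : ℝ) + Λ i 1 * ((γ 1 0 * x + γ 1 1 * y : ℤ) : ℝ) =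
        E i 0 * x + E i 1 * y := by
      intro i x y
      rw [hent, hent]
      push_cast
      ring
    have hu : ∀ i, |E i 0 * u + E i 1 * w| ≤ 2 * a := by
      intro i
      rcases huw with ⟨rfl, rfl⟩ | ⟨rfl, rfl⟩
      · simpa using hEb i 0
      · simpa using hEb i 1
    refine ⟨γ 0 0 * s + γ 0 1 * t, γ 1 0 * s + γ 1 1 * t, γ 0 0 * (s + u) + γ 0 1 * (t + w),
      γ 1 0 * (s + u) + γ 1 1 * (t + w), ?_, ?_, ?_⟩
    · have : (γ 0 0 * s + γ 0 1 * t) * (γ 1 0 * (s + u) + γ 1 1 * (t + w)) -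
          (γ 1 0 * s + γ 1 1 * t) * (γ 0 0 * (s + u) + γ 0 1 * (t + w)) = s * w - t * u := by
        linear_combination (s * w - t * u) * hγdet
      rwa [this]
    · rw [hr, hr]
      exact ⟨b0.trans (by linarith), b1.trans (by linarith)⟩
    · rw [hr, hr]
      have h0 := abs_le.1 (hu 0)
      have h1 := abs_le.1 (hu 1)
      rw [abs_le] at b0 b1
      push_cast
      constructor <;> rw [abs_le] <;> constructor <;> linarith
  rcases hne with hne | hne
  · exact main 0 1 (Or.inr ⟨rfl, rfl⟩) (by simpa using hne)
  · exact main 1 0 (Or.inl ⟨rfl, rfl⟩) (by simpa using hne)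

section
variable {a s e lam β τ P Q P' Q' x x' l b δ : ℝ}

lemma lt_abs_affine (ha : 1 ≤ a) (hs : 0 < s) (hse : s ^ 2 * e = 1) (he1 : e ≤ 1)
    (hl1 : 9 / 10 ≤ lam) (hl2 : lam ≤ 10 / 9) (hβ : |β| ≤ 1 / 10) (hτ : |τ| ≤ e / 100)
    (hP' : P' = lam * P + β * (Q + τ * P)) (hQ' : Q' * lam = Q + τ * P)
    (hQ : 0 < Q) (hQs : 2 * a * Q ≤ s) (hP : |P| ≤ 4 * Q) (hx0 : 0 ≤ x) (hx : x ≤ 4 / 3)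
    (hl : |l - lam ^ 2| ≤ e / 100) (hb : |b - lam * β| ≤ e / 100)
    (hbad : 1 / a ≤ max |s * (P' + x * Q')| |s⁻¹ * Q'|) :
    e / 2 < |b + (l * (P / Q) + x)| := by
  have he : 0 < e := by
    by_contra! h
    nlinarith [sq_nonneg s]
  obtain ⟨z, hz⟩ : ∃ z, z = P / Q := ⟨_, rfl⟩
  have hPz : P = z * Q := by rw [hz, div_mul_cancel₀ _ hQ.ne']
  rw [← hz]
  have hz4 : |z| ≤ 4 := by rwa [hz, abs_div, abs_of_pos hQ, div_le_iff₀ hQ]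
  have hτz : |τ * z| ≤ e / 100 * 4 := abs_mul_le_mul hτ hz4
  have hτz' := abs_le.1 hτz
  have hQ1 : Q' * lam = Q * (1 + τ * z) := by rw [hQ', hPz]; ring
  have hQle : |Q'| < 2 * Q := by
    have h1 : |Q'| * lam = Q * (1 + τ * z) := by
      have : |Q'| * lam = |Q' * lam| := by rw [abs_mul, abs_of_pos (by linarith : 0 < lam)]
      rw [this, hQ1, abs_of_pos (mul_pos hQ (by linarith))]
    have h2 : Q * (1 + τ * z) ≤ Q * (104 / 100) := by gcongr; linarith
    have h3 : |Q'| * (9 / 10) ≤ |Q'| * lam := by gcongr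
    linarith
  have h1 : 1 / a ≤ |s * (P' + x * Q')| := by
    rcases le_max_iff.1 hbad with h | h
    · exact h
    · exfalso
      rw [abs_mul, abs_of_pos (inv_pos.2 hs), div_le_iff₀ (by linarith)] at h
      have : s⁻¹ * |Q'| * a < s⁻¹ * (2 * Q) * a := by gcongr
      have h4 : s⁻¹ * (2 * Q) * a = s⁻¹ * (2 * a * Q) := by ring
      have h5 : s⁻¹ * (2 * a * Q) ≤ s⁻¹ * s := by gcongr
      rw [inv_mul_cancel₀ hs.ne'] at h5
      linarith
  have hid : (P' + x * Q') * lam = Q * (lam ^ 2 * z + (1 + τ * z) * (lam * β + x)) := by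
    rw [add_mul, mul_assoc x, hQ1, hP', hPz]
    ring
  obtain ⟨Y, hY⟩ : ∃ Y, Y = lam ^ 2 * z + (1 + τ * z) * (lam * β + x) := ⟨_, rfl⟩
  rw [← hY] at hid
  have hYl : 9 / 5 * e ≤ |Y| := by
    have h2 : |P' + x * Q'| * lam = Q * |Y| := by
      have : |P' + x * Q'| * lam = |(P' + x * Q') * lam| := by rw [abs_mul _ lam, abs_of_pos (by linarith : 0 < lam)]
      rw [this, hid, abs_mul, abs_of_pos hQ]
    rw [abs_mul, abs_of_pos hs, div_le_iff₀ (by linarith)] at h1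
    have h3 : lam ≤ s * (Q * |Y|) * a := by
      rw [← h2]
      have : 1 * lam ≤ s * |P' + x * Q'| * a * lam := by gcongr
      linarith
    have h4 : 2 * (s * (Q * |Y|) * a) ≤ s * s * |Y| := by
      have : (2 * a * Q) * (s * |Y|) ≤ s * (s * |Y|) := by gcongr
      linarith
    have h5 : 9 / 5 ≤ s ^ 2 * |Y| := by nlinarith
    have h6 : 9 / 5 * e ≤ s ^ 2 * |Y| * e := by gcongr
    have h7 : s ^ 2 * |Y| * e = |Y| := by rw [mul_right_comm, hse, one_mul]
    linarith
  have hlb : |lam * β| ≤ 10 / 9 * (1 / 10) := abs_mul_le_mul (by rw [abs_le]; constructor <;> linarith) hβ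
  have hlb' := abs_le.1 hlb
  have e1 : |τ * z * (lam * β + x)| ≤ e / 100 * 4 * (3 / 2) :=
    abs_mul_le_mul hτz (by rw [abs_le]; constructor <;> linarith)
  have e2 : |(l - lam ^ 2) * z| ≤ e / 100 * 4 := abs_mul_le_mul hl hz4
  have e3 : Y = b + (l * z + x) - ((b - lam * β) + (l - lam ^ 2) * z - τ * z * (lam * β + x)) := by
    rw [hY]; ring
  have e4 : |Y| ≤ |b + (l * z + x)| + |((b - lam * β) + (l - lam ^ 2) * z - τ * z * (lam * β + x))| := by
    rw [e3]; exact abs_sub _ _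
  have e5 : |((b - lam * β) + (l - lam ^ 2) * z - τ * z * (lam * β + x))| ≤ e / 100 + e / 100 * 4 + e / 100 * 4 * (3 / 2) :=
    (abs_sub _ _).trans (add_le_add ((abs_add_le _ _).trans (add_le_add hb e2)) e1)
  linarith

lemma abs_affine_le (ha : 1 ≤ a) (he0 : 0 < e) (he1 : e ≤ δ) (hδ1 : δ ≤ 1)
    (hl1 : 9 / 10 ≤ lam) (hl2 : lam ≤ 10 / 9) (hβ : |β| ≤ 1 / 10) (hτ : |τ| ≤ e / 100)
    (hP' : P' = lam * P + β * (Q + τ * P)) (hQ' : Q' * lam = Q + τ * P)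
    (hQ : 0 < Q') (hQs : 12 * a * Q' ≤ 5 * s) (hP : |P' + x' * Q'| ≤ δ / 20 * Q') (hx0 : 0 ≤ x') (hx : x' ≤ 4 / 3)
    (hxx : |x - x'| ≤ 4 / 3 * δ)
    (hl : |l - lam ^ 2| ≤ e / 100) (hb : |b - lam * β| ≤ e / 100) :
    0 < Q ∧ 2 * a * Q ≤ s ∧ |P| ≤ 4 * Q ∧ |b + (l * (P / Q) + x)| ≤ 2 * δ := by
  obtain ⟨y, hy⟩ : ∃ y, y = P' / Q' := ⟨_, rfl⟩
  have hPy : P' = y * Q' := by rw [hy, div_mul_cancel₀ _ hQ.ne']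
  have hyx : |y + x'| ≤ δ / 20 := by
    rw [hPy, ← add_mul, abs_mul, abs_of_pos hQ] at hP
    exact le_of_mul_le_mul_right hP hQ
  have hyx' := abs_le.1 hyx
  have hy4 : |y| ≤ 7 / 5 := by rw [abs_le]; constructor <;> linarith
  have hlβ : |β * lam| ≤ 1 / 10 * (10 / 9) := abs_mul_le_mul hβ (by rw [abs_le]; constructor <;> linarith)
  have hlP : lam * P = (y - β * lam) * Q' := by
    rw [← hQ', hPy] at hP'
    linear_combination -hP'
  have hPle : |P| ≤ 17 / 10 * Q' := by
    have h1 : lam * |P| ≤ (7 / 5 + 1 / 10 * (10 / 9)) * Q' := by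
      have : lam * |P| = |lam * P| := by rw [abs_mul, abs_of_pos (by linarith : 0 < lam)]
      rw [this, hlP, abs_mul, abs_of_pos hQ]
      gcongr
      exact (abs_sub _ _).trans (add_le_add hy4 hlβ)
    have h2 : 9 / 10 * |P| ≤ lam * |P| := by gcongr
    linarith
  have hτP : |τ * P| ≤ e / 100 * (17 / 10 * Q') := abs_mul_le_mul hτ hPle
  have heQ : e / 100 * (17 / 10 * Q') ≤ 1 / 100 * (17 / 10 * Q') := by gcongr; linarith
  have hτP' := abs_le.1 hτP
  have hQ1 : 9 / 10 * Q' ≤ Q' * lam := by rw [mul_comm]; gcongr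
  have hQ2 : Q' * lam ≤ 10 / 9 * Q' := by rw [mul_comm]; gcongr
  have hQ0 : 0 < Q := by linarith
  have hQlo : 17 / 20 * Q' ≤ Q := by linarith
  have hQhi : Q ≤ 6 / 5 * Q' := by linarith
  have hPQ : |P| ≤ 4 * Q := by linarith
  refine ⟨hQ0, ?_, hPQ, ?_⟩
  · have : 2 * a * Q ≤ 2 * a * (6 / 5 * Q') := by gcongr
    linarith
  obtain ⟨z, hz⟩ : ∃ z, z = P / Q := ⟨_, rfl⟩
  have hPz : P = z * Q := by rw [hz, div_mul_cancel₀ _ hQ0.ne']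
  rw [← hz]
  have hz2 : |z| ≤ 2 := by
    rw [hz, abs_div, abs_of_pos hQ0, div_le_iff₀ hQ0]; linarith
  have hQz : Q' * lam = Q * (1 + τ * z) := by rw [hQ', hPz]; ring
  obtain ⟨Y, hY⟩ : ∃ Y, Y = lam ^ 2 * z + (1 + τ * z) * (lam * β + x') := ⟨_, rfl⟩
  have hid : (y + x') * (Q' * lam) = Q * Y := by
    have : (P' + x' * Q') * lam = Q * Y := by
      rw [add_mul, mul_assoc x', hQz, hP', hY, hPz]
      ring
    rw [← this, hPy]; ring
  have hYle : |Y| ≤ δ / 20 * (4 / 3) := by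
    have h1 : Q * |Y| ≤ Q * (δ / 20 * (4 / 3)) := by
      have : Q * |Y| = |Q * Y| := by rw [abs_mul, abs_of_pos hQ0]
      rw [this, ← hid, abs_mul, abs_of_pos (by linarith : 0 < Q' * lam)]
      calc |y + x'| * (Q' * lam) ≤ δ / 20 * (4 / 3 * Q) :=
            mul_le_mul hyx (by linarith) (by linarith) (by linarith)
        _ = _ := by ring
    exact le_of_mul_le_mul_left h1 hQ0
  have hlb' := abs_le.1 hlβ
  have hτz : |τ * z| ≤ e / 100 * 2 := abs_mul_le_mul hτ hz2
  have e1 : |τ * z * (lam * β + x')| ≤ e / 100 * 2 * (3 / 2) :=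
    abs_mul_le_mul hτz (by rw [abs_le]; constructor <;> linarith)
  have e2 : |(l - lam ^ 2) * z| ≤ e / 100 * 2 := abs_mul_le_mul hl hz2
  have e3 : b + (l * z + x) = Y + ((b - lam * β) + (l - lam ^ 2) * z - τ * z * (lam * β + x')) + (x - x') := by
    rw [hY]; ring
  rw [e3]
  have e5 : |((b - lam * β) + (l - lam ^ 2) * z - τ * z * (lam * β + x'))| ≤ e / 100 + e / 100 * 2 + e / 100 * 2 * (3 / 2) :=
    (abs_sub _ _).trans (add_le_add ((abs_add_le _ _).trans (add_le_add hb e2)) e1)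
  have e6 := (abs_add_le _ _).trans (add_le_add (abs_add_le Y ((b - lam * β) + (l - lam ^ 2) * z - τ * z * (lam * β + x'))) le_rfl |>.trans (add_le_add (add_le_add hYle e5) hxx))
  linarith
end

lemma flow_apply_zero (y x : ℝ) (Λ : SLR) (j : Fin 2) :
    (av y * uu x * Λ) 0 j = Real.exp y * (Λ 0 j + x * Λ 1 j) := by
  simp [SLR.mul_apply]
  ring

lemma flow_apply_one (y x : ℝ) (Λ : SLR) (j : Fin 2) :
    (av y * uu x * Λ) 1 j = (Real.exp y)⁻¹ * Λ 1 j := by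
  simp [SLR.mul_apply, Real.exp_neg]

lemma coprime_pair_ext {p q p' q' : ℕ} (hp : 0 < p) (h : p.Coprime q) (h' : p'.Coprime q')
    (e : p * q' = p' * q) : p = p' ∧ q = q' := by
  have h1 : p ∣ p' := h.dvd_of_dvd_mul_right (e ▸ Dvd.intro _ rfl)
  have h2 : p' ∣ p := h'.dvd_of_dvd_mul_right (e ▸ Dvd.intro _ rfl)
  have h3 := Nat.dvd_antisymm h1 h2
  subst h3
  exact ⟨rfl, (Nat.eq_of_mul_eq_mul_left hp e).symm⟩

/-- The slopes of lattice vectors that are short in the vertical direction and not too horizontal. -/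
def slopes (a s : ℝ) (g : SLR) : Set ℝ :=
  {z | ∃ p q : ℤ, 0 < g 1 0 * p + g 1 1 * q ∧ 2 * a * (g 1 0 * p + g 1 1 * q) ≤ s ∧
    |g 0 0 * p + g 0 1 * q| ≤ 4 * (g 1 0 * p + g 1 1 * q) ∧
    z = (g 0 0 * p + g 0 1 * q) / (g 1 0 * p + g 1 1 * q)}

lemma abs_le_of_mem_slopes {a s z : ℝ} {g : SLR} (hz : z ∈ slopes a s g) : |z| ≤ 4 := by
  obtain ⟨p, q, h1, h2, h3, rfl⟩ := hz
  rwa [abs_div, abs_of_pos h1, div_le_iff₀ h1]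

lemma slopes_cross (g : SLR) (p q p' q' : ℤ) :
    (g 0 0 * p + g 0 1 * q) * (g 1 0 * p' + g 1 1 * q') - (g 0 0 * p' + g 0 1 * q') * (g 1 0 * p + g 1 1 * q) =
      ((p * q' - p' * q : ℤ) : ℝ) := by
  have := g.det_eq
  push_cast
  linear_combination (p * q' - p' * q) * this

lemma slopes_separated {a s z z' : ℝ} {g : SLR} (ha : 0 < a) (hs : 0 < s) (hz : z ∈ slopes a s g)
    (hz' : z' ∈ slopes a s g) (hne : z ≠ z') : 4 * a ^ 2 / s ^ 2 ≤ |z - z'| := by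
  obtain ⟨p, q, h1, h2, h3, rfl⟩ := hz
  obtain ⟨p', q', h1', h2', h3', rfl⟩ := hz'
  have hc := slopes_cross g p q p' q'
  obtain ⟨P, hP⟩ : ∃ P, P = g 0 0 * p + g 0 1 * q := ⟨_, rfl⟩
  obtain ⟨Q, hQ⟩ : ∃ Q, Q = g 1 0 * p + g 1 1 * q := ⟨_, rfl⟩
  obtain ⟨P', hP'⟩ : ∃ P, P = g 0 0 * p' + g 0 1 * q' := ⟨_, rfl⟩
  obtain ⟨Q', hQ'⟩ : ∃ Q, Q = g 1 0 * p' + g 1 1 * q' := ⟨_, rfl⟩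
  rw [← hP, ← hQ, ← hP', ← hQ'] at hc hne ⊢
  rw [← hQ] at h1 h2
  rw [← hQ'] at h1' h2'
  rw [div_sub_div _ _ h1.ne' h1'.ne', abs_div, abs_of_pos (mul_pos h1 h1')]
  have h4 : P * Q' - Q * P' ≠ 0 := by
    intro h
    apply hne
    rw [div_eq_div_iff h1.ne' h1'.ne']
    linarith
  have h5 : 1 ≤ |P * Q' - Q * P'| := by
    rw [mul_comm Q, hc] at h4 ⊢
    rw [← Int.cast_abs]
    exact_mod_cast Int.one_le_abs (by exact_mod_cast h4)
  rw [div_le_div_iff₀ (by positivity) (by positivity)]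
  have h6 : (2 * a * Q) * (2 * a * Q') ≤ s * s := by gcongr
  calc 4 * a ^ 2 * (Q * Q') = (2 * a * Q) * (2 * a * Q') := by ring
    _ ≤ 1 * (s * s) := by linarith
    _ ≤ |P * Q' - Q * P'| * (s * s) := by gcongr
    _ = _ := by ring

lemma slopes_finite {a s : ℝ} {g : SLR} (ha : 0 < a) (hs : 0 < s) : (slopes a s g).Finite := by
  have hσ : 0 < 4 * a ^ 2 / s ^ 2 := by positivity
  refine Set.Finite.of_finite_image (f := fun z => ⌊z / (4 * a ^ 2 / s ^ 2)⌋) ?_ ?_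
  · refine (Set.finite_Icc ⌊-4 / (4 * a ^ 2 / s ^ 2)⌋ ⌊4 / (4 * a ^ 2 / s ^ 2)⌋).subset ?_
    rintro _ ⟨z, hz, rfl⟩
    have := abs_le.1 (abs_le_of_mem_slopes hz)
    exact ⟨Int.floor_le_floor (by gcongr; exact this.1), Int.floor_le_floor (by gcongr; exact this.2)⟩
  · intro z hz z' hz' h
    by_contra hne
    have h2 := Int.abs_sub_lt_one_of_floor_eq_floor h
    rw [← sub_div, abs_div, abs_of_pos hσ, div_lt_one hσ] at h2
    exact h2.not_ge (slopes_separated ha hs hz hz' hne)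

section
variable {r a lam β τ l b : ℝ} {g Λ : SLR}

/-- On a box around the coordinates of a lattice with a well-spread orbit, the spike sum is very
negative. -/
lemma sum_spike_le (hr : 0 < r) (hr4 : r ≤ 1 / 4) (ha : 1 ≤ a) {h n M : ℕ} (hn : 2 * h ≤ n)
    (hbad : ∀ v : Fin n → Bool, Bad a (av (n * al r) * uu (xw r v) * Λ))
    (hbad' : ∀ v : Fin (2 * h) → Bool, Bad a (av ((2 * h : ℕ) * al r) * uu (xw r v) * Λ))
    (hl1 : 9 / 10 ≤ lam) (hl2 : lam ≤ 10 / 9) (hβ : |β| ≤ 1 / 10) (hτ : |τ| ≤ r ^ n / 100)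
    (h0 : ∀ j, Λ 0 j = lam * g 0 j + β * (g 1 j + τ * g 0 j)) (h1 : ∀ j, Λ 1 j * lam = g 1 j + τ * g 0 j)
    (hl : |l - lam ^ 2| ≤ r ^ n / 100) (hb : |b - lam * β| ≤ r ^ n / 100)
    (hM : 500 * a ^ 2 * M * Real.exp ((2 * h : ℕ) * al r) ≤ Real.exp (n * al r))
    {Z : Finset ℝ} (hZ : ∀ z, z ∈ Z ↔ z ∈ slopes a (Real.exp (n * al r)) g) (v : Fin n → Bool) :
    ∑ z ∈ Z, spike (r ^ n / 2) (2 * r ^ (2 * h)) (b + (l * z + xw r v)) ≤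
      -(r ^ n / 2 / (2 * r ^ (2 * h)) * ((M : ℝ) ^ 2 / 4)) := by
  classical
  obtain ⟨s, hs⟩ : ∃ s, s = Real.exp (n * al r) := ⟨_, rfl⟩
  obtain ⟨S, hS⟩ : ∃ S, S = Real.exp ((2 * h : ℕ) * al r) := ⟨_, rfl⟩
  have hs0 : 0 < s := hs ▸ Real.exp_pos _
  have hS0 : 0 < S := hS ▸ Real.exp_pos _
  have hse : s ^ 2 * r ^ n = 1 := by
    rw [hs, ← exp_al hr, ← Real.exp_nat_mul, ← Real.exp_add]
    simp
  have hSe : S ^ 2 * r ^ (2 * h) = 1 := by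
    rw [hS, ← exp_al hr, ← Real.exp_nat_mul, ← Real.exp_add]
    simp
  rw [← hs] at hZ hM
  rw [← hS] at hM
  have he0 : 0 < r ^ n := pow_pos hr n
  have hδ0 : 0 < r ^ (2 * h) := pow_pos hr _
  have heδ : r ^ n ≤ r ^ (2 * h) := pow_le_pow_of_le_one hr.le (by linarith) hn
  have hδ1 : r ^ (2 * h) ≤ 1 := pow_le_one₀ hr.le (by linarith)
  have hrel0 : ∀ p q : ℤ, Λ 0 0 * p + Λ 0 1 * q = lam * (g 0 0 * p + g 0 1 * q) +
      β * ((g 1 0 * p + g 1 1 * q) + τ * (g 0 0 * p + g 0 1 * q)) := by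
    intro p q; rw [h0, h0]; ring
  have hrel1 : ∀ p q : ℤ, (Λ 1 0 * p + Λ 1 1 * q) * lam = (g 1 0 * p + g 1 1 * q) + τ * (g 0 0 * p + g 0 1 * q) := by
    intro p q; linear_combination (p : ℝ) * h1 0 + (q : ℝ) * h1 1
  have hω : ∀ z ∈ Z, tophat (r ^ n / 2) (b + (l * z + xw r v)) = 0 := by
    intro z hz
    obtain ⟨p, q, z1, z2, z3, rfl⟩ := (hZ z).1 hz
    refine tophat_of_lt ?_
    have hpq : p ≠ 0 ∨ q ≠ 0 := by
      by_contra! hc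
      rw [hc.1, hc.2] at z1
      simp at z1
    have hB := hbad v p q hpq
    rw [flow_apply_zero, flow_apply_zero, flow_apply_one, flow_apply_one, ← hs] at hB
    refine lt_abs_affine ha hs0 hse (heδ.trans hδ1) hl1 hl2 hβ hτ (hrel0 p q) (hrel1 p q) z1 z2 z3
      (xw_nonneg hr v) (xw_le hr hr4 v) hl hb ?_
    convert hB using 3 <;> ring
  have hcard : (M : ℝ) ^ 2 / 4 ≤ ∑ z ∈ Z, tophat (2 * r ^ (2 * h)) (b + (l * z + xw r v)) := by
    obtain ⟨t, rfl⟩ := Nat.exists_eq_add_of_le hn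
    obtain ⟨v', v'', hv⟩ : ∃ (v' : Fin (2 * h) → Bool) (v'' : Fin t → Bool), v = Fin.append v' v'' :=
      ⟨fun i => v (Fin.castAdd t i), fun i => v (Fin.natAdd (2 * h) i), (Fin.append_castAdd_natAdd (f := v)).symm⟩
    have hxx : |xw r v - xw r v'| ≤ 4 / 3 * r ^ (2 * h) := by
      rw [hv, xw_append, add_sub_cancel_left, abs_mul, abs_of_pos hδ0, abs_of_nonneg (xw_nonneg hr _), mul_comm]
      gcongr
      exact xw_le hr hr4 _
    obtain ⟨m₁, m₂, k₁, k₂, hdet, ⟨hf0, hf1⟩, hf2, hf3⟩ := exists_vertical_pair (hbad' v') ha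
    rw [flow_apply_zero, flow_apply_zero, ← hS] at hf0 hf2
    rw [flow_apply_one, flow_apply_one, ← hS] at hf1 hf3
    refine (sq_le_card_coprime M).trans ?_
    obtain ⟨C, hC⟩ : ∃ C, C = (Finset.Icc 1 M ×ˢ Finset.Icc 1 M).filter fun p : ℕ × ℕ => Nat.Coprime p.1 p.2 := ⟨_, rfl⟩
    rw [← hC]
    have hkey : ∀ c ∈ C, ∃ X Y : ℤ, X = c.1 * m₁ + c.2 * k₁ ∧ Y = c.1 * m₂ + c.2 * k₂ ∧
        0 < g 1 0 * X + g 1 1 * Y ∧ 2 * a * (g 1 0 * X + g 1 1 * Y) ≤ s ∧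
        |g 0 0 * X + g 0 1 * Y| ≤ 4 * (g 1 0 * X + g 1 1 * Y) ∧
        |b + (l * ((g 0 0 * X + g 0 1 * Y) / (g 1 0 * X + g 1 1 * Y)) + xw r v)| ≤ 2 * r ^ (2 * h) := by
      intro c hc
      rw [hC] at hc
      simp only [Finset.mem_filter, Finset.mem_product, Finset.mem_Icc] at hc
      obtain ⟨⟨⟨c1, c2⟩, c3, c4⟩, -⟩ := hc
      have c1' : (1 : ℝ) ≤ c.1 := by exact_mod_cast c1
      have c2' : (c.1 : ℝ) ≤ M := by exact_mod_cast c2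
      have c3' : (1 : ℝ) ≤ c.2 := by exact_mod_cast c3
      have c4' : (c.2 : ℝ) ≤ M := by exact_mod_cast c4
      obtain ⟨X, hX⟩ : ∃ X : ℤ, X = c.1 * m₁ + c.2 * k₁ := ⟨_, rfl⟩
      obtain ⟨Y, hY⟩ : ∃ Y : ℤ, Y = c.1 * m₂ + c.2 * k₂ := ⟨_, rfl⟩
      refine ⟨X, Y, hX, hY, ?_⟩
      obtain ⟨P', hP'⟩ : ∃ P', P' = Λ 0 0 * X + Λ 0 1 * Y := ⟨_, rfl⟩
      obtain ⟨Q', hQ'⟩ : ∃ Q', Q' = Λ 1 0 * X + Λ 1 1 * Y := ⟨_, rfl⟩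
      obtain ⟨A₁, hA₁⟩ : ∃ A, A = S * (Λ 0 0 + xw r v' * Λ 1 0) * m₁ + S * (Λ 0 1 + xw r v' * Λ 1 1) * m₂ := ⟨_, rfl⟩
      obtain ⟨A₂, hA₂⟩ : ∃ A, A = S * (Λ 0 0 + xw r v' * Λ 1 0) * k₁ + S * (Λ 0 1 + xw r v' * Λ 1 1) * k₂ := ⟨_, rfl⟩
      obtain ⟨B₁, hB₁⟩ : ∃ A, A = S⁻¹ * Λ 1 0 * m₁ + S⁻¹ * Λ 1 1 * m₂ := ⟨_, rfl⟩
      obtain ⟨B₂, hB₂⟩ : ∃ A, A = S⁻¹ * Λ 1 0 * k₁ + S⁻¹ * Λ 1 1 * k₂ := ⟨_, rfl⟩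
      rw [← hA₁] at hf0
      rw [← hA₂] at hf2
      rw [← hB₁] at hf1
      rw [← hB₂] at hf3
      have eA : S * (P' + xw r v' * Q') = c.1 * A₁ + c.2 * A₂ := by
        rw [hP', hQ', hA₁, hA₂, hX, hY]; push_cast; ring
      have eB : S⁻¹ * Q' = c.1 * B₁ + c.2 * B₂ := by
        rw [hQ', hB₁, hB₂, hX, hY]; push_cast; ring
      have eB' : Q' = S * (c.1 * B₁ + c.2 * B₂) := by rw [← eB, mul_inv_cancel_left₀ hS0.ne']
      rw [abs_le] at hf0 hf1 hf2 hf3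
      have hBpos : 96 * a * (c.1 + c.2) ≤ c.1 * B₁ + c.2 * B₂ := by
        have : c.1 * (96 * a) ≤ c.1 * B₁ := by gcongr; linarith
        have : c.2 * (96 * a) ≤ c.2 * B₂ := by gcongr; linarith
        linarith
      have hBle : c.1 * B₁ + c.2 * B₂ ≤ 208 * a * M := by
        have : c.1 * B₁ ≤ M * (104 * a) := by gcongr <;> linarith
        have : c.2 * B₂ ≤ M * (104 * a) := by gcongr <;> linarith
        linarith
      have hAle : |c.1 * A₁ + c.2 * A₂| ≤ 4 * a * (c.1 + c.2) := by
        have u1 : c.1 * A₁ ≤ c.1 * (4 * a) := by gcongr; linarith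
        have u2 : c.2 * A₂ ≤ c.2 * (4 * a) := by gcongr; linarith
        have u3 : c.1 * (-(4 * a)) ≤ c.1 * A₁ := by gcongr; linarith
        have u4 : c.2 * (-(4 * a)) ≤ c.2 * A₂ := by gcongr; linarith
        rw [abs_le]
        constructor <;> linarith
      have hcc : 0 < a * ((c.1 : ℝ) + c.2) := by positivity
      have hBp : 0 < c.1 * B₁ + c.2 * B₂ := by linarith
      have hQ'0 : 0 < Q' := by rw [eB']; positivity
      refine abs_affine_le ha he0 heδ hδ1 hl1 hl2 hβ hτ (hP'.trans (hrel0 X Y)) ((congrArg (· * lam) hQ').trans (hrel1 X Y)) hQ'0 ?_ ?_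
        (xw_nonneg hr v') (xw_le hr hr4 v') hxx hl hb
      · rw [eB']
        have : 12 * a * (S * (c.1 * B₁ + c.2 * B₂)) ≤ 12 * a * (S * (208 * a * M)) := by gcongr
        have h9 : 0 ≤ a ^ 2 * M * S := by positivity
        linarith
      · have hδS : r ^ (2 * h) * S = S⁻¹ := by
          field_simp
          linarith
        have e5 : |P' + xw r v' * Q'| = S⁻¹ * |c.1 * A₁ + c.2 * A₂| := by
          rw [← eA, abs_mul, abs_of_pos hS0, inv_mul_cancel_left₀ hS0.ne']
        rw [e5, eB']
        calc S⁻¹ * |c.1 * A₁ + c.2 * A₂| ≤ S⁻¹ * (1 / 20 * (c.1 * B₁ + c.2 * B₂)) := by gcongr; linarith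
          _ = _ := by rw [← hδS]; ring
    have hle : C.card ≤ (Z.filter fun z => |b + (l * z + xw r v)| ≤ 2 * r ^ (2 * h)).card := by
      refine Finset.card_le_card_of_injOn (fun c : ℕ × ℕ =>
        (g 0 0 * ((c.1 * m₁ + c.2 * k₁ : ℤ) : ℝ) + g 0 1 * ((c.1 * m₂ + c.2 * k₂ : ℤ) : ℝ)) /
        (g 1 0 * ((c.1 * m₁ + c.2 * k₁ : ℤ) : ℝ) + g 1 1 * ((c.1 * m₂ + c.2 * k₂ : ℤ) : ℝ))) ?_ ?_
      · intro c hc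
        obtain ⟨X, Y, rfl, rfl, u1, u2, u3, u4⟩ := hkey c hc
        simp only [Finset.coe_filter, mem_ofPred_eq, hZ]
        exact ⟨⟨_, _, u1, u2, u3, rfl⟩, u4⟩
      · intro c hc c' hc' hEq
        obtain ⟨X, Y, hX, hY, u1, -, -, -⟩ := hkey c hc
        obtain ⟨X', Y', hX', hY', u1', -, -, -⟩ := hkey c' hc'
        simp only [← hX, ← hY, ← hX', ← hY'] at hEq
        rw [div_eq_div_iff u1.ne' u1'.ne'] at hEq
        have hz := slopes_cross g X Y X' Y'
        rw [hEq, sub_self] at hz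
        have hz' : X * Y' - X' * Y = 0 := by exact_mod_cast hz.symm
        have hz2 : ((c.1 : ℤ) * c'.2 - c'.1 * c.2) * (m₁ * k₂ - m₂ * k₁) = 0 := by
          rw [← hz', hX, hY, hX', hY']; ring
        have hz3 : (c.1 : ℤ) * c'.2 = c'.1 * c.2 := by
          rcases mul_eq_zero.1 hz2 with h | h
          · linarith
          · exact absurd h hdet
        have hz4 : c.1 * c'.2 = c'.1 * c.2 := by exact_mod_cast hz3
        rw [Finset.mem_coe, hC] at hc hc'
        simp only [Finset.mem_filter, Finset.mem_product, Finset.mem_Icc] at hc hc'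
        obtain ⟨e1, e2⟩ := coprime_pair_ext hc.1.1.1 hc.2 hc'.2 hz4
        exact Prod.ext e1 e2
    calc (C.card : ℝ) ≤ ((Z.filter fun z => |b + (l * z + xw r v)| ≤ 2 * r ^ (2 * h)).card : ℝ) := by exact_mod_cast hle
      _ = ∑ z ∈ Z.filter (fun z => |b + (l * z + xw r v)| ≤ 2 * r ^ (2 * h)), tophat (2 * r ^ (2 * h)) (b + (l * z + xw r v)) := by
          rw [Finset.sum_congr rfl (g := fun _ => (1 : ℝ)) (fun z hz => tophat_of_le (Finset.mem_filter.1 hz).2)]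
          simp
      _ ≤ _ := Finset.sum_le_sum_of_subset_of_nonneg (Finset.filter_subset _ _) fun _ _ _ => tophat_nonneg _ _
  have e : ∑ z ∈ Z, spike (r ^ n / 2) (2 * r ^ (2 * h)) (b + (l * z + xw r v)) =
      -(r ^ n / 2 / (2 * r ^ (2 * h)) * ∑ z ∈ Z, tophat (2 * r ^ (2 * h)) (b + (l * z + xw r v))) := by
    rw [Finset.mul_sum, ← Finset.sum_neg_distrib]
    refine Finset.sum_congr rfl fun z hz => ?_
    rw [spike, hω z hz, zero_sub]
  rw [e]
  gcongr
end

/-- The lattice `Λ` is obtained from `g` by a shear of parameter `τ` followed by an upper triangular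
matrix with entries `lam` and `β`, in the ranges needed for the second moment estimate. -/
structure Boxed (r a : ℝ) (n h : ℕ) (g Λ : SLR) (lam β τ : ℝ) : Prop where
  bad : ∀ v : Fin n → Bool, Bad a (av (n * al r) * uu (xw r v) * Λ)
  bad' : ∀ v : Fin (2 * h) → Bool, Bad a (av ((2 * h : ℕ) * al r) * uu (xw r v) * Λ)
  l1 : 9 / 10 ≤ lam
  l2 : lam ≤ 10 / 9
  hβ : |β| ≤ 1 / 10
  hτ : |τ| ≤ r ^ n / 100
  h0 : ∀ j, Λ 0 j = lam * g 0 j + β * (g 1 j + τ * g 0 j)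
  h1 : ∀ j, Λ 1 j * lam = g 1 j + τ * g 0 j

lemma floor_mul_bounds {x ε : ℝ} (hε : 0 < ε) : x - ε ≤ ⌊x / ε⌋ * ε ∧ (⌊x / ε⌋ + 1) * ε ≤ x + ε ∧
    ∀ y ∈ Ico (⌊x / ε⌋ * ε) ((⌊x / ε⌋ + 1) * ε), |y - x| ≤ ε := by
  have h1 : ⌊x / ε⌋ * ε ≤ x := (le_div_iff₀ hε).1 (Int.floor_le _)
  have h2 : x < (⌊x / ε⌋ + 1) * ε := (div_lt_iff₀ hε).1 (Int.lt_floor_add_one _)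
  refine ⟨by linarith, by linarith, fun y hy => abs_le.2 ?_⟩
  obtain ⟨h3, h4⟩ := hy
  constructor <;> linarith

theorem card_boxes_le {r a : ℝ} (hr : 0 < r) (hr4 : r ≤ 1 / 4) (ha : 200 ≤ a) {h n : ℕ} (h2 : 2 ≤ h)
    (hn : 2 * h ≤ n) (hS : 500 * a ^ 2 * Real.exp ((2 * h : ℕ) * al r) ≤ Real.exp (n * al r))
    {g : SLR} {B : Finset (ℤ × ℤ)} (hB : ∀ p ∈ B, ∃ Λ lam β τ, Boxed r a n h g Λ lam β τ ∧
      p = (⌊lam ^ 2 / (r ^ n / 100)⌋, ⌊lam * β / (r ^ n / 100)⌋)) :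
    B.card * (r ^ n / 100) ^ 2 ≤ a ^ 17 * (1 / 2) ^ h := by
  classical
  obtain ⟨s, hs⟩ : ∃ s, s = Real.exp (n * al r) := ⟨_, rfl⟩
  obtain ⟨S, hS'⟩ : ∃ S, S = Real.exp ((2 * h : ℕ) * al r) := ⟨_, rfl⟩
  have hs0 : 0 < s := hs ▸ Real.exp_pos _
  have hS0 : 0 < S := hS' ▸ Real.exp_pos _
  have hse : s ^ 2 * r ^ n = 1 := by
    rw [hs, ← exp_al hr, ← Real.exp_nat_mul, ← Real.exp_add]
    simp
  have hSe : S ^ 2 * r ^ (2 * h) = 1 := by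
    rw [hS', ← exp_al hr, ← Real.exp_nat_mul, ← Real.exp_add]
    simp
  have ha0 : 0 < a := by linarith
  have hrn : 0 < r ^ n := pow_pos hr n
  have hrh : 0 < r ^ h := pow_pos hr h
  have hr2h : 0 < r ^ (2 * h) := pow_pos hr _
  have hrn1 : r ^ n ≤ 1 := pow_le_one₀ hr.le (by linarith)
  have hr2hh : r ^ (2 * h) = r ^ h * r ^ h := by ring
  have hrh16 : r ^ h ≤ 1 / 16 := calc
    r ^ h ≤ r ^ 2 := pow_le_pow_of_le_one hr.le (by linarith) h2
    _ ≤ (1 / 4) ^ 2 := by gcongr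
    _ = 1 / 16 := by norm_num
  have hrh2 : r ^ h ≤ (1 / 2) ^ h := by gcongr; linarith
  have hε : 0 < r ^ n / 100 := by positivity
  rw [← hs, ← hS'] at hS
  have hden : 0 < 500 * a ^ 2 * S := by positivity
  obtain ⟨M, hM⟩ : ∃ M, M = ⌊s / (500 * a ^ 2 * S)⌋₊ := ⟨_, rfl⟩
  have hx1 : 1 ≤ s / (500 * a ^ 2 * S) := by rwa [one_le_div hden]
  have hM1 : 500 * a ^ 2 * M * S ≤ s := by
    have := Nat.floor_le (zero_le_one.trans hx1)
    rw [← hM, le_div_iff₀ hden] at this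
    linarith
  have hM2 : s / (1000 * a ^ 2 * S) ≤ M := by
    have h3 := Nat.lt_floor_add_one (s / (500 * a ^ 2 * S))
    have h4 : 1 ≤ M := by rw [hM]; exact Nat.le_floor (by simpa using hx1)
    have h5 : (1 : ℝ) ≤ M := by exact_mod_cast h4
    rw [← hM, div_lt_iff₀ hden] at h3
    rw [div_le_iff₀ (by positivity)]
    have : (M + 1) * (500 * a ^ 2 * S) ≤ (M + M) * (500 * a ^ 2 * S) := by gcongr
    linarith
  obtain ⟨c, hc⟩ : ∃ c, c = r ^ n / 2 / (2 * r ^ (2 * h)) * ((M : ℝ) ^ 2 / 4) := ⟨_, rfl⟩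
  have hc0 : 0 ≤ c := by rw [hc]; positivity
  have hcl : 1 / (16000000 * a ^ 4) ≤ c := by
    rw [hc]
    have hrn' : r ^ n = 1 / s ^ 2 := by rw [eq_div_iff (by positivity)]; linarith
    have hrh' : r ^ (2 * h) = 1 / S ^ 2 := by rw [eq_div_iff (by positivity)]; linarith
    rw [hrn', hrh']
    calc 1 / (16000000 * a ^ 4) = 1 / s ^ 2 / 2 / (2 * (1 / S ^ 2)) * ((s / (1000 * a ^ 2 * S)) ^ 2 / 4) := by
          field_simp; norm_num
      _ ≤ _ := by gcongr
  have hfin := slopes_finite (g := g) ha0 hs0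
  have hσ : 4 * a ^ 2 / s ^ 2 = 4 * a ^ 2 * r ^ n := by
    rw [div_eq_iff (by positivity), mul_assoc, mul_comm (r ^ n), hse, mul_one]
  have ha2 : 1 ≤ a ^ 2 := one_le_pow₀ (by linarith)
  have hσκ : 4 * a ^ 2 * r ^ n ≤ 2 * r ^ (2 * h) := by
    have h3 : (500 * a ^ 2 * S) ^ 2 ≤ s ^ 2 := by gcongr
    have h4 : (500 * a ^ 2 * S) ^ 2 * (r ^ n * r ^ (2 * h)) ≤ s ^ 2 * (r ^ n * r ^ (2 * h)) := by gcongr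
    have h5 : (500 * a ^ 2 * S) ^ 2 * (r ^ n * r ^ (2 * h)) = 250000 * a ^ 4 * r ^ n * (S ^ 2 * r ^ (2 * h)) := by
      ring
    have h6 : s ^ 2 * (r ^ n * r ^ (2 * h)) = (s ^ 2 * r ^ n) * r ^ (2 * h) := by ring
    rw [h5, h6, hSe, hse] at h4
    have h7 : a ^ 2 * r ^ n ≤ a ^ 4 * r ^ n := by
      gcongr
      · linarith
      · norm_num
    have h8 : 0 ≤ a ^ 2 * r ^ n := by positivity
    linarith
  have key := second_moment (ι := Fin n → Bool) (X := fun w => xw r w) (Z := hfin.toFinset) (B := B)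
    (ω := r ^ n / 2) (σ := 4 * a ^ 2 * r ^ n) (κ := 2 * r ^ (2 * h)) (ϑ := r ^ h) (ν := (1 / 2) ^ h)
    (ε := r ^ n / 100) (m := (Fintype.card (Fin n → Bool) * c) ^ 2) (by positivity)
    (by
      have : 1 * r ^ n ≤ a ^ 2 * r ^ n := by gcongr
      linarith) hσκ
    (by
      rw [hr2hh]
      have : r ^ h * r ^ h ≤ r ^ h * (1 / 16) := by gcongr
      linarith)
    (by
      rw [hr2hh] at hσκ
      have : r ^ h * r ^ h ≤ r ^ h * (1 / 16) := by gcongr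
      linarith)
    (fun z hz z' hz' hne => by
      rw [Finite.mem_toFinset] at hz hz'
      rw [← hσ]
      exact slopes_separated ha0 hs0 hz hz' hne)
    (fun z hz => by
      rw [Finite.mem_toFinset] at hz
      exact abs_le_of_mem_slopes hz)
    (card_near_pairs_le hr hr4 (by omega)) hε
    (by
      intro p hp
      obtain ⟨Λ, lam, β, τ, H, rfl⟩ := hB p hp
      obtain ⟨b1, b2, -⟩ := floor_mul_bounds (x := lam ^ 2) hε
      have h3 : (9 / 10 : ℝ) ^ 2 ≤ lam ^ 2 := by have := H.l1; gcongr
      have h4 : lam ^ 2 ≤ (10 / 9 : ℝ) ^ 2 := by have := H.l1; have := H.l2; gcongr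
      constructor
      · linarith
      · linarith)
    (by
      intro p hp l hl b hb
      obtain ⟨Λ, lam, β, τ, H, rfl⟩ := hB p hp
      have hl' := (floor_mul_bounds (x := lam ^ 2) hε).2.2 l hl
      have hb' := (floor_mul_bounds (x := lam * β) hε).2.2 b hb
      have hsum : ∑ w : Fin n → Bool, ∑ z ∈ hfin.toFinset,
          spike (r ^ n / 2) (2 * r ^ (2 * h)) (b + (l * z + xw r w)) ≤ ∑ _w : Fin n → Bool, -c := by
        refine Finset.sum_le_sum fun w _ => ?_
        rw [hc]
        exact sum_spike_le hr hr4 (by linarith) hn H.bad H.bad' H.l1 H.l2 H.hβ H.hτ H.h0 H.h1 hl' hb'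
          (by rw [← hs, ← hS']; exact hM1) (fun z => by rw [Finite.mem_toFinset, hs]) w
      rw [Finset.sum_const, Finset.card_univ, nsmul_eq_mul] at hsum
      rw [← neg_sq (∑ w : Fin n → Bool, _)]
      refine pow_le_pow_left₀ (by positivity) ?_ 2
      linarith)
  have hcard : (0 : ℝ) < (Fintype.card (Fin n → Bool) : ℝ) ^ 2 := by
    have : 0 < Fintype.card (Fin n → Bool) := Fintype.card_pos
    positivity
  have h3 : c ^ 2 * (B.card * (r ^ n / 100) ^ 2) ≤ 26400 * (1 / 2) ^ h := by
    have h4 : 2 * r ^ (2 * h) / r ^ h = 2 * r ^ h := by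
      rw [hr2hh, div_eq_iff hrh.ne']; ring
    rw [h4, mul_pow, mul_assoc] at key
    have := le_of_mul_le_mul_left key hcard
    linarith
  have h4 : (1 / (16000000 * a ^ 4)) ^ 2 * (B.card * (r ^ n / 100) ^ 2) ≤ 26400 * (1 / 2) ^ h := by
    refine le_trans ?_ h3
    gcongr
  have h5 : (B.card * (r ^ n / 100) ^ 2) ≤ 26400 * (1 / 2) ^ h * (16000000 * a ^ 4) ^ 2 := by
    rw [div_pow, one_pow, one_div, inv_mul_le_iff₀ (by positivity)] at h4
    linarith
  refine h5.trans ?_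
  have h6 : (200 : ℝ) ^ 9 ≤ a ^ 9 := by gcongr
  calc 26400 * (1 / 2) ^ h * (16000000 * a ^ 4) ^ 2 = (26400 * 16000000 ^ 2) * (a ^ 8 * (1 / 2) ^ h) := by ring
    _ ≤ 200 ^ 9 * (a ^ 8 * (1 / 2) ^ h) := by gcongr; norm_num
    _ ≤ a ^ 9 * (a ^ 8 * (1 / 2) ^ h) := by gcongr
    _ = _ := by ring

lemma Near1.bounds {k : SLR} (hk : Near1 (1 / 100) k) :
    (99 / 100 ≤ k 0 0 ∧ k 0 0 ≤ 101 / 100) ∧ (99 / 100 ≤ k 1 1 ∧ k 1 1 ≤ 101 / 100) := by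
  have h1 := _root_.abs_le.1 hk.h00
  have h2 := _root_.abs_le.1 hk.h11
  refine ⟨⟨?_, ?_⟩, ?_, ?_⟩ <;> linarith [h1.1, h1.2, h2.1, h2.2]

lemma abs_mul_add_mul_le {x y a b x' y' a' b' : ℝ} (hx : |x| ≤ x') (hy : |y| ≤ y') (ha : |a| ≤ a') (hb : |b| ≤ b') :
    |x * a + y * b| ≤ x' * a' + y' * b' :=
  (abs_add_le _ _).trans (add_le_add (abs_mul_le_mul hx ha) (abs_mul_le_mul hy hb))

lemma near1_mul_inv_of_params {ε : ℝ} {k k' : SLR} (hk : Near1 (1 / 100) k) (hk' : Near1 (1 / 100) k')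
    (hε : 0 ≤ ε)
    (h1 : |(1 / k 1 1) ^ 2 - (1 / k' 1 1) ^ 2| ≤ ε) (h2 : |1 / k 1 1 * k 0 1 - 1 / k' 1 1 * k' 0 1| ≤ ε)
    (h3 : |k 1 0 / k 1 1 - k' 1 0 / k' 1 1| ≤ ε) : Near1 (5 * ε) (k * k'⁻¹) := by
  obtain ⟨⟨a1, a2⟩, b1, b2⟩ := hk.bounds
  obtain ⟨⟨a1', a2'⟩, b1', b2'⟩ := hk'.bounds
  have d := k.det_eq
  have d' := k'.det_eq
  have c01 := hk.h01
  have c10 := hk.h10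
  have c01' := hk'.h01
  have c10' := hk'.h10
  obtain ⟨p, hp⟩ : ∃ p, p = k 0 0 := ⟨_, rfl⟩
  obtain ⟨x, hx⟩ : ∃ p, p = k 0 1 := ⟨_, rfl⟩
  obtain ⟨y, hy⟩ : ∃ p, p = k 1 0 := ⟨_, rfl⟩
  obtain ⟨u, hu⟩ : ∃ p, p = k 1 1 := ⟨_, rfl⟩
  obtain ⟨p', hp'⟩ : ∃ p, p = k' 0 0 := ⟨_, rfl⟩
  obtain ⟨x', hx'⟩ : ∃ p, p = k' 0 1 := ⟨_, rfl⟩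
  obtain ⟨y', hy'⟩ : ∃ p, p = k' 1 0 := ⟨_, rfl⟩
  obtain ⟨u', hu'⟩ : ∃ p, p = k' 1 1 := ⟨_, rfl⟩
  have e00 : (k * k'⁻¹) 0 0 = p * u' - x * y' := by
    rw [SLR.mul_apply, SLR.inv00, SLR.inv10, hp, hx, hu', hy']; ring
  have e01 : (k * k'⁻¹) 0 1 = x * p' - p * x' := by
    rw [SLR.mul_apply, SLR.inv01, SLR.inv11, hp, hx, hp', hx']; ring
  have e10 : (k * k'⁻¹) 1 0 = y * u' - u * y' := by
    rw [SLR.mul_apply, SLR.inv00, SLR.inv10, hu, hy, hu', hy']; ring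
  have e11 : (k * k'⁻¹) 1 1 = u * p' - y * x' := by
    rw [SLR.mul_apply, SLR.inv01, SLR.inv11, hy, hu, hp', hx']; ring
  rw [← hp] at a1 a2
  rw [← hu] at b1 b2
  rw [← hp'] at a1' a2'
  rw [← hu'] at b1' b2'
  rw [← hp, ← hx, ← hy, ← hu] at d
  rw [← hp', ← hx', ← hy', ← hu'] at d'
  rw [← hx] at c01
  rw [← hy] at c10
  rw [← hx'] at c01'
  rw [← hy'] at c10'
  rw [← hu, ← hu'] at h1 h2 h3
  rw [← hx, ← hx'] at h2
  rw [← hy, ← hy'] at h3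
  have u0 : 0 < u := by linarith
  have u0' : 0 < u' := by linarith
  have Au : |u| ≤ 101 / 100 := abs_le.2 ⟨by linarith, b2⟩
  have Au' : |u'| ≤ 101 / 100 := abs_le.2 ⟨by linarith, b2'⟩
  have Ap' : |p'| ≤ 101 / 100 := abs_le.2 ⟨by linarith, a2'⟩
  have du : |u - u'| ≤ 3 / 5 * ε := by
    have e : (u' - u) * (u' + u) = ((1 / u) ^ 2 - (1 / u') ^ 2) * (u ^ 2 * u' ^ 2) := by
      field_simp; ring
    have h4 : |(u' - u) * (u' + u)| ≤ ε * ((101 / 100) ^ 2 * (101 / 100) ^ 2) := by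
      rw [e, abs_mul, abs_of_nonneg (by positivity : 0 ≤ u ^ 2 * u' ^ 2)]
      gcongr
    rw [abs_mul, abs_of_pos (by linarith : 0 < u' + u), abs_sub_comm] at h4
    have h5 : |u - u'| * (198 / 100) ≤ |u - u'| * (u' + u) := by gcongr; linarith
    linarith
  have quot : ∀ {z z' : ℝ}, |z'| ≤ 1 / 100 → |z / u - z' / u'| ≤ ε → |z - z'| ≤ 11 / 10 * ε := by
    intro z z' hz hd
    have e : z - z' = (z / u - z' / u') * u + (u - u') * (z' / u') := by
      field_simp; ring
    have hq : |z' / u'| ≤ 1 / 50 := by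
      rw [abs_div, abs_of_pos u0', div_le_iff₀ u0']
      linarith
    rw [e]
    have := abs_mul_add_mul_le hd du Au hq
    linarith
  have dx : |x - x'| ≤ 11 / 10 * ε := quot c01' (by
    rwa [one_div_mul_eq_div, one_div_mul_eq_div] at h2)
  have dy : |y - y'| ≤ 11 / 10 * ε := quot c10' h3
  have dp : |p - p'| ≤ ε := by
    have e : (p - p') * u = ((x - x') * y + (y - y') * x') + (u - u') * (-p') := by linear_combination d - d'
    have h4 : |(p - p') * u| ≤ (11 / 10 * ε * (1 / 100) + 11 / 10 * ε * (1 / 100)) + 3 / 5 * ε * (101 / 100) := by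
      rw [e]
      refine (abs_add_le _ _).trans (add_le_add (abs_mul_add_mul_le dx dy c10 c01') (abs_mul_le_mul du ?_))
      rwa [abs_neg]
    rw [abs_mul, abs_of_pos u0] at h4
    have h5 : |p - p'| * (99 / 100) ≤ |p - p'| * u := by gcongr
    linarith
  constructor
  · rw [e00, show p * u' - x * y' - 1 = (p - p') * u' + (x - x') * (-y') by linear_combination d']
    have := abs_mul_add_mul_le dp dx Au' (by rwa [abs_neg] : |-y'| ≤ 1 / 100)
    linarith
  · rw [e01, show x * p' - p * x' = (x - x') * p' + (p - p') * (-x') by ring]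
    have := abs_mul_add_mul_le dx dp Ap' (by rwa [abs_neg] : |-x'| ≤ 1 / 100)
    linarith
  · rw [e10, show y * u' - u * y' = (y - y') * u' + (u - u') * (-y') by ring]
    have := abs_mul_add_mul_le dy du Au' (by rwa [abs_neg] : |-y'| ≤ 1 / 100)
    linarith
  · rw [e11, show u * p' - y * x' - 1 = (u - u') * p' + (y - y') * (-x') by linear_combination d']
    have := abs_mul_add_mul_le du dy Ap' (by rwa [abs_neg] : |-x'| ≤ 1 / 100)
    linarith

lemma exists_fiber_ge {α β : Type*} [DecidableEq β] {T : Finset α} (hT : T.Nonempty) {f : α → β} {P : Finset β}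
    (h : ∀ x ∈ T, f x ∈ P) : ∃ y, T.card ≤ P.card * (T.filter fun x => f x = y).card := by
  have hP : P.Nonempty := ⟨f hT.choose, h _ hT.choose_spec⟩
  obtain ⟨y, -, hy⟩ := P.exists_max_image (fun y => (T.filter fun x => f x = y).card) hP
  refine ⟨y, ?_⟩
  rw [mul_comm]
  exact Finset.card_le_mul_card_image_of_maps_to h _ hy

/-- The lower triangular unipotent matrix. -/
def lowU (q : ℝ) : SLR := ⟨!![1, 0; q, 1], by simp [Matrix.det_fin_two]⟩

lemma lowU_mul_zero (q : ℝ) (g : SLR) (j : Fin 2) : (lowU q * g) 0 j = g 0 j := by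
  rw [SLR.mul_apply]; simp [lowU]

lemma lowU_mul_one (q : ℝ) (g : SLR) (j : Fin 2) : (lowU q * g) 1 j = g 1 j + q * g 0 j := by
  rw [SLR.mul_apply]; simp [lowU]; ring

/-- A lattice close to `g0` is boxed relative to a shear of `g0`. -/
lemma boxed_of_near1 {r a : ℝ} {n h : ℕ} {g0 k Λ : SLR} {q0 : ℝ}
    (hbad : ∀ v : Fin n → Bool, Bad a (av (n * al r) * uu (xw r v) * Λ))
    (hbad' : ∀ v : Fin (2 * h) → Bool, Bad a (av ((2 * h : ℕ) * al r) * uu (xw r v) * Λ))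
    (hk : Near1 (1 / 100) k) (e : Λ = k * g0) (hq : |k 1 0 / k 1 1 - q0| ≤ r ^ n / 100) :
    Boxed r a n h (lowU q0 * g0) Λ (1 / k 1 1) (k 0 1) (k 1 0 / k 1 1 - q0) := by
  obtain ⟨-, b1, b2⟩ := hk.bounds
  have u0 : 0 < k 1 1 := by linarith
  have d := k.det_eq
  refine ⟨hbad, hbad', ?_, ?_, hk.h01.trans (by norm_num), hq, fun j => ?_, fun j => ?_⟩
  · rw [le_div_iff₀ u0]; linarith
  · rw [div_le_iff₀ u0]; linarith
  · rw [lowU_mul_zero, lowU_mul_one, e, SLR.mul_apply]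
    field_simp
    linear_combination g0 0 j * d
  · rw [lowU_mul_zero, lowU_mul_one, e, SLR.mul_apply]
    field_simp
    ring

lemma floor_mem_Icc_of_abs_le {x c : ℝ} (h : |x| ≤ c) : ⌊x⌋ ∈ Finset.Icc (-⌈c⌉) ⌈c⌉ := by
  obtain ⟨h1, h2⟩ := abs_le.1 h
  rw [Finset.mem_Icc]
  constructor
  · rw [Int.le_floor]
    push_cast
    linarith [Int.le_ceil c]
  · have : (⌊x⌋ : ℝ) ≤ ⌈c⌉ := (Int.floor_le x).trans (h2.trans (Int.le_ceil c))
    exact_mod_cast this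

lemma card_Icc_ceil_le {c : ℝ} (hc : 0 ≤ c) : ((Finset.Icc (-⌈c⌉) ⌈c⌉).card : ℝ) ≤ 2 * c + 3 := by
  have h := Int.ceil_nonneg hc
  rw [Int.card_Icc]
  have h2 : ((⌈c⌉ + 1 - -⌈c⌉).toNat : ℤ) = ⌈c⌉ + 1 - -⌈c⌉ := Int.toNat_of_nonneg (by omega)
  have h3 : (((⌈c⌉ + 1 - -⌈c⌉).toNat : ℕ) : ℝ) = ⌈c⌉ + 1 - -⌈c⌉ := by exact_mod_cast h2
  rw [h3]
  linarith [Int.ceil_lt_add_one c]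

lemma cell_mem_of_bad {a η : ℝ} {g : SLR} (h : Bad a g) (ha : 1 ≤ a) (hη : 0 < η) :
    cell η g ∈ (Finset.Icc (-⌈2 * a / η⌉) ⌈2 * a / η⌉ ×ˢ Finset.Icc (-⌈2 * a / η⌉) ⌈2 * a / η⌉ ×ˢ
      Finset.Icc (-⌈2 * a / η⌉) ⌈2 * a / η⌉ ×ˢ Finset.Icc (-⌈2 * a / η⌉) ⌈2 * a / η⌉) := by
  have key : ∀ i j, ⌊red g i j / η⌋ ∈ Finset.Icc (-⌈2 * a / η⌉) ⌈2 * a / η⌉ := by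
    intro i j
    refine floor_mem_Icc_of_abs_le ?_
    rw [abs_div, abs_of_pos hη]
    gcongr
    exact h.abs_red_le ha i j
  simp only [cell, Finset.mem_product]
  exact ⟨key _ _, key _ _, key _ _, key _ _⟩

/-- Only few words with well separated cells lead to lattices that are close to a given one. -/
lemma card_near_le {r a : ℝ} {g : SLR} {N i n : ℕ} (H : Ens r a g N) (hi : i ≤ N) {T : Finset (Fin i → Bool)}
    (hT : InjOn (fun w : Fin i → Bool => cell (r ^ n * mesh a) (lat r g w)) T) {w' : Fin i → Bool} {ε : ℝ} (hε0 : 0 ≤ ε)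
    (hε : ε ≤ r ^ n) (hn : ∀ w ∈ T, Near ε (lat r g w') (lat r g w)) : (T.card : ℝ) ≤ a ^ 120 := by
  have ha := H.ha
  have ha0 : 0 < a := by linarith
  have hr := H.hr
  have hη := (Ens.mesh_le H n).1
  have hr1 : r ^ n ≤ 1 := pow_le_one₀ hr.le (by linarith [H.hr4])
  obtain ⟨η, hηe⟩ : ∃ η, η = r ^ n * mesh a := ⟨_, rfl⟩
  rw [← hηe] at hη hT
  have h1 := encard_cell_near_le (H.bad i hi w') (by linarith) hη (hε.trans hr1)
    (S := lat r g '' (T : Set (Fin i → Bool))) (by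
      rintro _ ⟨w, hw, rfl⟩
      exact ⟨H.bad i hi w, hn w hw⟩)
  have hεη : ε ≤ a ^ 20 * η := by
    rw [hηe, mesh, ← pow_mul, mul_left_comm, mul_inv_cancel₀ (by positivity), mul_one]
    exact hε
  have h2 := log_cell_count_le (p := 20) (by linarith) hη hε0 hεη
  obtain ⟨K, hK⟩ : ∃ K, K = (2 * ⌈32 * a ^ 2⌉ + 1).toNat ^ 4 *
      (2 * (⌈256 * a ^ 3 * ε / η⌉ + 1) + 1).toNat ^ 4 := ⟨_, rfl⟩
  rw [← hK] at h1 h2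
  rw [Set.image_image, hT.encard_image, Set.encard_coe_eq_coe_finsetCard, Nat.cast_le] at h1
  have h3 : (T.card : ℝ) ≤ K := by exact_mod_cast h1
  rcases Nat.eq_zero_or_pos K with h0 | h0
  · rw [h0] at h3
    exact h3.trans (by simpa using by positivity)
  · have hK0 : (0 : ℝ) < K := by exact_mod_cast h0
    refine h3.trans ?_
    rw [← Real.log_le_log_iff hK0 (by positivity), Real.log_pow]
    norm_num at h2 ⊢
    exact h2

lemma exists_boxes {r a : ℝ} {g : SLR} {N i n h : ℕ} (H : Ens r a g N) (hin : i + n ≤ N) (hh : 2 * h ≤ n) :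
    ∃ (g1 : SLR) (B : Finset (ℤ × ℤ)), (∀ p ∈ B, ∃ Λ lam β τ, Boxed r a n h g1 Λ lam β τ ∧
      p = (⌊lam ^ 2 / (r ^ n / 100)⌋, ⌊lam * β / (r ^ n / 100)⌋)) ∧
      Real.exp (entL r g (r ^ n * mesh a) i) ≤ a ^ 137 / r ^ n * B.card := by
  classical
  have ha := H.ha
  have ha0 : 0 < a := by linarith
  have hr := H.hr
  have hrn : 0 < r ^ n := pow_pos hr n
  have hrn1 : r ^ n ≤ 1 := pow_le_one₀ hr.le (by linarith [H.hr4])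
  have hi : i ≤ N := by omega
  obtain ⟨η, hη⟩ : ∃ η, η = r ^ n * mesh a := ⟨_, rfl⟩
  obtain ⟨φ, hφ⟩ : ∃ φ : (Fin i → Bool) → ℤ × ℤ × ℤ × ℤ, φ = fun w => cell η (lat r g w) := ⟨_, rfl⟩
  obtain ⟨T, -, hT⟩ := (Set.surjOn_image φ univ).exists_subset_injOn_image_eq
  rw [image_univ] at hT
  obtain ⟨T, rfl⟩ : ∃ T' : Finset (Fin i → Bool), (T' : Set _) = T := ⟨T.toFinite.toFinset, by simp⟩
  obtain ⟨hinj, him⟩ := hT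
  have hTc : (range φ).encard = T.card := by
    rw [← him, hinj.encard_image, Set.encard_coe_eq_coe_finsetCard]
  have hTn : T.Nonempty := by
    have : (φ '' (T : Set (Fin i → Bool))).Nonempty := him ▸ range_nonempty φ
    simpa using this
  have hexp : Real.exp (entL r g (r ^ n * mesh a) i) ≤ T.card := by
    rw [← Real.le_log_iff_exp_le (by exact_mod_cast hTn.card_pos)]
    refine ent_le_log_of_encard_range_le hTn.card_pos ?_
    rw [← hη, ← hφ, hTc]
  obtain ⟨η0, hη0⟩ : ∃ η0, η0 = 1 / (400 * a) := ⟨_, rfl⟩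
  have hη0p : 0 < η0 := by rw [hη0]; positivity
  obtain ⟨y, hy⟩ := exists_fiber_ge hTn (f := fun w => cell η0 (lat r g w))
    (fun w _ => cell_mem_of_bad (H.bad i hi w) (by linarith) hη0p)
  have hc : 2 * a / η0 = 800 * a ^ 2 := by rw [hη0]; field_simp; norm_num
  obtain ⟨T1, hT1⟩ : ∃ T1, T1 = T.filter fun w => cell η0 (lat r g w) = y := ⟨_, rfl⟩
  have hy' : (T.card : ℝ) ≤ a ^ 16 * T1.card := by
    rw [← hT1] at hy
    have h1 := (Nat.cast_le (α := ℝ)).2 hy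
    refine h1.trans ?_
    rw [Finset.card_product, Finset.card_product, Finset.card_product, hc]
    push_cast
    have h2 := card_Icc_ceil_le (c := 800 * a ^ 2) (by positivity)
    have h3 : 2 * (800 * a ^ 2) + 3 ≤ a ^ 4 := by
      have h4 : (200 : ℝ) ^ 2 ≤ a ^ 2 := by gcongr
      have h5 : (200 : ℝ) ^ 2 * a ^ 2 ≤ a ^ 2 * a ^ 2 := by gcongr
      have h6 : a ^ 2 * a ^ 2 = a ^ 4 := by ring
      linarith
    have h7 := h2.trans h3
    calc _ ≤ a ^ 4 * (a ^ 4 * (a ^ 4 * a ^ 4)) * (T1.card : ℝ) := by gcongr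
      _ = _ := by ring
  have hT1n : T1.Nonempty := by
    rw [← Finset.card_pos]
    by_contra h0
    have h1 : (T1.card : ℝ) = 0 := by exact_mod_cast Nat.eq_zero_of_not_pos h0
    have h2 : (0 : ℝ) < T.card := by exact_mod_cast hTn.card_pos
    rw [h1] at hy'
    linarith
  obtain ⟨w0, hw0⟩ := hT1n
  have hT1y : ∀ w ∈ T1, cell η0 (lat r g w) = y := by
    intro w hw
    rw [hT1, Finset.mem_filter] at hw
    exact hw.2
  have hnear : ∀ w : Fin i → Bool, ∃ (γ : SLZ) (k : SLR), Near1 (1 / 100) k ∧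
      (w ∈ T1 → lat r g w * embZ γ = k * lat r g w0) := by
    intro w
    by_cases hw : w ∈ T1
    · obtain ⟨γ, k, hk, e⟩ := near_of_cell_eq (g' := lat r g w) (H.bad i hi w0) (by linarith) hη0p
        ((hT1y w0 hw0).trans (hT1y w hw).symm)
      exact ⟨γ, k, hk.mono (by rw [hη0]; field_simp; norm_num), fun _ => e⟩
    · exact ⟨1, 1, Near1.one (by norm_num), fun h => absurd h hw⟩
  choose γ k hk e using hnear
  obtain ⟨ε, hε⟩ : ∃ ε, ε = r ^ n / 100 := ⟨_, rfl⟩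
  have hεp : 0 < ε := by rw [hε]; positivity
  have hq : ∀ w, |k w 1 0 / k w 1 1 / ε| ≤ 2 / r ^ n := by
    intro w
    obtain ⟨-, b1, b2⟩ := (hk w).bounds
    have := (hk w).h10
    have h1 : |k w 1 0 / k w 1 1| ≤ 1 / 50 := by
      rw [abs_div, abs_of_pos (by linarith : 0 < k w 1 1), div_le_iff₀ (by linarith)]
      linarith
    rw [abs_div, abs_of_pos hεp, hε, div_le_div_iff₀ (by positivity) hrn]
    calc |k w 1 0 / k w 1 1| * r ^ n ≤ 1 / 50 * r ^ n := by gcongr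
      _ = _ := by ring
  obtain ⟨z, hz⟩ := exists_fiber_ge ⟨w0, hw0⟩ (f := fun w => ⌊k w 1 0 / k w 1 1 / ε⌋)
    (fun w _ => floor_mem_Icc_of_abs_le (hq w))
  obtain ⟨T2, hT2⟩ : ∃ T2, T2 = T1.filter fun w => ⌊k w 1 0 / k w 1 1 / ε⌋ = z := ⟨_, rfl⟩
  have hz' : (T1.card : ℝ) ≤ a / r ^ n * T2.card := by
    rw [← hT2] at hz
    have h1 := (Nat.cast_le (α := ℝ)).2 hz
    refine h1.trans ?_
    push_cast
    have h2 := card_Icc_ceil_le (c := 2 / r ^ n) (by positivity)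
    have h3 : 2 * (2 / r ^ n) + 3 ≤ a / r ^ n := by
      have : 3 ≤ 3 / r ^ n := by rw [le_div_iff₀ hrn]; linarith
      have h4 : 200 / r ^ n ≤ a / r ^ n := by gcongr
      have h5 : 0 ≤ 1 / r ^ n := by positivity
      have h6 : 2 * (2 / r ^ n) = 4 * (1 / r ^ n) := by ring
      have h7 : 3 / r ^ n = 3 * (1 / r ^ n) := by ring
      have h8 : 200 / r ^ n = 200 * (1 / r ^ n) := by ring
      linarith
    gcongr
    exact h2.trans h3
  have hT2z : ∀ w ∈ T2, w ∈ T1 ∧ ⌊k w 1 0 / k w 1 1 / ε⌋ = z := by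
    intro w hw
    rwa [hT2, Finset.mem_filter] at hw
  have hT2q : ∀ w ∈ T2, |k w 1 0 / k w 1 1 - z * ε| ≤ r ^ n / 100 := by
    intro w hw
    have h1 := (floor_mul_bounds (x := k w 1 0 / k w 1 1) hεp).1
    have h2 := Int.floor_le (k w 1 0 / k w 1 1 / ε)
    rw [(hT2z w hw).2] at h1 h2
    rw [le_div_iff₀ hεp] at h2
    rw [← hε, abs_of_nonneg (by linarith)]
    linarith
  have hbad : ∀ l ≤ n, ∀ w : Fin i → Bool, ∀ v : Fin l → Bool,
      Bad a (av (l * al r) * uu (xw r v) * (lat r g w * embZ (γ w))) := by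
    intro l hl w v
    rw [← mul_assoc, ← lat_append hr]
    exact (H.bad (i + l) (by omega) _).mul_embZ _
  obtain ⟨box, hbox⟩ : ∃ box : (Fin i → Bool) → ℤ × ℤ, box = fun w =>
    (⌊(1 / k w 1 1) ^ 2 / (r ^ n / 100)⌋, ⌊1 / k w 1 1 * k w 0 1 / (r ^ n / 100)⌋) := ⟨_, rfl⟩
  refine ⟨lowU (z * ε) * lat r g w0, T2.image box, ?_, ?_⟩
  · intro p hp
    obtain ⟨w, hw, rfl⟩ := Finset.mem_image.1 hp
    refine ⟨_, _, _, _, boxed_of_near1 (hbad n le_rfl w) (hbad (2 * h) hh w) (hk w)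
      (e w (hT2z w hw).1) (hT2q w hw), ?_⟩
    rw [hbox]
  · have hfib : ∀ b ∈ T2.image box, (T2.filter fun w => box w = b).card ≤ ⌊a ^ 120⌋₊ := by
      intro b hb
      obtain ⟨w', hw', hwb⟩ := Finset.mem_image.1 hb
      refine Nat.le_floor (card_near_le H hi (n := n) (ε := 5 * ε) (w' := w') (hinj.mono ?_ |> fun h => by
        rw [← hη]; rwa [hφ] at h) (by positivity) (by rw [hε]; linarith) ?_)
      · intro w hw
        rw [Finset.mem_coe, Finset.mem_filter] at hw
        have h1 := (hT2z w hw.1).1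
        rw [hT1, Finset.mem_filter] at h1
        exact h1.1
      · intro w hw
        rw [Finset.mem_filter] at hw
        obtain ⟨hw, hwb'⟩ := hw
        have hbb := hwb'.trans hwb.symm
        rw [hbox] at hbb
        simp only [Prod.mk.injEq] at hbb
        rw [← hε] at hbb
        refine ⟨γ w * (γ w')⁻¹, k w * (k w')⁻¹, near1_mul_inv_of_params (hk w) (hk w') hεp.le
          (abs_sub_le_of_floor_eq hεp hbb.1) (abs_sub_le_of_floor_eq hεp hbb.2)
          (abs_sub_le_of_floor_eq hεp ((hT2z w hw).2.trans (hT2z w' hw').2.symm)), ?_⟩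
        have e1 := e w (hT2z w hw).1
        have e2 := e w' (hT2z w' hw').1
        have e3 : lat r g w0 * (embZ (γ w'))⁻¹ = (k w')⁻¹ * lat r g w' := by
          rw [mul_inv_eq_iff_eq_mul, mul_assoc, e2, inv_mul_cancel_left]
        rw [map_mul, map_inv, ← mul_assoc, e1, mul_assoc, e3, mul_assoc]
    have h1 := Finset.card_le_mul_card_image T2 _ hfib
    have h2 : (T2.card : ℝ) ≤ a ^ 120 * (T2.image box).card := by
      have h3 : (T2.card : ℝ) ≤ ⌊a ^ 120⌋₊ * (T2.image box).card := by exact_mod_cast h1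
      refine h3.trans ?_
      gcongr
      exact Nat.floor_le (by positivity)
    calc Real.exp (entL r g (r ^ n * mesh a) i) ≤ T.card := hexp
      _ ≤ a ^ 16 * T1.card := hy'
      _ ≤ a ^ 16 * (a / r ^ n * (a ^ 120 * (T2.image box).card)) := by
        gcongr
        exact hz'.trans (by gcongr)
      _ = _ := by ring

theorem exists_not_ens {r : ℝ} (hr : 0 < r) (hr4 : r ≤ 1 / 4) :
    ∃ C T0 : ℝ, 0 < C ∧ ∀ (a : ℝ) (N : ℕ) (g : SLR), T0 ≤ Real.log a → C * Real.log a ≤ N → ¬ Ens r a g N := by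
  obtain ⟨ρ, hρ⟩ : ∃ ρ, ρ = -Real.log r := ⟨_, rfl⟩
  have hl2 : 0.6931471803 < Real.log 2 := Real.log_two_gt_d9
  have hl2' : Real.log 2 < 0.6931471808 := Real.log_two_lt_d9
  have hρ2 : 2 * Real.log 2 ≤ ρ := by
    have h1 : Real.log r ≤ Real.log (1 / 4) := Real.log_le_log hr hr4
    have h2 : Real.log (1 / 4) = -(2 * Real.log 2) := by
      rw [one_div, Real.log_inv, show (4 : ℝ) = 2 ^ 2 by norm_num, Real.log_pow]
      norm_num
    rw [hρ]
    linarith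
  have hρ0 : 0 < ρ := by linarith
  obtain ⟨ε, hε⟩ : ∃ ε, ε = Real.log 2 / (32 * ρ) := ⟨_, rfl⟩
  have hε0 : 0 < ε := by rw [hε]; positivity
  obtain ⟨C, T0, hC, hE⟩ := exists_high_entropy hr hr4 hε0 3000
  refine ⟨C, T0, hC, fun a N g hT hN H => ?_⟩
  obtain ⟨i, n, hin, hn, hent⟩ := hE a N g hT hN H
  have ha := H.ha
  have ha0 : 0 < a := by linarith
  have hla : 1 ≤ Real.log a := by
    rw [Real.le_log_iff_exp_le ha0]
    linarith [Real.exp_one_lt_d9]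
  obtain ⟨h, hh⟩ : ∃ h, h = n / 8 := ⟨_, rfl⟩
  have hn3 : 3000 ≤ n := by
    have : (3000 : ℝ) ≤ n := by linarith
    exact_mod_cast this
  have hh2 : 2 ≤ h := by omega
  have hhn : 2 * h ≤ n := by omega
  have h8 : n ≤ 8 * h + 7 := by omega
  have h8' : (n : ℝ) ≤ 8 * h + 7 := by exact_mod_cast h8
  have h4' : 8 * (h : ℝ) ≤ n := by
    have : 8 * h ≤ n := by omega
    exact_mod_cast this
  have hal : al r = ρ / 2 := by rw [hρ, al]
  obtain ⟨g1, B, hB, hcount⟩ := exists_boxes H hin hhn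
  have hbox := card_boxes_le hr hr4 ha hh2 hhn (by
    rw [← Real.log_le_log_iff (by positivity) (Real.exp_pos _), Real.log_exp,
      Real.log_mul (by positivity) (Real.exp_pos _).ne', Real.log_exp, hal]
    have h1 : Real.log (500 * a ^ 2) ≤ Real.log (a ^ 4) := by
      refine Real.log_le_log (by positivity) ?_
      have h5 : (200 : ℝ) ^ 2 ≤ a ^ 2 := by gcongr
      calc 500 * a ^ 2 ≤ 200 ^ 2 * a ^ 2 := by gcongr; norm_num
        _ ≤ a ^ 2 * a ^ 2 := by gcongr
        _ = a ^ 4 := by ring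
    rw [Real.log_pow] at h1
    push_cast at h1 ⊢
    have h2 : (n - 2 * h : ℝ) * (ρ / 2) ≥ 2000 * Real.log a * (1 / 2) := by
      have : 2000 * Real.log a ≤ n - 2 * h := by linarith
      have h3 : (1 : ℝ) / 2 ≤ ρ / 2 := by linarith
      exact mul_le_mul this h3 (by norm_num) (by linarith)
    linarith) hB
  have hrn : 0 < r ^ n := pow_pos hr n
  have h1 : Real.exp ((3 - ε) * (n * ρ)) ≤ a ^ 156 * (1 / 2) ^ h / (r ^ n) ^ 3 := by
    rw [hρ]
    refine (Real.exp_le_exp.2 hent).trans (hcount.trans ?_)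
    have h2 : (B.card : ℝ) ≤ a ^ 17 * (1 / 2) ^ h / (r ^ n / 100) ^ 2 := by
      rwa [le_div_iff₀ (by positivity)]
    have h3 : (100 : ℝ) ^ 2 ≤ a ^ 2 := by gcongr; linarith
    calc a ^ 137 / r ^ n * B.card ≤ a ^ 137 / r ^ n * (a ^ 17 * (1 / 2) ^ h / (r ^ n / 100) ^ 2) := by gcongr
      _ = 100 ^ 2 * (a ^ 154 * (1 / 2) ^ h / (r ^ n) ^ 3) := by field_simp
      _ ≤ a ^ 2 * (a ^ 154 * (1 / 2) ^ h / (r ^ n) ^ 3) := by gcongr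
      _ = _ := by ring
  have h2 := (Real.le_log_iff_exp_le (by positivity)).2 h1
  rw [Real.log_div (by positivity) (by positivity), Real.log_mul (by positivity) (by positivity), Real.log_pow,
    Real.log_pow, Real.log_pow, Real.log_pow, one_div, Real.log_inv, show Real.log r = -ρ by linarith] at h2
  have h3 : ε * (n * ρ) = n * Real.log 2 / 32 := by
    rw [hε]; field_simp
  push_cast at h2
  have h4 : (h : ℝ) * Real.log 2 ≤ 156 * Real.log a + n * Real.log 2 / 32 := by linarith
  have h5 : (n : ℝ) * Real.log 2 ≤ (8 * h + 7) * Real.log 2 := by gcongr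
  have h6 : 3000 * Real.log a * (6 / 10) ≤ n * Real.log 2 := by
    refine mul_le_mul hn (by linarith) (by norm_num) (by positivity)
  linarith

/-- Short vectors along a piece of a missing-digit horocycle. -/
theorem exists_short_vector {r : ℝ} (hr : 0 < r) (hr4 : r ≤ 1 / 4) :
    ∃ C δ0 : ℝ, 0 < C ∧ 0 < δ0 ∧ δ0 < 1 ∧ ∀ δ, 0 < δ → δ ≤ δ0 → ∀ g : SLR, ∃ (n : ℕ) (w : Fin n → Bool) (p q : ℤ),
      (n : ℝ) ≤ C * Real.log δ⁻¹ ∧ (p ≠ 0 ∨ q ≠ 0) ∧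
      |lat r g w 0 0 * p + lat r g w 0 1 * q| < δ ∧ |lat r g w 1 0 * p + lat r g w 1 1 * q| < δ := by
  obtain ⟨C, T0, hC, hE⟩ := exists_not_ens hr hr4
  obtain ⟨A, hA⟩ : ∃ A, A = max (max 200 r⁻¹) (Real.exp T0) := ⟨_, rfl⟩
  have hA200 : 200 ≤ A := hA ▸ (le_max_left _ _).trans (le_max_left _ _)
  have hAr : r⁻¹ ≤ A := hA ▸ (le_max_right _ _).trans (le_max_left _ _)
  have hAT : Real.exp T0 ≤ A := hA ▸ le_max_right _ _
  have hA0 : 0 < A := by linarith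
  refine ⟨C + 1, A⁻¹, by linarith, by positivity, inv_lt_one_of_one_lt₀ (by linarith), fun δ hδ hδA g => ?_⟩
  have h1 : A ≤ δ⁻¹ := by rwa [le_inv_comm₀ hA0 hδ]
  have hl : 1 ≤ Real.log δ⁻¹ := by
    rw [Real.le_log_iff_exp_le (by positivity)]
    linarith [Real.exp_one_lt_d9]
  by_contra! hcon
  refine hE δ⁻¹ ⌈C * Real.log δ⁻¹⌉₊ g ?_ (Nat.le_ceil _)
    ⟨hr, hr4, hA200.trans h1, hAr.trans h1, fun i hi w p q hpq => ?_⟩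
  · rw [Real.le_log_iff_exp_le (by positivity)]
    exact hAT.trans h1
  · rw [one_div, inv_inv]
    have h2 : (i : ℝ) ≤ (C + 1) * Real.log δ⁻¹ := by
      have h3 : (i : ℝ) ≤ ⌈C * Real.log δ⁻¹⌉₊ := by exact_mod_cast hi
      have h4 := Nat.ceil_lt_add_one (a := C * Real.log δ⁻¹) (by positivity)
      linarith
    by_contra! h
    have h5 := max_lt_iff.1 h
    exact absurd (hcon i w p q h2 hpq h5.1) (not_le.2 h5.2)

/-- The affine map `x ↦ c * x + b` maps `K` to itself. -/
def Pres (K : Set ℝ) (c b : ℝ) : Prop := ∀ x ∈ K, c * x + b ∈ K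

lemma Pres.comp {K : Set ℝ} {c b c' b' : ℝ} (h : Pres K c b) (h' : Pres K c' b') :
    Pres K (c * c') (c * b' + b) := fun x hx => by
  have := h _ (h' x hx)
  rwa [mul_add, ← mul_assoc, add_assoc] at this

lemma Pres.id {K : Set ℝ} : Pres K 1 0 := fun x hx => by simpa using hx

lemma pres_word {K : Set ℝ} {r b t : ℝ} (h0 : Pres K r b) (h1 : Pres K r (b + t)) {n : ℕ} (w : Fin n → Bool) :
    Pres K (r ^ n) (b * (∑ k ∈ Finset.range n, r ^ k) + t * xw r w) := by
  induction n with
  | zero => simpa [xw, bsum] using Pres.id (K := K)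
  | succ n ih =>
    have e : w = Fin.cons (w 0) (Fin.tail w) := (Fin.cons_self_tail w).symm
    have h : Pres K r (b + if w 0 then t else 0) := by
      cases w 0
      · simpa using h0
      · simpa using h1
    have h2 := h.comp (ih (Fin.tail w))
    rw [e, xw_cons, Finset.sum_range_succ', pow_succ']
    convert h2 using 1
    simp only [pow_succ', ← Finset.mul_sum, pow_zero]
    cases w 0 <;> simp <;> ring

/-- The lattice detecting rational approximations near the point `β` at scale `σ ^ 2`. -/
noncomputable def detLat (β σ : ℝ) (hσ : σ ≠ 0) : SLR :=
  ⟨!![β / σ, -1 / σ; σ, 0], by rw [Matrix.det_fin_two]; simp; field_simp⟩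

lemma exists_approx {r : ℝ} (hr : 0 < r) (hr4 : r ≤ 1 / 4) :
    ∃ C δ0 : ℝ, 0 < C ∧ 0 < δ0 ∧ δ0 < 1 ∧ ∀ δ, 0 < δ → δ ≤ δ0 → ∀ β σ, 0 < σ → σ ≤ 1 →
      ∃ (n : ℕ) (w : Fin n → Bool) (p : ℤ) (q : ℕ), (n : ℝ) ≤ C * Real.log δ⁻¹ ∧ 0 < q ∧
        |q * (β + σ ^ 2 * xw r w) - p| ≤ δ * σ * Real.exp (-(n * al r)) ∧
        q * σ ≤ δ * Real.exp (n * al r) := by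
  obtain ⟨C, δ0, hC, hδ0, hδ1, H⟩ := exists_short_vector hr hr4
  refine ⟨C, δ0, hC, hδ0, hδ1, fun δ hδ hδδ β σ hσ hσ1 => ?_⟩
  obtain ⟨n, w, q, p, hn, hpq, h1, h2⟩ := H δ hδ hδδ (detLat β σ hσ.ne')
  have hE : 0 < Real.exp (n * al r) := Real.exp_pos _
  have g00 : detLat β σ hσ.ne' 0 0 = β / σ := rfl
  have g01 : detLat β σ hσ.ne' 0 1 = -1 / σ := rfl
  have g10 : detLat β σ hσ.ne' 1 0 = σ := rfl
  have g11 : detLat β σ hσ.ne' 1 1 = 0 := rfl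
  have al0 : 0 ≤ al r := by
    have := Real.log_nonpos hr.le (by linarith)
    unfold al
    linarith
  have e1 : lat r (detLat β σ hσ.ne') w 0 0 * q + lat r (detLat β σ hσ.ne') w 0 1 * p =
      Real.exp (n * al r) * (q * (β + σ ^ 2 * xw r w) - p) / σ := by
    rw [lat, flow_apply_zero, flow_apply_zero, g00, g01, g10, g11]
    field_simp
    ring
  have e2 : lat r (detLat β σ hσ.ne') w 1 0 * q + lat r (detLat β σ hσ.ne') w 1 1 * p =
      (Real.exp (n * al r))⁻¹ * (q * σ) := by
    rw [lat, flow_apply_one, flow_apply_one, g10, g11]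
    ring
  rw [e1, abs_div, abs_mul, abs_of_pos hE, abs_of_pos hσ, div_lt_iff₀ hσ] at h1
  rw [e2, abs_mul, abs_inv, abs_of_pos hE, inv_mul_lt_iff₀ hE, abs_mul, abs_of_pos hσ] at h2
  have h1' : |q * (β + σ ^ 2 * xw r w) - p| ≤ δ * σ * Real.exp (-(n * al r)) := by
    rw [Real.exp_neg, ← div_eq_mul_inv, le_div_iff₀ hE]
    linarith
  have hq : q ≠ 0 := by
    rintro rfl
    have hp : p ≠ 0 := by simpa using hpq
    have h3 : (1 : ℝ) ≤ |(p : ℝ)| := by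
      rw [← Int.cast_abs]; exact_mod_cast Int.one_le_abs hp
    have h4 : Real.exp (-(n * al r)) ≤ 1 := Real.exp_le_one_iff.2 (neg_nonpos.2 (by positivity))
    have h5 : δ * σ * Real.exp (-(n * al r)) ≤ δ * 1 * 1 := by gcongr
    simp only [Int.cast_zero, zero_mul, zero_sub, abs_neg] at h1'
    linarith
  have hqa : ((q.natAbs : ℕ) : ℝ) = |(q : ℝ)| := by
    rw [Nat.cast_natAbs, Int.cast_abs]
  rcases lt_or_gt_of_ne hq with h0 | h0
  · have h0' : (q : ℝ) < 0 := by exact_mod_cast h0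
    refine ⟨n, w, -p, q.natAbs, hn, Int.natAbs_pos.2 hq, ?_, ?_⟩
    · rw [hqa, abs_of_neg h0', ← abs_neg]
      convert h1' using 2
      push_cast
      ring
    · rw [hqa]; linarith
  · have h0' : (0 : ℝ) < q := by exact_mod_cast h0
    refine ⟨n, w, p, q.natAbs, hn, Int.natAbs_pos.2 hq, ?_, ?_⟩
    · rw [hqa, abs_of_pos h0']
      exact h1'
    · rw [hqa]; linarith

/-- Extending a cylinder so that all its points share one good rational approximation. -/
theorem exists_forced {K : Set ℝ} (hK : IsCompact K) {r b0 t : ℝ} (hr : 0 < r) (hr4 : r ≤ 1 / 4) (ht : 0 < t)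
    (h0 : Pres K r b0) (h1 : Pres K r (b0 + t)) :
    ∃ C M v0 : ℝ, 0 < C ∧ 0 < M ∧ 1 < v0 ∧ ∀ v, 1 < v → v < v0 → ∃ c0, 0 < c0 ∧ ∀ c b, 0 < c → c ≤ c0 →
      ∃ u e, Pres K u e ∧ 0 < u ∧ u ≤ 1 ∧ -Real.log u ≤ C * (v - 1) * -Real.log c ∧
        ∃ (p : ℤ) (q : ℕ), 0 < q ∧ ∀ x ∈ K, |q * (c * (u * x + e) + b) - p| < psiv v q ∧
          |q * (c * (u * x + e) + b) - p| ≤ M * √c := by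
  obtain ⟨C, δ0, hC, hδ0, hδ1, H⟩ := exists_approx hr hr4
  obtain ⟨p0, hp0⟩ : ∃ p0, p0 = b0 / (1 - r) := ⟨_, rfl⟩
  obtain ⟨D, hD⟩ := hK.isBounded.exists_norm_le
  have al0 : 0 < al r := by
    have := Real.log_neg hr (by linarith)
    unfold al
    linarith
  obtain ⟨M1, hM1⟩ : ∃ M1, M1 = 1 + (|D| + |p0|) / t := ⟨_, rfl⟩
  have hM10 : 1 ≤ M1 := by
    have : 0 ≤ (|D| + |p0|) / t := by positivity
    linarith
  have hM1l : 0 ≤ Real.log M1 := Real.log_nonneg hM10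
  have hden : 0 < 1 + 2 * (C * al r) := by positivity
  have ha0 : 0 < 1 / (1 + 2 * (C * al r)) := by positivity
  refine ⟨C * al r, M1 * √t, 1 + 1 / (1 + 2 * (C * al r)), by positivity, by positivity, by linarith,
    fun v hv hv0 => ?_⟩
  have hv' : 0 < v - 1 := by linarith
  have hvC : (v - 1) * (1 + 2 * (C * al r)) ≤ 1 := by
    have : v - 1 ≤ 1 / (1 + 2 * (C * al r)) := by linarith
    rwa [le_div_iff₀ hden] at this
  have hCv : 0 < C * al r * (v - 1) := by positivity
  have hCv' : C * al r * (v - 1) ≤ 1 / 2 := by linarith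
  have hv1 : v - 1 ≤ 1 := by linarith
  obtain ⟨L, hL⟩ : ∃ L, L = Real.log M1 + |Real.log t| - Real.log δ0 := ⟨_, rfl⟩
  have hδ0l : Real.log δ0 < 0 := Real.log_neg hδ0 hδ1
  have hL0 : 0 < L := by have := abs_nonneg (Real.log t); linarith
  refine ⟨Real.exp (-(1 + 4 * L / (v - 1))), Real.exp_pos _, fun c b hc hc0 => ?_⟩
  obtain ⟨X, hX⟩ : ∃ X, X = -Real.log c := ⟨_, rfl⟩
  have hcX : Real.log c = -X := by linarith
  have hXl : 1 + 4 * L / (v - 1) ≤ X := by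
    have := Real.log_le_log hc hc0
    rw [Real.log_exp] at this
    linarith
  have hXL : 4 * L < (v - 1) * X := by
    have : (v - 1) * (1 + 4 * L / (v - 1)) ≤ (v - 1) * X := by gcongr
    have e : (v - 1) * (1 + 4 * L / (v - 1)) = (v - 1) + 4 * L := by field_simp
    linarith
  have hX0 : 0 < X := by
    by_contra hn
    have : (v - 1) * X ≤ 0 := mul_nonpos_of_nonneg_of_nonpos hv'.le (by linarith)
    linarith
  have hXL' : 4 * L < X := by
    have : (v - 1) * X ≤ 1 * X := by gcongr
    linarith
  have hlt := le_abs_self (Real.log t)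
  have hlt' := neg_abs_le (Real.log t)
  obtain ⟨σ, hσ⟩ : ∃ σ, σ = √(c * t) := ⟨_, rfl⟩
  have hσ0 : 0 < σ := hσ ▸ Real.sqrt_pos.2 (by positivity)
  have hσ2 : σ ^ 2 = c * t := by rw [hσ, Real.sq_sqrt (by positivity)]
  have hσl : Real.log σ = (Real.log t - X) / 2 := by
    rw [hσ, Real.log_sqrt (by positivity), Real.log_mul hc.ne' ht.ne', hcX]
    ring
  have hσ1 : σ ≤ 1 := by
    rw [← Real.log_nonpos_iff hσ0.le, hσl]
    linarith
  obtain ⟨δ, hδ⟩ : ∃ δ, δ = Real.exp (-((v - 1) * X / 2)) := ⟨_, rfl⟩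
  have hδp : 0 < δ := hδ ▸ Real.exp_pos _
  have hδl : Real.log δ = -((v - 1) * X / 2) := by rw [hδ, Real.log_exp]
  obtain ⟨n, w, p, q, hn, hq, hp1, hq1⟩ := H δ hδp (by
    rw [← Real.log_le_log_iff hδp hδ0, hδl]
    linarith [abs_nonneg (Real.log t)]) (c * p0 + b) σ hσ0 hσ1
  rw [Real.log_inv, hδl, neg_neg] at hn
  have hnal : n * al r ≤ C * al r * (v - 1) * X / 2 := by
    calc n * al r ≤ C * ((v - 1) * X / 2) * al r := by gcongr
      _ = _ := by ring
  obtain ⟨E, hE⟩ : ∃ E, E = Real.exp (n * al r) := ⟨_, rfl⟩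
  have hE0 : 0 < E := hE ▸ Real.exp_pos _
  have hE1 : 1 ≤ E := hE ▸ Real.one_le_exp (by positivity)
  have hEr : r ^ n = (E ^ 2)⁻¹ := by
    rw [hE, ← exp_al hr, ← Real.exp_nat_mul, ← Real.exp_neg]
    simp
  rw [← hE] at hq1
  rw [Real.exp_neg, ← hE] at hp1
  have hr1 : r < 1 := by linarith
  have hsum : b0 * (∑ k ∈ Finset.range n, r ^ k) = p0 * (1 - r ^ n) := by
    rw [hp0, geom_sum_eq hr1.ne, ← neg_sub 1 (r ^ n), ← neg_sub 1 r, neg_div_neg_eq]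
    ring
  have hdiff : ∀ x, c * (r ^ n * x + (b0 * (∑ k ∈ Finset.range n, r ^ k) + t * xw r w)) + b =
      (c * p0 + b + σ ^ 2 * xw r w) + c * r ^ n * (x - p0) := by
    intro x
    rw [hsum, hσ2]
    ring
  have hq0 : (0 : ℝ) < q := by exact_mod_cast hq
  have hbound : ∀ x ∈ K, |q * (c * (r ^ n * x + (b0 * (∑ k ∈ Finset.range n, r ^ k) + t * xw r w)) + b) - p| ≤
      δ * σ * E⁻¹ * M1 := by
    intro x hx
    have hxD : |x - p0| ≤ |D| + |p0| := by
      have h3 : |x| ≤ D := hD x hx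
      have h4 := abs_sub x p0
      linarith [le_abs_self D]
    rw [hdiff, show q * (c * p0 + b + σ ^ 2 * xw r w + c * r ^ n * (x - p0)) - p =
      (q * (c * p0 + b + σ ^ 2 * xw r w) - p) + q * (c * r ^ n * (x - p0)) by ring]
    refine (abs_add_le _ _).trans ?_
    have h5 : |q * (c * r ^ n * (x - p0))| ≤ δ * σ * E⁻¹ * ((|D| + |p0|) / t) := by
      rw [abs_mul, abs_mul, abs_of_pos hq0, abs_of_pos (by positivity), hEr]
      have h6 : (q : ℝ) ≤ δ * E / σ := by rwa [le_div_iff₀ hσ0]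
      calc (q : ℝ) * (c * (E ^ 2)⁻¹ * |x - p0|) ≤ δ * E / σ * (c * (E ^ 2)⁻¹ * (|D| + |p0|)) := by gcongr
        _ = δ * E / σ * ((σ ^ 2 / t) * (E ^ 2)⁻¹ * (|D| + |p0|)) := by
          rw [hσ2, mul_div_cancel_right₀ _ ht.ne']
        _ = _ := by field_simp
    rw [hM1, mul_add (δ * σ * E⁻¹), mul_one]
    exact add_le_add hp1 h5
  refine ⟨r ^ n, b0 * (∑ k ∈ Finset.range n, r ^ k) + t * xw r w, pres_word h0 h1 w, pow_pos hr n,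
    pow_le_one₀ hr.le hr1.le, ?_, p, q, hq, fun x hx => ⟨(hbound x hx).trans_lt ?_, (hbound x hx).trans ?_⟩⟩
  · rw [Real.log_pow, show Real.log r = -(2 * al r) by unfold al; ring, ← hX]
    linarith
  · have hB : (q : ℝ) ≤ δ * E / σ := by rwa [le_div_iff₀ hσ0]
    have hB0 : 0 < δ * E / σ := by positivity
    refine lt_of_lt_of_le ?_ (Real.rpow_le_rpow_of_nonpos hq0 hB (by linarith : -v ≤ 0))
    rw [← Real.log_lt_log_iff (by positivity) (Real.rpow_pos_of_pos hB0 _), Real.log_rpow hB0,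
      Real.log_div (by positivity) hσ0.ne', Real.log_mul hδp.ne' hE0.ne',
      Real.log_mul (by positivity) (by positivity), Real.log_mul (by positivity) (by positivity),
      Real.log_mul hδp.ne' hσ0.ne', Real.log_inv, hδl, hσl, hE, Real.log_exp]
    have h7 : (v - 1) * (n * al r) ≤ (v - 1) * (C * al r * (v - 1) * X / 2) := by gcongr
    have h8 : C * al r * (v - 1) * ((v - 1) * X) ≤ 1 / 2 * ((v - 1) * X) := by gcongr
    have h9 : -((v - 1) * Real.log t) ≤ |Real.log t| := by
      rw [← mul_neg]
      calc (v - 1) * -Real.log t ≤ (v - 1) * |Real.log t| := by gcongr; exact neg_le_abs _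
        _ ≤ 1 * |Real.log t| := by gcongr
        _ = _ := one_mul _
    have h10 : 0 < (v - 1) * ((v - 1) * X) := by positivity
    have h11 := abs_nonneg (Real.log t)
    have e : (-v * (-((v - 1) * X / 2) + n * al r - (Real.log t - X) / 2)) -
        (-((v - 1) * X / 2) + (Real.log t - X) / 2 + -(n * al r) + Real.log M1) =
        (v - 1) * X / 2 + (v - 1) * ((v - 1) * X) / 2 - (v - 1) * (n * al r) + (v - 1) * Real.log t / 2 - Real.log M1 := by ring
    linarith
  · have hδ1' : δ ≤ 1 := by
      rw [hδ]; exact Real.exp_le_one_iff.2 (neg_nonpos.2 (by positivity))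
    calc δ * σ * E⁻¹ * M1 ≤ 1 * σ * 1 * M1 := by gcongr; exact inv_le_one_of_one_le₀ hE1
      _ = _ := by rw [hσ, Real.sqrt_mul hc.le]; ring

lemma mem_wellApprox_of_forall {v y : ℝ}
    (h : ∀ ε : ℝ, 0 < ε → ∃ (p : ℤ) (q : ℕ), 0 < q ∧ |(q : ℝ) * y - p| < psiv v q ∧ |(q : ℝ) * y - p| < ε) :
    y ∈ wellApprox (psiv v) := by
  by_cases hy : ∃ (p : ℤ) (q : ℕ), 0 < q ∧ (q : ℝ) * y - p = 0
  · obtain ⟨p, q, hq, hpq⟩ := hy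
    refine Set.infinite_of_injective_forall_mem (f := fun n : ℕ => (((n + 1 : ℕ) : ℤ) * p, (n + 1) * q)) ?_ ?_
    · intro a b hab
      have := (Prod.ext_iff.1 hab).2
      simp only at this
      have := Nat.eq_of_mul_eq_mul_right hq this
      omega
    · intro n
      have hq0 : 0 < (n + 1) * q := by positivity
      refine ⟨hq0, ?_⟩
      have e : (((n + 1) * q : ℕ) : ℝ) * y - ((((n + 1 : ℕ) : ℤ) * p : ℤ) : ℝ) = (n + 1) * (q * y - p) := by
        push_cast; ring
      simp only
      rw [e, hpq, mul_zero, abs_zero]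
      exact Real.rpow_pos_of_pos (by exact_mod_cast hq0) _
  · push Not at hy
    intro hfin
    obtain ⟨ε, hε, hmin⟩ : ∃ ε : ℝ, 0 < ε ∧ ∀ pq ∈ {pq : ℤ × ℕ | 0 < pq.2 ∧ |(pq.2 : ℝ) * y - (pq.1 : ℝ)| < psiv v pq.2},
        ε ≤ |(pq.2 : ℝ) * y - (pq.1 : ℝ)| := by
      rcases Set.eq_empty_or_nonempty {pq : ℤ × ℕ | 0 < pq.2 ∧ |(pq.2 : ℝ) * y - (pq.1 : ℝ)| < psiv v pq.2} with he | hne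
      · exact ⟨1, one_pos, by rw [he]; simp⟩
      · obtain ⟨a, ha, hamin⟩ := Set.exists_min_image _ (fun pq : ℤ × ℕ => |(pq.2 : ℝ) * y - (pq.1 : ℝ)|) hfin hne
        exact ⟨_, abs_pos.2 (hy a.1 a.2 ha.1), hamin⟩
    obtain ⟨p, q, hq, h1, h2⟩ := h ε hε
    exact absurd h2 (not_lt.2 (hmin (p, q) ⟨hq, h1⟩))

lemma ofReal_le_dimH_range {m : ℕ} (hm : 1 < m) (y : (ℕ → Fin m) → ℝ) {κ g : ℝ} (hκ : 0 < κ) (hg : 0 < g)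
    (h : ∀ (ω ω' : ℕ → Fin m) (k : ℕ), (∀ i < k, ω i = ω' i) → ω k ≠ ω' k →
      κ * Real.exp (-(g * k)) ≤ |y ω - y ω'|) :
    ENNReal.ofReal (Real.log m / g) ≤ dimH (range y) := by
  have hm0 : (0 : ℝ) < m := by exact_mod_cast (by omega : 0 < m)
  have hlog : 0 < Real.log m := Real.log_pos (by exact_mod_cast hm)
  obtain ⟨γ, hγ⟩ : ∃ γ, γ = Real.log m / g := ⟨_, rfl⟩
  have hγ0 : 0 < γ := by rw [hγ]; positivity
  have : NeZero m := ⟨by omega⟩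
  have key : ∀ ω ω', |Real.ofDigits ω - Real.ofDigits ω'| ≤ (κ⁻¹ * |y ω - y ω'|) ^ γ := by
    intro ω ω'
    by_cases hne : ω = ω'
    · subst hne; simp [Real.zero_rpow hγ0.ne']
    · have hex : ∃ k, ω k ≠ ω' k := by
        by_contra hc; push Not at hc; exact hne (funext hc)
      classical
      have hk := Nat.find_spec hex
      have hlt : ∀ i < Nat.find hex, ω i = ω' i := fun i hi => by
        simpa using Nat.find_min hex hi
      have h1 := h ω ω' _ hlt hk
      refine (Real.abs_ofDigits_sub_ofDigits_le hlt).trans ?_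
      have h2 : Real.exp (-(g * (Nat.find hex : ℕ))) ≤ κ⁻¹ * |y ω - y ω'| := by
        rwa [← div_eq_inv_mul, le_div_iff₀' hκ]
      have h3 : ((m : ℝ) ^ (Nat.find hex))⁻¹ = (Real.exp (-(g * (Nat.find hex : ℕ)))) ^ γ := by
        rw [← Real.exp_mul, hγ, show -(g * (Nat.find hex : ℕ)) * (Real.log m / g) = -((Nat.find hex : ℕ) * Real.log m) by
          field_simp, Real.exp_neg, Real.exp_nat_mul, Real.exp_log hm0]
      rw [h3]
      gcongr
  have hinj : ∀ ω ω', y ω = y ω' → Real.ofDigits ω = Real.ofDigits ω' := by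
    intro ω ω' he
    have := key ω ω'
    rw [he, sub_self, abs_zero, mul_zero, Real.zero_rpow hγ0.ne'] at this
    exact sub_eq_zero.1 (abs_eq_zero.1 (le_antisymm this (abs_nonneg _)))
  obtain ⟨f, hf⟩ : ∃ f : ℝ → ℝ, ∀ ω, f (y ω) = Real.ofDigits ω := by
    refine ⟨fun x => by classical exact if hx : x ∈ range y then Real.ofDigits hx.choose else 0, fun ω => ?_⟩
    have hx : y ω ∈ range y := ⟨ω, rfl⟩
    simp only [hx, dif_pos]
    exact hinj _ _ hx.choose_spec
  obtain ⟨γ', hγ'⟩ : ∃ γ' : NNReal, γ' = γ.toNNReal := ⟨_, rfl⟩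
  have hγc : (γ' : ℝ) = γ := by rw [hγ', Real.coe_toNNReal _ hγ0.le]
  have hH : HolderOnWith (κ⁻¹ ^ γ).toNNReal γ' f (range y) := by
    rintro _ ⟨ω, rfl⟩ _ ⟨ω', rfl⟩
    rw [hf, hf, edist_dist, edist_dist, Real.dist_eq, Real.dist_eq, hγc,
      ENNReal.ofReal_rpow_of_nonneg (abs_nonneg _) hγ0.le]
    change _ ≤ ENNReal.ofReal (κ⁻¹ ^ γ) * _
    rw [← ENNReal.ofReal_mul (by positivity), ← Real.mul_rpow (by positivity) (abs_nonneg _)]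
    exact ENNReal.ofReal_le_ofReal (key ω ω')
  have hγ'0 : 0 < γ' := by rw [← NNReal.coe_pos, hγc]; exact hγ0
  have h4 := hH.dimH_image_le hγ'0
  have h5 : dimH (Icc (0 : ℝ) 1) ≤ dimH (f '' range y) := by
    refine dimH_mono fun x hx => ?_
    obtain ⟨ω, -, hω⟩ := Real.ofDigits_SurjOn hm hx
    exact ⟨y ω, ⟨ω, rfl⟩, (hf ω).trans hω⟩
  have h6 : dimH (Icc (0 : ℝ) 1) = 1 := by
    have := Real.dimH_of_nonempty_interior (E := ℝ) (s := Icc (0 : ℝ) 1) (by rw [interior_Icc]; exact ⟨1 / 2, by norm_num⟩)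
    simpa using this
  rw [h6] at h5
  have h7 := h5.trans h4
  rw [ENNReal.le_div_iff_mul_le (Or.inl (by simpa using hγ'0.ne')) (Or.inl ENNReal.coe_ne_top), one_mul] at h7
  refine le_trans (le_of_eq ?_) h7
  rw [← hγ, ENNReal.ofReal, hγ']

/-- Composition of the affine maps `x ↦ z.1 * x + z.2`. -/
def affComp (z z' : ℝ × ℝ) : ℝ × ℝ := (z.1 * z'.1, z.1 * z'.2 + z.2)

/-- The cylinder map reached after `k` letters of `ω`, where the map `force z` is inserted after the
letters whose position is a power of `4`. -/
noncomputable def forcedMap {m : ℕ} (ϱ : ℝ) (d : Fin m → ℝ) (force : ℝ × ℝ → ℝ × ℝ) (ω : ℕ → Fin m) : ℕ → ℝ × ℝ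
  | 0 => (1, 0)
  | k + 1 =>
    if k + 1 = 4 ^ Nat.log 4 (k + 1) then
      affComp (affComp (forcedMap ϱ d force ω k) (ϱ, d (ω k)))
        (force (affComp (forcedMap ϱ d force ω k) (ϱ, d (ω k))))
    else affComp (forcedMap ϱ d force ω k) (ϱ, d (ω k))

section forcedMap

variable {m : ℕ} {ϱ : ℝ} {d : Fin m → ℝ} {force : ℝ × ℝ → ℝ × ℝ}

lemma forcedMap_congr {ω ω' : ℕ → Fin m} {k : ℕ} (h : ∀ i < k, ω i = ω' i) :
    forcedMap ϱ d force ω k = forcedMap ϱ d force ω' k := by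
  induction k with
  | zero => rfl
  | succ k ih =>
    simp only [forcedMap, ih fun i hi => h i (by omega), h k (by omega)]

lemma forcedMap_pos_le (hϱ : 0 < ϱ) (hf : ∀ z : ℝ × ℝ, 0 < (force z).1 ∧ (force z).1 ≤ 1) (ω : ℕ → Fin m) (k : ℕ) :
    0 < (forcedMap ϱ d force ω k).1 ∧ (forcedMap ϱ d force ω k).1 ≤ ϱ ^ k := by
  induction k with
  | zero => simp [forcedMap]
  | succ k ih =>
    obtain ⟨h1, h2⟩ := ih
    have h3 : (forcedMap ϱ d force ω k).1 * ϱ ≤ ϱ ^ (k + 1) := by rw [pow_succ]; gcongr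
    have h4 : 0 < (forcedMap ϱ d force ω k).1 * ϱ := by positivity
    rw [forcedMap]
    split_ifs
    · obtain ⟨h5, h6⟩ := hf (affComp (forcedMap ϱ d force ω k) (ϱ, d (ω k)))
      exact ⟨mul_pos h4 h5, (mul_le_of_le_one_right h4.le h6).trans h3⟩
    · exact ⟨h4, h3⟩

lemma forcedMap_log_le (hϱ : 0 < ϱ) (hϱ1 : ϱ < 1) {θ : ℝ} (hθ : 0 < θ) (hθ1 : θ ≤ 1)
    (hf : ∀ z : ℝ × ℝ, 0 < (force z).1 ∧ (force z).1 ≤ 1)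
    (hf2 : ∀ z : ℝ × ℝ, 0 < z.1 → z.1 ≤ 1 → -Real.log (force z).1 ≤ θ * -Real.log z.1) (ω : ℕ → Fin m) (k : ℕ) :
    -Real.log (forcedMap ϱ d force ω k).1 ≤ (1 + 2 * θ) * k * -Real.log ϱ := by
  have hl : 0 < -Real.log ϱ := neg_pos.2 (Real.log_neg hϱ hϱ1)
  obtain ⟨l, hl'⟩ : ∃ l, l = -Real.log ϱ := ⟨_, rfl⟩
  rw [← hl'] at hl ⊢
  have hp : ∀ k : ℕ, k ≠ 0 → ((4 : ℝ) ^ Nat.log 4 k) ≤ k := fun k hk => by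
    exact_mod_cast Nat.pow_log_le_self 4 hk
  have key : ∀ k : ℕ, -Real.log (forcedMap ϱ d force ω (k + 1)).1 ≤
      (((k + 1 : ℕ) : ℝ) + 2 * θ * (4 : ℝ) ^ Nat.log 4 (k + 1)) * l := by
    have step : ∀ (k : ℕ) (A : ℝ), 0 ≤ A → -Real.log (forcedMap ϱ d force ω k).1 ≤ (k + 2 * θ * A) * l →
        (k + 1 = 4 ^ Nat.log 4 (k + 1) → 4 * A ≤ k + 1) → A ≤ (4 : ℝ) ^ Nat.log 4 (k + 1) →
        -Real.log (forcedMap ϱ d force ω (k + 1)).1 ≤ (((k + 1 : ℕ) : ℝ) + 2 * θ * (4 : ℝ) ^ Nat.log 4 (k + 1)) * l := by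
      intro k A hA0 hk hA4 hA
      obtain ⟨h1, h2⟩ := forcedMap_pos_le (d := d) hϱ hf ω k
      have hz1 : 0 < (affComp (forcedMap ϱ d force ω k) (ϱ, d (ω k))).1 := mul_pos h1 hϱ
      have hz2 : (affComp (forcedMap ϱ d force ω k) (ϱ, d (ω k))).1 ≤ 1 :=
        mul_le_one₀ (h2.trans (pow_le_one₀ hϱ.le hϱ1.le)) hϱ.le hϱ1.le
      have hzl : -Real.log (affComp (forcedMap ϱ d force ω k) (ϱ, d (ω k))).1 ≤ (k + 1 + 2 * θ * A) * l := by
        change -Real.log ((forcedMap ϱ d force ω k).1 * ϱ) ≤ _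
        rw [Real.log_mul h1.ne' hϱ.ne']
        linarith
      rw [forcedMap]
      split_ifs with hpow
      · have h5 := hf (affComp (forcedMap ϱ d force ω k) (ϱ, d (ω k)))
        have h6 := hf2 _ hz1 hz2
        change -Real.log ((affComp (forcedMap ϱ d force ω k) (ϱ, d (ω k))).1 * (force _).1) ≤ _
        rw [Real.log_mul hz1.ne' h5.1.ne']
        have h7 : ((4 : ℝ) ^ Nat.log 4 (k + 1)) = k + 1 := by exact_mod_cast hpow.symm
        have h8 := hA4 hpow
        have h9 : θ * A ≤ θ * ((k + 1) / 4) := by gcongr; linarith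
        have h10 : θ * -Real.log (affComp (forcedMap ϱ d force ω k) (ϱ, d (ω k))).1 ≤ θ * ((k + 1 + 2 * θ * A) * l) := by
          gcongr
        have h11 : (1 + θ) * (k + 1 + 2 * θ * A) ≤ (1 + θ) * (k + 1 + 2 * (θ * ((k + 1) / 4))) := by
          refine mul_le_mul_of_nonneg_left ?_ (by positivity)
          linarith
        have h12 : (1 + θ) * ((k : ℝ) + 1 + 2 * (θ * ((k + 1) / 4))) ≤ k + 1 + 2 * θ * (k + 1) := by
          have : θ * θ ≤ θ * 1 := by gcongr
          have : (θ * θ) * ((k : ℝ) + 1) ≤ (θ * 1) * (k + 1) := by gcongr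
          linarith
        have h13 := mul_le_mul_of_nonneg_right (h11.trans h12) hl.le
        rw [h7]
        push_cast
        linarith
      · refine hzl.trans ?_
        push_cast
        gcongr
    intro k
    induction k with
    | zero =>
      refine step 0 0 le_rfl (by simp [forcedMap]) (fun _ => by norm_num) (by simp)
    | succ k ih =>
      refine step (k + 1) _ (by positivity) ih (fun h => ?_) ?_
      · have h1 : 4 ^ Nat.log 4 (k + 1) ≤ k + 1 := Nat.pow_log_le_self 4 (by omega)
        have h2 : (4 : ℕ) ^ Nat.log 4 (k + 1) < 4 ^ Nat.log 4 (k + 1 + 1) := by omega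
        have h3 : Nat.log 4 (k + 1) < Nat.log 4 (k + 1 + 1) := (Nat.pow_lt_pow_iff_right (by norm_num)).1 h2
        have h4 : (4 : ℕ) ^ (Nat.log 4 (k + 1) + 1) ≤ 4 ^ Nat.log 4 (k + 1 + 1) := Nat.pow_le_pow_right (by norm_num) h3
        have h5 : 4 * 4 ^ Nat.log 4 (k + 1) ≤ k + 1 + 1 := by
          rw [pow_succ] at h4; omega
        exact_mod_cast h5
      · gcongr
        · norm_num
        · omega
  cases k with
  | zero => simp [forcedMap]
  | succ k =>
    refine (key k).trans ?_
    have h1 := hp (k + 1) (by omega)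
    calc _ ≤ (((k + 1 : ℕ) : ℝ) + 2 * θ * ((k + 1 : ℕ) : ℝ)) * l := by gcongr
      _ = _ := by ring

end forcedMap

lemma exists_mem_iInter_affine {K : Set ℝ} (hK : IsCompact K) (hne : K.Nonempty) (S : ℕ → ℝ × ℝ)
    (hS : ∀ k, ∃ z', Pres K z'.1 z'.2 ∧ S (k + 1) = affComp (S k) z') :
    ∃ y, ∀ k, ∃ x ∈ K, y = (S k).1 * x + (S k).2 := by
  have hc : ∀ k, IsCompact ((fun x => (S k).1 * x + (S k).2) '' K) := fun k =>
    hK.image (by fun_prop)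
  obtain ⟨y, hy⟩ := IsCompact.nonempty_iInter_of_sequence_nonempty_isCompact_isClosed
    (fun k => (fun x => (S k).1 * x + (S k).2) '' K) (fun k => by
      rintro _ ⟨x, hx, rfl⟩
      obtain ⟨z', hz', e⟩ := hS k
      refine ⟨z'.1 * x + z'.2, hz' x hx, ?_⟩
      simp only [e, affComp]
      ring) (fun k => hne.image _) (hc 0) (fun k => (hc k).isClosed)
  refine ⟨y, fun k => ?_⟩
  obtain ⟨x, hx, e⟩ := mem_iInter.1 hy k
  exact ⟨x, hx, e.symm⟩

/-- Forcing a good rational approximation at positions growing geometrically costs little dimension. -/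
lemma le_dimH_of_forcing {K : Set ℝ} (hK : IsCompact K) (hne : K.Nonempty) {m : ℕ} (hm : 1 < m) {ϱ : ℝ}
    (hϱ : 0 < ϱ) (hϱ1 : ϱ < 1) {d : Fin m → ℝ} (hd : ∀ i, Pres K ϱ (d i)) {κ : ℝ} (hκ : 0 < κ)
    (hsep : ∀ i j, i ≠ j → ∀ x ∈ K, ∀ y ∈ K, κ ≤ |(ϱ * x + d i) - (ϱ * y + d j)|)
    {v c0 θ M : ℝ} (hc0 : 0 < c0) (hθ : 0 < θ) (hθ1 : θ ≤ 1)
    (H : ∀ c b, 0 < c → c ≤ c0 → ∃ u e, Pres K u e ∧ 0 < u ∧ u ≤ 1 ∧ -Real.log u ≤ θ * -Real.log c ∧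
      ∃ (p : ℤ) (q : ℕ), 0 < q ∧ ∀ x ∈ K, |q * (c * (u * x + e) + b) - p| < psiv v q ∧
        |q * (c * (u * x + e) + b) - p| ≤ M * √c) :
    ENNReal.ofReal (Real.log m / (-Real.log ϱ * (1 + 2 * θ))) ≤ dimH (wellApprox (psiv v) ∩ K) := by
  have hl : 0 < -Real.log ϱ := neg_pos.2 (Real.log_neg hϱ hϱ1)
  have hF : ∀ z : ℝ × ℝ, ∃ w : ℝ × ℝ, Pres K w.1 w.2 ∧ 0 < w.1 ∧ w.1 ≤ 1 ∧
      (0 < z.1 → z.1 ≤ 1 → -Real.log w.1 ≤ θ * -Real.log z.1) ∧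
      (0 < z.1 → z.1 ≤ c0 → ∃ (p : ℤ) (q : ℕ), 0 < q ∧ ∀ x ∈ K, |q * (z.1 * (w.1 * x + w.2) + z.2) - p| < psiv v q ∧
        |q * (z.1 * (w.1 * x + w.2) + z.2) - p| ≤ M * √z.1) := by
    intro z
    by_cases hz : 0 < z.1 ∧ z.1 ≤ c0
    · obtain ⟨u, e, h1, h2, h3, h4, h5⟩ := H z.1 z.2 hz.1 hz.2
      exact ⟨(u, e), h1, h2, h3, fun _ _ => h4, fun _ _ => h5⟩
    · refine ⟨(1, 0), Pres.id, one_pos, le_rfl, fun h0 h1 => ?_, fun h0 h1 => absurd ⟨h0, h1⟩ hz⟩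
      rw [Real.log_one, neg_zero]
      exact mul_nonneg hθ.le (neg_nonneg.2 (Real.log_nonpos h0.le h1))
  choose force hfP hf0 hf1 hfl hfq using hF
  have hS : ∀ (ω : ℕ → Fin m) k, ∃ z', Pres K z'.1 z'.2 ∧
      forcedMap ϱ d force ω (k + 1) = affComp (affComp (forcedMap ϱ d force ω k) (ϱ, d (ω k))) z' := by
    intro ω k
    rw [forcedMap]
    split_ifs
    · exact ⟨_, hfP _, rfl⟩
    · exact ⟨(1, 0), Pres.id, by simp [affComp]⟩
  have hS' : ∀ (ω : ℕ → Fin m) k, ∃ z', Pres K z'.1 z'.2 ∧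
      forcedMap ϱ d force ω (k + 1) = affComp (forcedMap ϱ d force ω k) z' := by
    intro ω k
    obtain ⟨z', h1, h2⟩ := hS ω k
    refine ⟨affComp (ϱ, d (ω k)) z', (hd _).comp h1, ?_⟩
    rw [h2]
    ext
    · simp only [affComp]; ring
    · simp only [affComp]; ring
  choose y hy using fun ω : ℕ → Fin m => exists_mem_iInter_affine hK hne _ (hS' ω)
  have hf01 : ∀ z : ℝ × ℝ, 0 < (force z).1 ∧ (force z).1 ≤ 1 := fun z => ⟨hf0 z, hf1 z⟩
  refine (ofReal_le_dimH_range hm y hκ (g := -Real.log ϱ * (1 + 2 * θ)) (by positivity) ?_).trans (dimH_mono ?_)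
  · intro ω ω' k hlt hk
    have expand : ∀ ω : ℕ → Fin m, ∃ x ∈ K, y ω = (forcedMap ϱ d force ω k).1 * (ϱ * x + d (ω k)) + (forcedMap ϱ d force ω k).2 := by
      intro ω
      obtain ⟨x, hx, e⟩ := hy ω (k + 1)
      obtain ⟨z', h1, h2⟩ := hS ω k
      refine ⟨z'.1 * x + z'.2, h1 x hx, ?_⟩
      rw [e, h2]
      simp only [affComp]
      ring
    obtain ⟨x, hx, e⟩ := expand ω
    obtain ⟨x', hx', e'⟩ := expand ω'
    rw [← forcedMap_congr hlt] at e'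
    obtain ⟨h1, -⟩ := forcedMap_pos_le (d := d) hϱ hf01 ω k
    have h2 := forcedMap_log_le (d := d) hϱ hϱ1 hθ hθ1 hf01 hfl ω k
    rw [e, e', add_sub_add_right_eq_sub, ← mul_sub, abs_mul, abs_of_pos h1, mul_comm κ]
    gcongr
    · rw [← Real.le_log_iff_exp_le h1]
      linarith
    · exact hsep _ _ hk x hx x' hx'
  · rintro _ ⟨ω, rfl⟩
    have hyK : y ω ∈ K := by
      obtain ⟨x, hx, e⟩ := hy ω 0
      rw [e]; simpa [forcedMap] using hx
    refine ⟨mem_wellApprox_of_forall fun ε hε => ?_, hyK⟩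
    obtain ⟨δ, hδ0, hδ⟩ : ∃ δ, 0 < δ ∧ (|M| + 1) * δ < ε := ⟨ε / (2 * (|M| + 1)), by positivity, by
      have : 0 < |M| + 1 := by positivity
      field_simp; norm_num⟩
    obtain ⟨j, hj⟩ := exists_pow_lt_of_lt_one (lt_min hc0 (by positivity : 0 < δ ^ 2)) hϱ1
    obtain ⟨k, hk⟩ : ∃ k, k + 1 = 4 ^ j := ⟨4 ^ j - 1, Nat.sub_add_cancel (Nat.one_le_pow _ _ (by norm_num))⟩
    obtain ⟨x, hx, e⟩ := hy ω (k + 1)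
    have hlog : k + 1 = 4 ^ Nat.log 4 (k + 1) := by
      rw [hk, Nat.log_pow (by norm_num)]
    rw [forcedMap, if_pos hlog] at e
    obtain ⟨z, hz⟩ : ∃ z, z = affComp (forcedMap ϱ d force ω k) (ϱ, d (ω k)) := ⟨_, rfl⟩
    rw [← hz] at e
    obtain ⟨h1, h2⟩ := forcedMap_pos_le (d := d) hϱ hf01 ω k
    have hz0 : 0 < z.1 := by rw [hz]; exact mul_pos h1 hϱ
    have hjk : j ≤ k + 1 := by rw [hk]; exact (Nat.lt_pow_self (by norm_num)).le
    have hz1 : z.1 < min c0 (δ ^ 2) := by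
      refine lt_of_le_of_lt ?_ hj
      calc z.1 = (forcedMap ϱ d force ω k).1 * ϱ := by rw [hz]; rfl
        _ ≤ ϱ ^ k * ϱ := by gcongr
        _ = ϱ ^ (k + 1) := (pow_succ _ _).symm
        _ ≤ ϱ ^ j := pow_le_pow_of_le_one hϱ.le hϱ1.le hjk
    obtain ⟨p, q, hq, hpq⟩ := hfq z hz0 (hz1.le.trans (min_le_left _ _))
    obtain ⟨h3, h4⟩ := hpq x hx
    have e2 : y ω = z.1 * ((force z).1 * x + (force z).2) + z.2 := by
      rw [e]; simp only [affComp]; ring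
    rw [← e2] at h3 h4
    refine ⟨p, q, hq, h3, h4.trans_lt ?_⟩
    have h5 : √z.1 ≤ δ := by
      rw [Real.sqrt_le_left hδ0.le]
      exact hz1.le.trans (min_le_right _ _)
    calc M * √z.1 ≤ (|M| + 1) * √z.1 := by gcongr; linarith [le_abs_self M]
      _ ≤ (|M| + 1) * δ := by gcongr
      _ < ε := hδ

namespace IFS

/-- Translation part of `F.wordMap`. -/
noncomputable def wordB (F : IFS) : List (Fin F.n) → ℝ
  | [] => 0
  | i :: w => F.c i * F.wordB w + F.b i

variable (F : IFS)

lemma wordMap_apply (w : List (Fin F.n)) (x : ℝ) : F.wordMap w x = F.wordC w * x + F.wordB w := by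
  induction w with
  | nil => simp [wordMap, wordC, wordB]
  | cons i w ih =>
    simp only [wordMap, Function.comp_apply, ih, wordC, wordB, map, List.map_cons, List.prod_cons]
    ring

lemma wordC_pos (w : List (Fin F.n)) : 0 < F.wordC w := by
  refine List.prod_pos fun x hx => ?_
  obtain ⟨i, -, rfl⟩ := List.mem_map.1 hx
  exact F.c_pos i

lemma wordC_ofFn {N : ℕ} (w : Fin N → Fin F.n) : F.wordC (List.ofFn w) = ∏ k, F.c (w k) := by
  rw [wordC, List.map_ofFn, List.prod_ofFn]
  rfl

variable {F} {K : Set ℝ}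

lemma IsAttractor.pres (hK : F.IsAttractor K) (i : Fin F.n) : Pres K (F.c i) (F.b i) := fun x hx => by
  rw [hK.2.2]
  exact mem_iUnion.2 ⟨i, x, hx, rfl⟩

lemma IsAttractor.pres_wordMap (hK : F.IsAttractor K) (w : List (Fin F.n)) : Pres K (F.wordC w) (F.wordB w) := by
  induction w with
  | nil => simpa [wordC, wordB] using Pres.id (K := K)
  | cons i w ih =>
    have := (hK.pres i).comp ih
    simpa [wordC, wordB] using this

lemma IsAttractor.exists_mem_wordMap (hK : F.IsAttractor K) (N : ℕ) {x : ℝ} (hx : x ∈ K) :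
    ∃ w : Fin N → Fin F.n, x ∈ F.wordMap (List.ofFn w) '' K := by
  induction N generalizing x with
  | zero => exact ⟨Fin.elim0, x, hx, by simp [wordMap]⟩
  | succ N ih =>
    have h := hx
    rw [hK.2.2] at h
    obtain ⟨i, y, hy, rfl⟩ := mem_iUnion.1 h
    obtain ⟨w, z, hz, rfl⟩ := ih hy
    exact ⟨Fin.cons i w, z, hz, by simp [List.ofFn_succ, wordMap]⟩

lemma exists_uniform_ratio (F : IFS) : ∃ ρ : ℝ, 0 ≤ ρ ∧ ρ < 1 ∧ ∀ i, F.c i ≤ ρ := by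
  have : Nonempty (Fin F.n) := ⟨⟨0, F.npos⟩⟩
  obtain ⟨i, hi⟩ := Finite.exists_max F.c
  exact ⟨F.c i, (F.c_pos i).le, F.c_lt_one i, hi⟩

lemma IsAttractor.dimH_le (hK : F.IsAttractor K) {t : ℝ} (ht : 0 ≤ t) (hsum : ∑ i, F.c i ^ t ≤ 1) :
    dimH K ≤ ENNReal.ofReal t := by
  obtain ⟨ρ, hρ0, hρ1, hρ⟩ := F.exists_uniform_ratio
  have hdist : ∀ x ∈ K, ∀ y ∈ K, |x - y| ≤ Metric.diam K := fun x hx y hy =>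
    Metric.dist_le_diam_of_mem hK.2.1.isBounded hx hy
  have hD : 0 ≤ Metric.diam K := Metric.diam_nonneg
  have hdiam : ∀ (w : List (Fin F.n)),
      Metric.ediam (F.wordMap w '' K) ≤ ENNReal.ofReal (F.wordC w * Metric.diam K) := by
    intro w
    refine Metric.ediam_le ?_
    rintro _ ⟨x, hx, rfl⟩ _ ⟨y, hy, rfl⟩
    rw [edist_dist, Real.dist_eq, wordMap_apply, wordMap_apply, add_sub_add_right_eq_sub, ← mul_sub, abs_mul,
      abs_of_pos (F.wordC_pos w)]
    exact ENNReal.ofReal_le_ofReal (mul_le_mul_of_nonneg_left (hdist x hx y hy) (F.wordC_pos w).le)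
  have hC : ∀ {N : ℕ} (w : Fin N → Fin F.n), F.wordC (List.ofFn w) ≤ ρ ^ N := by
    intro N w
    rw [wordC_ofFn]
    refine (Finset.prod_le_prod (fun k _ => (F.c_pos _).le) fun k _ => hρ (w k)).trans ?_
    simp
  have hmeas := Measure.hausdorffMeasure_le_liminf_sum (ι := fun N : ℕ => Fin N → Fin F.n) t K (l := Filter.atTop)
    (fun N => ENNReal.ofReal (ρ ^ N * Metric.diam K))
    (by
      rw [← ENNReal.ofReal_zero]
      refine ENNReal.tendsto_ofReal ?_
      simpa using (tendsto_pow_atTop_nhds_zero_of_lt_one hρ0 hρ1).mul_const (Metric.diam K))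
    (fun N w => F.wordMap (List.ofFn w) '' K)
    (Filter.Eventually.of_forall fun N w => (hdiam _).trans
      (ENNReal.ofReal_le_ofReal (mul_le_mul_of_nonneg_right (hC w) hD)))
    (Filter.Eventually.of_forall fun N x hx => mem_iUnion.2 (hK.exists_mem_wordMap N hx))
  have hbd : ∀ N : ℕ, ∑ w : Fin N → Fin F.n, Metric.ediam (F.wordMap (List.ofFn w) '' K) ^ t ≤
      ENNReal.ofReal (Metric.diam K ^ t) := by
    intro N
    calc _ ≤ ∑ w : Fin N → Fin F.n, ENNReal.ofReal ((∏ k, F.c (w k) ^ t) * Metric.diam K ^ t) := by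
          refine Finset.sum_le_sum fun w _ => ?_
          refine (ENNReal.rpow_le_rpow (hdiam _) ht).trans (le_of_eq ?_)
          rw [ENNReal.ofReal_rpow_of_nonneg (mul_nonneg (F.wordC_pos _).le hD) ht,
            Real.mul_rpow (F.wordC_pos _).le hD, wordC_ofFn,
            Real.finsetProd_rpow _ _ fun k _ => (F.c_pos _).le]
      _ = ENNReal.ofReal ((∑ i, F.c i ^ t) ^ N * Metric.diam K ^ t) := by
          rw [← ENNReal.ofReal_sum_of_nonneg, ← Finset.sum_mul, Fintype.sum_pow]
          intro w _
          have : 0 ≤ ∏ k, F.c (w k) ^ t := Finset.prod_nonneg fun k _ => Real.rpow_nonneg (F.c_pos _).le _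
          have := Real.rpow_nonneg hD t
          positivity
      _ ≤ _ := by
          refine ENNReal.ofReal_le_ofReal (mul_le_of_le_one_left (Real.rpow_nonneg hD t) ?_)
          exact pow_le_one₀ (Finset.sum_nonneg fun i _ => Real.rpow_nonneg (F.c_pos i).le _) hsum
  have hfin : μH[t] K ≤ ENNReal.ofReal (Metric.diam K ^ t) :=
    hmeas.trans ((Filter.liminf_le_liminf (Filter.Eventually.of_forall hbd)).trans (by simp))
  have e : ((t.toNNReal : NNReal) : ℝ) = t := Real.coe_toNNReal _ ht
  exact dimH_le_of_hausdorffMeasure_ne_top (d := t.toNNReal) (by rw [e]; exact (hfin.trans_lt ENNReal.ofReal_lt_top).ne)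

lemma IsAttractor.one_lt_sum (hK : F.IsAttractor K) {t : ℝ} (ht : 0 ≤ t) (htd : ENNReal.ofReal t < dimH K) :
    1 < ∑ i, F.c i ^ t := by
  by_contra! h
  exact absurd (hK.dimH_le ht h) (not_le.2 htd)

lemma IsAttractor.subset_singleton (hK : F.IsAttractor K) {p : ℝ} (hp : ∀ i, F.c i * p + F.b i = p) : K ⊆ {p} := by
  obtain ⟨x, hx, hmax⟩ := hK.2.1.exists_isMaxOn hK.1 (f := fun x => |x - p|) (by fun_prop)
  have h := hx
  rw [hK.2.2] at h
  obtain ⟨i, y, hy, e⟩ := mem_iUnion.1 h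
  have e1 : x - p = F.c i * (y - p) := by
    rw [← e, map]
    have := hp i
    linarith
  have h1 : |x - p| ≤ F.c i * |x - p| := by
    conv_lhs => rw [e1, abs_mul, abs_of_pos (F.c_pos i)]
    exact mul_le_mul_of_nonneg_left (hmax hy) (F.c_pos i).le
  have h2 : |x - p| ≤ 0 := by
    have h3 := F.c_lt_one i
    by_contra! h4
    have : F.c i * |x - p| < 1 * |x - p| := by gcongr
    linarith
  intro y hy
  have h3 : |y - p| ≤ 0 := (hmax hy).trans h2
  exact sub_eq_zero.1 (abs_eq_zero.1 (le_antisymm h3 (abs_nonneg _)))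

end IFS

lemma Pres.pow {K : Set ℝ} {r b : ℝ} (h : Pres K r b) (N : ℕ) :
    Pres K (r ^ N) (b * ∑ k ∈ Finset.range N, r ^ k) := by
  induction N with
  | zero => simpa using Pres.id (K := K)
  | succ N ih =>
    have := h.comp ih
    rw [pow_succ', Finset.sum_range_succ']
    convert this using 1
    simp only [pow_succ', ← Finset.mul_sum, pow_zero]
    ring

namespace IFS

variable {F : IFS} {K : Set ℝ}

lemma IsAttractor.exists_pres_pair (hK : F.IsAttractor K) (hdim : 0 < dimH K) :
    ∃ r b t, 0 < r ∧ r ≤ 1 / 4 ∧ 0 < t ∧ Pres K r b ∧ Pres K r (b + t) := by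
  obtain ⟨i, j, hij⟩ : ∃ i j, F.b i * (1 - F.c j) ≠ F.b j * (1 - F.c i) := by
    by_contra! h
    have i0 : Fin F.n := ⟨0, F.npos⟩
    have h0 : 0 < 1 - F.c i0 := sub_pos.2 (F.c_lt_one i0)
    have hsub := hK.subset_singleton (p := F.b i0 / (1 - F.c i0)) fun i => by
      have := h i i0
      field_simp
      linarith
    have := (subsingleton_singleton.anti hsub).dimH_zero
    exact hdim.ne' this
  obtain ⟨r, hr⟩ : ∃ r, r = F.c i * F.c j := ⟨_, rfl⟩
  have hr0 : 0 < r := by rw [hr]; exact mul_pos (F.c_pos i) (F.c_pos j)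
  have hr1 : r < 1 := by
    rw [hr]; exact mul_lt_one_of_nonneg_of_lt_one_left (F.c_pos i).le (F.c_lt_one i) (F.c_lt_one j).le
  obtain ⟨b, b', hb, h0, h1⟩ : ∃ b b', b < b' ∧ Pres K r b ∧ Pres K r b' := by
    have h0 := (hK.pres i).comp (hK.pres j)
    have h1 := (hK.pres j).comp (hK.pres i)
    rw [mul_comm (F.c j), ← hr] at h1
    rw [← hr] at h0
    have hne : F.c i * F.b j + F.b i ≠ F.c j * F.b i + F.b j := fun h => hij (by linarith)
    rcases lt_or_gt_of_ne hne with h | h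
    · exact ⟨_, _, h, h0, h1⟩
    · exact ⟨_, _, h, h1, h0⟩
  obtain ⟨N, hN⟩ := exists_pow_lt_of_lt_one (by norm_num : (0 : ℝ) < 1 / 4) hr1
  have hS : 0 < ∑ k ∈ Finset.range (N + 1), r ^ k :=
    Finset.sum_pos (fun k _ => pow_pos hr0 k) (by simp)
  refine ⟨r ^ (N + 1), b * ∑ k ∈ Finset.range (N + 1), r ^ k, (b' - b) * ∑ k ∈ Finset.range (N + 1), r ^ k,
    pow_pos hr0 _, ?_, mul_pos (sub_pos.2 hb) hS, h0.pow _, ?_⟩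
  · exact (pow_le_pow_of_le_one hr0.le hr1.le (Nat.le_succ N)).trans hN.le
  · rw [← add_mul, add_sub_cancel]
    exact h1.pow _

end IFS

namespace IFS

variable {F : IFS} {K U : Set ℝ}

lemma map_injective (F : IFS) (i : Fin F.n) : Function.Injective (F.map i) := fun x y h => by
  simp only [map] at h
  exact mul_left_cancel₀ (F.c_pos i).ne' (by linarith)

lemma OSCWith.wordMap_subset (hU : F.OSCWith U) (w : List (Fin F.n)) : F.wordMap w '' U ⊆ U := by
  induction w with
  | nil => simp [wordMap]
  | cons i w ih =>
    rw [wordMap, image_comp]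
    exact (image_mono ih).trans ((subset_iUnion _ i).trans hU.2.2.2.1)

lemma OSCWith.disjoint_wordMap (hU : F.OSCWith U) : ∀ w w' : List (Fin F.n), w.length = w'.length → w ≠ w' →
    Disjoint (F.wordMap w '' U) (F.wordMap w' '' U)
  | [], [], _, h => absurd rfl h
  | i :: w, j :: w', hl, h => by
    rw [wordMap, wordMap, image_comp, image_comp]
    by_cases hij : i = j
    · subst hij
      rw [disjoint_image_iff (F.map_injective i)]
      exact OSCWith.disjoint_wordMap hU w w' (by simpa using hl) fun e => h (by rw [e])
    · exact (hU.2.2.2.2 hij).mono (image_mono (hU.wordMap_subset w)) (image_mono (hU.wordMap_subset w'))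

lemma OSCWith.le_abs_sub (hU : F.OSCWith U) {u ε : ℝ} (hu : Metric.ball u ε ⊆ U) (hε : 0 < ε)
    {w w' : List (Fin F.n)} (hl : w.length = w'.length) (hne : w ≠ w') :
    F.wordC w' * ε ≤ |F.wordMap w u - F.wordMap w' u| := by
  by_contra! h
  have hc := F.wordC_pos w'
  refine disjoint_left.1 (hU.disjoint_wordMap w w' hl hne) ⟨u, hu (Metric.mem_ball_self hε), rfl⟩
    ⟨u + (F.wordMap w u - F.wordMap w' u) / F.wordC w', hu ?_, ?_⟩
  · rw [Metric.mem_ball, Real.dist_eq, add_sub_cancel_left, abs_div, abs_of_pos hc, div_lt_iff₀ hc]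
    linarith
  · rw [wordMap_apply F w', wordMap_apply F w' u]
    field_simp
    ring

/-- The open set condition provides homogeneous separated subsystems of almost full dimension. -/
lemma IsAttractor.exists_homogeneous (hK : F.IsAttractor K) (hOSC : F.OSC) {t : ℝ} (ht : 0 < t)
    (htd : ENNReal.ofReal t < dimH K) :
    ∃ (m : ℕ) (ϱ κ : ℝ) (d : Fin m → ℝ), 1 < m ∧ 0 < ϱ ∧ ϱ < 1 ∧ 0 < κ ∧ (∀ i, Pres K ϱ (d i)) ∧
      (∀ i j, i ≠ j → ∀ x ∈ K, ∀ y ∈ K, κ ≤ |(ϱ * x + d i) - (ϱ * y + d j)|) ∧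
      t ≤ Real.log m / -Real.log ϱ := by
  classical
  obtain ⟨U, hU⟩ := hOSC
  obtain ⟨u, huU⟩ := hU.1
  obtain ⟨ε, hε, hball⟩ := Metric.isOpen_iff.1 hU.2.1 u huU
  obtain ⟨D, hD⟩ : ∃ D : ℝ, ∀ x ∈ K, |x - u| ≤ D := by
    obtain ⟨D, hD⟩ := hK.2.1.isBounded.subset_closedBall u
    exact ⟨D, fun x hx => hD hx⟩
  obtain ⟨M, hM⟩ := exists_nat_ge (2 * D / ε + 2)
  have hM' : 2 * D + 2 * ε ≤ M * ε := by
    have := mul_le_mul_of_nonneg_right hM hε.le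
    rwa [add_mul, div_mul_cancel₀ _ hε.ne'] at this
  obtain ⟨x0, hx0⟩ := hK.1
  have hD0 : 0 ≤ D := (abs_nonneg _).trans (hD x0 hx0)
  have hM0 : 0 < M := by
    have : (0 : ℝ) < M := by
      by_contra! h
      have : (M : ℝ) * ε ≤ 0 * ε := by gcongr
      linarith
    exact_mod_cast this
  have : NeZero M := ⟨hM0.ne'⟩
  obtain ⟨S, hS⟩ : ∃ S, S = ∑ i, F.c i ^ t := ⟨_, rfl⟩
  have hS1 : 1 < S := by rw [hS]; exact hK.one_lt_sum ht.le htd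
  obtain ⟨N, hN1, hN⟩ : ∃ N : ℕ, 1 ≤ N ∧ ((N + 1 : ℕ) : ℝ) ^ F.n * M ≤ S ^ N := by
    have h1 := tendsto_pow_const_div_const_pow_of_one_lt F.n hS1
    have hMS : (0 : ℝ) < 1 / (S * M) := by positivity
    obtain ⟨n, hn, hn2⟩ := ((h1.eventually_lt_const hMS).and (Filter.eventually_ge_atTop 2)).exists
    obtain ⟨N, rfl⟩ : ∃ N, n = N + 1 := ⟨n - 1, by omega⟩
    refine ⟨N, by omega, ?_⟩
    rw [div_lt_div_iff₀ (by positivity) (by positivity), one_mul, pow_succ, ← mul_assoc, mul_right_comm] at hn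
    exact (lt_of_mul_lt_mul_right hn (by positivity)).le
  let g : (Fin N → Fin F.n) → ℤ := fun w => ⌊F.wordMap (List.ofFn w) u / (F.wordC (List.ofFn w) * ε)⌋
  let color : (Fin N → Fin F.n) → (Fin F.n → Fin (N + 1)) × ZMod M := fun w =>
    (fun i => ⟨(Finset.univ.filter fun k => w k = i).card,
      Nat.lt_succ_of_le ((Finset.card_le_univ _).trans (by simp))⟩, (g w : ZMod M))
  obtain ⟨y, hy⟩ := Fintype.exists_le_sum_fiber_of_nsmul_le_sum (f := color) (b := (1 : ℝ))
    (w := fun w => F.wordC (List.ofFn w) ^ t) (by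
      simp only [Fintype.card_prod, Fintype.card_fun, Fintype.card_fin, ZMod.card, nsmul_eq_mul, mul_one]
      push_cast at hN ⊢
      refine hN.trans (le_of_eq ?_)
      rw [hS, Fintype.sum_pow]
      refine Finset.sum_congr rfl fun w _ => ?_
      rw [wordC_ofFn, Real.finsetProd_rpow _ _ fun k _ => (F.c_pos _).le])
  obtain ⟨T, hT⟩ : ∃ T, T = Finset.univ.filter fun w => color w = y := ⟨_, rfl⟩
  rw [← hT] at hy
  obtain ⟨ϱ, hϱ⟩ : ∃ ϱ, ϱ = ∏ i, F.c i ^ (y.1 i : ℕ) := ⟨_, rfl⟩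
  have hTc : ∀ w ∈ T, F.wordC (List.ofFn w) = ϱ := by
    intro w hw
    rw [hT, Finset.mem_filter] at hw
    rw [hϱ, ← hw.2, wordC_ofFn, ← Finset.prod_fiberwise' Finset.univ w F.c]
    simp [color]
  have hTg : ∀ w ∈ T, ∀ w' ∈ T, (M : ℤ) ∣ g w - g w' := by
    intro w hw w' hw'
    rw [hT, Finset.mem_filter] at hw hw'
    have : (color w).2 = (color w').2 := by rw [hw.2, hw'.2]
    have h2 : ((g w : ℤ) : ZMod M) = (g w' : ℤ) := this
    rw [eq_comm, ZMod.intCast_eq_intCast_iff_dvd_sub] at h2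
    exact h2
  have hTne : T.Nonempty := by
    rw [Finset.nonempty_iff_ne_empty]
    rintro rfl
    norm_num at hy
  obtain ⟨w0, hw0⟩ := hTne
  have hϱ0 : 0 < ϱ := by rw [← hTc w0 hw0]; exact F.wordC_pos _
  have hϱ1 : ϱ < 1 := by
    rw [← hTc w0 hw0, wordC_ofFn]
    obtain ⟨ρ, hρ0, hρ1, hρ⟩ := F.exists_uniform_ratio
    refine (Finset.prod_le_prod (fun k _ => (F.c_pos _).le) fun k _ => hρ (w0 k)).trans_lt ?_
    rw [Finset.prod_const, Finset.card_univ, Fintype.card_fin]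
    exact pow_lt_one₀ hρ0 hρ1 (by omega)
  have hϱt : 0 < ϱ ^ t := Real.rpow_pos_of_pos hϱ0 t
  have hcard : 1 ≤ (T.card : ℝ) * ϱ ^ t := by
    refine hy.trans (le_of_eq ?_)
    rw [Finset.sum_congr rfl fun w hw => by rw [hTc w hw], Finset.sum_const, nsmul_eq_mul]
  have hl : 0 < -Real.log ϱ := neg_pos.2 (Real.log_neg hϱ0 hϱ1)
  have hT0 : (0 : ℝ) < T.card := by exact_mod_cast Finset.card_pos.2 ⟨w0, hw0⟩
  have hlogT : t * -Real.log ϱ ≤ Real.log T.card := by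
    have h1 := Real.log_le_log one_pos hcard
    rw [Real.log_one, Real.log_mul hT0.ne' hϱt.ne', Real.log_rpow hϱ0] at h1
    linarith
  refine ⟨T.card, ϱ, ϱ * ε, fun i => F.wordB (List.ofFn (T.equivFin.symm i : Fin N → Fin F.n)), ?_, hϱ0, hϱ1,
    mul_pos hϱ0 hε, fun i => ?_, fun i j hij x hx x' hx' => ?_, ?_⟩
  · by_contra! h
    have h1 : Real.log T.card ≤ 0 := Real.log_nonpos hT0.le (by exact_mod_cast h)
    have h2 : 0 < t * -Real.log ϱ := mul_pos ht hl
    linarith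
  · have h := hK.pres_wordMap (List.ofFn (T.equivFin.symm i : Fin N → Fin F.n))
    rwa [hTc _ (T.equivFin.symm i).2] at h
  · obtain ⟨w, hw⟩ : ∃ w, w = (T.equivFin.symm i : Fin N → Fin F.n) := ⟨_, rfl⟩
    obtain ⟨w', hw'⟩ : ∃ w, w = (T.equivFin.symm j : Fin N → Fin F.n) := ⟨_, rfl⟩
    have hwT : w ∈ T := by rw [hw]; exact (T.equivFin.symm i).2
    have hwT' : w' ∈ T := by rw [hw']; exact (T.equivFin.symm j).2
    have hne : w ≠ w' := by
      rw [hw, hw']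
      exact fun e => hij (T.equivFin.symm.injective (Subtype.ext e))
    simp only [← hw, ← hw']
    have e1 : F.wordMap (List.ofFn w) u = ϱ * u + F.wordB (List.ofFn w) := by rw [wordMap_apply, hTc w hwT]
    have e2 : F.wordMap (List.ofFn w') u = ϱ * u + F.wordB (List.ofFn w') := by rw [wordMap_apply, hTc w' hwT']
    have h1 := hU.le_abs_sub hball hε (w := List.ofFn w) (w' := List.ofFn w') (by simp)
      (fun e => hne (List.ofFn_injective e))
    rw [hTc w' hwT', e1, e2, add_sub_add_left_eq_sub] at h1
    have hϱε : 0 < ϱ * ε := mul_pos hϱ0 hε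
    have hg : g w = ⌊(ϱ * u + F.wordB (List.ofFn w)) / (ϱ * ε)⌋ := by simp only [g, hTc w hwT, e1]
    have hg' : g w' = ⌊(ϱ * u + F.wordB (List.ofFn w')) / (ϱ * ε)⌋ := by simp only [g, hTc w' hwT', e2]
    have hgl := Int.floor_le ((ϱ * u + F.wordB (List.ofFn w)) / (ϱ * ε))
    have hgu := Int.lt_floor_add_one ((ϱ * u + F.wordB (List.ofFn w)) / (ϱ * ε))
    have hgl' := Int.floor_le ((ϱ * u + F.wordB (List.ofFn w')) / (ϱ * ε))
    have hgu' := Int.lt_floor_add_one ((ϱ * u + F.wordB (List.ofFn w')) / (ϱ * ε))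
    rw [← hg] at hgl hgu
    rw [← hg'] at hgl' hgu'
    obtain ⟨δ, hδ⟩ : ∃ δ, δ = (F.wordB (List.ofFn w) - F.wordB (List.ofFn w')) / (ϱ * ε) := ⟨_, rfl⟩
    have hδe : (ϱ * u + F.wordB (List.ofFn w)) / (ϱ * ε) - (ϱ * u + F.wordB (List.ofFn w')) / (ϱ * ε) = δ := by
      rw [hδ, ← sub_div, add_sub_add_left_eq_sub]
    have hδ1 : 1 ≤ |δ| := by
      rw [hδ, abs_div, abs_of_pos hϱε, le_div_iff₀ hϱε, one_mul]
      exact h1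
    have hδg : |δ - ((g w - g w' : ℤ) : ℝ)| < 1 := by
      rw [abs_lt]
      push_cast
      constructor <;> linarith
    have hgne : g w - g w' ≠ 0 := by
      intro h0
      rw [h0, Int.cast_zero, sub_zero] at hδg
      linarith
    have hgM : (M : ℝ) ≤ |((g w - g w' : ℤ) : ℝ)| := by
      have := Int.le_of_dvd (abs_pos.2 hgne) ((dvd_abs _ _).2 (hTg w hwT w' hwT'))
      exact_mod_cast this
    have hδM : (M : ℝ) - 1 ≤ |δ| := by
      have := abs_sub_abs_le_abs_sub (((g w - g w' : ℤ) : ℝ)) δ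
      rw [abs_sub_comm] at this
      linarith
    have h3 : |F.wordB (List.ofFn w) - F.wordB (List.ofFn w')| = |δ| * (ϱ * ε) := by
      rw [hδ, abs_div, abs_of_pos hϱε, div_mul_cancel₀ _ hϱε.ne']
    have h4 : ((M : ℝ) - 1) * (ϱ * ε) ≤ |F.wordB (List.ofFn w) - F.wordB (List.ofFn w')| := by
      rw [h3]; gcongr
    have h5 : ϱ * (2 * D + 2 * ε) ≤ ϱ * (M * ε) := by gcongr
    have h6 : |ϱ * x' - ϱ * x| ≤ ϱ * (2 * D) := by
      rw [← mul_sub, abs_mul, abs_of_pos hϱ0]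
      gcongr
      calc |x' - x| = |(x' - u) - (x - u)| := by ring_nf
        _ ≤ |x' - u| + |x - u| := abs_sub _ _
        _ ≤ 2 * D := by linarith [hD x hx, hD x' hx']
    have h7 : |F.wordB (List.ofFn w) - F.wordB (List.ofFn w')| ≤
        |ϱ * x + F.wordB (List.ofFn w) - (ϱ * x' + F.wordB (List.ofFn w'))| + |ϱ * x' - ϱ * x| := by
      refine le_trans (le_of_eq ?_) (abs_add_le _ _)
      ring_nf
    linarith
  · rwa [le_div_iff₀ hl]

end IFS

lemma dimH_real_le_one (K : Set ℝ) : dimH K ≤ 1 := by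
  refine (dimH_mono (subset_univ K)).trans (le_of_eq ?_)
  simpa using Real.dimH_univ

/-- Lower bound on `dim_H (W(v) ∩ K)` for `v` close to `1`. -/
theorem stmt3 (F : IFS) (hOSC : F.OSC) (K : Set ℝ) (hK : F.IsAttractor K)
    (s : ℝ) (hs : s = (dimH K).toReal) :
    ∃ vmax : ℝ, 1 < vmax ∧ ∃ C : ℝ, 0 < C ∧ ∀ v : ℝ, 1 < v → v < vmax →
      ENNReal.ofReal (s - C * (1 - 2 / (v + 1))) ≤ dimH (wellApprox (psiv v) ∩ K) := by
  have hfin : dimH K ≠ ⊤ := ((dimH_real_le_one K).trans_lt ENNReal.one_lt_top).ne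
  have hs1 : s ≤ 1 := by
    rw [hs]; exact ENNReal.toReal_le_of_le_ofReal zero_le_one (by simpa using dimH_real_le_one K)
  have frac : ∀ v : ℝ, 1 < v → 1 - 2 / (v + 1) = (v - 1) / (v + 1) := fun v hv => by field_simp; ring
  by_cases hdim : dimH K = 0
  · refine ⟨2, by norm_num, 1, one_pos, fun v hv _ => ?_⟩
    rw [hs, hdim, frac v hv, ENNReal.ofReal_of_nonpos]
    · exact zero_le
    · have : 0 < (v - 1) / (v + 1) := div_pos (by linarith) (by linarith)
      simp only [ENNReal.toReal_zero]
      linarith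
  obtain ⟨r, b0, t0, hr, hr4, ht, h0, h1⟩ := hK.exists_pres_pair (pos_iff_ne_zero.2 hdim)
  obtain ⟨C, M, v0, hC, hM, hv0, H⟩ := exists_forced hK.2.1 hr hr4 ht h0 h1
  refine ⟨min v0 (min 2 (1 + 1 / C)), by simp [hv0, hC], 3 * (1 + 2 * C), by positivity, fun v hv hvm => ?_⟩
  obtain ⟨hvv0, hvm2⟩ := lt_min_iff.1 hvm
  obtain ⟨hv2, hvC⟩ := lt_min_iff.1 hvm2
  have hv10 : 0 < v - 1 := sub_pos.2 hv
  have hbound : s - 3 * (1 + 2 * C) * (1 - 2 / (v + 1)) ≤ s - (1 + 2 * C) * (v - 1) := by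
    rw [frac v hv]
    have h3 : (v - 1) / 3 ≤ (v - 1) / (v + 1) := by gcongr; linarith
    have h4 : 3 * (1 + 2 * C) * ((v - 1) / 3) ≤ 3 * (1 + 2 * C) * ((v - 1) / (v + 1)) := by gcongr
    linarith
  refine (ENNReal.ofReal_le_ofReal hbound).trans ?_
  obtain ⟨θ, hθ⟩ : ∃ θ, θ = C * (v - 1) := ⟨_, rfl⟩
  have hθ0 : 0 < θ := by rw [hθ]; positivity
  have hθ1 : θ ≤ 1 := by
    have h5 : v - 1 ≤ 1 / C := by linarith
    rw [le_div_iff₀ hC] at h5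
    linarith
  rcases le_or_gt (s - (v - 1)) 0 with hneg | hpos
  · rw [ENNReal.ofReal_of_nonpos]
    · exact zero_le
    · have : 0 < C * (v - 1) := by positivity
      linarith
  have htd : ENNReal.ofReal (s - (v - 1)) < dimH K := by
    rw [ENNReal.ofReal_lt_iff_lt_toReal hpos.le hfin, ← hs]
    linarith
  obtain ⟨m, ϱ, κ, d, hm, hϱ, hϱ1, hκ, hd, hsep, hlog⟩ := hK.exists_homogeneous hOSC hpos htd
  obtain ⟨c0, hc0, Hc⟩ := H v hv hvv0
  rw [← hθ] at Hc
  refine le_trans (ENNReal.ofReal_le_ofReal ?_) (le_dimH_of_forcing hK.2.1 hK.1 hm hϱ hϱ1 hd hκ hsep hc0 hθ0 hθ1 Hc)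
  rw [← div_div, le_div_iff₀ (by positivity)]
  refine le_trans ?_ hlog
  have h6 : (s - (v - 1)) * θ ≤ 1 * θ := by gcongr; linarith
  have h7 : 0 ≤ θ * θ := by positivity
  have e : (s - (1 + 2 * C) * (v - 1)) = s - (v - 1) - 2 * θ := by rw [hθ]; ring
  rw [e]
  linarith
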